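/- For every odd prime p there exists a constant C > 0 such that the following holds. Let δ ∈ (0,1), let A ⊆ G = 𝔽_p^n, and let 𝒫 be a partition of G such that each P ∈ 𝒫 is an atom of a quadratic factor 𝓑_P = (L_P, Q_P) of complexity (ℓ_P, q_P) and rank at least C(ℓ_P+q_P+log_p(δ^(−1))). Suppose |⋃_{P∈𝒥} P| > δ|G|, where 𝒥 = {P ∈ 𝒫 : ‖(1_A − α_P)·1_P‖_{U³} > δ·‖1_P‖_{U³}} and α_P = |A∩P|/|P|. Then there is a partition 𝒫' of G refining 𝒫 such that ind(A,𝒫') ≥ ind(A,𝒫) + C^(−2)·δ^{2C+2}, and such that each P' ∈ 𝒫' either belongs to 𝒫∖𝒥, or satisfies P' ⊆ P for some P ∈ 𝒥 and is an atom of a quadratic factor 𝓑'_P = (L'_P, Q'_P) refining 𝓑_P with L_P ⊆ L'_P, Q_P ⊆ Q'_P, |L'_P| ≤ |L_P|+1, and |Q'_P| ≤ |Q_P|+1. -/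

import Mathlib

open scoped BigOperators symmDiff
open Finset

attribute [local instance] Classical.propDecidable

namespace PaperTS

noncomputable section

/-- The group `𝔽_p^n`, written additively. -/
abbrev Vec (p n : ℕ) := Fin n → ZMod p

/-- Dot product on `𝔽_p^n`. -/
def dot {p n : ℕ} (x y : Vec p n) : ZMod p := ∑ i, x i * y i

/-- A quadratic factor of complexity `(ℓ, q)` on `𝔽_p^n`: a set of `ℓ` linearly independent
vectors together with a set of `q` pairwise distinct symmetric matrices. -/
structure QuadFactor (p n ℓ q : ℕ) where
  L : Fin ℓ → Vec p n
  Q : Fin q → Matrix (Fin n) (Fin n) (ZMod p)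
  linIndep : LinearIndependent (ZMod p) L
  symm : ∀ j, (Q j).IsSymm
  inj : Function.Injective Q

/-- Labels of atoms of a quadratic factor of complexity `(ℓ, q)`. -/
abbrev Label (p ℓ q : ℕ) := (Fin ℓ → ZMod p) × (Fin q → ZMod p)

namespace QuadFactor

variable {p n ℓ q : ℕ}

/-- The linear form `β_L`. -/
def betaL (B : QuadFactor p n ℓ q) (x : Vec p n) : Fin ℓ → ZMod p :=
  fun i => dot x (B.L i)

/-- The bilinear form `β_Q`. -/
def betaQ (B : QuadFactor p n ℓ q) (x y : Vec p n) : Fin q → ZMod p :=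
  fun j => dot x ((B.Q j).mulVec y)

/-- The labelling map `β_𝓑`. -/
def betaB (B : QuadFactor p n ℓ q) (x : Vec p n) : Label p ℓ q :=
  (B.betaL x, B.betaQ x x)

/-- The atom of `B` with label `ab`. -/
def atom (B : QuadFactor p n ℓ q) (ab : Label p ℓ q) : Set (Vec p n) :=
  {x | B.betaB x = ab}

/-- The fibre `β_Q^{-1}(d) ⊆ G × G`. -/
def fibQ (B : QuadFactor p n ℓ q) (d : Fin q → ZMod p) : Set (Vec p n × Vec p n) :=
  {xy | B.betaQ xy.1 xy.2 = d}

/-- The rank of a quadratic factor: `n` if `q = 0`, and otherwise the minimal rank of a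
nontrivial linear combination of the matrices. -/
def rank (B : QuadFactor p n ℓ q) : ℕ :=
  if q = 0 then n
  else sInf ((fun c : Fin q → ZMod p => (∑ j, c j • B.Q j).rank) '' {c | c ≠ 0})

end QuadFactor

/-- Refinement of quadratic factors: every atom of `B'` is contained in an atom of `B`. -/
def Refines {p n ℓ' q' ℓ q : ℕ} (B' : QuadFactor p n ℓ' q') (B : QuadFactor p n ℓ q) : Prop :=
  ∀ ab' : Label p ℓ' q', ∃ ab : Label p ℓ q, B'.atom ab' ⊆ B.atom ab

/-- `Σ(d)` for a tuple of labels `d = (d_a, d_b, d_c, d_ab, d_ac, d_bc)`. -/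
def SigmaD {p ℓ q : ℕ} (da db dc : Label p ℓ q) (dab dac dbc : Fin q → ZMod p) :
    Label p ℓ q :=
  (da.1 + db.1 + dc.1, da.2 + db.2 + dc.2 + 2 • dab + 2 • dac + 2 • dbc)

/-- Real-valued indicator function of a set. -/
def ind1 {G : Type*} (S : Set G) : G → ℝ := S.indicator 1

/-- Density of `A` on `P`. -/
def density {G : Type*} (A P : Set G) : ℝ := ((A ∩ P).ncard : ℝ) / (P.ncard : ℝ)

/-- Sum of `g` over a set in a fintype. -/
def setSum {α : Type*} [Fintype α] (s : Set α) (g : α → ℝ) : ℝ :=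
  ∑ x ∈ Finset.univ.filter (fun x => x ∈ s), g x

/-- Average of `g` over a set in a fintype. -/
def expOver {α : Type*} [Fintype α] (s : Set α) (g : α → ℝ) : ℝ :=
  setSum s g / (s.ncard : ℝ)

/-- The normalized indicator `μ_Γ` of `Γ ⊆ G × G`. -/
def mu {G : Type*} [Fintype G] (Γ : Set (G × G)) (xy : G × G) : ℝ :=
  ((Fintype.card G : ℝ) ^ 2 / (Γ.ncard : ℝ)) * ind1 Γ xy

/-- The product of the 8 values of `f` on the cube generated by `x, h₁, h₂, h₃`. -/
def cubeProd {G : Type*} [AddCommGroup G] (f : G → ℝ) (x h₁ h₂ h₃ : G) : ℝ :=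
  f x * f (x + h₁) * f (x + h₂) * f (x + h₃) * f (x + h₁ + h₂) * f (x + h₁ + h₃) *
    f (x + h₂ + h₃) * f (x + h₁ + h₂ + h₃)

/-- The eighth power of the (unnormalized) `U³` norm. -/
def U3pow8 {G : Type*} [AddCommGroup G] [Fintype G] (f : G → ℝ) : ℝ :=
  ∑ x : G, ∑ h₁ : G, ∑ h₂ : G, ∑ h₃ : G, cubeProd f x h₁ h₂ h₃

/-- The (unnormalized) `U³` norm. -/
def U3norm {G : Type*} [AddCommGroup G] [Fintype G] (f : G → ℝ) : ℝ :=
  U3pow8 f ^ ((1 : ℝ) / 8)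

/-- The Prendiville local `U³` norm of `f` relative to the set `B`
(equal to `0` when `‖1_B‖_{U³} = 0`, by the division-by-zero convention). -/
def U3localP {G : Type*} [AddCommGroup G] [Fintype G] (f : G → ℝ) (B : Set G) : ℝ :=
  U3norm (fun x => f x * ind1 B x) / U3norm (ind1 B)

/-- `Ω_B`: the 4-tuples all of whose associated cube points lie in `B`. -/
def Omega {G : Type*} [AddCommGroup G] (B : Set G) : Set (G × G × G × G) :=
  fun t =>
    match t with
    | (x, h₁, h₂, h₃) =>
        x ∈ B ∧ x + h₁ ∈ B ∧ x + h₂ ∈ B ∧ x + h₃ ∈ B ∧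
        x + h₁ + h₂ ∈ B ∧ x + h₁ + h₃ ∈ B ∧ x + h₂ + h₃ ∈ B ∧ x + h₁ + h₂ + h₃ ∈ B

/-- The change of variables `Ψ : G⁶ → G⁴`. -/
def Psi {G : Type*} [AddCommGroup G] : G × G × G × G × G × G → G × G × G × G :=
  fun t =>
    match t with
    | (x₁, x₂, y₁, y₂, z₁, z₂) => (x₁ + y₁ + z₁, x₂ - x₁, y₂ - y₁, z₂ - z₁)

/-- `K_{2,2,2}(d)`. -/
def K222 {p n ℓ q : ℕ} (B : QuadFactor p n ℓ q) (da db dc : Label p ℓ q)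
    (dab dac dbc : Fin q → ZMod p) :
    Set (Vec p n × Vec p n × Vec p n × Vec p n × Vec p n × Vec p n) :=
  fun t =>
    match t with
    | (x₁, x₂, y₁, y₂, z₁, z₂) =>
        B.betaB x₁ = da ∧ B.betaB x₂ = da ∧ B.betaB y₁ = db ∧ B.betaB y₂ = db ∧
        B.betaB z₁ = dc ∧ B.betaB z₂ = dc ∧
        B.betaQ x₁ y₁ = dab ∧ B.betaQ x₁ y₂ = dab ∧ B.betaQ x₂ y₁ = dab ∧ B.betaQ x₂ y₂ = dab ∧
        B.betaQ x₁ z₁ = dac ∧ B.betaQ x₁ z₂ = dac ∧ B.betaQ x₂ z₁ = dac ∧ B.betaQ x₂ z₂ = dac ∧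
        B.betaQ y₁ z₁ = dbc ∧ B.betaQ y₁ z₂ = dbc ∧ B.betaQ y₂ z₁ = dbc ∧ B.betaQ y₂ z₂ = dbc

/-- The product `∏_{i,j,k ∈ {1,2}} f (x_i + y_j + z_k)` for a 6-tuple. -/
def prod8 {G : Type*} [AddCommGroup G] (f : G → ℝ) :
    G × G × G × G × G × G → ℝ :=
  fun t =>
    match t with
    | (x₁, x₂, y₁, y₂, z₁, z₂) =>
        f (x₁ + y₁ + z₁) * f (x₁ + y₁ + z₂) * f (x₁ + y₂ + z₁) * f (x₁ + y₂ + z₂) *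
        f (x₂ + y₁ + z₁) * f (x₂ + y₁ + z₂) * f (x₂ + y₂ + z₁) * f (x₂ + y₂ + z₂)

/-- The eighth power of the Terry–Wolf local `U³` norm. -/
def TW8 {p n ℓ q : ℕ} [NeZero p] (B : QuadFactor p n ℓ q) (f : Vec p n → ℝ)
    (da db dc : Label p ℓ q) (dab dac dbc : Fin q → ZMod p) : ℝ :=
  expOver (B.atom da) fun x₀ => expOver (B.atom da) fun x₁ =>
  expOver (B.atom db) fun y₀ => expOver (B.atom db) fun y₁ =>
  expOver (B.atom dc) fun z₀ => expOver (B.atom dc) fun z₁ =>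
    (mu (B.fibQ dab) (x₀, y₀) * mu (B.fibQ dab) (x₀, y₁) *
     mu (B.fibQ dab) (x₁, y₀) * mu (B.fibQ dab) (x₁, y₁) *
     mu (B.fibQ dac) (x₀, z₀) * mu (B.fibQ dac) (x₀, z₁) *
     mu (B.fibQ dac) (x₁, z₀) * mu (B.fibQ dac) (x₁, z₁) *
     mu (B.fibQ dbc) (y₀, z₀) * mu (B.fibQ dbc) (y₀, z₁) *
     mu (B.fibQ dbc) (y₁, z₀) * mu (B.fibQ dbc) (y₁, z₁)) *
    prod8 f (x₀, x₁, y₀, y₁, z₀, z₁)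

/-- `A` has VC₂-dimension at least `k`. -/
def HasVC2Dim {G : Type*} [AddCommGroup G] (A : Set G) (k : ℕ) : Prop :=
  ∃ (a b : Fin k → G) (c : Set (Fin k × Fin k) → G),
    ∀ (i j : Fin k) (S : Set (Fin k × Fin k)), (a i + b j + c S ∈ A ↔ (i, j) ∈ S)

/-- `A` has VC₂-dimension at most `k`. -/
def VC2dimLE {G : Type*} [AddCommGroup G] (A : Set G) (k : ℕ) : Prop :=
  ∀ m : ℕ, HasVC2Dim A m → m ≤ k

/-- A growth function: an increasing function `ℝ → ℝ≥0`. -/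
def GrowthFunction (ρ : ℝ → ℝ) : Prop :=
  Monotone ρ ∧ ∀ x, 0 ≤ ρ x

/-- `ρ` is bounded by a polynomial of degree `d` on `[1, ∞)`. -/
def PolyBound (ρ : ℝ → ℝ) (d : ℕ) : Prop :=
  ∃ C > (0 : ℝ), ∀ x : ℝ, 1 ≤ x → ρ x ≤ C * x ^ d

/-- `ρ` is a polynomial growth function of degree (exactly) `d`, i.e. `d ≥ 1` is minimal
with `ρ(x) ≤ C x^d` for `x ≥ 1`. -/
def PolyGrowthDegree (ρ : ℝ → ℝ) (d : ℕ) : Prop :=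
  1 ≤ d ∧ PolyBound ρ d ∧ ∀ d' : ℕ, 1 ≤ d' → PolyBound ρ d' → d ≤ d'

/-- The index `ind(A, 𝒫)` of a partition. -/
def indx {p n : ℕ} (A : Set (Vec p n)) (Ps : Finset (Set (Vec p n))) : ℝ :=
  (∑ P ∈ Ps, density A P ^ 2 * (P.ncard : ℝ)) / (p : ℝ) ^ n

/-- `P` fails to be `δ`-uniform for `A` with respect to the localized `U³` norm. -/
def BadPart {G : Type*} [AddCommGroup G] [Fintype G] (δ : ℝ) (A P : Set G) : Prop :=
  δ * U3norm (ind1 P) < U3norm (fun x => (ind1 A x - density A P) * ind1 P x)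

/-- `ker(U)^⊥`, the orthogonal complement of the kernel of `U`. -/
def kerPerp {p n : ℕ} (U : Matrix (Fin n) (Fin n) (ZMod p)) : Set (Vec p n) :=
  {v | ∀ w : Vec p n, U.mulVec w = 0 → dot v w = 0}

/-- `B'` is a `ρ`-matrix deletion of `B`. -/
def IsMatrixDeletion {p n ℓ' q' ℓ q : ℕ} (ρ : ℝ → ℝ)
    (B' : QuadFactor p n ℓ' q') (B : QuadFactor p n ℓ q) : Prop :=
  q' + 1 = q ∧
  ∃ c : Fin q → ZMod p, c ≠ 0 ∧
    (((∑ j, c j • B.Q j).rank : ℝ) < ρ ((ℓ : ℝ) + (q : ℝ))) ∧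
    (∃ i : Fin q, c i ≠ 0 ∧ Set.range B'.Q = Set.range B.Q \ {B.Q i}) ∧
    Set.range B.L ⊆ Set.range B'.L ∧
    Submodule.span (ZMod p) (Set.range B'.L) =
      Submodule.span (ZMod p) (Set.range B.L ∪ kerPerp (∑ j, c j • B.Q j))

/-- The functions `τ_i^ρ : ℤ × ℤ → ℝ`. -/
def tau (ρ : ℝ → ℝ) : ℕ → ℤ × ℤ → ℝ
  | 0, xy => (xy.1 : ℝ)
  | i + 1, xy => tau ρ i xy + ρ (tau ρ i xy + (xy.2 : ℝ) - (i : ℝ))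

/-- `f_σ^ρ` for binary strings `σ : Fin m → ℤ` (with values in `{-1, 1}`). -/
def fseq (ρ : ℝ → ℝ) : (m : ℕ) → (Fin m → ℤ) → ℝ × ℝ
  | 0, _ => (0, 0)
  | m + 1, σ =>
      let ab := fseq ρ m (fun j => σ j.castSucc)
      if σ (Fin.last m) = 1 then (ab.1 + 1, ab.2 + 1)
      else (ab.1 + ρ (ab.1 + ab.2), ab.2 - 1)

end

set_option linter.unusedSectionVars false

/-! ### Entropy on finite weighted spaces -/

section Entropy

variable {Ω' : Type*} [Fintype Ω'] {Ω : Type*} [Fintype Ω]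

/-- `w` is a probability weight on a finite type. -/
structure IsProb (w : Ω → ℝ) : Prop where
  nonneg : ∀ ω, 0 ≤ w ω
  sum_one : ∑ ω, w ω = 1

/-- The probability that `X = s`. -/
noncomputable def pr {α : Type*} (w : Ω → ℝ) (X : Ω → α) (s : α) : ℝ :=
  ∑ ω, if X ω = s then w ω else 0

/-- The Shannon entropy of `X`. -/
noncomputable def Hent {α : Type*} (w : Ω → ℝ) (X : Ω → α) : ℝ :=
  -∑ ω, w ω * Real.log (pr w X (X ω))

/-- The weight `w` conditioned on `Y = Y ω₀`. -/
noncomputable def cw {α : Type*} (w : Ω → ℝ) (Y : Ω → α) (ω₀ : Ω) : Ω → ℝ :=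
  fun ω => if Y ω = Y ω₀ then w ω / pr w Y (Y ω₀) else 0

section Basic

variable {α β γ ι : Type*} {w : Ω → ℝ}

lemma pr_nonneg (hw : IsProb w) (X : Ω → α) (s : α) : 0 ≤ pr w X s :=
  sum_nonneg fun ω _ => by split_ifs <;> simp [hw.nonneg ω]

lemma le_pr (hw : IsProb w) (X : Ω → α) (ω : Ω) : w ω ≤ pr w X (X ω) := by
  have := single_le_sum (f := fun ω' => if X ω' = X ω then w ω' else 0) (s := univ)
    (fun ω' _ => by split_ifs <;> simp [hw.nonneg ω']) (mem_univ ω)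
  simpa [pr] using this

lemma pr_pos (hw : IsProb w) (X : Ω → α) {ω : Ω} (h : 0 < w ω) : 0 < pr w X (X ω) :=
  h.trans_le (le_pr hw X ω)

lemma pr_le_one (hw : IsProb w) (X : Ω → α) (s : α) : pr w X s ≤ 1 := by
  rw [← hw.sum_one]
  exact sum_le_sum fun ω _ => by split_ifs <;> simp [hw.nonneg ω]

lemma pr_le_pr (hw : IsProb w) {X : Ω → α} {Y : Ω → β}
    (h : ∀ ω ω', X ω = X ω' → Y ω = Y ω') (ω : Ω) : pr w X (X ω) ≤ pr w Y (Y ω) := by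
  refine sum_le_sum fun ω' _ => ?_
  by_cases h1 : X ω' = X ω
  · simp [h1, h _ _ h1]
  · rw [if_neg h1]
    split_ifs
    exacts [hw.nonneg _, le_rfl]

lemma sum_pr [Fintype α] (X : Ω → α) : ∑ s, pr w X s = ∑ ω, w ω := by
  unfold pr
  rw [sum_comm]
  simp

lemma isProb_pr [Fintype α] (hw : IsProb w) (X : Ω → α) : IsProb (pr w X) :=
  ⟨pr_nonneg hw X, by rw [sum_pr, hw.sum_one]⟩

lemma Hent_nonneg (hw : IsProb w) (X : Ω → α) : 0 ≤ Hent w X := by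
  unfold Hent
  rw [neg_nonneg]
  refine sum_nonpos fun ω _ => mul_nonpos_of_nonneg_of_nonpos (hw.nonneg ω) ?_
  exact Real.log_nonpos (pr_nonneg hw X _) (pr_le_one hw X _)

lemma Hent_mono (hw : IsProb w) {X : Ω → α} {Y : Ω → β}
    (h : ∀ ω ω', X ω = X ω' → Y ω = Y ω') : Hent w Y ≤ Hent w X := by
  unfold Hent
  rw [neg_le_neg_iff]
  refine sum_le_sum fun ω _ => ?_
  rcases (hw.nonneg ω).eq_or_lt with h0 | h0
  · simp [← h0]
  · exact mul_le_mul_of_nonneg_left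
      (Real.log_le_log (pr_pos hw X h0) (pr_le_pr hw h ω)) h0.le

lemma Hent_congr (hw : IsProb w) {X : Ω → α} {Y : Ω → β}
    (h : ∀ ω ω', X ω = X ω' ↔ Y ω = Y ω') : Hent w X = Hent w Y :=
  le_antisymm (Hent_mono hw fun _ _ h' => (h _ _).2 h') (Hent_mono hw fun _ _ h' => (h _ _).1 h')

lemma Hent_const (hw : IsProb w) (c : α) : Hent w (fun _ => c) = 0 := by
  simp [Hent, pr, hw.sum_one]

/-- Strong subadditivity, in relational form. -/
lemma Hent_submod {δ : Type*} (hw : IsProb w) {P : Ω → α} {Q : Ω → β} {Z : Ω → γ} {J : Ω → δ}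
    (hPZ : ∀ ω ω', P ω = P ω' → Z ω = Z ω') (hQZ : ∀ ω ω', Q ω = Q ω' → Z ω = Z ω')
    (hJ : ∀ ω ω', P ω = P ω' → Q ω = Q ω' → J ω = J ω') :
    Hent w J + Hent w Z ≤ Hent w P + Hent w Q := by
  have hJ' : Hent w J ≤ Hent w (fun ω => (P ω, Q ω)) :=
    Hent_mono hw fun ω ω' h => hJ _ _ (Prod.ext_iff.1 h).1 (Prod.ext_iff.1 h).2
  refine (add_le_add_left hJ' _).trans ?_
  set K : Ω → α × β := fun ω => (P ω, Q ω) with hK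
  have key : ∑ ω, w ω * (pr w P (P ω) * pr w Q (Q ω) / (pr w K (K ω) * pr w Z (Z ω))) ≤ 1 := by
    have e1 : ∀ ω, w ω * (pr w P (P ω) * pr w Q (Q ω) / (pr w K (K ω) * pr w Z (Z ω))) =
        ∑ a, ∑ b, w a * w b * ((if P a = P ω then 1 else 0) * (if Q b = Q ω then 1 else 0) *
          (w ω / (pr w K (K ω) * pr w Z (Z ω)))) := by
      intro ω
      have : pr w P (P ω) * pr w Q (Q ω) = ∑ a, ∑ b, w a * w b *
          ((if P a = P ω then 1 else 0) * (if Q b = Q ω then 1 else 0)) := by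
        unfold pr
        rw [sum_mul_sum]
        refine sum_congr rfl fun a _ => sum_congr rfl fun b _ => ?_
        split_ifs <;> simp
      rw [mul_div_assoc', mul_comm (w ω), this, mul_div_assoc, sum_mul]
      refine sum_congr rfl fun a _ => ?_
      rw [sum_mul]
      refine sum_congr rfl fun b _ => ?_
      ring
    simp_rw [e1]
    rw [sum_comm]
    have e2 : ∀ a, ∑ ω, ∑ b, w a * w b *
        ((if P a = P ω then 1 else 0) * (if Q b = Q ω then 1 else 0) *
          (w ω / (pr w K (K ω) * pr w Z (Z ω)))) ≤ w a := by
      intro a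
      rw [sum_comm]
      have e3 : ∀ b, ∑ ω, w a * w b *
        ((if P a = P ω then 1 else 0) * (if Q b = Q ω then 1 else 0) *
          (w ω / (pr w K (K ω) * pr w Z (Z ω)))) ≤
          w a * ((if Z b = Z a then w b else 0) / pr w Z (Z a)) := by
        intro b
        rw [← mul_sum, mul_assoc]
        refine mul_le_mul_of_nonneg_left ?_ (hw.nonneg a)
        by_cases hz : ∃ ω₀, P a = P ω₀ ∧ Q b = Q ω₀
        · obtain ⟨ω₀, ha, hb⟩ := hz
          have hab : Z b = Z a := (hQZ _ _ hb).trans (hPZ _ _ ha).symm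
          rw [if_pos hab, mul_sum]
          have : ∀ ω, w b * ((if P a = P ω then 1 else 0) * (if Q b = Q ω then 1 else 0) *
              (w ω / (pr w K (K ω) * pr w Z (Z ω)))) =
              w b / pr w Z (Z a) * ((if K ω = K ω₀ then w ω else 0) / pr w K (K ω₀)) := by
            intro ω
            by_cases h1 : P a = P ω
            · by_cases h2 : Q b = Q ω
              · have hKK : K ω = K ω₀ := Prod.ext (h1.symm.trans ha) (h2.symm.trans hb)
                rw [if_pos h1, if_pos h2, if_pos hKK, hKK, hPZ _ _ h1]
                ring
              · have hKK : ¬ K ω = K ω₀ := fun h => h2 (hb.trans (Prod.ext_iff.1 h).2.symm)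
                simp [h2, hKK]
            · have hKK : ¬ K ω = K ω₀ := fun h => h1 (ha.trans (Prod.ext_iff.1 h).1.symm)
              simp [h1, hKK]
          simp_rw [this]
          rw [← mul_sum, ← sum_div]
          have hKs : (∑ i, if K i = K ω₀ then w i else 0) = pr w K (K ω₀) := by
            unfold pr
            exact sum_congr rfl fun i _ => by congr
          rw [hKs]
          exact mul_le_of_le_one_right (div_nonneg (hw.nonneg b) (pr_nonneg hw _ _))
            (div_self_le_one _)
        · push Not at hz
          have : ∑ ω, ((if P a = P ω then 1 else 0) * (if Q b = Q ω then 1 else 0) *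
              (w ω / (pr w K (K ω) * pr w Z (Z ω)))) = 0 := by
            refine sum_eq_zero fun ω _ => ?_
            by_cases h1 : P a = P ω
            · simp [hz ω h1]
            · simp [h1]
          rw [this, mul_zero]
          refine div_nonneg ?_ (pr_nonneg hw _ _)
          split_ifs <;> simp [hw.nonneg b]
      refine (sum_le_sum fun b _ => e3 b).trans ?_
      rw [← mul_sum, ← sum_div]
      change w a * (pr w Z (Z a) / pr w Z (Z a)) ≤ _
      exact mul_le_of_le_one_right (hw.nonneg a) (div_self_le_one _)
    exact (sum_le_sum fun a _ => e2 a).trans hw.sum_one.le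
  have hlog : ∑ ω, w ω * (Real.log (pr w P (P ω)) + Real.log (pr w Q (Q ω)) -
      Real.log (pr w K (K ω)) - Real.log (pr w Z (Z ω))) ≤
      ∑ ω, w ω * (pr w P (P ω) * pr w Q (Q ω) / (pr w K (K ω) * pr w Z (Z ω)) - 1) := by
    refine sum_le_sum fun ω _ => ?_
    rcases (hw.nonneg ω).eq_or_lt with h0 | h0
    · simp [← h0]
    · refine mul_le_mul_of_nonneg_left ?_ h0.le
      have hP := pr_pos hw P h0
      have hQ := pr_pos hw Q h0
      have hKp := pr_pos hw K h0
      have hZ := pr_pos hw Z h0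
      have := Real.log_le_sub_one_of_pos
        (x := pr w P (P ω) * pr w Q (Q ω) / (pr w K (K ω) * pr w Z (Z ω))) (by positivity)
      rw [Real.log_div (by positivity) (by positivity), Real.log_mul hP.ne' hQ.ne',
        Real.log_mul hKp.ne' hZ.ne'] at this
      linarith
  have e4 : ∑ ω, w ω * (pr w P (P ω) * pr w Q (Q ω) / (pr w K (K ω) * pr w Z (Z ω)) - 1) ≤ 0 := by
    simp_rw [mul_sub, mul_one]
    rw [sum_sub_distrib, hw.sum_one]
    linarith
  have e5 := hlog.trans e4
  simp_rw [mul_sub, mul_add] at e5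
  rw [sum_sub_distrib, sum_sub_distrib, sum_add_distrib] at e5
  unfold Hent
  linarith

/-- Subadditivity of entropy. -/
lemma Hent_subadd (hw : IsProb w) {P : Ω → α} {Q : Ω → β} {J : Ω → γ}
    (hJ : ∀ ω ω', P ω = P ω' → Q ω = Q ω' → J ω = J ω') :
    Hent w J ≤ Hent w P + Hent w Q := by
  have := Hent_submod hw (Z := fun _ : Ω => ()) (P := P) (Q := Q) (J := J)
    (fun _ _ _ => rfl) (fun _ _ _ => rfl) hJ
  have h2 := Hent_nonneg hw (fun _ : Ω => ())
  linarith

lemma sum_pr_mul [Fintype α] (X : Ω → α) (f : α → ℝ) :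
    ∑ s, pr w X s * f s = ∑ ω, w ω * f (X ω) := by
  unfold pr
  simp_rw [sum_mul]
  rw [sum_comm]
  refine sum_congr rfl fun ω _ => ?_
  simp [ite_mul]

lemma pr_pr [Fintype α] (X : Ω → α) (f : α → β) (t : β) :
    pr (pr w X) f t = pr w (fun ω => f (X ω)) t := by
  have := sum_pr_mul (w := w) X (fun s => if f s = t then 1 else 0)
  simpa [pr] using this

lemma Hent_pr [Fintype α] (X : Ω → α) (f : α → β) :
    Hent (pr w X) f = Hent w (fun ω => f (X ω)) := by
  unfold Hent
  simp_rw [pr_pr]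
  rw [sum_pr_mul X (fun s => Real.log (pr w (fun ω => f (X ω)) (f s)))]

lemma Hent_eq_sum [Fintype α] (X : Ω → α) :
    Hent w X = ∑ s, Real.negMulLog (pr w X s) := by
  unfold Hent Real.negMulLog
  rw [← sum_pr_mul X (fun s => Real.log (pr w X s)), ← sum_neg_distrib]
  exact sum_congr rfl fun s _ => by ring

lemma Hent_equiv {Ω' : Type*} [Fintype Ω'] (e : Ω ≃ Ω') {w' : Ω' → ℝ} (h : ∀ ω, w' (e ω) = w ω)
    (X : Ω' → α) : Hent w (fun ω => X (e ω)) = Hent w' X := by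
  have hp : ∀ s, pr w (fun ω => X (e ω)) s = pr w' X s := by
    intro s
    unfold pr
    rw [← e.sum_comp]
    simp [h]
  unfold Hent
  rw [← e.sum_comp]
  simp [h, hp]

/-- Entropy is at most the logarithm of the size of the support. -/
lemma Hent_le_log_card (hw : IsProb w) (X : Ω → α) (T : Finset α)
    (hT : ∀ ω, w ω ≠ 0 → X ω ∈ T) : Hent w X ≤ Real.log T.card := by
  have h1 : ∑ ω, w ω * (1 / (T.card * pr w X (X ω))) ≤ 1 := by
    have hle : ∀ ω, w ω * (1 / (T.card * pr w X (X ω))) ≤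
        ∑ t ∈ T, (1 / T.card) * ((if X ω = t then w ω else 0) / pr w X t) := by
      intro ω
      by_cases h0 : w ω = 0
      · simp [h0]
      · have hmem := hT ω h0
        have : ∀ t ∈ T, (1 / (T.card : ℝ)) * ((if X ω = t then w ω else 0) / pr w X t) =
            if X ω = t then w ω * (1 / (T.card * pr w X (X ω))) else 0 := by
          intro t _
          by_cases ht : X ω = t
          · simp only [ht, if_true]
            field_simp
          · simp [ht]
        rw [sum_congr rfl this, sum_ite_eq, if_pos hmem]
    refine (sum_le_sum fun ω _ => hle ω).trans ?_
    rw [sum_comm]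
    have : ∀ t ∈ T, ∑ ω, (1 / (T.card : ℝ)) * ((if X ω = t then w ω else 0) / pr w X t) ≤
        1 / T.card := by
      intro t _
      rw [← mul_sum, ← sum_div]
      exact mul_le_of_le_one_right (by positivity) (div_self_le_one _)
    refine (sum_le_sum this).trans ?_
    rw [sum_const, nsmul_eq_mul, mul_one_div]
    exact div_self_le_one _
  have h2 : ∑ ω, w ω * (-Real.log (pr w X (X ω)) - Real.log T.card) ≤
      ∑ ω, w ω * (1 / (T.card * pr w X (X ω)) - 1) := by
    refine sum_le_sum fun ω _ => ?_
    rcases (hw.nonneg ω).eq_or_lt with h0 | h0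
    · simp [← h0]
    · refine mul_le_mul_of_nonneg_left ?_ h0.le
      have hX := pr_pos hw X h0
      have hc : 0 < (T.card : ℝ) := by exact_mod_cast card_pos.2 ⟨_, hT ω h0.ne'⟩
      have := Real.log_le_sub_one_of_pos (x := 1 / (T.card * pr w X (X ω))) (by positivity)
      rw [Real.log_div one_ne_zero (by positivity), Real.log_mul hc.ne' hX.ne',
        Real.log_one] at this
      linarith
  simp_rw [mul_sub] at h2
  rw [sum_sub_distrib, sum_sub_distrib, ← sum_mul, ← sum_mul, hw.sum_one] at h2
  simp only [mul_neg, sum_neg_distrib] at h2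
  unfold Hent
  linarith

end Basic

end Entropy

section CondProd

variable {Ω Ω' : Type*} [Fintype Ω] [Fintype Ω']
variable {α β γ δ ι κ : Type*} {w : Ω → ℝ} {w' : Ω' → ℝ}

lemma isProb_cw (hw : IsProb w) (Y : Ω → α) {ω₀ : Ω} (h : 0 < w ω₀) : IsProb (cw w Y ω₀) := by
  refine ⟨fun ω => ?_, ?_⟩
  · unfold cw
    split_ifs
    exacts [div_nonneg (hw.nonneg _) (pr_nonneg hw _ _), le_rfl]
  · have : ∀ ω, cw w Y ω₀ ω = (if Y ω = Y ω₀ then w ω else 0) / pr w Y (Y ω₀) := by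
      intro ω
      unfold cw
      split_ifs <;> simp
    simp_rw [this]
    rw [← sum_div]
    exact div_self (pr_pos hw Y h).ne'

/-- The chain rule for conditional entropy. -/
lemma sum_mul_Hent_cw (hw : IsProb w) (X : Ω → α) (Y : Ω → β) :
    ∑ ω₀, w ω₀ * Hent (cw w Y ω₀) X = Hent w (fun ω => (X ω, Y ω)) - Hent w Y := by
  have hpr : ∀ ω₀ ω, Y ω = Y ω₀ → pr (cw w Y ω₀) X (X ω) =
      pr w (fun ω => (X ω, Y ω)) (X ω, Y ω) / pr w Y (Y ω) := by
    intro ω₀ ω h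
    unfold pr
    rw [sum_div]
    refine sum_congr rfl fun a _ => ?_
    unfold cw pr
    rw [h]
    by_cases h1 : X a = X ω <;> by_cases h2 : Y a = Y ω₀ <;> simp [h1, h2]
  have e1 : ∀ ω₀, w ω₀ * Hent (cw w Y ω₀) X = ∑ ω, -(w ω * Real.log
      (pr w (fun ω => (X ω, Y ω)) (X ω, Y ω) / pr w Y (Y ω))) *
        ((if Y ω₀ = Y ω then w ω₀ else 0) / pr w Y (Y ω)) := by
    intro ω₀
    unfold Hent
    rw [mul_neg, mul_sum, ← sum_neg_distrib]
    refine sum_congr rfl fun ω _ => ?_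
    by_cases h : Y ω = Y ω₀
    · rw [hpr ω₀ ω h, if_pos h.symm]
      simp only [cw, h, if_true]
      ring
    · have h' : ¬ Y ω₀ = Y ω := fun h' => h h'.symm
      simp [cw, h, h']
  simp_rw [e1]
  rw [sum_comm]
  unfold Hent
  rw [sub_neg_eq_add, neg_add_eq_sub, ← sum_sub_distrib]
  refine sum_congr rfl fun ω _ => ?_
  rw [← mul_sum, ← sum_div]
  rcases (hw.nonneg ω).eq_or_lt with h0 | h0
  · simp [← h0]
  · have h1 := pr_pos hw Y h0
    have h2 := pr_pos hw (fun ω => (X ω, Y ω)) h0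
    change -(w ω * Real.log (pr w (fun ω => (X ω, Y ω)) (X ω, Y ω) / pr w Y (Y ω))) *
        (pr w Y (Y ω) / pr w Y (Y ω)) = _
    rw [div_self h1.ne', Real.log_div h2.ne' h1.ne']
    ring

/-- The product weight on a product of two spaces. -/
def pairW (w : Ω → ℝ) (w' : Ω' → ℝ) : Ω × Ω' → ℝ := fun ω => w ω.1 * w' ω.2

lemma isProb_pairW (hw : IsProb w) (hw' : IsProb w') : IsProb (pairW w w') :=
  ⟨fun ω => mul_nonneg (hw.nonneg _) (hw'.nonneg _), by
    unfold pairW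
    rw [Fintype.sum_prod_type]
    simp_rw [← mul_sum]
    rw [hw'.sum_one]
    simp [hw.sum_one]⟩

lemma pr_pairW (X : Ω → α) (Y : Ω' → β) (s : α × β) :
    pr (pairW w w') (fun ω => (X ω.1, Y ω.2)) s = pr w X s.1 * pr w' Y s.2 := by
  unfold pr pairW
  rw [Fintype.sum_prod_type, sum_mul_sum]
  refine sum_congr rfl fun a _ => sum_congr rfl fun b _ => ?_
  by_cases h1 : X a = s.1 <;> by_cases h2 : Y b = s.2 <;> simp [Prod.ext_iff, h1, h2]

lemma pr_pairW_fst (hw' : IsProb w') (X : Ω → α) (s : α) :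
    pr (pairW w w') (fun ω => X ω.1) s = pr w X s := by
  unfold pr pairW
  rw [Fintype.sum_prod_type]
  refine sum_congr rfl fun a _ => ?_
  by_cases h : X a = s <;> simp [h, ← mul_sum, hw'.sum_one]

lemma pr_pairW_snd (hw : IsProb w) (X : Ω' → α) (s : α) :
    pr (pairW w w') (fun ω => X ω.2) s = pr w' X s := by
  unfold pr pairW
  rw [Fintype.sum_prod_type, sum_comm]
  refine sum_congr rfl fun a _ => ?_
  by_cases h : X a = s <;> simp [h, ← sum_mul, hw.sum_one]

lemma Hent_pairW_fst (hw' : IsProb w') (X : Ω → α) :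
    Hent (pairW w w') (fun ω => X ω.1) = Hent w X := by
  unfold Hent
  simp_rw [pr_pairW_fst hw']
  unfold pairW
  rw [Fintype.sum_prod_type]
  congr 1
  refine sum_congr rfl fun a _ => ?_
  simp_rw [← sum_mul, ← mul_sum, hw'.sum_one, mul_one]

lemma Hent_pairW_snd (hw : IsProb w) (X : Ω' → α) :
    Hent (pairW w w') (fun ω => X ω.2) = Hent w' X := by
  unfold Hent
  simp_rw [pr_pairW_snd hw]
  unfold pairW
  rw [Fintype.sum_prod_type, sum_comm]
  congr 1
  refine sum_congr rfl fun a _ => ?_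
  simp_rw [← sum_mul, hw.sum_one, one_mul]

lemma Hent_pairW (hw : IsProb w) (hw' : IsProb w') (X : Ω → α) (Y : Ω' → β) :
    Hent (pairW w w') (fun ω => (X ω.1, Y ω.2)) = Hent w X + Hent w' Y := by
  have e : ∀ ω : Ω × Ω', pairW w w' ω * Real.log (pr w X (X ω.1) * pr w' Y (Y ω.2)) =
      pairW w w' ω * Real.log (pr (pairW w w') (fun ω => X ω.1) (X ω.1)) +
      pairW w w' ω * Real.log (pr (pairW w w') (fun ω => Y ω.2) (Y ω.2)) := by
    intro ω
    rw [pr_pairW_fst hw', pr_pairW_snd hw]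
    rcases (hw.nonneg ω.1).eq_or_lt with h0 | h0
    · simp [pairW, ← h0]
    rcases (hw'.nonneg ω.2).eq_or_lt with h1 | h1
    · simp [pairW, ← h1]
    rw [Real.log_mul (pr_pos hw X h0).ne' (pr_pos hw' Y h1).ne']
    ring
  rw [← Hent_pairW_fst hw' X, ← Hent_pairW_snd hw Y]
  unfold Hent
  rw [← neg_add, ← sum_add_distrib]
  congr 1
  refine sum_congr rfl fun ω _ => ?_
  rw [pr_pairW, e]

lemma pr_eq_pairW [Fintype α] [Fintype β] (X : Ω → α) (Y : Ω' → β) :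
    pr (pairW w w') (fun ω => (X ω.1, Y ω.2)) = pairW (pr w X) (pr w' Y) :=
  funext fun s => pr_pairW X Y s

lemma Hent_pairW_pr [Fintype α] [Fintype β] (X : Ω → α) (Y : Ω' → β) (g : α × β → γ) :
    Hent (pairW (pr w X) (pr w' Y)) g = Hent (pairW w w') (fun ω => g (X ω.1, Y ω.2)) := by
  rw [← pr_eq_pairW, Hent_pr]

lemma cw_pairW (Y : Ω → α) (Y' : Ω' → β) (ω₀ : Ω × Ω') :
    cw (pairW w w') (fun ω => (Y ω.1, Y' ω.2)) ω₀ = pairW (cw w Y ω₀.1) (cw w' Y' ω₀.2) := by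
  funext ω
  unfold cw
  rw [pr_pairW]
  unfold pairW
  by_cases h1 : Y ω.1 = Y ω₀.1 <;> by_cases h2 : Y' ω.2 = Y' ω₀.2 <;>
    simp [h1, h2, div_mul_div_comm]

/-- The product weight on a power of a space. -/
def prodW [Fintype ι] (w : ι → Ω → ℝ) : (ι → Ω) → ℝ := fun ω => ∏ i, w i (ω i)

section Pi

variable [Fintype ι] [Fintype κ] {v : ι → Ω → ℝ}

lemma sum_prod_eval (f : ι → Ω → ℝ) : ∑ ω : ι → Ω, ∏ i, f i (ω i) = ∏ i, ∑ x, f i x := by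
  rw [Finset.prod_univ_sum, Fintype.piFinset_univ]

lemma isProb_prodW (hv : ∀ i, IsProb (v i)) : IsProb (prodW v) :=
  ⟨fun ω => prod_nonneg fun i _ => (hv i).nonneg _, by
    unfold prodW
    rw [sum_prod_eval]
    exact prod_eq_one fun i _ => (hv i).sum_one⟩

lemma pr_prodW (X : ι → Ω → α) (s : ι → α) :
    pr (prodW v) (fun ω i => X i (ω i)) s = ∏ i, pr (v i) (X i) (s i) := by
  unfold pr prodW
  rw [← sum_prod_eval]
  refine sum_congr rfl fun ω _ => ?_
  by_cases h : (fun i => X i (ω i)) = s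
  · rw [if_pos h]
    refine prod_congr rfl fun i _ => ?_
    rw [if_pos (congr_fun h i)]
  · rw [if_neg h]
    obtain ⟨i, hi⟩ := Function.ne_iff.1 h
    exact (prod_eq_zero (mem_univ i) (if_neg hi)).symm

lemma Hent_prodW_pr [Fintype α] (X : ι → Ω → α) (g : (ι → α) → γ) :
    Hent (prodW fun i => pr (v i) (X i)) g = Hent (prodW v) (fun ω => g fun i => X i (ω i)) := by
  rw [← Hent_pr (w := prodW v) (fun ω i => X i (ω i)) g]
  congr 1
  funext s
  rw [pr_prodW]
  rfl

lemma cw_prodW (Y : ι → Ω → α) (ω₀ : ι → Ω) :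
    cw (prodW v) (fun ω i => Y i (ω i)) ω₀ = prodW fun i => cw (v i) (Y i) (ω₀ i) := by
  funext ω
  unfold cw
  rw [pr_prodW]
  unfold prodW
  by_cases h : (fun i => Y i (ω i)) = fun i => Y i (ω₀ i)
  · rw [if_pos h, ← prod_div_distrib]
    exact prod_congr rfl fun i _ => (if_pos (congr_fun h i)).symm
  · rw [if_neg h]
    obtain ⟨i, hi⟩ := Function.ne_iff.1 h
    exact (prod_eq_zero (mem_univ i) (if_neg hi)).symm

lemma sum_prodW_mul (hv : ∀ i, IsProb (v i)) (i : ι) (f : Ω → ℝ) :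
    ∑ ω, prodW v ω * f (ω i) = ∑ x, v i x * f x := by
  have : ∀ ω : ι → Ω, prodW v ω * f (ω i) =
      ∏ j, (v j (ω j) * if j = i then f (ω j) else 1) := by
    intro ω
    rw [prod_mul_distrib, prod_ite_eq' univ i (fun j => f (ω j)), if_pos (mem_univ i)]
    rfl
  simp_rw [this]
  rw [sum_prod_eval (fun j x => v j x * if j = i then f x else 1),
    prod_eq_single i]
  · simp
  · intro j _ hj
    simp [hj, (hv j).sum_one]
  · simp

lemma Hent_prodW_eval (hv : ∀ i, IsProb (v i)) (i : ι) (X : Ω → α) :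
    Hent (prodW v) (fun ω => X (ω i)) = Hent (v i) X := by
  have hp : ∀ s, pr (prodW v) (fun ω => X (ω i)) s = pr (v i) X s := by
    intro s
    have := sum_prodW_mul hv i (fun x => if X x = s then 1 else 0)
    simpa [pr] using this
  unfold Hent
  simp_rw [hp]
  rw [sum_prodW_mul hv i (fun x => Real.log (pr (v i) X (X x)))]

lemma Hent_prodW (hv : ∀ i, IsProb (v i)) (X : ι → Ω → α) :
    Hent (prodW v) (fun ω i => X i (ω i)) = ∑ i, Hent (v i) (X i) := by
  have e : ∀ ω : ι → Ω, prodW v ω * Real.log (∏ i, pr (v i) (X i) (X i (ω i))) =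
      ∑ i, prodW v ω * Real.log (pr (v i) (X i) (X i (ω i))) := by
    intro ω
    by_cases h : prodW v ω = 0
    · simp [h]
    · rw [← mul_sum, Real.log_prod]
      intro i _
      have : v i (ω i) ≠ 0 := fun h0 => h (prod_eq_zero (mem_univ i) h0)
      exact (pr_pos (hv i) (X i) (lt_of_le_of_ne ((hv i).nonneg _) this.symm)).ne'
  unfold Hent
  rw [sum_neg_distrib]
  congr 1
  simp_rw [pr_prodW, e]
  rw [sum_comm]
  refine sum_congr rfl fun i _ => ?_
  rw [sum_prodW_mul hv i (fun x => Real.log (pr (v i) (X i) (X i x)))]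

/-- Marginals of a product weight along an injection. -/
lemma pr_prodW_comp (hv : ∀ i, IsProb (v i)) {e : κ → ι} (he : Function.Injective e)
    (s : κ → Ω) : pr (prodW v) (fun ω k => ω (e k)) s = prodW (fun k => v (e k)) s := by
  have : ∀ ω : ι → Ω, (if (fun k => ω (e k)) = s then prodW v ω else 0) =
      ∏ i, (if ∀ k, e k = i → ω i = s k then v i (ω i) else 0) := by
    intro ω
    by_cases h : (fun k => ω (e k)) = s
    · rw [if_pos h]
      refine prod_congr rfl fun i _ => ?_
      rw [if_pos]
      rintro k rfl
      exact congr_fun h k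
    · rw [if_neg h]
      obtain ⟨k, hk⟩ := Function.ne_iff.1 h
      exact (prod_eq_zero (mem_univ (e k)) (if_neg fun h' => hk (h' k rfl))).symm
  unfold pr
  rw [sum_congr rfl fun ω _ => (by convert this ω),
    sum_prod_eval (fun i x => if ∀ k, e k = i → x = s k then v i x else 0)]
  symm
  refine Fintype.prod_of_injective e he _ _ ?_ ?_
  · intro i hi
    rw [← (hv i).sum_one]
    refine sum_congr rfl fun x _ => ?_
    rw [if_pos]
    intro k hk
    exact absurd ⟨k, hk⟩ hi
  · intro k
    have : ∀ x, (∀ k', e k' = e k → x = s k') ↔ x = s k := fun x =>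
      ⟨fun h => h k rfl, fun h k' hk' => by rw [he hk', h]⟩
    simp_rw [this]
    simp

lemma Hent_prodW_comp (hv : ∀ i, IsProb (v i)) {e : κ → ι} (he : Function.Injective e)
    (X : (κ → Ω) → α) :
    Hent (prodW v) (fun ω => X fun k => ω (e k)) = Hent (prodW fun k => v (e k)) X := by
  rw [← Hent_pr (w := prodW v) (fun ω k => ω (e k)) X]
  congr 1
  funext s
  exact pr_prodW_comp hv he s

lemma pr_prodW_pair (hv : ∀ i, IsProb (v i)) {i j : ι} (hij : i ≠ j) (s : Ω × Ω) :
    pr (prodW v) (fun ω => (ω i, ω j)) s = pairW (v i) (v j) s := by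
  have he : Function.Injective (fun b : Bool => if b then i else j) := by
    intro a b
    cases a <;> cases b <;> simp [hij, hij.symm]
  have := pr_prodW_comp hv he (fun b => if b then s.1 else s.2)
  simp only [prodW, Fintype.prod_bool, if_true, Bool.false_eq_true, if_false] at this
  unfold pairW
  rw [← this]
  unfold pr
  refine sum_congr rfl fun ω _ => ?_
  congr 1
  simp [funext_iff, Prod.ext_iff, and_comm]

lemma Hent_prodW_pair (hv : ∀ i, IsProb (v i)) {i j : ι} (hij : i ≠ j) (X : Ω × Ω → α) :
    Hent (prodW v) (fun ω => X (ω i, ω j)) = Hent (pairW (v i) (v j)) X := by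
  rw [← Hent_pr (w := prodW v) (fun ω => (ω i, ω j)) X]
  congr 1
  funext s
  exact pr_prodW_pair hv hij s

end Pi

end CondProd

section GroupEntropy

variable {Ω : Type*} [Fintype Ω] {w : Ω → ℝ} {G : Type*} [AddCommGroup G]

/-- The Kaimanovich–Vershik inequality. -/
lemma Hent_add_add_le (hw : IsProb w) (X Y Z : Ω → G)
    (h : Hent w X + Hent w Y + Hent w Z ≤ Hent w (fun ω => ((X ω, Y ω), Z ω))) :
    Hent w X + Hent w (fun ω => X ω + Y ω + Z ω) ≤
      Hent w (fun ω => X ω + Y ω) + Hent w (fun ω => X ω + Z ω) := by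
  have h1 := Hent_submod hw (P := fun ω => (X ω + Y ω, Z ω)) (Q := fun ω => (X ω + Z ω, Y ω))
    (Z := fun ω => X ω + Y ω + Z ω) (J := fun ω => ((X ω, Y ω), Z ω))
    (by
      intro ω ω' h
      simp only [Prod.mk.injEq] at h
      simp only [h.1, h.2])
    (by
      intro ω ω' h
      simp only [Prod.mk.injEq] at h
      rw [add_right_comm, h.1, h.2, add_right_comm])
    (by
      intro ω ω' h h'
      simp only [Prod.mk.injEq] at h h'
      have e := h.1
      rw [h'.2, add_left_inj] at e
      simp only [Prod.mk.injEq]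
      exact ⟨⟨e, h'.2⟩, h.2⟩)
  have h2 := Hent_subadd hw (P := fun ω => X ω + Y ω) (Q := Z) (J := fun ω => (X ω + Y ω, Z ω))
    (fun ω ω' h h' => Prod.ext h h')
  have h3 := Hent_subadd hw (P := fun ω => X ω + Z ω) (Q := Y) (J := fun ω => (X ω + Z ω, Y ω))
    (fun ω ω' h h' => Prod.ext h h')
  linarith

/-- The entropic Ruzsa triangle inequality, for `A` independent of `(B, C)`. -/
lemma Hent_triangle (hw : IsProb w) (A B C : Ω → G)
    (h : Hent w A + Hent w (fun ω => (B ω, C ω)) ≤ Hent w (fun ω => (A ω, (B ω, C ω)))) :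
    Hent w (fun ω => A ω - C ω) + Hent w (fun ω => (B ω, C ω)) ≤
      Hent w (fun ω => A ω - B ω) + Hent w (fun ω => B ω - C ω) + Hent w C := by
  have h1 := Hent_submod hw (P := fun ω => (A ω - B ω, B ω - C ω)) (Q := fun ω => (A ω, C ω))
    (Z := fun ω => A ω - C ω) (J := fun ω => (A ω, (B ω, C ω)))
    (by
      intro ω ω' h
      simp only [Prod.mk.injEq] at h
      rw [← sub_add_sub_cancel (A ω) (B ω), h.1, h.2, sub_add_sub_cancel])
    (by
      intro ω ω' h
      simp only [Prod.mk.injEq] at h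
      rw [h.1, h.2])
    (by
      intro ω ω' h h'
      simp only [Prod.mk.injEq] at h h'
      have e := h.1
      rw [h'.1, sub_right_inj] at e
      simp only [Prod.mk.injEq]
      exact ⟨h'.1, e, h'.2⟩)
  have h2 := Hent_subadd hw (P := fun ω => A ω - B ω) (Q := fun ω => B ω - C ω)
    (J := fun ω => (A ω - B ω, B ω - C ω)) (fun ω ω' h h' => Prod.ext h h')
  have h3 := Hent_subadd hw (P := A) (Q := C) (J := fun ω => (A ω, C ω))
    (fun ω ω' h h' => Prod.ext h h')
  linarith

end GroupEntropy

section Blocks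

variable {Ω ι : Type*} [Fintype Ω] [Fintype ι] {v : ι → Ω → ℝ} {α β γ : Type*}

/-- The restriction of `ω` to the coordinates in `A`. -/
noncomputable def restr (A : Finset ι) (ω : ι → Ω) : ι → Option Ω :=
  fun i => if i ∈ A then some (ω i) else none

lemma restr_eq_iff {A : Finset ι} {ω ω' : ι → Ω} :
    restr A ω = restr A ω' ↔ ∀ i ∈ A, ω i = ω' i := by
  constructor
  · intro h i hi
    have := congr_fun h i
    simpa [restr, hi] using this
  · intro h
    funext i
    by_cases hi : i ∈ A
    · simp [restr, hi, h i hi]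
    · simp [restr, hi]

lemma Hent_restr_le (hv : ∀ i, IsProb (v i)) (A : Finset ι) :
    Hent (prodW v) (restr A) ≤ ∑ i ∈ A, Hent (v i) id := by
  have hw := isProb_prodW hv
  induction A using Finset.induction_on with
  | empty =>
    rw [sum_empty]
    have := Hent_mono hw (X := fun _ : ι → Ω => ()) (Y := restr ∅)
      (fun ω ω' _ => restr_eq_iff.2 (by simp))
    rwa [Hent_const hw] at this
  | insert i A hi ih =>
    rw [sum_insert hi]
    have := Hent_subadd hw (P := fun ω : ι → Ω => id (ω i)) (Q := restr A) (J := restr (insert i A))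
      (fun ω ω' h h' => restr_eq_iff.2 (by
        intro j hj
        rcases mem_insert.1 hj with rfl | hj
        · exact h
        · exact restr_eq_iff.1 h' j hj))
    rw [Hent_prodW_eval hv] at this
    linarith

/-- Functions of disjoint blocks of coordinates are independent. -/
lemma Hent_indep (hv : ∀ i, IsProb (v i)) (A : Finset ι) {f : (ι → Ω) → α} {g : (ι → Ω) → β}
    (hf : ∀ ω ω' : ι → Ω, (∀ i ∈ A, ω i = ω' i) → f ω = f ω')
    (hg : ∀ ω ω' : ι → Ω, (∀ i ∉ A, ω i = ω' i) → g ω = g ω') :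
    Hent (prodW v) f + Hent (prodW v) g ≤ Hent (prodW v) (fun ω => (f ω, g ω)) := by
  have hw := isProb_prodW hv
  have h1 := Hent_submod hw (P := restr A) (Q := fun ω => (f ω, g ω)) (Z := f)
    (J := fun ω => (restr A ω, g ω)) (fun ω ω' h => hf _ _ (restr_eq_iff.1 h))
    (fun ω ω' h => (Prod.ext_iff.1 h).1)
    (fun ω ω' h h' => Prod.ext h (Prod.ext_iff.1 h').2)
  have h2 := Hent_submod hw (P := restr Aᶜ) (Q := fun ω => (restr A ω, g ω)) (Z := g)
    (J := fun ω : ι → Ω => fun i => id (ω i))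
    (fun ω ω' h => hg _ _ (fun i hi => restr_eq_iff.1 h i (mem_compl.2 hi)))
    (fun ω ω' h => (Prod.ext_iff.1 h).2)
    (fun ω ω' h h' => funext fun i => by
      by_cases hi : i ∈ A
      · exact restr_eq_iff.1 (Prod.ext_iff.1 h').1 i hi
      · exact restr_eq_iff.1 h i (mem_compl.2 hi))
  rw [Hent_prodW hv (fun _ => id)] at h2
  have h3 := Hent_restr_le hv A
  have h4 := Hent_restr_le hv Aᶜ
  have h5 := sum_add_sum_compl A (fun i => Hent (v i) id)
  linarith

end Blocks

section Lin

variable {p : ℕ} [Fact p.Prime] {G : Type*} [AddCommGroup G] [Module (ZMod p) G] [Fintype G]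
variable {ι κ : Type*} [Fintype ι] [Fintype κ] {μ : ι → G → ℝ}

/-- The coefficient vector with the single nonzero entry `c` at `i`. -/
noncomputable abbrev sgl (i : ι) (c : ZMod p) : ι → ZMod p := Pi.single i c

/-- The linear combination of coordinates with coefficients `a`. -/
def lin (a : ι → ZMod p) (ω : ι → G) : G := ∑ i, a i • ω i

lemma lin_add (a b : ι → ZMod p) (ω : ι → G) : lin (a + b) ω = lin a ω + lin b ω := by
  simp [lin, add_smul, sum_add_distrib]

lemma lin_neg (a : ι → ZMod p) (ω : ι → G) : lin (-a) ω = -lin a ω := by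
  simp [lin]

lemma lin_sub (a b : ι → ZMod p) (ω : ι → G) : lin (a - b) ω = lin a ω - lin b ω := by
  simp [lin, sub_smul]

lemma lin_single (i : ι) (c : ZMod p) (ω : ι → G) : lin (sgl i c) ω = c • ω i := by
  unfold lin
  rw [sum_eq_single i]
  · simp
  · intro j _ hj
    simp [Pi.single_eq_of_ne hj]
  · simp

lemma lin_congr {a : ι → ZMod p} {ω ω' : ι → G} (h : ∀ i, a i ≠ 0 → ω i = ω' i) :
    lin a ω = lin a ω' := by
  refine sum_congr rfl fun i _ => ?_
  by_cases h0 : a i = 0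
  · simp [h0]
  · rw [h i h0]

/-- The entropy of a linear combination of independent variables. -/
noncomputable def Lf (μ : ι → G → ℝ) (a : ι → ZMod p) : ℝ := Hent (prodW μ) (lin a)

/-- The entropy of a law. -/
noncomputable def hent (ν : G → ℝ) : ℝ := Hent ν id

/-- The entropic Ruzsa distance between two laws. -/
noncomputable def rdist (ν ν' : G → ℝ) : ℝ :=
  Hent (pairW ν ν') (fun s => s.1 - s.2) - (hent ν + hent ν') / 2

lemma Hent_lin_pair (hμ : ∀ i, IsProb (μ i)) {a b : ι → ZMod p} (hab : ∀ i, a i = 0 ∨ b i = 0) :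
    Lf μ a + Lf μ b ≤ Hent (prodW μ) (fun ω => (lin a ω, lin b ω)) := by
  refine Hent_indep hμ (univ.filter fun i => a i ≠ 0) ?_ ?_
  · exact fun ω ω' h => lin_congr fun i hi => h i (by simp [hi])
  · refine fun ω ω' h => lin_congr fun i hi => h i ?_
    have := hab i
    simp only [mem_filter, mem_univ, true_and, not_not]
    tauto

lemma Hent_lin_triple (hμ : ∀ i, IsProb (μ i)) {a b c : ι → ZMod p}
    (hab : ∀ i, a i = 0 ∨ b i = 0) (hac : ∀ i, a i = 0 ∨ c i = 0) (hbc : ∀ i, b i = 0 ∨ c i = 0) :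
    Lf μ a + Lf μ b + Lf μ c ≤ Hent (prodW μ) (fun ω => ((lin a ω, lin b ω), lin c ω)) := by
  refine (add_le_add_left (Hent_lin_pair hμ hab) _).trans ?_
  refine Hent_indep hμ (univ.filter fun i => c i = 0) ?_ ?_
  · intro ω ω' h
    refine Prod.ext (lin_congr fun i hi => h i ?_) (lin_congr fun i hi => h i ?_)
    · have := hac i
      simp only [mem_filter, mem_univ, true_and]
      tauto
    · have := hbc i
      simp only [mem_filter, mem_univ, true_and]
      tauto
  · exact fun ω ω' h => lin_congr fun i hi => h i (by simp [hi])

lemma Lf_KV (hμ : ∀ i, IsProb (μ i)) {a b c : ι → ZMod p}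
    (hab : ∀ i, a i = 0 ∨ b i = 0) (hac : ∀ i, a i = 0 ∨ c i = 0) (hbc : ∀ i, b i = 0 ∨ c i = 0) :
    Lf μ a + Lf μ (a + b + c) ≤ Lf μ (a + b) + Lf μ (a + c) := by
  have := Hent_add_add_le (isProb_prodW hμ) _ _ _ (Hent_lin_triple hμ hab hac hbc)
  simp_rw [← lin_add] at this
  exact this

lemma Lf_le_add (hμ : ∀ i, IsProb (μ i)) {a b : ι → ZMod p} (hab : ∀ i, a i = 0 ∨ b i = 0) :
    Lf μ a ≤ Lf μ (a + b) := by
  have h1 := Hent_lin_pair hμ hab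
  have h2 := Hent_subadd (isProb_prodW hμ) (P := lin (a + b)) (Q := lin b)
    (J := fun ω : ι → G => (lin a ω, lin b ω)) (fun ω ω' h h' => by
      rw [lin_add, lin_add, h', add_left_inj] at h
      exact Prod.ext h h')
  unfold Lf at *
  linarith

lemma Lf_neg (hμ : ∀ i, IsProb (μ i)) (a : ι → ZMod p) : Lf μ (-a) = Lf μ a :=
  Hent_congr (isProb_prodW hμ) fun ω ω' => by rw [lin_neg, lin_neg, neg_inj]

lemma Lf_single (hμ : ∀ i, IsProb (μ i)) (i : ι) {c : ZMod p} (hc : c ≠ 0) :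
    Lf μ (sgl i c) = hent (μ i) := by
  unfold hent
  rw [← Hent_prodW_eval hμ i id]
  refine Hent_congr (isProb_prodW hμ) fun ω ω' => ?_
  rw [lin_single, lin_single]
  exact (smul_right_injective G hc).eq_iff

lemma Lf_comp (hμ : ∀ i, IsProb (μ i)) {e : κ → ι} (he : Function.Injective e)
    {a : ι → ZMod p} (ha : ∀ i, i ∉ Set.range e → a i = 0) :
    Lf μ a = Lf (fun k => μ (e k)) (fun k => a (e k)) := by
  unfold Lf
  rw [← Hent_prodW_comp hμ he]
  congr 1
  funext ω
  refine (Fintype.sum_of_injective e he _ _ ?_ ?_).symm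
  · intro i hi
    rw [ha i hi, zero_smul]
  · intro k
    rfl

lemma Lf_sub_pair (hμ : ∀ i, IsProb (μ i)) {i j : ι} (hij : i ≠ j) :
    Lf μ (sgl i (1 : ZMod p) - sgl j 1) =
      Hent (pairW (μ i) (μ j)) (fun s => s.1 - s.2) := by
  unfold Lf
  rw [← Hent_prodW_pair hμ hij]
  congr 1
  funext ω
  rw [lin_sub, lin_single, lin_single, one_smul, one_smul]

lemma single_disjoint {i j : ι} (hij : i ≠ j) (c d : ZMod p) (k : ι) :
    sgl i c k = 0 ∨ sgl j d k = 0 := by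
  by_cases h : k = i
  · right
    exact Pi.single_eq_of_ne (by rw [h]; exact hij) _
  · exact Or.inl (Pi.single_eq_of_ne h _)

/-- Iterated Kaimanovich–Vershik inequality with a common base variable. -/
lemma Lf_star (hμ : ∀ i, IsProb (μ i)) {i₀ : ι} {c : ZMod p} {a : ι → ZMod p} {K : ℝ}
    (T : Finset ι) (hT : i₀ ∉ T)
    (h : ∀ i ∈ T, Lf μ (sgl i₀ c + sgl i (a i)) ≤ Lf μ (sgl i₀ c) + K) :
    Lf μ (sgl i₀ c + ∑ i ∈ T, sgl i (a i)) ≤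
      Lf μ (sgl i₀ c) + T.card * K := by
  induction T using Finset.induction_on with
  | empty => simp
  | insert i T hi ih =>
    rw [sum_insert hi, card_insert_of_notMem hi]
    have hi0 : i₀ ≠ i := fun h' => hT (by simp [h'])
    have hT' : i₀ ∉ T := fun h' => hT (mem_insert_of_mem h')
    have h1 := ih hT' fun j hj => h j (mem_insert_of_mem hj)
    have h2 := h i (mem_insert_self _ _)
    have hs : ∀ j, j ∉ T → (∑ i ∈ T, sgl i (a i) : ι → ZMod p) j = 0 := by
      intro j hj
      rw [Finset.sum_apply]
      exact sum_eq_zero fun k hk => Pi.single_eq_of_ne (by rintro rfl; exact hj hk) _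
    have h3 := Lf_KV hμ (a := sgl i₀ c) (b := sgl i (a i))
      (c := ∑ i ∈ T, sgl i (a i)) (single_disjoint hi0 _ _)
      (fun j => by
        by_cases hj : j = i₀
        · exact Or.inr (hs j (hj ▸ hT'))
        · exact Or.inl (Pi.single_eq_of_ne hj _))
      (fun j => by
        by_cases hj : j = i
        · exact Or.inr (hs j (hj ▸ hi))
        · exact Or.inl (Pi.single_eq_of_ne hj _))
    rw [← add_assoc]
    push_cast
    linarith

lemma sum_single_support (a : ι → ZMod p) :
    ∑ i ∈ univ.filter (fun i => a i ≠ 0), sgl i (a i) = a := by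
  funext j
  rw [Finset.sum_apply, sum_filter]
  rw [sum_eq_single j]
  · by_cases h : a j = 0 <;> simp [h]
  · intro i _ hij
    simp [Pi.single_eq_of_ne hij.symm]
  · simp

end Lin

section Minimiser

variable {G : Type*} [AddCommGroup G] [Fintype G] {J : Type*} [Fintype J]

/-- The entropy of the sum of independent variables with laws `μ j`. -/
noncomputable def hsum (μ : J → G → ℝ) : ℝ := Hent (prodW μ) (fun ω => ∑ j, ω j)

/-- The multidistance functional with a penalty for the distance to a reference law. -/
noncomputable def ptau (η : ℝ) (ν : G → ℝ) (μ : J → G → ℝ) : ℝ :=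
  hsum μ - (∑ j, hent (μ j)) / Fintype.card J + η * ∑ j, rdist (μ j) ν

/-- `μ` minimises `ptau η ν` among tuples of laws. -/
structure IsTauMin (η : ℝ) (ν : G → ℝ) (μ : J → G → ℝ) : Prop where
  prob : ∀ j, IsProb (μ j)
  le : ∀ μ' : J → G → ℝ, (∀ j, IsProb (μ' j)) → ptau η ν μ ≤ ptau η ν μ'

lemma continuous_pr {Ω α T : Type*} [Fintype Ω] [TopologicalSpace T] {f : T → Ω → ℝ}
    (hf : ∀ ω, Continuous fun t => f t ω) (X : Ω → α) (s : α) :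
    Continuous fun t => pr (f t) X s := by
  unfold pr
  refine continuous_finsetSum _ fun ω _ => ?_
  by_cases h : X ω = s
  · simpa [h] using hf ω
  · simpa [h] using continuous_const

lemma continuous_Hent {Ω α T : Type*} [Fintype Ω] [Fintype α] [TopologicalSpace T]
    {f : T → Ω → ℝ} (hf : ∀ ω, Continuous fun t => f t ω) (X : Ω → α) :
    Continuous fun t => Hent (f t) X := by
  simp_rw [Hent_eq_sum]
  exact continuous_finsetSum _ fun s _ =>
    Real.continuous_negMulLog.comp (continuous_pr hf X s)

lemma continuous_tau (η : ℝ) (ν : G → ℝ) :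
    Continuous fun μ : J → G → ℝ => ptau η ν μ := by
  have h1 : ∀ (j : J) (g : G), Continuous fun μ : J → G → ℝ => μ j g :=
    fun j g => by fun_prop
  have h2 : Continuous fun μ : J → G → ℝ => hsum μ :=
    continuous_Hent (fun ω => by unfold prodW; fun_prop) _
  have h3 : ∀ j, Continuous fun μ : J → G → ℝ => hent (μ j) :=
    fun j => continuous_Hent (fun ω => h1 j ω) _
  have h4 : ∀ j, Continuous fun μ : J → G → ℝ => rdist (μ j) ν := by
    intro j
    unfold rdist
    exact (continuous_Hent (fun ω : G × G => (h1 j ω.1).mul continuous_const) _).sub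
      (((h3 j).add continuous_const).div_const _)
  unfold ptau
  exact (h2.sub ((continuous_finsetSum _ fun j _ => h3 j).div_const _)).add
    (continuous_const.mul (continuous_finsetSum _ fun j _ => h4 j))

lemma exists_isTauMin (η : ℝ) {ν : G → ℝ} (hν : IsProb ν) :
    ∃ μ : J → G → ℝ, IsTauMin η ν μ := by
  let K : Set (J → G → ℝ) := {μ | ∀ j, IsProb (μ j)}
  have hK : IsCompact K := by
    refine (isCompact_Icc (a := (0 : J → G → ℝ)) (b := 1)).of_isClosed_subset ?_ ?_
    · have : K = ⋂ j, ((⋂ g, {μ : J → G → ℝ | 0 ≤ μ j g}) ∩ {μ | ∑ g, μ j g = 1}) := by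
        ext μ
        simp only [K, Set.mem_ofPred_eq, Set.mem_iInter, Set.mem_inter_iff]
        exact ⟨fun h j => ⟨(h j).1, (h j).2⟩, fun h j => ⟨(h j).1, (h j).2⟩⟩
      rw [this]
      refine isClosed_iInter fun j => (isClosed_iInter fun g => ?_).inter ?_
      · exact isClosed_le continuous_const (by fun_prop)
      · exact isClosed_eq (by fun_prop) continuous_const
    · intro μ hμ
      refine ⟨fun j g => (hμ j).nonneg g, fun j g => ?_⟩
      have := le_pr (hμ j) id g
      exact this.trans (pr_le_one (hμ j) id _)
  obtain ⟨μ, hμ, hmin⟩ := hK.exists_isMinOn ⟨fun _ => ν, fun _ => hν⟩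
    (continuous_tau (J := J) η ν).continuousOn
  exact ⟨μ, hμ, fun μ' hμ' => hmin hμ'⟩

lemma cw_const {Ω : Type*} [Fintype Ω] {w : Ω → ℝ} (hw : IsProb w) (ω₀ : Ω) :
    cw w (fun _ => ()) ω₀ = w := by
  funext ω
  simp [cw, pr, hw.sum_one]

section CondDist

variable {Ω α : Type*} [Fintype Ω] {w : Ω → ℝ} {ν : G → ℝ}

lemma rdist_pr (Z : Ω → G) : rdist (pr w Z) ν =
    Hent (pairW w ν) (fun s => Z s.1 - s.2) - (Hent w Z + hent ν) / 2 := by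
  unfold rdist
  congr 1
  · have hν : ν = pr ν id := by
      funext s
      simp [pr]
    conv_lhs => rw [hν]
    rw [Hent_pairW_pr]
    rfl
  · unfold hent
    rw [Hent_pr]
    rfl

/-- Conditioning increases the distance to a law by at most half of the mutual information. -/
lemma sum_rdist_cw_le (hw : IsProb w) (hν : IsProb ν) (Z : Ω → G) (Y : Ω → α) :
    ∑ ω₀, w ω₀ * rdist (pr (cw w Y ω₀) Z) ν ≤ Hent (pairW w ν) (fun s => Z s.1 - s.2) -
      (Hent w (fun ω => (Z ω, Y ω)) - Hent w Y + hent ν) / 2 := by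
  have hp := isProb_pairW hw hν
  simp_rw [rdist_pr]
  have h1 : ∑ ω₀, w ω₀ * Hent (pairW (cw w Y ω₀) ν) (fun s => Z s.1 - s.2) =
      ∑ s₀, pairW w ν s₀ * Hent (cw (pairW w ν) (fun s => (Y s.1, ())) s₀)
        (fun s => Z s.1 - s.2) := by
    rw [Fintype.sum_prod_type]
    refine sum_congr rfl fun ω₀ _ => ?_
    have : ∀ g, cw (pairW w ν) (fun s => (Y s.1, ())) (ω₀, g) = pairW (cw w Y ω₀) ν := by
      intro g
      rw [cw_pairW Y (fun _ => ()) (ω₀, g), cw_const hν]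
    simp_rw [this]
    rw [← sum_mul]
    unfold pairW
    simp_rw [← mul_sum, hν.sum_one, mul_one]
  rw [sum_mul_Hent_cw hp] at h1
  have h2 := sum_mul_Hent_cw hw Z Y
  have h3 := Hent_subadd hp (P := fun s : Ω × G => Z s.1 - s.2) (Q := fun s => (Y s.1, ()))
    (J := fun s => (Z s.1 - s.2, (Y s.1, ()))) (fun _ _ h h' => Prod.ext h h')
  have h4 : ∀ ω₀, w ω₀ * (Hent (pairW (cw w Y ω₀) ν) (fun s => Z s.1 - s.2) -
      (Hent (cw w Y ω₀) Z + hent ν) / 2) =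
      w ω₀ * Hent (pairW (cw w Y ω₀) ν) (fun s => Z s.1 - s.2) -
      (w ω₀ * Hent (cw w Y ω₀) Z) / 2 - w ω₀ * (hent ν / 2) := fun _ => by ring
  simp_rw [h4]
  rw [sum_sub_distrib, sum_sub_distrib, ← sum_mul, ← sum_div, h1, h2, hw.sum_one]
  linarith

/-- Adding an independent variable increases the distance by at most half of the growth of the
entropy. -/
lemma Hent_add_sub_le (hw : IsProb w) (hν : IsProb ν) (X Y : Ω → G)
    (h : Hent w X + Hent w Y ≤ Hent w (fun ω => (X ω, Y ω))) :
    Hent w X + Hent (pairW w ν) (fun s => X s.1 + Y s.1 - s.2) ≤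
      Hent w (fun ω => X ω + Y ω) + Hent (pairW w ν) (fun s => X s.1 - s.2) := by
  have hp := isProb_pairW hw hν
  have h1 := Hent_add_add_le hp (fun s => X s.1) (fun s => Y s.1) (fun s => -s.2) (by
    rw [Hent_pairW_fst hν X, Hent_pairW_fst hν Y,
      Hent_pairW hw hν (fun ω => (X ω, Y ω)) (fun g => -g), Hent_pairW_snd hw (fun g => -g)]
    linarith)
  rw [Hent_pairW_fst hν X, Hent_pairW_fst hν (fun ω => X ω + Y ω)] at h1
  simpa only [sub_eq_add_neg] using h1

end CondDist

/-- The minimality of `ptau` tested against conditioned tuples. -/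
lemma IsTauMin.le_cond {η : ℝ} {ν : G → ℝ} {μ : J → G → ℝ} (hmin : IsTauMin η ν μ) (hη : 0 ≤ η)
    (hν : IsProb ν) {Ω α : Type*} [Fintype Ω] {w : J → Ω → ℝ} (hw : ∀ j, IsProb (w j))
    (Z : J → Ω → G) (Y : J → Ω → α) :
    ptau η ν μ ≤
      (Hent (prodW w) (fun ω => (∑ j, Z j (ω j), fun j => Y j (ω j))) -
        Hent (prodW w) (fun ω j => Y j (ω j))) -
      (∑ j, (Hent (w j) (fun ω => (Z j ω, Y j ω)) - Hent (w j) (Y j))) / Fintype.card J +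
      η * ∑ j, (Hent (pairW (w j) ν) (fun s => Z j s.1 - s.2) -
        (Hent (w j) (fun ω => (Z j ω, Y j ω)) - Hent (w j) (Y j) + hent ν) / 2) := by
  have hW := isProb_prodW hw
  have h1 : ∀ ω₀ : J → Ω, prodW w ω₀ * ptau η ν μ ≤
      prodW w ω₀ * Hent (cw (prodW w) (fun ω j => Y j (ω j)) ω₀) (fun ω => ∑ j, Z j (ω j)) -
      (∑ j, prodW w ω₀ * Hent (cw (w j) (Y j) (ω₀ j)) (Z j)) / Fintype.card J +
      η * ∑ j, prodW w ω₀ * rdist (pr (cw (w j) (Y j) (ω₀ j)) (Z j)) ν := by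
    intro ω₀
    rcases (hW.nonneg ω₀).eq_or_lt with h0 | h0
    · simp [← h0]
    · have hpos : ∀ j, 0 < w j (ω₀ j) := by
        intro j
        refine lt_of_le_of_ne ((hw j).nonneg _) fun h => h0.ne' ?_
        exact prod_eq_zero (mem_univ j) h.symm
      have hle := hmin.le (fun j => pr (cw (w j) (Y j) (ω₀ j)) (Z j))
        (fun j => isProb_pr (isProb_cw (hw j) (Y j) (hpos j)) (Z j))
      have hle' := mul_le_mul_of_nonneg_left hle h0.le
      refine hle'.trans (le_of_eq ?_)
      rw [← mul_sum, ← mul_sum, mul_left_comm, mul_div_assoc, ← mul_sub, ← mul_add]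
      congr 1
      unfold ptau hsum hent
      rw [Hent_prodW_pr (fun j => Z j) (fun s : J → G => ∑ j, s j), cw_prodW]
      simp_rw [Hent_pr]
      rfl
  have h2 := sum_le_sum fun ω₀ (_ : ω₀ ∈ (univ : Finset (J → Ω))) => h1 ω₀
  rw [← sum_mul, hW.sum_one, one_mul, sum_add_distrib, sum_sub_distrib, ← sum_div, ← mul_sum,
    sum_mul_Hent_cw hW, sum_comm] at h2
  have h3 : ∀ j, ∑ ω₀, prodW w ω₀ * Hent (cw (w j) (Y j) (ω₀ j)) (Z j) =
      Hent (w j) (fun ω => (Z j ω, Y j ω)) - Hent (w j) (Y j) := by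
    intro j
    rw [sum_prodW_mul hw j (fun x => Hent (cw (w j) (Y j) x) (Z j)), sum_mul_Hent_cw (hw j)]
  simp_rw [h3] at h2
  refine h2.trans (add_le_add_right (mul_le_mul_of_nonneg_left ?_ hη) _)
  rw [sum_comm]
  refine sum_le_sum fun j _ => ?_
  rw [sum_prodW_mul hw j (fun x => rdist (pr (cw (w j) (Y j) x) (Z j)) ν)]
  exact sum_rdist_cw_le (hw j) hν (Z j) (Y j)

lemma Hent_pi_le {Ω ι α : Type*} [Fintype Ω] [Fintype ι] {w : Ω → ℝ} (hw : IsProb w)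
    (X : ι → Ω → α) : Hent w (fun ω i => X i ω) ≤ ∑ i, Hent w (X i) := by
  have key : ∀ A : Finset ι, Hent w (fun ω i => if i ∈ A then some (X i ω) else none) ≤
      ∑ i ∈ A, Hent w (X i) := by
    intro A
    induction A using Finset.induction_on with
    | empty => simp [Hent_const hw]
    | insert i A hi ih =>
      rw [sum_insert hi]
      refine (Hent_subadd hw (P := X i)
        (Q := fun ω i => if i ∈ A then some (X i ω) else none) ?_).trans (add_le_add_right ih _)
      intro ω ω' h h'
      funext j
      have := congr_fun h' j
      by_cases hj : j = i
      · subst hj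
        simp [h]
      · simpa [hj] using this
  refine (Hent_mono hw ?_).trans (key univ)
  intro ω ω' h
  funext i
  simpa using congr_fun h i

end Minimiser

section Array

variable {G : Type*} [AddCommGroup G] [Fintype G] {J K : Type*} [Fintype J] [Fintype K]

lemma pr_prodW_eval {Ω ι : Type*} [Fintype Ω] [Fintype ι] {v : ι → Ω → ℝ}
    (hv : ∀ i, IsProb (v i)) (i : ι) : pr (prodW v) (fun ω => ω i) = v i := by
  funext s
  have := sum_prodW_mul hv i (fun x => if x = s then 1 else 0)
  simpa [pr] using this

lemma hsum_comp {μ : J → G → ℝ} (hμ : ∀ j, IsProb (μ j)) (σ : Equiv.Perm J) :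
    hsum (fun j => μ (σ j)) = hsum μ := by
  unfold hsum
  rw [← Hent_prodW_comp hμ σ.injective]
  congr 1
  funext ω
  exact Equiv.sum_comp σ ω

/-- The sum of a row together with its first `n` entries. -/
noncomputable def rowPrefix {k : ℕ} (e : K ≃ Fin (k + 1)) (n : ℕ) (x : K → G) : G × (K → G) :=
  (∑ t, x t, fun t => if (e t).val < n then x t else 0)

lemma Hent_rowPrefix_zero {k : ℕ} (e : K ≃ Fin (k + 1)) {lam : K → G → ℝ}
    (hlam : ∀ t, IsProb (lam t)) :
    Hent (prodW lam) (rowPrefix e 0) = hsum lam :=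
  Hent_congr (isProb_prodW hlam) fun x y => by simp [rowPrefix]

lemma Hent_rowPrefix_self {k : ℕ} (e : K ≃ Fin (k + 1)) {lam : K → G → ℝ}
    (hlam : ∀ t, IsProb (lam t)) :
    Hent (prodW lam) (rowPrefix e k) = ∑ t, hent (lam t) := by
  unfold hent
  rw [← Hent_prodW hlam fun _ => id]
  refine Hent_congr (isProb_prodW hlam) fun x y => ⟨fun h => ?_, fun h => ?_⟩
  · simp only [rowPrefix, Prod.mk.injEq, funext_iff] at h
    have h1 : ∀ t, t ≠ e.symm (Fin.last k) → x t = y t := fun t ht => by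
      have h3 := h.2 t
      have h4 : e t ≠ Fin.last k := fun h => ht (by rw [← h, e.symm_apply_apply])
      have h5 : (e t).val < k := Fin.val_lt_last h4
      rwa [if_pos h5, if_pos h5] at h3
    have h2 := h.1
    rw [← add_sum_erase _ _ (mem_univ (e.symm (Fin.last k))),
      ← add_sum_erase _ _ (mem_univ (e.symm (Fin.last k))),
      sum_congr rfl fun t ht => h1 t (ne_of_mem_erase ht), add_left_inj] at h2
    funext t
    by_cases ht : t = e.symm (Fin.last k)
    · rw [ht]
      exact h2
    · exact h1 t ht
  · have : x = y := h
    rw [this]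

lemma Hent_rowPrefix_succ {k : ℕ} (e : K ≃ Fin (k + 1)) {lam : K → G → ℝ}
    (hlam : ∀ t, IsProb (lam t))
    (t : K) :
    Hent (prodW lam) (fun x => (x t, rowPrefix e (e t).val x)) =
      Hent (prodW lam) (rowPrefix e ((e t).val + 1)) := by
  refine Hent_congr (isProb_prodW hlam) fun x y => ?_
  simp only [rowPrefix, Prod.mk.injEq, funext_iff]
  constructor
  · rintro ⟨h1, h2, h3⟩
    refine ⟨h2, fun s => ?_⟩
    rcases lt_trichotomy (e s).val (e t).val with hs | hs | hs
    · have := h3 s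
      rw [if_pos hs, if_pos hs] at this
      rw [if_pos (by omega), if_pos (by omega), this]
    · rw [e.injective (Fin.ext hs), h1]
    · rw [if_neg (by omega), if_neg (by omega)]
  · rintro ⟨h2, h3⟩
    refine ⟨?_, h2, fun s => ?_⟩
    · simpa using h3 t
    · have := h3 s
      by_cases hs : (e s).val < (e t).val
      · rw [if_pos (by omega), if_pos (by omega)] at this
        rw [if_pos hs, if_pos hs, this]
      · rw [if_neg hs, if_neg hs]

/-- In an array of independent variables whose columns are permutations of a minimiser, the row
sums and the column sums are nearly independent given the total sum. -/
lemma IsTauMin.array_le {η : ℝ} {ν : G → ℝ} {μ : J → G → ℝ} (hmin : IsTauMin η ν μ) (hη : 0 ≤ η)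
    (hν : IsProb ν) {k : ℕ} (e : K ≃ Fin (k + 1))
    (hk : Fintype.card J = k + 1) {lam : J → K → G → ℝ}
    (hcol : ∀ t, ∃ σ : Equiv.Perm J, ∀ j, lam j t = μ (σ j)) :
    Hent (prodW fun j => prodW (lam j)) (fun ω j => ∑ t, ω j t) +
      Hent (prodW fun j => prodW (lam j)) (fun ω t => ∑ j, ω j t) -
      Hent (prodW fun j => prodW (lam j)) (fun ω => (fun j => ∑ t, ω j t, fun t => ∑ j, ω j t)) -
      Hent (prodW fun j => prodW (lam j)) (fun ω => ∑ j, ∑ t, ω j t) ≤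
      η * (∑ j, hsum (lam j) - ∑ j, hent (μ j)) := by
  have hlam : ∀ j t, IsProb (lam j t) := by
    intro j t
    obtain ⟨σ, hσ⟩ := hcol t
    rw [hσ]
    exact hmin.prob _
  set w : J → (K → G) → ℝ := fun j => prodW (lam j) with hwdef
  have hw : ∀ j, IsProb (w j) := fun j => isProb_prodW (hlam j)
  have hW := isProb_prodW hw
  set Hs := ∑ j, hent (μ j) with hHs
  set d := ∑ j, rdist (μ j) ν with hd
  have hHs' : ∀ t, ∑ j, hent (lam j t) = Hs := by
    intro t
    obtain ⟨σ, hσ⟩ := hcol t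
    simp_rw [hσ]
    exact Equiv.sum_comp σ (fun j => hent (μ j))
  have hd' : ∀ t, ∑ j, rdist (lam j t) ν = d := by
    intro t
    obtain ⟨σ, hσ⟩ := hcol t
    simp_rw [hσ]
    exact Equiv.sum_comp σ (fun j => rdist (μ j) ν)
  have hD : ∀ j t, Hent (pairW (w j) ν) (fun s => s.1 t - s.2) =
      rdist (lam j t) ν + (hent (lam j t) + hent ν) / 2 := by
    intro j t
    have h1 := rdist_pr (w := w j) (ν := ν) (fun x => x t)
    rw [hwdef] at h1 ⊢
    simp only at h1 ⊢
    rw [pr_prodW_eval (hlam j)] at h1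
    have h2 : Hent (prodW (lam j)) (fun x => x t) = hent (lam j t) :=
      Hent_prodW_eval (hlam j) t id
    rw [h2] at h1
    linarith
  set A : ℕ → ℝ := fun n => ∑ j, Hent (w j) (rowPrefix e n) with hA
  set b : ℕ → ℝ := fun n => Hent (prodW w) (fun ω : J → K → G =>
    (fun j => ∑ t, ω j t, fun t : K => if (e t).val < n then ∑ j, ω j t else 0)) with hb
  have hK : Fintype.card K = k + 1 := by rw [Fintype.card_congr e, Fintype.card_fin]
  have hcard : (Fintype.card J : ℝ) = k + 1 := by rw [hk]; push_cast; rfl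
  have step : ∀ n ∈ range k, ptau η ν μ ≤ (b (n + 1) - b n) -
      (A (n + 1) - A n) / (k + 1) + η * (d + Hs / 2 - (A (n + 1) - A n) / 2) := by
    intro n hn
    have hn' : n < k + 1 := by
      have := mem_range.1 hn
      omega
    set t : K := e.symm ⟨n, hn'⟩ with ht
    have het : (e t).val = n := by simp [ht]
    have h1 := hmin.le_cond hη hν hw (fun _ x => x t) (fun _ => rowPrefix e n)
    have h2 : ∀ j, Hent (w j) (fun x => (x t, rowPrefix e n x)) =
        Hent (w j) (rowPrefix e (n + 1)) := by
      intro j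
      have := Hent_rowPrefix_succ e (hlam j) t
      rwa [het] at this
    have h3 := Hent_submod hW (P := fun ω j => rowPrefix e n (ω j))
      (Q := fun ω : J → K → G =>
        (fun j => ∑ t, ω j t, fun t : K => if (e t).val < n + 1 then ∑ j, ω j t else 0))
      (Z := fun ω : J → K → G =>
        (fun j => ∑ t, ω j t, fun t : K => if (e t).val < n then ∑ j, ω j t else 0))
      (J := fun ω : J → K → G => (∑ j, ω j t, fun j => rowPrefix e n (ω j)))
      (by
        intro ω ω' h
        simp only [rowPrefix, funext_iff, Prod.mk.injEq] at h ⊢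
        refine ⟨fun j => (h j).1, fun s => ?_⟩
        split_ifs with hs
        · refine sum_congr rfl fun j _ => ?_
          have := (h j).2 s
          rwa [if_pos hs, if_pos hs] at this
        · rfl)
      (by
        intro ω ω' h
        simp only [funext_iff, Prod.mk.injEq] at h ⊢
        refine ⟨h.1, fun s => ?_⟩
        have := h.2 s
        split_ifs with hs
        · rwa [if_pos (by omega), if_pos (by omega)] at this
        · rfl)
      (by
        intro ω ω' h h'
        simp only [funext_iff, Prod.mk.injEq] at h' ⊢
        refine ⟨?_, fun j => congr_fun h j⟩
        have := h'.2 t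
        rwa [if_pos (by omega), if_pos (by omega)] at this)
    simp_rw [h2, hD] at h1
    have h4 : ∑ j, (Hent (w j) (rowPrefix e (n + 1)) - Hent (w j) (rowPrefix e n)) =
        A (n + 1) - A n := by rw [sum_sub_distrib]
    have h5 : ∑ j, (rdist (lam j t) ν + (hent (lam j t) + hent ν) / 2 -
        (Hent (w j) (rowPrefix e (n + 1)) - Hent (w j) (rowPrefix e n) + hent ν) / 2) =
        d + Hs / 2 - (A (n + 1) - A n) / 2 := by
      rw [← hd' t, ← hHs' t, ← h4, sum_div, sum_div, ← sum_add_distrib, ← sum_sub_distrib]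
      exact sum_congr rfl fun j _ => by ring
    rw [h4, h5, hcard] at h1
    have h6 : Hent (prodW w) (fun ω : J → K → G => (∑ j, ω j t,
        fun j => rowPrefix e n (ω j))) - Hent (prodW w) (fun ω j => rowPrefix e n (ω j)) ≤
        b (n + 1) - b n := by
      simp only [hb]
      linarith
    linarith
  have hsumm := sum_le_sum step
  rw [sum_const, card_range, nsmul_eq_mul, sum_add_distrib, sum_sub_distrib, sum_range_sub,
    ← sum_div, sum_range_sub, ← mul_sum, sum_sub_distrib, sum_const, card_range, nsmul_eq_mul,
    ← sum_div, sum_range_sub] at hsumm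
  have hA0 : A 0 = ∑ j, hsum (lam j) := sum_congr rfl fun j _ => Hent_rowPrefix_zero e (hlam j)
  have hAk : A k = (k + 1) * Hs := by
    rw [hA]
    simp only [hwdef]
    rw [sum_congr rfl fun j _ => Hent_rowPrefix_self e (hlam j), sum_comm,
      sum_congr rfl fun t _ => hHs' t, sum_const, card_univ, hK, nsmul_eq_mul]
    push_cast
    rfl
  have hbk : b k ≤ Hent (prodW w) (fun ω => (fun j => ∑ t, ω j t, fun t => ∑ j, ω j t)) := by
    refine Hent_mono hW fun ω ω' h => ?_
    simp only [funext_iff, Prod.mk.injEq] at h ⊢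
    exact ⟨h.1, fun s => by rw [h.2 s]⟩
  have hb0 : b 0 = Hent (prodW w) (fun ω j => ∑ t, ω j t) :=
    Hent_congr hW fun ω ω' => by simp
  have hC : Hent (prodW w) (fun ω t => ∑ j, ω j t) ≤ (k + 1) * hsum μ := by
    refine (Hent_pi_le hW (fun t (ω : J → K → G) => ∑ j, ω j t)).trans (le_of_eq ?_)
    have : ∀ t : K, Hent (prodW w) (fun ω => ∑ j, ω j t) = hsum μ := by
      intro t
      obtain ⟨σ, hσ⟩ := hcol t
      rw [← hsum_comp hmin.prob σ]
      have h1 := Hent_prodW_pr (v := w) (fun _ x => x t) (fun s : J → G => ∑ j, s j)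
      rw [← h1]
      unfold hsum
      congr 2
      funext j
      rw [← hσ]
      exact pr_prodW_eval (hlam j) t
    rw [sum_congr rfl fun t _ => this t, sum_const, card_univ, hK, nsmul_eq_mul]
    push_cast
    rfl
  have hR := hmin.le_cond hη hν hw (fun _ x => ∑ t, x t) (fun _ _ => ())
  have hR1 : ∀ j, Hent (w j) (fun x => (∑ t, x t, ())) = hsum (lam j) :=
    fun j => Hent_congr (hw j) fun _ _ => by simp
  have hR2 : Hent (prodW w) (fun ω => (∑ j, ∑ t, ω j t, fun _ : J => ())) =
      Hent (prodW w) (fun ω => ∑ j, ∑ t, ω j t) := Hent_congr hW fun _ _ => by simp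
  simp_rw [Hent_const (hw _), Hent_const hW, hR1] at hR
  rw [hR2, hcard] at hR
  have hR3 : ∑ j, (Hent (pairW (w j) ν) (fun s => ∑ t, s.1 t - s.2) -
      (hsum (lam j) - 0 + hent ν) / 2) ≤
        ∑ j, (hsum (lam j) / 2 - hent (lam j (e.symm (Fin.last k))) / 2 +
        rdist (lam j (e.symm (Fin.last k))) ν) := by
    refine sum_le_sum fun j _ => ?_
    have h1 := Hent_add_sub_le (hw j) hν (fun x => x (e.symm (Fin.last k)))
      (fun x => ∑ t ∈ univ.erase (e.symm (Fin.last k)), x t)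
        (Hent_indep (hlam j) {e.symm (Fin.last k)}
        (fun x y h => h _ (mem_singleton_self _))
        (fun x y h => sum_congr rfl fun t _ => h _ (by simpa using ne_of_mem_erase ‹_›)))
    have h2 : ∀ x : K → G, x (e.symm (Fin.last k)) + ∑ t ∈ univ.erase (e.symm (Fin.last k)), x t =
        ∑ t, x t :=
      fun x => add_sum_erase _ _ (mem_univ _)
    simp_rw [h2] at h1
    rw [hD] at h1
    have h3 : Hent (w j) (fun x => x (e.symm (Fin.last k))) = hent (lam j (e.symm (Fin.last k))) :=
      Hent_prodW_eval (hlam j) (e.symm (Fin.last k)) id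
    have h4 : Hent (w j) (fun x => ∑ t, x t) = hsum (lam j) := rfl
    rw [h3, h4] at h1
    linarith
  have hR4 := hR.trans (add_le_add_right (mul_le_mul_of_nonneg_left hR3 hη) _)
  simp_rw [sum_add_distrib, sum_sub_distrib, ← sum_div, hHs', hd', sum_const_zero] at hR4
  simp only [sub_zero] at hR4
  rw [← hA0]
  rw [← hA0] at hR4
  have hpt : ptau η ν μ = hsum μ - Hs / (k + 1) + η * d := by
    unfold ptau
    rw [hcard]
  have hk0 : (0 : ℝ) < k + 1 := by positivity
  have e1 : (A k - A 0) / ((k : ℝ) + 1) = Hs - A 0 / (k + 1) := by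
    rw [hAk, sub_div, mul_div_cancel_left₀ _ hk0.ne']
  have e2 : (k : ℝ) * (Hs / (k + 1)) = Hs - Hs / (k + 1) := by
    field_simp
    ring
  rw [e1, hAk, hpt] at hsumm
  rw [hpt] at hR4
  have e3 : η * (↑k * (d + Hs / 2) - ((↑k + 1) * Hs - A 0) / 2) =
      k * (η * d) + η * (A 0 - Hs) / 2 := by ring
  rw [e3] at hsumm
  have e4 : (k : ℝ) * (hsum μ - Hs / (k + 1) + η * d) =
      k * hsum μ - (Hs - Hs / (k + 1)) + k * (η * d) := by rw [← e2]; ring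
  rw [e4] at hsumm
  have e5 : η * (A 0 / 2 - Hs / 2 + d) = η * (A 0 - Hs) / 2 + η * d := by ring
  rw [e5] at hR4
  linarith

end Array

section Bounds

variable {p : ℕ} [Fact p.Prime] {G : Type*} [AddCommGroup G] [Module (ZMod p) G] [Fintype G]
variable {ι κ : Type*} [Fintype ι] [Fintype κ] {μ : ι → G → ℝ}

lemma Lf_smul (hμ : ∀ i, IsProb (μ i)) {c : ZMod p} (hc : c ≠ 0) (a : ι → ZMod p) :
    Lf μ (c • a) = Lf μ a := by
  refine Hent_congr (isProb_prodW hμ) fun ω ω' => ?_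
  have h : ∀ ω : ι → G, lin (c • a) ω = c • lin a ω := fun ω => by
    simp [lin, smul_sum, smul_smul]
  rw [h, h]
  exact smul_right_injective G hc |>.eq_iff

lemma Lf_triangle (hμ : ∀ i, IsProb (μ i)) {x y z : ι} (hxy : x ≠ y) (hxz : x ≠ z) (hyz : y ≠ z)
    (b c d : ZMod p) :
    Lf μ (sgl x 1 - sgl y c) + Lf μ (sgl z d) ≤
      Lf μ (sgl x 1 - (sgl y b + sgl z d)) + Lf μ (sgl y (b - c) + sgl z d) := by
  have hp := isProb_prodW hμ
  have h1 := Hent_triangle hp (lin (sgl x (1 : ZMod p))) (lin (sgl y b + sgl z d))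
    (lin (sgl y c)) (by
      refine Hent_indep hμ {x} (fun ω ω' h => lin_congr fun i hi => h i ?_) (fun ω ω' h => ?_)
      · by_contra hne
        exact hi (Pi.single_eq_of_ne (by simpa using hne) _)
      · rw [lin_add, lin_single, lin_single, lin_add, lin_single, lin_single, lin_single,
          lin_single, h y (by simpa using hxy.symm), h z (by simpa using hxz.symm)])
  have h2 := Hent_submod hp (P := fun ω : ι → G => (lin (sgl y b + sgl z d) ω, lin (sgl y c) ω))
    (Q := fun ω : ι → G => ω y) (Z := lin (sgl y c))
    (J := fun ω : ι → G => (ω y, lin (sgl z d) ω))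
    (fun ω ω' h => (Prod.ext_iff.1 h).2)
    (fun ω ω' h => by rw [lin_single, lin_single, h])
    (fun ω ω' h h' => by
      have := (Prod.ext_iff.1 h).1
      simp only [lin_add, lin_single] at this
      rw [h', add_right_inj] at this
      rw [lin_single, lin_single, this, h'])
  have h3 := Hent_indep hμ {y} (f := fun ω : ι → G => ω y) (g := lin (sgl z d))
    (fun ω ω' h => h y (by simp)) (fun ω ω' h => by
      rw [lin_single, lin_single, h z (by simpa using hyz.symm)])
  simp_rw [← lin_sub] at h1
  have h4 : sgl y b + sgl z d - sgl y c = sgl y (b - c) + sgl z d := by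
    unfold sgl
    rw [Pi.single_sub]
    abel
  rw [h4] at h1
  unfold Lf
  linarith

/-- Linear forms in independent variables that have nearly equal entropies and nearly no doubling
all have nearly the same entropy. -/
lemma Lf_le_of_pair (hμ : ∀ i, IsProb (μ i)) {h k M : ℝ} (h0 : 0 ≤ h) (hk : 0 ≤ k) (hM : 1 ≤ M)
    (hι : 3 ≤ Fintype.card ι) (hub : ∀ x, hent (μ x) ≤ h + k)
    (hlb : ∀ x, h - M * k ≤ hent (μ x))
    (hpair : ∀ x y, x ≠ y → Lf μ (sgl x (1 : ZMod p) + sgl y 1) ≤ h + (M + 2) * k)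
    (a : ι → ZMod p) : Lf μ a ≤ h + (1 + Fintype.card ι * (p * (6 * M + 6) + 1 + M)) * k := by
  have hd := fun i j (h : i ≠ j) (c d : ZMod p) (k : ι) => single_disjoint h c d k
  have hz : ∀ x y : ι, ∃ z, z ≠ x ∧ z ≠ y := by
    intro x y
    have : ({x, y} : Finset ι).card < Fintype.card ι := (card_le_two).trans_lt (by omega)
    obtain ⟨z, hz⟩ := exists_mem_notMem_of_card_lt_card (s := {x, y}) (t := univ)
      (by simpa using this)
    simp only [mem_univ, mem_insert, mem_singleton, not_or, true_and] at hz
    exact ⟨z, hz⟩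
  have hs : ∀ x, Lf μ (sgl x (1 : ZMod p)) = hent (μ x) := fun x => Lf_single hμ x one_ne_zero
  have hMk : 0 ≤ M * k := by positivity
  have hdiff : ∀ x y, x ≠ y → Lf μ (sgl x (1 : ZMod p) - sgl y 1) ≤ h + (3 * M + 4) * k := by
    intro x y hxy
    obtain ⟨z, hzx, hzy⟩ := hz x y
    have h1 := Lf_triangle hμ hxy hzx.symm hzy.symm (0 : ZMod p) 1 (-1)
    have e1 : sgl x (1 : ZMod p) - (sgl y 0 + sgl z (-1)) = sgl x 1 + sgl z 1 := by
      unfold sgl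
      rw [Pi.single_zero, Pi.single_neg]
      abel
    have e2 : sgl y ((0 : ZMod p) - 1) + sgl z (-1) = -(sgl y 1 + sgl z 1) := by
      unfold sgl
      rw [zero_sub, Pi.single_neg, Pi.single_neg]
      abel
    rw [e1, e2, Lf_neg hμ, Lf_single hμ z (neg_ne_zero.2 one_ne_zero)] at h1
    have := hpair x z hzx.symm
    have := hpair y z hzy.symm
    have := hlb z
    linarith
  have hthree : ∀ x y z, x ≠ y → x ≠ z → y ≠ z →
      Lf μ (sgl x (1 : ZMod p) - (sgl y (-1) + sgl z 1)) ≤ h + (5 * M + 6) * k := by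
    intro x y z hxy hxz hyz
    have h1 := Lf_KV hμ (a := sgl x (1 : ZMod p)) (b := sgl y 1) (c := sgl z (-1))
      (hd x y hxy _ _) (hd x z hxz _ _) (hd y z hyz _ _)
    have e1 : sgl x (1 : ZMod p) - (sgl y (-1) + sgl z 1) = sgl x 1 + sgl y 1 + sgl z (-1) := by
      unfold sgl
      rw [Pi.single_neg, Pi.single_neg]
      abel
    have e2 : sgl x (1 : ZMod p) + sgl z (-1) = sgl x 1 - sgl z 1 := by
      unfold sgl
      rw [Pi.single_neg]
      abel
    rw [e2, hs] at h1
    rw [e1]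
    have := hpair x y hxy
    have := hdiff x z hxz
    have := hlb x
    linarith
  have hscal : ∀ n : ℕ, ∀ x y, x ≠ y →
      Lf μ (sgl x (1 : ZMod p) + sgl y (n : ZMod p)) ≤ h + (1 + n * (6 * M + 6)) * k := by
    intro n
    induction n with
    | zero =>
      intro x y _
      have := hub x
      have h1 : sgl y ((0 : ℕ) : ZMod p) = 0 := by simp
      rw [h1, add_zero, hs]
      simpa using this
    | succ n ih =>
      intro x y hxy
      obtain ⟨z, hzx, hzy⟩ := hz x y
      have h1 := Lf_triangle hμ hxy hzx.symm hzy.symm (-1) (-((n : ZMod p) + 1)) 1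
      have e1 : sgl x (1 : ZMod p) - sgl y (-((n : ZMod p) + 1)) =
          sgl x 1 + sgl y ((n + 1 : ℕ) : ZMod p) := by
        unfold sgl
        rw [Pi.single_neg, sub_neg_eq_add]
        push_cast
        rfl
      have e2 : sgl y (-1 - -((n : ZMod p) + 1)) + sgl z 1 = sgl z 1 + sgl y (n : ZMod p) := by
        rw [add_comm]
        congr 2
        ring
      rw [e1, e2, hs] at h1
      have := hthree x y z hxy hzx.symm hzy.symm
      have := ih z y hzy
      have := hlb z
      rw [Nat.cast_succ (R := ℝ)]
      linarith
  have hscal' : ∀ x y, x ≠ y → ∀ c : ZMod p, Lf μ (sgl x (1 : ZMod p) + sgl y c) ≤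
      Lf μ (sgl x (1 : ZMod p)) + (p * (6 * M + 6) + 1 + M) * k := by
    intro x y hxy c
    have h1 := hscal c.val x y hxy
    rw [ZMod.natCast_zmod_val] at h1
    have h2 : (c.val : ℝ) * ((6 * M + 6) * k) ≤ p * ((6 * M + 6) * k) :=
      mul_le_mul_of_nonneg_right (by exact_mod_cast (ZMod.val_lt c).le) (by positivity)
    have := hlb x
    rw [hs]
    linarith
  by_cases ha : a = 0
  · have : Lf μ a = 0 := by
      have : lin (0 : ι → ZMod p) = fun _ : ι → G => (0 : G) := by
        funext ω
        simp [lin]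
      rw [ha, Lf, this, Hent_const (isProb_prodW hμ)]
    rw [this]
    positivity
  obtain ⟨x, hx⟩ := Function.ne_iff.1 ha
  simp only [Pi.zero_apply] at hx
  rw [← Lf_smul hμ (inv_ne_zero hx)]
  set b := (a x)⁻¹ • a with hb
  have hbx : b x = 1 := by simp [hb, inv_mul_cancel₀ hx]
  have h1 := Lf_star hμ (i₀ := x) (c := 1) (a := b) (K := (p * (6 * M + 6) + 1 + M) * k)
    ((univ.filter fun i => b i ≠ 0).erase x) (notMem_erase _ _) (fun i hi =>
      hscal' x i (ne_of_mem_erase hi).symm _)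
  have h2 : sgl x 1 + ∑ i ∈ (univ.filter fun i => b i ≠ 0).erase x, sgl i (b i) = b := by
    conv_rhs => rw [← sum_single_support b]
    rw [← add_sum_erase _ _ (show x ∈ univ.filter fun i => b i ≠ 0 by simp [hbx]), hbx]
  rw [h2, hs] at h1
  have h3 : (((univ.filter fun i => b i ≠ 0).erase x).card : ℝ) ≤ Fintype.card ι := by
    exact_mod_cast card_le_univ _
  have h4 := mul_le_mul_of_nonneg_right h3
    (show 0 ≤ (p * (6 * M + 6) + 1 + M) * k by positivity)
  have := hub x
  linarith

end Bounds

section Transversal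

variable {p : ℕ} [Fact p.Prime] {G : Type*} [AddCommGroup G] [Module (ZMod p) G] [Fintype G]
variable {ι J : Type*} [Fintype ι] [Fintype J] {μ : J → G → ℝ}

lemma sgl_self (i : ι) (c : ZMod p) : sgl i c i = c := Pi.single_eq_same _ _

lemma sgl_ne {i j : ι} (h : j ≠ i) (c : ZMod p) : sgl i c j = 0 := Pi.single_eq_of_ne h _

/-- The average entropy of a tuple of laws. -/
noncomputable def havg (μ : J → G → ℝ) : ℝ := (∑ j, hent (μ j)) / Fintype.card J

lemma hsum_eq_Lf : hsum μ = Lf μ (fun _ => (1 : ZMod p)) := by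
  unfold hsum Lf lin
  simp

lemma Lf_le_hsum (hμ : ∀ j, IsProb (μ j)) {a : J → ZMod p} (ha : ∀ j, a j = 0 ∨ a j = 1) :
    Lf μ a ≤ hsum μ := by
  have h := Lf_le_add hμ (a := a) (b := fun j => 1 - a j) fun j => by
    rcases ha j with h | h <;> simp [h]
  rw [hsum_eq_Lf (p := p)]
  refine h.trans_eq ?_
  congr 1
  funext j
  simp

lemma hent_le_hsum (p : ℕ) [Fact p.Prime] [Module (ZMod p) G] (hμ : ∀ j, IsProb (μ j)) (j : J) :
    hent (μ j) ≤ hsum μ := by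
  rw [← Lf_single hμ j (one_ne_zero (α := ZMod p))]
  refine Lf_le_hsum hμ fun i => ?_
  by_cases h : i = j
  · subst h
    simp
  · left
    exact Pi.single_eq_of_ne h _

lemma hsum_sub_havg_nonneg (p : ℕ) [Fact p.Prime] [Module (ZMod p) G] [Nonempty J]
    (hμ : ∀ j, IsProb (μ j)) : 0 ≤ hsum μ - havg μ := by
  have hc : (0 : ℝ) < Fintype.card J := by exact_mod_cast Fintype.card_pos
  rw [sub_nonneg, havg, div_le_iff₀ hc]
  calc ∑ j, hent (μ j) ≤ ∑ _j : J, hsum μ := sum_le_sum fun j _ => hent_le_hsum p hμ j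
    _ = hsum μ * Fintype.card J := by rw [sum_const, card_univ, nsmul_eq_mul, mul_comm]

lemma le_hent (p : ℕ) [Fact p.Prime] [Module (ZMod p) G] [Nonempty J]
    (hμ : ∀ j, IsProb (μ j)) (j : J) :
    havg μ - Fintype.card J * (hsum μ - havg μ) ≤ hent (μ j) := by
  have hc : (0 : ℝ) < Fintype.card J := by exact_mod_cast Fintype.card_pos
  have h0 := hsum_sub_havg_nonneg p hμ
  have h1 : ∑ i, hent (μ i) = Fintype.card J * havg μ := by
    rw [havg]
    field_simp
  have h2 : ∑ i ∈ univ.erase j, hent (μ i) ≤ ((Fintype.card J : ℝ) - 1) * hsum μ := by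
    refine (sum_le_sum fun i _ => hent_le_hsum p hμ i).trans_eq ?_
    rw [sum_const, card_erase_of_mem (mem_univ j), card_univ, nsmul_eq_mul,
      Nat.cast_sub Fintype.card_pos]
    simp
  rw [← add_sum_erase _ _ (mem_univ j)] at h1
  linarith

lemma Lf_pair_le_hsum (hμ : ∀ j, IsProb (μ j)) {a : ι → J} (ha : Function.Surjective a) {x y : ι}
    (hxy : a x ≠ a y) : Lf (fun i => μ (a i)) (sgl x (1 : ZMod p) + sgl y 1) ≤ hsum μ := by
  choose g hg using ha
  let f : J → ι := fun j => if j = a x then x else if j = a y then y else g j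
  have hf : ∀ j, a (f j) = j := by
    intro j
    simp only [f]
    split_ifs with h1 h2
    · exact h1.symm
    · exact h2.symm
    · exact hg j
  have hne : x ≠ y := fun h => hxy (by rw [h])
  have hinj : Function.Injective f := Function.LeftInverse.injective hf
  have hfx : f (a x) = x := if_pos rfl
  have hfy : f (a y) = y := by simp [f, hxy.symm]
  rw [Lf_comp (fun i => hμ (a i)) hinj (fun i hi => by
    have h1 : i ≠ x := fun h => hi ⟨a x, by rw [hfx, h]⟩
    have h2 : i ≠ y := fun h => hi ⟨a y, by rw [hfy, h]⟩
    rw [Pi.add_apply, sgl_ne h1, sgl_ne h2, add_zero])]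
  simp_rw [hf]
  refine Lf_le_hsum hμ fun j => ?_
  rw [Pi.add_apply]
  by_cases h1 : f j = x
  · rw [h1, sgl_self, sgl_ne hne]
    simp
  · rw [sgl_ne h1, zero_add]
    by_cases h2 : f j = y
    · rw [h2, sgl_self]
      simp
    · rw [sgl_ne h2]
      simp

/-- Linear forms in copies of the variables of a tuple have entropy close to the average. -/
lemma Lf_le_havg (hμ : ∀ j, IsProb (μ j)) {a : ι → J} (ha : Function.Surjective a)
    (hJ : 2 ≤ Fintype.card J) (hι : 3 ≤ Fintype.card ι) (f : ι → ZMod p) :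
    Lf (fun i => μ (a i)) f ≤ havg μ + (1 + Fintype.card ι * (p * (6 * Fintype.card J + 6) + 1 +
      Fintype.card J)) * (hsum μ - havg μ) := by
  have : Nonempty J := Fintype.card_pos_iff.1 (by omega)
  have hJ' : (2 : ℝ) ≤ Fintype.card J := by exact_mod_cast hJ
  have hk := hsum_sub_havg_nonneg p hμ
  have hlb := le_hent p hμ
  refine Lf_le_of_pair (fun i => hμ (a i)) ?_ hk (by linarith) hι
    (fun x => by linarith [hent_le_hsum p hμ (a x)]) (fun x => hlb (a x)) ?_ f
  · exact div_nonneg (sum_nonneg fun j _ => Hent_nonneg (hμ j) _) (by positivity)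
  intro x y hxy
  by_cases hxy' : a x = a y
  · obtain ⟨j, hj⟩ := Fintype.exists_ne_of_one_lt_card (show 1 < Fintype.card J by omega) (a x)
    obtain ⟨z, rfl⟩ := ha j
    have hzx : z ≠ x := fun h => hj (by rw [h])
    have hzy : z ≠ y := fun h => hj (by rw [h, hxy'])
    have h1 := Lf_KV (fun i => hμ (a i)) (a := sgl z (1 : ZMod p)) (b := sgl x 1) (c := sgl y 1)
      (single_disjoint hzx _ _) (single_disjoint hzy _ _) (single_disjoint hxy _ _)
    have h2 := Lf_le_add (fun i => hμ (a i)) (a := sgl x (1 : ZMod p) + sgl y 1) (b := sgl z 1)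
      (fun i => by
        rcases single_disjoint hzx (1 : ZMod p) 1 i with h | h
        · exact Or.inr h
        · rcases single_disjoint hzy (1 : ZMod p) 1 i with h' | h'
          · exact Or.inr h'
          · left
            rw [Pi.add_apply, h, h', add_zero])
    have h3 : sgl x (1 : ZMod p) + sgl y 1 + sgl z 1 = sgl z 1 + sgl x 1 + sgl y 1 := by abel
    rw [h3] at h2
    rw [Lf_single (fun i => hμ (a i)) z one_ne_zero] at h1
    have := Lf_pair_le_hsum (p := p) hμ ha hj
    have := Lf_pair_le_hsum (p := p) hμ ha (x := z) (y := y) (by rwa [← hxy'])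
    have := hlb (a z)
    linarith
  · refine (Lf_pair_le_hsum hμ ha hxy').trans ?_
    have := mul_nonneg (by linarith : (0 : ℝ) ≤ Fintype.card J) hk
    linarith

end Transversal

section Grid

variable {p : ℕ} [Fact p.Prime] {G : Type*} [AddCommGroup G] [Module (ZMod p) G] [Fintype G]
variable {ι J T : Type*} [Fintype ι] [Fintype J] [Fintype T]

lemma Hent_prodW_curry {Ω α : Type*} [Fintype Ω] (φ : ι ≃ J × T) (v : ι → Ω → ℝ)
    (F : (J → T → Ω) → α) :
    Hent (prodW fun j => prodW fun t => v (φ.symm (j, t))) F =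
      Hent (prodW v) (fun ω => F fun j t => ω (φ.symm (j, t))) := by
  let e : (ι → Ω) ≃ (J → T → Ω) := (Equiv.arrowCongr φ (Equiv.refl Ω)).trans (Equiv.curry J T Ω)
  refine (Hent_equiv e (fun ω => ?_) F).symm
  change ∏ j, ∏ t, v (φ.symm (j, t)) (ω (φ.symm (j, t))) = ∏ i, v i (ω i)
  rw [← Equiv.prod_comp φ.symm, Fintype.prod_prod_type]

/-- Conditional near-independence of two linear forms given the sum of all variables, when one of
them is a function of row sums and the other a function of column sums. -/
lemma IsTauMin.grid_le {η : ℝ} {ν : G → ℝ} {μ : J → G → ℝ} (hmin : IsTauMin η ν μ) (hη : 0 ≤ η)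
    (hν : IsProb ν) (hJ : 2 ≤ Fintype.card J) {a : ι → J}
    (φ : ι ≃ J × J) (hcol : Function.Injective fun x => (a x, (φ x).2)) {f g : ι → ZMod p}
    (hf : ∀ x y, (φ x).1 = (φ y).1 → f x = f y) (hg : ∀ x y, (φ x).2 = (φ y).2 → g x = g y)
    {K : ℝ} (hK : ∀ f : ι → ZMod p, Lf (fun i => μ (a i)) f ≤ havg μ + K) :
    Hent (prodW fun i => μ (a i)) (fun ω => (lin f ω, lin (fun _ => (1 : ZMod p)) ω)) +
      Hent (prodW fun i => μ (a i)) (fun ω => (lin g ω, lin (fun _ => (1 : ZMod p)) ω)) ≤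
    Hent (prodW fun i => μ (a i)) (fun ω => ((lin f ω, lin g ω), lin (fun _ => (1 : ZMod p)) ω)) +
      Lf (fun i => μ (a i)) (fun _ => (1 : ZMod p)) + η * (Fintype.card J * K) := by
  have hμ : ∀ i, IsProb (μ (a i)) := fun i => hmin.prob _
  have hw := isProb_prodW hμ
  have hbij : ∀ t, ∃ σ : Equiv.Perm J, ∀ j, (fun j t => μ (a (φ.symm (j, t)))) j t = μ (σ j) := by
    intro t
    have hinj : Function.Injective fun j => a (φ.symm (j, t)) := fun j j' h => by
      have h1 := @hcol (φ.symm (j, t)) (φ.symm (j', t)) (by simpa using h)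
      simpa using h1
    exact ⟨Equiv.ofBijective _ (Finite.injective_iff_bijective.1 hinj), fun j => rfl⟩
  obtain ⟨k, hk⟩ : ∃ k, Fintype.card J = k + 1 := ⟨Fintype.card J - 1, by omega⟩
  have h1 := hmin.array_le hη hν (Fintype.equivFinOfCardEq hk) hk hbij
  rw [Hent_prodW_curry φ fun i => μ (a i), Hent_prodW_curry φ fun i => μ (a i),
    Hent_prodW_curry φ fun i => μ (a i), Hent_prodW_curry φ fun i => μ (a i)] at h1
  beta_reduce at h1
  have hrow : ∀ f : ι → ZMod p, (∀ x y, (φ x).1 = (φ y).1 → f x = f y) → ∀ ω ω' : ι → G,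
      (fun j => ∑ t, ω (φ.symm (j, t))) = (fun j => ∑ t, ω' (φ.symm (j, t))) →
      lin f ω = lin f ω' := by
    intro f hf ω ω' h
    have key : ∀ ω : ι → G, lin f ω = ∑ j, f (φ.symm (j, j)) • ∑ t, ω (φ.symm (j, t)) := by
      intro ω
      rw [lin, ← Equiv.sum_comp φ.symm, Fintype.sum_prod_type]
      refine sum_congr rfl fun j _ => ?_
      rw [smul_sum]
      exact sum_congr rfl fun t _ => by rw [hf _ (φ.symm (j, j)) (by simp)]
    rw [key, key]
    exact sum_congr rfl fun j _ => by rw [congr_fun h j]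
  have hcl : ∀ g : ι → ZMod p, (∀ x y, (φ x).2 = (φ y).2 → g x = g y) → ∀ ω ω' : ι → G,
      (fun t => ∑ j, ω (φ.symm (j, t))) = (fun t => ∑ j, ω' (φ.symm (j, t))) →
      lin g ω = lin g ω' := by
    intro g hg ω ω' h
    have key : ∀ ω : ι → G, lin g ω = ∑ t, g (φ.symm (t, t)) • ∑ j, ω (φ.symm (j, t)) := by
      intro ω
      rw [lin, ← Equiv.sum_comp φ.symm, Fintype.sum_prod_type_right]
      refine sum_congr rfl fun j _ => ?_
      rw [smul_sum]
      exact sum_congr rfl fun t _ => by rw [hg _ (φ.symm (j, j)) (by simp)]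
    rw [key, key]
    exact sum_congr rfl fun j _ => by rw [congr_fun h j]
  have hS : (fun ω : ι → G => ∑ j, ∑ t, ω (φ.symm (j, t))) = lin (fun _ => (1 : ZMod p)) := by
    funext ω
    rw [lin, ← Equiv.sum_comp φ.symm, Fintype.sum_prod_type]
    simp
  rw [hS] at h1
  have h2 := Hent_submod hw (P := fun ω : ι → G => fun j => ∑ t, ω (φ.symm (j, t)))
    (Q := fun ω : ι → G => (lin f ω, fun t => ∑ j, ω (φ.symm (j, t))))
    (Z := fun ω : ι → G => (lin f ω, lin (fun _ => (1 : ZMod p)) ω))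
    (J := fun ω : ι → G => (fun j => ∑ t, ω (φ.symm (j, t)), fun t => ∑ j, ω (φ.symm (j, t))))
    (fun ω ω' h => by rw [hrow f hf ω ω' h, hrow _ (fun _ _ _ => rfl) ω ω' h])
    (fun ω ω' h => Prod.ext (Prod.ext_iff.1 h).1
      (hcl _ (fun _ _ _ => rfl) ω ω' (Prod.ext_iff.1 h).2))
    (fun ω ω' h h' => Prod.ext h (Prod.ext_iff.1 h').2)
  have h3 := Hent_submod hw (P := fun ω : ι → G => fun t => ∑ j, ω (φ.symm (j, t)))
    (Q := fun ω : ι → G => ((lin f ω, lin g ω), lin (fun _ => (1 : ZMod p)) ω))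
    (Z := fun ω : ι → G => (lin g ω, lin (fun _ => (1 : ZMod p)) ω))
    (J := fun ω : ι → G => (lin f ω, fun t => ∑ j, ω (φ.symm (j, t))))
    (fun ω ω' h => by rw [hcl g hg ω ω' h, hcl _ (fun _ _ _ => rfl) ω ω' h])
    (fun ω ω' h => Prod.ext (Prod.ext_iff.1 (Prod.ext_iff.1 h).1).2 (Prod.ext_iff.1 h).2)
    (fun ω ω' h h' => Prod.ext (Prod.ext_iff.1 (Prod.ext_iff.1 h').1).1 h)
  have h4 : ∑ j, hsum (fun t => μ (a (φ.symm (j, t)))) - ∑ j, hent (μ j) ≤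
      Fintype.card J * K := by
    have hc : (0 : ℝ) < Fintype.card J := by
      rw [hk]
      positivity
    have h5 : ∑ j, hent (μ j) = Fintype.card J * havg μ := by
      rw [havg]
      field_simp
    have h6 : ∀ j, hsum (fun t => μ (a (φ.symm (j, t)))) ≤ havg μ + K := by
      intro j
      have hinj : Function.Injective fun t => φ.symm (j, t) := fun t t' h => by simpa using h
      have h7 := Lf_comp (p := p) hμ hinj (a := fun i => if (φ i).1 = j then 1 else 0)
        (fun i hi => if_neg fun h => hi ⟨(φ i).2, by rw [← h]; simp⟩)
      simp only [Equiv.apply_symm_apply, if_true] at h7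
      rw [hsum_eq_Lf (p := p), ← h7]
      exact hK _
    have h8 := sum_le_sum fun j (_ : j ∈ univ) => h6 j
    rw [sum_const, card_univ, nsmul_eq_mul] at h8
    linarith
  have h9 := mul_le_mul_of_nonneg_left h4 hη
  unfold Lf
  linarith

end Grid

section FibreProduct

variable {Ω α β γ : Type*} [Fintype Ω] {w : Ω → ℝ}

lemma Hent_ae_congr {X Y : Ω → α} (h : ∀ ω, w ω ≠ 0 → X ω = Y ω) : Hent w X = Hent w Y := by
  have hpr : ∀ s, pr w X s = pr w Y s := by
    intro s
    unfold pr
    refine sum_congr rfl fun ω _ => ?_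
    by_cases hω : w ω = 0
    · simp [hω]
    · rw [h ω hω]
  unfold Hent
  congr 1
  refine sum_congr rfl fun ω _ => ?_
  by_cases hω : w ω = 0
  · simp [hω]
  · rw [hpr, h ω hω]

/-- The law of two copies of `w` that are conditionally independent given `Z`. -/
noncomputable def fibW (w : Ω → ℝ) (Z : Ω → α) : Ω × Ω → ℝ := fun s => w s.1 * cw w Z s.1 s.2

lemma sum_cw (hw : IsProb w) (Z : Ω → α) (ω₀ : Ω) (h : w ω₀ ≠ 0) : ∑ ω, cw w Z ω₀ ω = 1 :=
  (isProb_cw hw Z (lt_of_le_of_ne (hw.nonneg _) h.symm)).sum_one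

lemma cw_nonneg (hw : IsProb w) (Z : Ω → α) (ω₀ ω : Ω) : 0 ≤ cw w Z ω₀ ω := by
  unfold cw
  split_ifs
  · exact div_nonneg (hw.nonneg _) (pr_nonneg hw _ _)
  · exact le_rfl

lemma sum_fibW_fst (hw : IsProb w) (Z : Ω → α) (f : Ω → ℝ) :
    ∑ s, fibW w Z s * f s.1 = ∑ ω, w ω * f ω := by
  rw [Fintype.sum_prod_type]
  refine sum_congr rfl fun ω _ => ?_
  by_cases h : w ω = 0
  · simp [fibW, h]
  · simp only [fibW]
    rw [← sum_mul, ← mul_sum, sum_cw hw Z ω h, mul_one]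

lemma fibW_swap (Z : Ω → α) (s : Ω × Ω) : fibW w Z s.swap = fibW w Z s := by
  unfold fibW cw
  by_cases h : Z s.1 = Z s.2
  · simp only [Prod.fst_swap, Prod.snd_swap, h, if_true]
    ring
  · simp [h, Ne.symm h]

lemma isProb_fibW (hw : IsProb w) (Z : Ω → α) : IsProb (fibW w Z) :=
  ⟨fun s => mul_nonneg (hw.nonneg _) (cw_nonneg hw _ _ _), by
    simpa [hw.sum_one] using sum_fibW_fst hw Z fun _ => 1⟩

lemma eq_of_fibW_ne_zero {Z : Ω → α} {s : Ω × Ω} (h : fibW w Z s ≠ 0) : Z s.1 = Z s.2 := by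
  by_contra h'
  exact h (by simp [fibW, cw, Ne.symm h'])

lemma pr_fibW_fst (hw : IsProb w) (Z : Ω → α) (X : Ω → β) (s : β) :
    pr (fibW w Z) (fun t => X t.1) s = pr w X s := by
  have h := sum_fibW_fst hw Z fun ω => if X ω = s then 1 else 0
  simpa [pr] using h

lemma Hent_fibW_fst (hw : IsProb w) (Z : Ω → α) (X : Ω → β) :
    Hent (fibW w Z) (fun t => X t.1) = Hent w X := by
  unfold Hent
  simp_rw [pr_fibW_fst hw]
  rw [sum_fibW_fst hw Z fun ω => Real.log (pr w X (X ω))]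

lemma Hent_fibW_snd (hw : IsProb w) (Z : Ω → α) (X : Ω → β) :
    Hent (fibW w Z) (fun t => X t.2) = Hent w X := by
  rw [← Hent_fibW_fst hw Z X, ← Hent_equiv (Equiv.prodComm Ω Ω) (fun s => fibW_swap Z s)]
  rfl

lemma cw_fibW (hw : IsProb w) (Z : Ω → α) (s : Ω × Ω) :
    cw (fibW w Z) (fun t => Z t.1) s = pairW (cw w Z s.1) (cw w Z s.1) := by
  funext t
  simp only [cw, pr_fibW_fst hw, pairW, fibW]
  by_cases h1 : Z t.1 = Z s.1
  · simp only [h1, if_true]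
    split_ifs <;> ring
  · simp [h1]

lemma sum_mul_Hent_pairW_cw (hw : IsProb w) (Z : Ω → α) (F : Ω × Ω → β) :
    ∑ ω, w ω * Hent (pairW (cw w Z ω) (cw w Z ω)) F =
      Hent (fibW w Z) (fun s => (F s, Z s.1)) - Hent w Z := by
  rw [← Hent_fibW_fst hw Z Z, ← sum_mul_Hent_cw (isProb_fibW hw Z) F fun s => Z s.1]
  simp_rw [cw_fibW hw]
  exact (sum_fibW_fst hw Z fun ω => Hent (pairW (cw w Z ω) (cw w Z ω)) F).symm

lemma Hent_fibW_pair (hw : IsProb w) (Z : Ω → α) (X : Ω → β) (Y : Ω → γ) :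
    Hent (fibW w Z) (fun s => ((X s.1, Y s.2), Z s.1)) + Hent w Z =
      Hent w (fun ω => (X ω, Z ω)) + Hent w (fun ω => (Y ω, Z ω)) := by
  have h := sum_mul_Hent_pairW_cw hw Z fun s => (X s.1, Y s.2)
  have h1 : ∑ ω, w ω * Hent (pairW (cw w Z ω) (cw w Z ω)) (fun s => (X s.1, Y s.2)) =
      ∑ ω, w ω * Hent (cw w Z ω) X + ∑ ω, w ω * Hent (cw w Z ω) Y := by
    rw [← sum_add_distrib]
    refine sum_congr rfl fun ω _ => ?_
    by_cases h0 : w ω = 0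
    · simp [h0]
    · have hc := isProb_cw hw Z (lt_of_le_of_ne (hw.nonneg ω) (Ne.symm h0))
      rw [Hent_pairW hc hc, mul_add]
  rw [h1, sum_mul_Hent_cw hw, sum_mul_Hent_cw hw] at h
  linarith

variable {G : Type*} [AddCommGroup G] [Fintype G]

/-- The entropic Balog–Szemerédi–Gowers lemma, relative to a conditioning variable `S`. -/
lemma sum_rdist_fibre_le (hw : IsProb w) (A B : Ω → G) (S : Ω → α) :
    ∑ ω, w ω * rdist (pr (cw w (fun ω => (A ω + B ω, S ω)) ω) A)
        (pr (cw w (fun ω => (A ω + B ω, S ω)) ω) B) ≤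
      2 * Hent w (fun ω => (A ω, S ω)) + 2 * Hent w (fun ω => (B ω, S ω)) - 3 * Hent w S -
        3 * Hent w (fun ω => ((A ω, B ω), S ω)) + 2 * Hent w (fun ω => (A ω + B ω, S ω)) := by
  set Z : Ω → G × α := fun ω => (A ω + B ω, S ω) with hZ
  have hF := isProb_fibW hw Z
  have e1 : ∑ ω, w ω * rdist (pr (cw w Z ω) A) (pr (cw w Z ω) B) =
      ∑ ω, w ω * Hent (pairW (cw w Z ω) (cw w Z ω)) (fun s => A s.1 - B s.2) -
        (∑ ω, w ω * Hent (cw w Z ω) A + ∑ ω, w ω * Hent (cw w Z ω) B) / 2 := by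
    rw [← sum_add_distrib, Finset.sum_div, ← sum_sub_distrib]
    refine sum_congr rfl fun ω _ => ?_
    unfold rdist hent
    rw [Hent_pairW_pr, Hent_pr, Hent_pr]
    simp only [id]
    ring
  rw [e1, sum_mul_Hent_pairW_cw hw, sum_mul_Hent_cw hw, sum_mul_Hent_cw hw]
  have eA : Hent w (fun ω => (A ω, Z ω)) = Hent w (fun ω => ((A ω, B ω), S ω)) :=
    Hent_congr hw fun ω ω' => by
      simp only [hZ, Prod.mk.injEq]
      constructor
      · rintro ⟨h1, h2, h3⟩
        rw [h1] at h2
        exact ⟨⟨h1, add_left_cancel h2⟩, h3⟩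
      · rintro ⟨⟨h1, h2⟩, h3⟩
        exact ⟨h1, by rw [h1, h2], h3⟩
  have eB : Hent w (fun ω => (B ω, Z ω)) = Hent w (fun ω => ((A ω, B ω), S ω)) :=
    Hent_congr hw fun ω ω' => by
      simp only [hZ, Prod.mk.injEq]
      constructor
      · rintro ⟨h1, h2, h3⟩
        rw [h1] at h2
        exact ⟨⟨add_right_cancel h2, h1⟩, h3⟩
      · rintro ⟨⟨h1, h2⟩, h3⟩
        exact ⟨h2, by rw [h1, h2], h3⟩
  have e3 := Hent_fibW_pair hw Z A B
  have eJ : Hent (fibW w Z) (fun s => ((A s.1, B s.2), Z s.1)) =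
      Hent (fibW w Z) (fun s => ((A s.1, B s.2), Z s.1)) := rfl
  have key : Hent (fibW w Z) (fun s => ((A s.1, B s.2), Z s.1)) +
      Hent (fibW w Z) (fun s => (A s.1 - B s.2, S s.1)) ≤
      Hent (fibW w Z) (fun s => ((A s.1, S s.1), B s.2)) +
      Hent (fibW w Z) (fun s => ((A s.1 + B s.1 - B s.2, S s.1), B s.1)) :=
    Hent_submod hF
      (fun s s' h => by
        simp only [Prod.mk.injEq] at h ⊢
        exact ⟨by rw [h.1.1, h.2], h.1.2⟩)
      (fun s s' h => by
        simp only [Prod.mk.injEq] at h ⊢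
        refine ⟨?_, h.1.2⟩
        have h1 := h.1.1
        rw [h.2] at h1
        calc A s.1 - B s.2 = (A s.1 + B s'.1 - B s.2) - B s'.1 := by abel
          _ = _ := by rw [h1]; abel)
      (fun s s' h h' => by
        simp only [Prod.mk.injEq, hZ] at h h' ⊢
        exact ⟨⟨h.1.1, h.2⟩, by rw [h.1.1, h'.2], h.1.2⟩)
  have hQ : Hent (fibW w Z) (fun s => ((A s.1 + B s.1 - B s.2, S s.1), B s.1)) =
      Hent (fibW w Z) (fun s => ((A s.2, S s.2), B s.1)) := by
    refine Hent_ae_congr fun s hs => ?_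
    have := eq_of_fibW_ne_zero hs
    simp only [hZ, Prod.mk.injEq] at this ⊢
    exact ⟨⟨by rw [this.1]; abel, this.2⟩, trivial⟩
  have b1 : Hent (fibW w Z) (fun s => ((A s.1, S s.1), B s.2)) + Hent w S ≤
      Hent w (fun ω => (A ω, S ω)) + Hent w (fun ω => (B ω, S ω)) := by
    have := Hent_submod hF (P := fun s => (A s.1, S s.1)) (Q := fun s => (B s.2, S s.1))
      (Z := fun s => S s.1) (J := fun s => ((A s.1, S s.1), B s.2))
      (fun s s' h => (Prod.mk.inj h).2) (fun s s' h => (Prod.mk.inj h).2)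
      (fun s s' h h' => Prod.ext h (Prod.mk.inj h').1)
    rw [Hent_fibW_fst hw Z S, Hent_fibW_fst hw Z fun ω => (A ω, S ω)] at this
    have h2 : Hent (fibW w Z) (fun s => (B s.2, S s.1)) = Hent w (fun ω => (B ω, S ω)) := by
      rw [← Hent_fibW_snd hw Z fun ω => (B ω, S ω)]
      refine Hent_ae_congr fun s hs => ?_
      rw [(Prod.mk.inj (eq_of_fibW_ne_zero (Z := Z) hs)).2]
    rwa [h2] at this
  have b2 : Hent (fibW w Z) (fun s => ((A s.2, S s.2), B s.1)) + Hent w S ≤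
      Hent w (fun ω => (A ω, S ω)) + Hent w (fun ω => (B ω, S ω)) := by
    rw [← Hent_equiv (Equiv.prodComm Ω Ω) (fun s => fibW_swap Z s)
      (fun s => ((A s.1, S s.1), B s.2))] at b1
    exact b1
  have b3 : Hent (fibW w Z) (fun s => (A s.1 - B s.2, Z s.1)) + Hent w S ≤
      Hent (fibW w Z) (fun s => (A s.1 - B s.2, S s.1)) + Hent w Z := by
    have := Hent_submod hF (P := fun s => (A s.1 - B s.2, S s.1)) (Q := fun s => Z s.1)
      (Z := fun s => S s.1) (J := fun s => (A s.1 - B s.2, Z s.1))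
      (fun s s' h => (Prod.mk.inj h).2) (fun s s' h => (Prod.mk.inj h).2)
      (fun s s' h h' => Prod.ext (Prod.mk.inj h).1 h')
    rwa [Hent_fibW_fst hw Z S, Hent_fibW_fst hw Z Z] at this
  rw [hQ] at key
  linarith

end FibreProduct

section Distance

variable {G : Type*} [AddCommGroup G] [Fintype G] {lam ρ ν : G → ℝ}

lemma pr_id (w : G → ℝ) : pr w id = w := by
  funext s
  simp [pr]

lemma hent_le_Hent_sub (hl : IsProb lam) (hρ : IsProb ρ) :
    hent lam ≤ Hent (pairW lam ρ) (fun s => s.1 - s.2) ∧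
      hent ρ ≤ Hent (pairW lam ρ) (fun s => s.1 - s.2) := by
  have h := Hent_pairW hl hρ id id
  have hP := isProb_pairW hl hρ
  have h1 := Hent_subadd hP (P := fun s => s.1 - s.2) (Q := fun s : G × G => id s.2)
    (J := fun s => (id s.1, id s.2)) (fun s s' h h' => by
      simp only [id] at h'
      rw [h'] at h
      exact Prod.ext (sub_left_injective h) h')
  have h2 := Hent_subadd hP (P := fun s => s.1 - s.2) (Q := fun s : G × G => id s.1)
    (J := fun s => (id s.1, id s.2)) (fun s s' h h' => by
      simp only [id] at h'
      rw [h'] at h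
      exact Prod.ext h' (sub_right_injective h))
  rw [h, Hent_pairW_snd hl] at h1
  rw [h, Hent_pairW_fst hρ] at h2
  unfold hent
  constructor <;> linarith

lemma abs_hent_sub_le (hl : IsProb lam) (hρ : IsProb ρ) :
    |hent lam - hent ρ| ≤ 2 * rdist lam ρ := by
  obtain ⟨h1, h2⟩ := hent_le_Hent_sub hl hρ
  rw [abs_le]
  unfold rdist
  constructor <;> linarith

lemma rdist_nonneg (hl : IsProb lam) (hρ : IsProb ρ) : 0 ≤ rdist lam ρ := by
  linarith [abs_hent_sub_le hl hρ, abs_nonneg (hent lam - hent ρ)]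

lemma rdist_comm (hl : IsProb lam) (hρ : IsProb ρ) : rdist lam ρ = rdist ρ lam := by
  unfold rdist
  rw [add_comm (hent ρ)]
  congr 1
  rw [← Hent_equiv (Equiv.prodComm G G) (w := pairW lam ρ) (w' := pairW ρ lam)
    (fun s => mul_comm _ _)]
  refine Hent_congr (isProb_pairW hl hρ) fun s t => ?_
  simp only [Equiv.prodComm_apply, Prod.fst_swap, Prod.snd_swap]
  rw [← neg_sub s.1, ← neg_sub t.1, neg_inj]

lemma rdist_triangle (hl : IsProb lam) (hρ : IsProb ρ) (hν : IsProb ν) :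
    rdist lam ν ≤ rdist lam ρ + rdist ρ ν := by
  have hP := isProb_pairW hl (isProb_pairW hρ hν)
  have hQ := isProb_pairW hρ hν
  have e0 : Hent (pairW lam (pairW ρ ν)) (fun s => (s.1, (s.2.1, s.2.2))) =
      hent lam + Hent (pairW ρ ν) (fun s : G × G => (s.1, s.2)) :=
    Hent_pairW hl hQ id fun x : G × G => (x.1, x.2)
  have e0' : Hent (pairW lam (pairW ρ ν)) (fun s => s.1) = hent lam := Hent_pairW_fst hQ id
  have e1 : Hent (pairW lam (pairW ρ ν)) (fun s => (s.2.1, s.2.2)) =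
      Hent (pairW ρ ν) (fun s : G × G => (s.1, s.2)) :=
    Hent_pairW_snd hl fun x : G × G => (x.1, x.2)
  have e1' : Hent (pairW ρ ν) (fun s : G × G => (s.1, s.2)) = hent ρ + hent ν :=
    Hent_pairW hρ hν id id
  have e2 : Hent (pairW lam (pairW ρ ν)) (fun s => s.2.2) = hent ν :=
    (Hent_pairW_snd hl fun x : G × G => x.2).trans (Hent_pairW_snd hρ id)
  have e3 : Hent (pairW lam (pairW ρ ν)) (fun s => s.2.1 - s.2.2) =
      Hent (pairW ρ ν) (fun s => s.1 - s.2) := Hent_pairW_snd hl fun x : G × G => x.1 - x.2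
  have h := Hent_triangle hP (fun s => s.1) (fun s => s.2.1) (fun s => s.2.2)
    (by rw [e0, e0', e1])
  have m1 : pr (pairW ρ ν) (fun s => s.1) = ρ :=
    funext fun t => (pr_pairW_fst hν id t).trans (congrFun (pr_id ρ) t)
  have m2 : pr (pairW ρ ν) (fun s => s.2) = ν :=
    funext fun t => (pr_pairW_snd hρ id t).trans (congrFun (pr_id ν) t)
  have e4 : Hent (pairW lam (pairW ρ ν)) (fun s => s.1 - s.2.1) =
      Hent (pairW lam ρ) (fun s => s.1 - s.2) := by
    have := Hent_pairW_pr (w := lam) (w' := pairW ρ ν) id (fun s => s.1) fun s => s.1 - s.2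
    rw [m1, pr_id] at this
    exact this.symm
  have e5 : Hent (pairW lam (pairW ρ ν)) (fun s => s.1 - s.2.2) =
      Hent (pairW lam ν) (fun s => s.1 - s.2) := by
    have := Hent_pairW_pr (w := lam) (w' := pairW ρ ν) id (fun s => s.2) fun s => s.1 - s.2
    rw [m2, pr_id] at this
    exact this.symm
  rw [e1, e1', e2, e3, e4, e5] at h
  unfold rdist
  linarith

variable {p : ℕ} [Fact p.Prime] [Module (ZMod p) G] {J : Type*} [Fintype J]

lemma hsum_const_sub_hent_le (p : ℕ) [Fact p.Prime] [Module (ZMod p) G] (hl : IsProb lam)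
    (hρ : IsProb ρ) :
    hsum (fun _ : J => lam) - hent lam ≤ (2 * Fintype.card J + 2) * rdist lam ρ := by
  let μ : Option J → G → ℝ := fun o => o.elim ρ fun _ => lam
  have hμ : ∀ o, IsProb (μ o) := by
    rintro (_ | j)
    exacts [hρ, hl]
  have hd := abs_le.1 (abs_hent_sub_le hl hρ)
  have h0 : Lf μ (sgl none (-1 : ZMod p)) = hent ρ := Lf_single hμ none (by simp)
  let T : Finset (Option J) := univ.map Function.Embedding.some
  have hT : none ∉ T := by simp [T]
  have hTc : T.card = Fintype.card J := by simp [T]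
  have h1 := Lf_star hμ (i₀ := none) (c := (-1 : ZMod p)) (a := fun _ => 1) (K := 2 * rdist lam ρ)
    T hT fun i hi => by
      obtain ⟨j, -, rfl⟩ := mem_map.1 hi
      rw [h0]
      have e : sgl none (-1 : ZMod p) + sgl (Function.Embedding.some j) 1 =
          sgl (some j) 1 - sgl none 1 := by
        funext o
        rcases o with _ | i
        · simp
        · simp
      rw [e, Lf_sub_pair hμ (by simp)]
      have : Hent (pairW (μ (some j)) (μ none)) (fun s => s.1 - s.2) =
        rdist lam ρ + (hent lam + hent ρ) / 2 := by
        unfold rdist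
        simp [μ]
      rw [this]
      linarith
  have h2 := Lf_le_add hμ (a := ∑ i ∈ T, sgl i (1 : ZMod p)) (b := sgl none (-1)) fun o => by
    rcases o with _ | j
    · left
      rw [Finset.sum_apply]
      exact sum_eq_zero fun i hi => sgl_ne (fun h : none = i => hT (by rwa [h])) _
    · right
      exact sgl_ne (by simp) _
  have h3 : Lf μ (∑ i ∈ T, sgl i (1 : ZMod p)) = hsum (fun _ : J => lam) := by
    rw [Lf_comp hμ (Option.some_injective J), hsum_eq_Lf (p := p)]
    · congr 1
      funext j
      rw [Finset.sum_apply, sum_eq_single (some j)]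
      · exact sgl_self _ _
      · exact fun i _ hi => sgl_ne hi.symm _
      · exact fun h => absurd (mem_map_of_mem _ (mem_univ j)) h
    · rintro (_ | j) ho
      · rw [Finset.sum_apply]
        exact sum_eq_zero fun i hi => sgl_ne (fun h : none = i => hT (by rwa [h])) _
      · exact absurd ⟨j, rfl⟩ ho
  rw [h3, add_comm] at h2
  rw [h0, hTc] at h1
  have := h2.trans h1
  linarith

end Distance

section Endgame

variable {p : ℕ} [Fact p.Prime] {G : Type*} [AddCommGroup G] [Module (ZMod p) G] [Fintype G]
variable {ι J : Type*} [Fintype ι] [Fintype J] {η : ℝ} {μ : J → G → ℝ} {ν : G → ℝ}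

lemma add_hent_le_Hent_triple {v : ι → G → ℝ} (hv : ∀ i, IsProb (v i)) {f g : ι → ZMod p}
    {e₁ e₂ : ι} (he : e₁ ≠ e₂) (h1 : f e₁ = 0) (h2 : f e₂ = 0) (h12 : g e₁ ≠ g e₂) :
    Lf v f + hent (v e₁) + hent (v e₂) ≤
      Hent (prodW v) (fun ω => ((lin f ω, lin g ω), lin (fun _ => (1 : ZMod p)) ω)) := by
  have hP := isProb_prodW hv
  let T : Finset ι := univ \ {e₁, e₂}
  have hT : ∀ i, i ∈ T ↔ i ≠ e₁ ∧ i ≠ e₂ := by simp [T]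
  have h := Hent_submod hP (P := fun ω => ((lin f ω, lin g ω), lin (fun _ => (1 : ZMod p)) ω))
    (Q := restr T) (Z := lin f) (J := fun ω i => id (ω i))
    (fun ω ω' h => (Prod.mk.inj (Prod.mk.inj h).1).1)
    (fun ω ω' h => lin_congr fun i hi => restr_eq_iff.1 h i ((hT i).2
      ⟨fun h => hi (by rw [h, h1]), fun h => hi (by rw [h, h2])⟩))
    (fun ω ω' h h' => by
      rw [restr_eq_iff] at h'
      simp only [Prod.mk.injEq] at h
      have key : ∀ c : ι → ZMod p, lin c ω = lin c ω' →
          c e₁ • (ω e₁ - ω' e₁) + c e₂ • (ω e₂ - ω' e₂) = 0 := by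
        intro c hc
        have h3 : ∑ i, c i • (ω i - ω' i) = 0 := by
          simp_rw [smul_sub, sum_sub_distrib]
          exact sub_eq_zero.2 hc
        rw [← h3, ← sum_subset (subset_univ {e₁, e₂}), sum_pair he]
        intro i _ hi
        rw [h' i ((hT i).2 (by simpa using hi)), sub_self, smul_zero]
      have k1 := key g h.1.2
      have k2 := key _ h.2
      simp only [one_smul] at k2
      have d1 : ω e₁ - ω' e₁ = -(ω e₂ - ω' e₂) := eq_neg_of_add_eq_zero_left k2
      rw [d1, smul_neg, neg_add_eq_sub, ← sub_smul] at k1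
      have d2 : ω e₂ - ω' e₂ = 0 :=
        (smul_eq_zero.1 k1).resolve_left (sub_ne_zero.2 h12.symm)
      rw [d2, neg_zero] at d1
      funext i
      by_cases i1 : i = e₁
      · rw [i1]
        exact sub_eq_zero.1 d1
      by_cases i2 : i = e₂
      · rw [i2]
        exact sub_eq_zero.1 d2
      exact h' i ((hT i).2 ⟨i1, i2⟩))
  rw [Hent_prodW hv] at h
  have h3 := Hent_restr_le hv T
  have h4 : ∑ i, Hent (v i) id = ∑ i ∈ T, Hent (v i) id + (hent (v e₁) + hent (v e₂)) := by
    rw [← sum_sdiff (subset_univ {e₁, e₂}), sum_pair he]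
    rfl
  unfold Lf
  linarith

lemma IsTauMin.le_of_forms (hmin : IsTauMin η ν μ) (hη : 0 ≤ η) (hν : IsProb ν) [Nonempty J]
    {a : ι → J} (ha : Function.Surjective a) {f g : ι → ZMod p}
    (hfg : ∀ s t, ∃ x, f x = s ∧ g x = t) {K ε : ℝ}
    (hK : ∀ f : ι → ZMod p, Lf (fun i => μ (a i)) f ≤ havg μ + K)
    (hI : Hent (prodW fun i => μ (a i)) (fun ω => (lin f ω, lin (fun _ => (1 : ZMod p)) ω)) +
      Hent (prodW fun i => μ (a i)) (fun ω => (lin g ω, lin (fun _ => (1 : ZMod p)) ω)) ≤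
      Hent (prodW fun i => μ (a i)) (fun ω => ((lin f ω, lin g ω), lin (fun _ => (1 : ZMod p)) ω)) +
      Lf (fun i => μ (a i)) (fun _ => (1 : ZMod p)) + ε)
    (h2 : 2 * Hent (prodW fun i => μ (a i))
        (fun ω => (lin f ω + lin g ω, lin (fun _ => (1 : ZMod p)) ω)) ≤
      Hent (prodW fun i => μ (a i)) (fun ω => (lin f ω, lin (fun _ => (1 : ZMod p)) ω)) +
      Hent (prodW fun i => μ (a i)) (fun ω => (lin g ω, lin (fun _ => (1 : ZMod p)) ω))) :
    hsum μ - havg μ ≤ (2 * Fintype.card J + 2) * (3 * ε) +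
      η * (5 / 2 * Fintype.card J * (K + Fintype.card J * (hsum μ - havg μ))) := by
  have hμ := hmin.prob
  set k := hsum μ - havg μ with hk
  set M : ℝ := (Fintype.card J : ℝ) with hM
  have hM0 : 0 < M := by
    rw [hM]
    exact_mod_cast Fintype.card_pos
  set v : ι → G → ℝ := fun i => μ (a i) with hv'
  have hv : ∀ i, IsProb (v i) := fun i => hμ _
  set w := prodW v with hw'
  have hw : IsProb w := isProb_prodW hv
  have hlb : ∀ j, havg μ - M * k ≤ hent (μ j) := le_hent p hμ
  set S : (ι → G) → G := lin (fun _ => (1 : ZMod p)) with hS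
  set Z : (ι → G) → G × G := fun ω => (lin f ω + lin g ω, S ω) with hZ
  -- distances between the laws
  have hd : ∀ i j, rdist (μ i) ν ≤ rdist (μ j) ν + (K + M * k) := by
    intro i j
    by_cases hij : i = j
    · rw [hij]
      have h1 := hK fun _ => 1
      obtain ⟨x, hx⟩ := ha i
      have h3 := hK (sgl x 1)
      rw [Lf_single hv x one_ne_zero] at h3
      have h4 := hlb (a x)
      simp only [hv'] at h3
      linarith
    · obtain ⟨x, rfl⟩ := ha i
      obtain ⟨y, rfl⟩ := ha j
      have hxy : x ≠ y := fun h => hij (by rw [h])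
      have h1 := hK (sgl x 1 - sgl y 1)
      rw [Lf_sub_pair hv hxy] at h1
      have h3 := rdist_triangle (hμ (a x)) (hμ (a y)) hν
      have h4 : rdist (μ (a x)) (μ (a y)) ≤ K + M * k := by
        unfold rdist
        linarith [hlb (a x), hlb (a y)]
      linarith
  obtain ⟨e₀, he₀, -⟩ := hfg 1 0
  obtain ⟨e₁, he₁, hg₁⟩ := hfg 0 0
  obtain ⟨e₂, he₂, hg₂⟩ := hfg 0 1
  have hsumd : M * rdist (μ (a e₀)) ν ≤ ∑ j, rdist (μ j) ν + M * (K + M * k) := by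
    have := sum_le_sum fun j (_ : j ∈ univ) => hd (a e₀) j
    simp only [sum_const, card_univ, nsmul_eq_mul, sum_add_distrib] at this
    exact this
  -- mutual information between the first form and the conditioning variable
  have htrip := add_hent_le_Hent_triple hv (g := g) (e₁ := e₁) (e₂ := e₂)
    (fun h => zero_ne_one (hg₁.symm.trans (h ▸ hg₂))) he₁ he₂
    (by rw [hg₁, hg₂]; exact zero_ne_one)
  have hAZ : Hent w (fun ω => (lin f ω, Z ω)) =
      Hent w (fun ω => ((lin f ω, lin g ω), S ω)) := by
    refine Hent_congr hw fun ω ω' => ?_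
    simp only [hZ, Prod.mk.injEq]
    constructor
    · rintro ⟨h1, h2, h3⟩
      rw [h1] at h2
      exact ⟨⟨h1, add_left_cancel h2⟩, h3⟩
    · rintro ⟨⟨h1, h2⟩, h3⟩
      exact ⟨h1, by rw [h1, h2], h3⟩
  have hZle : Hent w Z ≤ 2 * (havg μ + K) := by
    have h3 := Hent_subadd hw (P := lin (f + g)) (Q := S) (J := Z) fun ω ω' h h' => by
      rw [lin_add, lin_add] at h
      exact Prod.ext h h'
    have h4 := hK (f + g)
    have h5 := hK fun _ => 1
    unfold Lf at h4 h5
    linarith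
  -- the penalty of the conditioned variable
  have hpen := sum_rdist_cw_le hw hν (lin f) Z
  have hpen2 : Hent (pairW w ν) (fun s => lin f s.1 - s.2) - (Lf v f + hent ν) / 2 ≤
      rdist (μ (a e₀)) ν + (K + M * k) / 2 := by
    have h3 := Hent_add_sub_le hw hν (lin (sgl e₀ (1 : ZMod p))) (lin (f - sgl e₀ 1))
      (Hent_lin_pair hv fun i => by
        by_cases h : i = e₀
        · right
          rw [h, Pi.sub_apply, he₀, sgl_self, sub_self]
        · left
          exact sgl_ne h _)
    have e1 : ∀ ω : ι → G, lin (sgl e₀ (1 : ZMod p)) ω + lin (f - sgl e₀ 1) ω = lin f ω := by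
      intro ω
      rw [← lin_add, add_sub_cancel]
    simp_rw [e1] at h3
    have e2 : Hent w (lin (sgl e₀ (1 : ZMod p))) = hent (μ (a e₀)) := Lf_single hv e₀ one_ne_zero
    have e3 : Hent (pairW w ν) (fun s => lin (sgl e₀ (1 : ZMod p)) s.1 - s.2) =
        rdist (μ (a e₀)) ν + (hent (μ (a e₀)) + hent ν) / 2 := by
      have h5 := rdist_pr (w := w) (ν := ν) (fun ω => ω e₀)
      rw [hw', pr_prodW_eval hv, ← hw'] at h5
      have h6 : Hent w (fun ω => ω e₀) = hent (μ (a e₀)) := Hent_prodW_eval hv e₀ id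
      rw [h6] at h5
      simp_rw [lin_single, one_smul]
      have h7 : v e₀ = μ (a e₀) := rfl
      rw [h7] at h5
      linarith
    rw [e2, e3] at h3
    have h4 := hK f
    have e4 : Hent w (fun ω => lin f ω) = Lf v f := rfl
    rw [e4] at h3
    linarith [hlb (a e₀)]
  -- replace every law by the conditioned one
  have hpt : ∀ ω, w ω * ptau η ν μ ≤ w ω * ((2 * M + 2) *
      rdist (pr (cw w Z ω) (lin f)) (pr (cw w Z ω) (lin g)) +
      η * (M * rdist (pr (cw w Z ω) (lin f)) ν)) := by
    intro ω
    by_cases h0 : w ω = 0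
    · simp [h0]
    have hc := isProb_cw hw Z (lt_of_le_of_ne (hw.nonneg ω) (Ne.symm h0))
    refine mul_le_mul_of_nonneg_left ?_ (hw.nonneg ω)
    have h3 := hmin.le (fun _ => pr (cw w Z ω) (lin f)) fun _ => isProb_pr hc _
    have h4 := hsum_const_sub_hent_le (J := J) p (isProb_pr hc (lin f)) (isProb_pr hc (lin g))
    refine h3.trans ?_
    unfold ptau
    simp only [sum_const, card_univ, nsmul_eq_mul]
    rw [← hM] at h4 ⊢
    rw [mul_div_cancel_left₀ _ hM0.ne']
    linarith
  have hsum' := sum_le_sum fun ω (_ : ω ∈ univ) => hpt ω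
  rw [← sum_mul, hw.sum_one, one_mul] at hsum'
  have hbsg := sum_rdist_fibre_le hw (lin f) (lin g) S
  have hsplit : ∑ ω, w ω * ((2 * M + 2) *
      rdist (pr (cw w Z ω) (lin f)) (pr (cw w Z ω) (lin g)) +
      η * (M * rdist (pr (cw w Z ω) (lin f)) ν)) =
      (2 * M + 2) * ∑ ω, w ω * rdist (pr (cw w Z ω) (lin f)) (pr (cw w Z ω) (lin g)) +
      η * (M * ∑ ω, w ω * rdist (pr (cw w Z ω) (lin f)) ν) := by
    simp only [mul_sum, ← sum_add_distrib]
    exact sum_congr rfl fun ω _ => by ring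
  rw [hsplit] at hsum'
  have hb1 : ∑ ω, w ω * rdist (pr (cw w Z ω) (lin f)) (pr (cw w Z ω) (lin g)) ≤ 3 * ε := by
    have e4 : Hent w S = Lf v (fun _ => (1 : ZMod p)) := rfl
    rw [e4] at hbsg
    linarith
  have hb2 : ∑ ω, w ω * rdist (pr (cw w Z ω) (lin f)) ν ≤
      rdist (μ (a e₀)) ν + 3 / 2 * (K + M * k) := by
    rw [hAZ] at hpen
    have := hlb (a e₁)
    have := hlb (a e₂)
    simp only [hv'] at *
    linarith
  have hb3 := mul_le_mul_of_nonneg_left hb1 (by linarith : 0 ≤ 2 * M + 2)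
  have hb4 : η * (M * ∑ ω, w ω * rdist (pr (cw w Z ω) (lin f)) ν) ≤
      η * (∑ j, rdist (μ j) ν + 5 / 2 * M * (K + M * k)) := by
    refine mul_le_mul_of_nonneg_left ?_ hη
    have := mul_le_mul_of_nonneg_left hb2 hM0.le
    linarith
  have hτ : ptau η ν μ = k + η * ∑ j, rdist (μ j) ν := rfl
  rw [hτ] at hsum'
  linarith

/-- A constant depending only on `p`, controlling all linear forms of a minimiser. -/
noncomputable def formConst (p : ℕ) : ℝ := 1 + (p * p : ℕ) * (p * (6 * p + 6) + 1 + p)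

/-- A constant depending only on `p`. -/
noncomputable def endConst (p : ℕ) : ℝ :=
  (2 * p + 2) * (3 * (p * formConst p)) + 5 / 2 * p * (formConst p + p)

lemma IsTauMin.hsum_sub_havg_le (hmin : IsTauMin η ν μ) (hη : 0 ≤ η) (hν : IsProb ν)
    (σ : J ≃ ZMod p) (φ : ι ≃ J × J) :
    hsum μ - havg μ ≤ η * (endConst p * (hsum μ - havg μ)) := by
  have hp2 : 2 ≤ p := (Fact.out : p.Prime).two_le
  have hcard : Fintype.card J = p := by rw [Fintype.card_congr σ, ZMod.card]
  have hJ : 2 ≤ Fintype.card J := by rwa [hcard]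
  have hcι : Fintype.card ι = p * p := by rw [Fintype.card_congr φ, Fintype.card_prod, hcard]
  have hι : 3 ≤ Fintype.card ι := by
    rw [hcι]
    nlinarith
  have : Nonempty J := Fintype.card_pos_iff.1 (by omega)
  set a : ι → J := fun x => (φ x).1 with ha'
  have ha : Function.Surjective a := fun j => ⟨φ.symm (j, j), by simp [ha']⟩
  have hμ := hmin.prob
  have hv : ∀ i, IsProb ((fun i => μ (a i)) i) := fun i => hμ _
  have hw : IsProb (prodW fun i => μ (a i)) := isProb_prodW hv
  have hK : ∀ f : ι → ZMod p, Lf (fun i => μ (a i)) f ≤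
      havg μ + formConst p * (hsum μ - havg μ) := by
    intro f
    have := Lf_le_havg hμ ha hJ hι f
    rwa [hcι, hcard] at this
  let u : ι → ZMod p := fun x => σ (φ x).1
  let v : ι → ZMod p := fun x => σ (φ x).2
  let z : ι → ZMod p := fun x => -(u x + v x)
  let c : ι → J := fun x => σ.symm (u x + v x)
  have hext : ∀ x y, u x = u y → v x = v y → x = y := fun x y h1 h2 =>
    φ.injective (Prod.ext (σ.injective h1) (σ.injective h2))
  have hbij : ∀ F : ι → J × J, Function.Injective F → Function.Bijective F := fun F hF =>
    (Fintype.bijective_iff_injective_and_card F).2 ⟨hF, Fintype.card_congr φ⟩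
  have hc : ∀ x y, c x = c y → u x + v x = u y + v y := fun x y h => σ.symm.injective h
  let φ₂ : ι ≃ J × J := Equiv.ofBijective (fun x => (a x, c x)) (hbij _ fun x y h => by
    obtain ⟨h1, h2⟩ := Prod.mk.inj h
    have h3 : u x = u y := congrArg σ h1
    have h4 := hc x y h2
    rw [h3] at h4
    exact hext x y h3 (add_left_cancel h4))
  let φ₃ : ι ≃ J × J := Equiv.ofBijective (fun x => (c x, (φ x).2)) (hbij _ fun x y h => by
    obtain ⟨h1, h2⟩ := Prod.mk.inj h
    have h3 : v x = v y := congrArg σ h2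
    have h4 := hc x y h1
    rw [h3] at h4
    exact hext x y (add_right_cancel h4) h3)
  have hz : ∀ x y, c x = c y → z x = z y := fun x y h => congrArg Neg.neg (hc x y h)
  have I₁ := hmin.grid_le hη hν hJ (a := a) φ (fun x y h => φ.injective h) (f := u) (g := v)
    (fun x y h => congrArg σ h) (fun x y h => congrArg σ h) hK
  have I₂ := hmin.grid_le hη hν hJ (a := a) φ₂ φ₂.injective (f := u) (g := z)
    (fun x y h => congrArg σ h) hz hK
  have I₃ := hmin.grid_le hη hν hJ (a := a) φ₃ (fun x y h => φ.injective h) (f := z) (g := v)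
    hz (fun x y h => congrArg σ h) hK
  have hsurj : ∀ s t : ZMod p, ∃ x, u x = s ∧ v x = t := fun s t =>
    ⟨φ.symm (σ.symm s, σ.symm t), by simp [u], by simp [v]⟩
  have hneg : ∀ f g h : ι → ZMod p, f + g = -h →
      Hent (prodW fun i => μ (a i)) (fun ω => (lin f ω + lin g ω, lin (fun _ => (1 : ZMod p)) ω)) =
      Hent (prodW fun i => μ (a i)) (fun ω => (lin h ω, lin (fun _ => (1 : ZMod p)) ω)) := by
    intro f g h e
    refine Hent_congr hw fun ω ω' => ?_
    simp only [← lin_add, e, lin_neg, Prod.mk.injEq, neg_inj]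
  have e₁ := hneg u v z (by funext x; simp [z])
  have e₂ := hneg u z v (by funext x; simp [z])
  have e₃ := hneg z v u (by funext x; simp [z])
  have fin : ∀ X : ℝ, X ≤ (2 * Fintype.card J + 2) *
      (3 * (η * (Fintype.card J * (formConst p * (hsum μ - havg μ))))) +
      η * (5 / 2 * Fintype.card J * (formConst p * (hsum μ - havg μ) +
        Fintype.card J * (hsum μ - havg μ))) →
      X ≤ η * (endConst p * (hsum μ - havg μ)) := by
    intro X hX
    refine hX.trans_eq ?_
    rw [hcard, endConst]
    ring
  refine fin _ ?_
  set hu := Hent (prodW fun i => μ (a i)) (fun ω => (lin u ω, lin (fun _ => (1 : ZMod p)) ω))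
  set hvv := Hent (prodW fun i => μ (a i)) (fun ω => (lin v ω, lin (fun _ => (1 : ZMod p)) ω))
  set hzz := Hent (prodW fun i => μ (a i)) (fun ω => (lin z ω, lin (fun _ => (1 : ZMod p)) ω))
  rcases le_total hu hvv with h1 | h1
  · rcases le_total hu hzz with h2 | h2
    · refine hmin.le_of_forms hη hν ha (f := z) (g := v) (fun s t => ?_) hK I₃ ?_
      · obtain ⟨x, hx1, hx2⟩ := hsurj (-s - t) t
        exact ⟨x, by simp [z, hx1, hx2], hx2⟩
      · rw [e₃]
        linarith
    · refine hmin.le_of_forms hη hν ha (f := u) (g := v) hsurj hK I₁ ?_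
      rw [e₁]
      linarith
  · rcases le_total hvv hzz with h2 | h2
    · refine hmin.le_of_forms hη hν ha (f := u) (g := z) (fun s t => ?_) hK I₂ ?_
      · obtain ⟨x, hx1, hx2⟩ := hsurj s (-t - s)
        exact ⟨x, hx1, by simp [z, hx1, hx2]⟩
      · rw [e₂]
        linarith
    · refine hmin.le_of_forms hη hν ha (f := u) (g := v) hsurj hK I₁ ?_
      rw [e₁]
      linarith

lemma IsTauMin.hsum_eq_havg (hmin : IsTauMin η ν μ) (hη : 0 ≤ η) (hη' : η * endConst p < 1)
    (hν : IsProb ν) (σ : J ≃ ZMod p) : hsum μ = havg μ := by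
  have : Nonempty J := ⟨σ.symm 0⟩
  have h0 := hsum_sub_havg_nonneg p hmin.prob
  have h1 := hmin.hsum_sub_havg_le hη hν σ (Equiv.refl (J × J))
  nlinarith

end Endgame

section Rigidity

variable {G : Type*} [AddCommGroup G] [Fintype G] {lam ν ρ : G → ℝ}

lemma pr_pairW_sub (lam ν : G → ℝ) (t : G) :
    pr (pairW lam ν) (fun s => s.1 - s.2) t = ∑ x, ν x * lam (t + x) := by
  unfold pr pairW
  rw [Fintype.sum_prod_type_right]
  refine sum_congr rfl fun x _ => ?_
  rw [sum_eq_single (t + x)]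
  · simp [mul_comm]
  · intro y _ hy
    rw [if_neg]
    rintro rfl
    exact hy (by simp)
  · simp

lemma hent_eq_sum (lam : G → ℝ) : hent lam = ∑ t, Real.negMulLog (lam t) := by
  unfold hent
  rw [Hent_eq_sum, pr_id]

lemma apply_add_eq_of_rdist_self (hl : IsProb lam) (h : rdist lam lam = 0) {x y : G}
    (hx : lam x ≠ 0) (hy : lam y ≠ 0) (t : G) : lam (t + x) = lam (t + y) := by
  have h1 : ∑ t, Real.negMulLog (∑ x, lam x * lam (t + x)) =
      ∑ t, ∑ x, lam x * Real.negMulLog (lam (t + x)) := by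
    have e1 : Hent (pairW lam lam) (fun s => s.1 - s.2) = hent lam := by
      unfold rdist at h
      linarith
    rw [Hent_eq_sum] at e1
    simp_rw [pr_pairW_sub] at e1
    rw [e1, sum_comm, hent_eq_sum]
    have : ∀ x, ∑ t, lam x * Real.negMulLog (lam (t + x)) =
        lam x * ∑ t, Real.negMulLog (lam t) := fun x => by
      rw [← mul_sum]
      exact congrArg _ (Equiv.sum_comp (Equiv.addRight x) fun t => Real.negMulLog (lam t))
    simp_rw [this, ← sum_mul, hl.sum_one, one_mul]
  have h2 : ∀ t, ∑ x, lam x * Real.negMulLog (lam (t + x)) ≤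
      Real.negMulLog (∑ x, lam x * lam (t + x)) := fun t =>
    Real.strictConcaveOn_negMulLog.concaveOn.le_map_sum (fun x _ => hl.nonneg x) hl.sum_one
      fun x _ => hl.nonneg _
  have h3 := (sum_eq_sum_iff_of_le fun t _ => h2 t).1 h1.symm t (mem_univ t)
  have h4 := (Real.strictConcaveOn_negMulLog.map_sum_eq_iff' (fun x _ => hl.nonneg x) hl.sum_one
      (fun x _ => hl.nonneg (t + x))).1 h3.symm
  exact (h4 x (mem_univ x) hx).trans (h4 y (mem_univ y) hy).symm

/-- The stabiliser of a function on a group. -/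
def funStab (f : G → ℝ) : AddSubgroup G where
  carrier := {g | ∀ t, f (t + g) = f t}
  zero_mem' t := by rw [add_zero]
  add_mem' {a b} ha hb t := by
    rw [← add_assoc]
    exact (hb _).trans (ha t)
  neg_mem' {a} ha t := by
    have := ha (t + -a)
    rw [neg_add_cancel_right] at this
    exact this.symm

lemma sub_mem_funStab (hl : IsProb lam) (h : rdist lam lam = 0) {x y : G}
    (hx : lam x ≠ 0) (hy : lam y ≠ 0) : x - y ∈ funStab lam := by
  intro t
  have := apply_add_eq_of_rdist_self hl h hx hy (t - y)
  rwa [sub_add_cancel, sub_add_eq_add_sub, add_sub_assoc] at this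

lemma exists_ne_zero (hl : IsProb lam) : ∃ x, lam x ≠ 0 := by
  by_contra! h
  have := hl.sum_one
  simp [h] at this

lemma hent_eq_log_card_funStab (hl : IsProb lam) (h : rdist lam lam = 0) :
    hent lam = Real.log (Nat.card (funStab lam)) := by
  obtain ⟨x₀, hx₀⟩ := exists_ne_zero hl
  let T : Finset G := univ.filter fun x => lam x ≠ 0
  have hT : T.card = Nat.card (funStab lam) := by
    rw [Nat.card_eq_fintype_card, ← card_univ (α := funStab lam)]
    refine card_bij' (fun x hx => ⟨x - x₀, sub_mem_funStab hl h (mem_filter.1 hx).2 hx₀⟩)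
      (fun g _ => x₀ + g) (by simp) (fun g _ => ?_) (by simp) (by simp)
    refine mem_filter.2 ⟨mem_univ _, ?_⟩
    rw [g.2 x₀]
    exact hx₀
  have hval : ∀ x ∈ T, lam x = lam x₀ := fun x hx => by
    have := sub_mem_funStab hl h (mem_filter.1 hx).2 hx₀ x₀
    rwa [add_sub_cancel] at this
  have hs : (T.card : ℝ) * lam x₀ = 1 := by
    rw [← hl.sum_one, ← sum_filter_ne_zero, sum_congr rfl hval, sum_const, nsmul_eq_mul]
  have hTe : hent lam = ∑ x ∈ T, Real.negMulLog (lam x) := by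
    rw [hent_eq_sum]
    refine (sum_subset (subset_univ _) fun x _ hx => ?_).symm
    have : lam x = 0 := by simpa [T] using hx
    simp [this]
  have h0 : lam x₀ = (T.card : ℝ)⁻¹ := eq_inv_of_mul_eq_one_right hs
  rw [hTe, sum_congr rfl fun x hx => by rw [hval x hx], sum_const, nsmul_eq_mul,
    Real.negMulLog, ← mul_assoc, mul_neg, hs, ← hT, h0, Real.log_inv]
  ring

lemma Hent_mkQ_le {p : ℕ} [Module (ZMod p) G] (hl : IsProb lam) (hν : IsProb ν)
    (V : Submodule (ZMod p) G) (hV : ∀ x y, lam x ≠ 0 → lam y ≠ 0 → x - y ∈ V) :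
    Hent ν V.mkQ ≤ 2 * rdist lam ν := by
  obtain ⟨x₀, hx₀⟩ := exists_ne_zero hl
  have hP := isProb_pairW hl hν
  have h := Hent_submod hP (P := fun s => (s.1 - s.2, V.mkQ s.2)) (Q := fun s => id s.2)
    (Z := fun s => V.mkQ s.2) (J := fun s => (id s.1, id s.2))
    (fun s s' h => (Prod.mk.inj h).2) (fun s s' h => congrArg V.mkQ h)
    (fun s s' h h' => by
      have h1 := (Prod.mk.inj h).1
      have h2 : s.2 = s'.2 := h'
      rw [h2] at h1
      exact Prod.ext (sub_left_injective h1) h2)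
  have e1 : Hent (pairW lam ν) (fun s => (s.1 - s.2, V.mkQ s.2)) =
      Hent (pairW lam ν) (fun s => s.1 - s.2) := by
    have : Hent (pairW lam ν) (fun s => (s.1 - s.2, V.mkQ s.2)) =
        Hent (pairW lam ν) (fun s => (s.1 - s.2, V.mkQ x₀ - V.mkQ (s.1 - s.2))) := by
      refine Hent_ae_congr fun s hs => ?_
      have h1 : lam s.1 ≠ 0 := fun h => hs (by simp [pairW, h])
      have h2 : V.mkQ s.1 = V.mkQ x₀ := by
        rw [← sub_eq_zero, ← map_sub]
        exact (Submodule.Quotient.mk_eq_zero V).2 (hV _ _ h1 hx₀)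
      rw [map_sub, h2]
      simp
    rw [this]
    refine Hent_congr hP fun s s' => ?_
    simp only [Prod.mk.injEq]
    exact ⟨fun h => h.1, fun h => ⟨h, by rw [h]⟩⟩
  rw [e1, Hent_pairW hl hν, Hent_pairW_snd hl, Hent_pairW_snd hl] at h
  have hd := abs_le.1 (abs_hent_sub_le hl hν)
  have e2 : Hent lam id = hent lam := rfl
  unfold rdist at *
  linarith

end Rigidity

section PFR

variable {p : ℕ} [Fact p.Prime] {G : Type*} [AddCommGroup G] [Module (ZMod p) G] [Fintype G]

lemma rdist_self_eq_zero (p : ℕ) [Fact p.Prime] [Module (ZMod p) G] {ι J : Type*} [Fintype ι]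
    [Fintype J] {μ : J → G → ℝ}
    (hμ : ∀ j, IsProb (μ j)) (h : hsum μ = havg μ) (φ : ι ≃ J × J)
    (hJ : 2 ≤ Fintype.card J) (j : J) : rdist (μ j) (μ j) = 0 := by
  have hι : 3 ≤ Fintype.card ι := by
    rw [Fintype.card_congr φ, Fintype.card_prod]
    nlinarith
  obtain ⟨j', hj'⟩ := Fintype.exists_ne_of_one_lt_card (by omega : 1 < Fintype.card J) j
  have : Nonempty J := ⟨j⟩
  have h1 := le_hent p hμ j
  have h2 := Lf_le_havg (p := p) hμ (a := fun x => (φ x).1)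
    (fun i => ⟨φ.symm (i, i), by simp⟩) hJ hι
    (sgl (φ.symm (j, j)) 1 - sgl (φ.symm (j, j')) 1)
  rw [Lf_sub_pair (fun i => hμ _) (by simpa using hj'.symm)] at h2
  simp only [Equiv.apply_symm_apply, h, sub_self, mul_zero, add_zero, sub_zero] at h1 h2
  have h3 := rdist_nonneg (hμ j) (hμ j)
  unfold rdist at h3 ⊢
  linarith

/-- The constant in the entropic form of Marton's conjecture over `𝔽_p`. -/
noncomputable def pfrConst (p : ℕ) : ℝ := 2 * ((2 * p + 2) * (endConst p + 1) + 2)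

lemma endConst_nonneg (p : ℕ) : 0 ≤ endConst p := by
  unfold endConst formConst
  positivity

/-- The entropic form of Marton's conjecture over `𝔽_p`. -/
theorem entropic_marton {ν ρ : G → ℝ} (hν : IsProb ν) (hρ : IsProb ρ) :
    ∃ V : Submodule (ZMod p) G,
      Real.log (Nat.card V) ≤ hent ν + pfrConst p * rdist ν ρ ∧
      Hent ν V.mkQ ≤ pfrConst p * rdist ν ρ := by
  have hp2 : 2 ≤ p := (Fact.out : p.Prime).two_le
  have hE := endConst_nonneg p
  set r := rdist ν ρ with hr
  have hr0 : 0 ≤ r := rdist_nonneg hν hρ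
  set η : ℝ := (endConst p + 1)⁻¹ with hη
  have hη0 : 0 < η := by positivity
  have hη1 : η * (endConst p + 1) = 1 := inv_mul_cancel₀ (by positivity)
  obtain ⟨μ, hmin⟩ := exists_isTauMin (J := ZMod p) η hν
  have hcard : Fintype.card (ZMod p) = p := ZMod.card p
  have hk := hmin.hsum_eq_havg hη0.le (by linarith) hν (Equiv.refl _)
  have hself : ∀ j, rdist (μ j) (μ j) = 0 :=
    rdist_self_eq_zero p hmin.prob hk (Equiv.refl _) (by rw [hcard]; exact hp2)
  have hνν : rdist ν ν ≤ 2 * r := by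
    have := rdist_triangle hν hρ hν
    rw [rdist_comm hρ hν] at this
    linarith
  have h1 := hmin.le (fun _ => ν) fun _ => hν
  have h2 := hsum_const_sub_hent_le (J := ZMod p) p hν hρ
  have h0 : ptau η ν μ = (hsum μ - havg μ) + η * ∑ j, rdist (μ j) ν := rfl
  have hp0 : (0 : ℝ) < p := by positivity
  have h3 : ptau η ν (fun _ : ZMod p => ν) = hsum (fun _ : ZMod p => ν) - hent ν +
      η * (p * rdist ν ν) := by
    unfold ptau
    simp only [sum_const, card_univ, hcard, nsmul_eq_mul]
    rw [mul_div_cancel_left₀ _ hp0.ne']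
  rw [hcard] at h2
  have h4 : η * ∑ j, rdist (μ j) ν ≤ (2 * p + 2) * r + η * (p * (2 * r)) := by
    have := mul_le_mul_of_nonneg_left hνν (by positivity : 0 ≤ η * p)
    rw [h0, h3, hk] at h1
    linarith
  have h5 : ∑ j, rdist (μ j) ν ≤ (2 * p + 2) * (endConst p + 1) * r + p * (2 * r) := by
    have := mul_le_mul_of_nonneg_left h4 (by positivity : 0 ≤ endConst p + 1)
    have e : ∀ x, (endConst p + 1) * (η * x) = x := fun x => by
      rw [← mul_assoc, mul_comm _ η, hη1, one_mul]
    rw [e, mul_add, e] at this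
    linarith
  obtain ⟨j, hj⟩ : ∃ j, rdist (μ j) ν ≤ ((2 * p + 2) * (endConst p + 1) + 2) * r := by
    by_contra! hcon
    have h6 := sum_lt_sum_of_nonempty (s := (univ : Finset (ZMod p))) univ_nonempty
      fun j _ => hcon j
    simp only [sum_const, card_univ, hcard, nsmul_eq_mul] at h6
    have h7 : (2 * p + 2) * (endConst p + 1) * r ≤ p * ((2 * p + 2) * (endConst p + 1) * r) :=
      le_mul_of_one_le_left (by positivity) (by exact_mod_cast (by omega : 1 ≤ p))
    linarith
  have hl := hmin.prob j
  have hd := abs_le.1 (abs_hent_sub_le hl hν)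
  let V := AddSubgroup.toZModSubmodule p (funStab (μ j))
  refine ⟨V, ?_, ?_⟩
  · have h6 := hent_eq_log_card_funStab hl (hself j)
    have h7 : Nat.card V = Nat.card (funStab (μ j)) := rfl
    rw [h7, ← h6]
    unfold pfrConst
    linarith
  · have := Hent_mkQ_le hl hν V fun x y hx hy => sub_mem_funStab hl (hself j) hx hy
    unfold pfrConst
    linarith

end PFR

section Uniform

variable {Ω α : Type*} [Fintype Ω] {E : Finset Ω}

/-- The uniform law on a finite set. -/
noncomputable def unifW (E : Finset Ω) : Ω → ℝ := fun ω => if ω ∈ E then (E.card : ℝ)⁻¹ else 0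

lemma isProb_unifW (hE : E.Nonempty) : IsProb (unifW E) := by
  have h : (0 : ℝ) < E.card := by exact_mod_cast hE.card_pos
  refine ⟨fun ω => ?_, ?_⟩
  · unfold unifW
    split_ifs <;> positivity
  · simp [unifW, h.ne']

lemma unifW_ne_zero {ω : Ω} (h : unifW E ω ≠ 0) : ω ∈ E := by
  by_contra h'
  exact h (if_neg h')

lemma Hent_unifW (hE : E.Nonempty) {X : Ω → α} (hX : Function.Injective X) :
    Hent (unifW E) X = Real.log E.card := by
  have hw := isProb_unifW hE
  have h1 : Hent (unifW E) X = Hent (unifW E) id :=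
    Hent_congr hw fun ω ω' => hX.eq_iff
  have hE' : (E.card : ℝ) ≠ 0 := by exact_mod_cast hE.card_pos.ne'
  have h2 : ∀ ω, pr (unifW E) id ω = unifW E ω := fun ω => by simp [pr]
  rw [h1]
  simp only [Hent, id, h2]
  unfold unifW
  rw [← sum_filter_add_sum_filter_not univ (· ∈ E)]
  rw [sum_congr rfl fun ω hω => by rw [if_pos (mem_filter.1 hω).2],
    sum_eq_zero (s := filter (fun ω => ω ∉ E) univ) fun ω hω => by
      rw [if_neg (mem_filter.1 hω).2, zero_mul]]
  simp [hE']

end Uniform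

section Graph

variable {V W : Type*} [AddCommGroup V] [AddCommGroup W] [Fintype V] [Fintype W]

lemma Hent_le_log_card_of_fst {Ω : Type*} [Fintype Ω] {w : Ω → ℝ} (hw : IsProb w) (X : Ω → V × W)
    (F : V → W) (h : ∀ ω, w ω ≠ 0 → (X ω).2 = F (X ω).1) :
    Hent w X ≤ Real.log (Fintype.card V) := by
  have := Hent_le_log_card hw X (univ.image fun x => (x, F x)) fun ω hω =>
    mem_image.2 ⟨(X ω).1, mem_univ _, Prod.ext rfl (h ω hω).symm⟩
  rwa [card_image_of_injective _ fun x y h => (Prod.mk.inj h).1, card_univ] at this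

/-- Additive structure on a dense set of pairs gives a dense law supported on a graph with small
doubling. -/
lemma exists_law_of_dense_pairs {E : Finset (V × V)} {S : Finset V} {F₁ F₂ F₃ : V → W} {γ : ℝ}
    (hγ : 0 < γ) (hS : ∀ e ∈ E, e.1 ∈ S)
    (hE : γ * (Fintype.card V : ℝ) ^ 2 ≤ E.card)
    (h : ∀ e ∈ E, F₁ e.1 + F₂ e.2 = F₃ (e.1 + e.2)) :
    ∃ ν ρ : V × W → ℝ, IsProb ν ∧ IsProb ρ ∧ rdist ν ρ ≤ 4 * -Real.log γ ∧
      Real.log (Fintype.card V) - 4 * -Real.log γ ≤ hent ν ∧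
      ∀ g, ν g ≠ 0 → g.1 ∈ S ∧ g.2 = F₁ g.1 := by
  set N : ℝ := (Fintype.card V : ℝ) with hN
  have hN0 : 0 < N := by
    rw [hN]
    exact_mod_cast Fintype.card_pos
  have hEc : (0 : ℝ) < E.card := lt_of_lt_of_le (by positivity) hE
  have hEn : E.Nonempty := card_pos.1 (by exact_mod_cast hEc)
  set w := unifW E with hw'
  have hw : IsProb w := isProb_unifW hEn
  let A : V × V → V × W := fun e => (e.1, F₁ e.1)
  let B : V × V → V × W := fun e => (e.2, F₂ e.2)
  let Z : V × V → (V × W) × Unit := fun e => (A e + B e, ())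
  have hbsg := sum_rdist_fibre_le hw A B fun _ => ()
  have hAB : Hent w (fun e => (A e, B e)) = Real.log E.card :=
    Hent_unifW hEn fun e e' h => by
      simp only [A, B, Prod.mk.injEq] at h
      exact Prod.ext h.1.1 h.2.1
  have hA : Hent w A ≤ Real.log N := Hent_le_log_card_of_fst hw A F₁ fun _ _ => rfl
  have hB : Hent w B ≤ Real.log N := Hent_le_log_card_of_fst hw B F₂ fun _ _ => rfl
  have hZ : Hent w Z ≤ Real.log N := by
    have h1 : Hent w Z = Hent w (fun e => A e + B e) := Hent_congr hw fun e e' => by simp [Z]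
    rw [h1]
    exact Hent_le_log_card_of_fst hw _ F₃ fun e he => h e (unifW_ne_zero he)
  have hlogE : Real.log γ + 2 * Real.log N ≤ Real.log E.card := by
    rw [← Real.log_rpow hN0, ← Real.log_mul hγ.ne' (by positivity)]
    refine Real.log_le_log (by positivity) ?_
    exact_mod_cast hE
  have e1 : Hent w (fun e => (A e, ())) = Hent w A := Hent_congr hw fun e e' => by simp
  have e2 : Hent w (fun e => (B e, ())) = Hent w B := Hent_congr hw fun e e' => by simp
  have e3 : Hent w (fun e => ((A e, B e), ())) = Hent w (fun e => (A e, B e)) :=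
    Hent_congr hw fun e e' => by simp
  rw [e1, e2, e3, hAB, Hent_const hw ()] at hbsg
  have hcond := sum_mul_Hent_cw hw A Z
  have e4 : Hent w (fun e => (A e, Z e)) = Real.log E.card := by
    rw [← hAB]
    refine Hent_congr hw fun e e' => ?_
    simp only [Z, Prod.mk.injEq, and_true]
    exact and_congr_right fun h => by rw [h, add_right_inj]
  rw [e4] at hcond
  obtain ⟨e, he0, he⟩ : ∃ e, w e ≠ 0 ∧ rdist (pr (cw w Z e) A) (pr (cw w Z e) B) +
      (Real.log N - Hent (cw w Z e) A) ≤ 4 * -Real.log γ := by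
    by_contra! hcon
    have h1 : ∑ e, w e * (4 * -Real.log γ) < ∑ e, w e *
        (rdist (pr (cw w Z e) A) (pr (cw w Z e) B) + (Real.log N - Hent (cw w Z e) A)) := by
      obtain ⟨e₀, he₀⟩ := hEn
      have hpos : ∀ e, w e ≠ 0 → 0 < w e := fun e h => lt_of_le_of_ne (hw.nonneg e) h.symm
      refine sum_lt_sum (fun e _ => ?_) ⟨e₀, mem_univ _, ?_⟩
      · by_cases h0 : w e = 0
        · simp [h0]
        · exact mul_le_mul_of_nonneg_left (hcon e h0).le (hw.nonneg e)
      · have h0 : w e₀ ≠ 0 := by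
          simp only [hw', unifW, if_pos he₀]
          positivity
        exact mul_lt_mul_of_pos_left (hcon e₀ h0) (hpos e₀ h0)
    rw [← sum_mul, hw.sum_one, one_mul] at h1
    simp_rw [mul_add, mul_sub, sum_add_distrib, sum_sub_distrib] at h1
    rw [hcond, ← sum_mul, hw.sum_one, one_mul] at h1
    change ∑ e, w e * rdist (pr (cw w Z e) A) (pr (cw w Z e) B) ≤ _ - 3 * _ + 2 * Hent w Z at hbsg
    linarith
  have hc := isProb_cw hw Z (lt_of_le_of_ne (hw.nonneg e) (Ne.symm he0))
  have hd := rdist_nonneg (isProb_pr hc A) (isProb_pr hc B)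
  have hAe : Hent (cw w Z e) A ≤ Real.log N := Hent_le_log_card_of_fst hc A F₁ fun _ _ => rfl
  refine ⟨pr (cw w Z e) A, pr (cw w Z e) B, isProb_pr hc A, isProb_pr hc B, by linarith, ?_, ?_⟩
  · have : hent (pr (cw w Z e) A) = Hent (cw w Z e) A := Hent_pr A id
    rw [this]
    linarith
  · intro g hg
    obtain ⟨e', -, he'⟩ := exists_ne_zero_of_sum_ne_zero hg
    have h2 : A e' = g := by
      by_contra hne
      exact he' (if_neg hne)
    rw [if_pos h2] at he'
    have h3 : w e' ≠ 0 := fun h0 => he' (by simp [cw, h0])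
    rw [← h2]
    exact ⟨hS e' (unifW_ne_zero h3), rfl⟩

variable {p : ℕ} [Fact p.Prime] [Module (ZMod p) V] [Module (ZMod p) W]

/-- A law with small entropy in a quotient charges some coset substantially. -/
lemma exists_coset_card {G : Type*} [AddCommGroup G] [Fintype G] [Module (ZMod p) G] {ν : G → ℝ}
    (hν : IsProb ν) (H : Submodule (ZMod p) G) (Γ : Finset G) (hΓ : ∀ g, ν g ≠ 0 → g ∈ Γ) :
    ∃ g₀ ∈ Γ, hent ν - Hent ν H.mkQ ≤ Real.log (Γ.filter fun g => g - g₀ ∈ H).card := by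
  have h1 := sum_mul_Hent_cw hν id H.mkQ
  have h2 : Hent ν (fun g => (id g, H.mkQ g)) = hent ν := Hent_congr hν fun g g' => by
    simp only [id, Prod.mk.injEq]
    exact ⟨fun h => h.1, fun h => ⟨h, by rw [h]⟩⟩
  rw [h2] at h1
  by_contra! hcon
  have hb : ∀ g, ν g ≠ 0 → Hent (cw ν H.mkQ g) id < hent ν - Hent ν H.mkQ := by
    intro g hg
    refine lt_of_le_of_lt ?_ (hcon g (hΓ g hg))
    refine Hent_le_log_card (isProb_cw hν _ (lt_of_le_of_ne (hν.nonneg g) hg.symm)) id _ ?_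
    intro x hx
    unfold cw at hx
    have hxg : H.mkQ x = H.mkQ g := by
      by_contra h
      exact hx (if_neg h)
    rw [if_pos hxg] at hx
    have hx0 : ν x ≠ 0 := fun h => hx (by rw [h, zero_div])
    exact mem_filter.2 ⟨hΓ x hx0, (Submodule.Quotient.eq H).1 hxg⟩
  obtain ⟨g₁, hg₁⟩ := exists_ne_zero hν
  have h3 : ∑ g, ν g * Hent (cw ν H.mkQ g) id < ∑ g, ν g * (hent ν - Hent ν H.mkQ) := by
    refine sum_lt_sum (fun g _ => ?_) ⟨g₁, mem_univ _, ?_⟩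
    · by_cases h0 : ν g = 0
      · simp [h0]
      · exact mul_le_mul_of_nonneg_left (hb g h0).le (hν.nonneg g)
    · exact mul_lt_mul_of_pos_left (hb g₁ hg₁) (lt_of_le_of_ne (hν.nonneg _) hg₁.symm)
  rw [h1, ← sum_mul, hν.sum_one, one_mul] at h3
  exact lt_irrefl _ h3

/-- If a subspace of `V × W` of size not much larger than `V` has a coset containing many points of
a graph, then the graph agrees with an affine map on many points. -/
lemma exists_affine_of_coset (H : Submodule (ZMod p) (V × W)) (S : Finset V) (F : V → W)
    (g₀ : V × W)
    {κ M : ℝ}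
    (hκ : 0 < κ) (hM : 0 < M)
    (h1 : κ * Fintype.card V ≤ (S.filter fun x => (x, F x) - g₀ ∈ H).card)
    (h2 : (Nat.card H : ℝ) ≤ M * Fintype.card V) :
    ∃ (T : V →ₗ[ZMod p] W) (c : W),
      κ ^ 2 / M * Fintype.card V ≤ (S.filter fun x => F x = T x + c).card := by
  set N : ℝ := (Fintype.card V : ℝ) with hN
  have hN0 : 0 < N := by
    rw [hN]
    exact_mod_cast Fintype.card_pos
  let π₁ : H →ₗ[ZMod p] V := (LinearMap.fst (ZMod p) V W).comp H.subtype
  obtain ⟨s, hs⟩ := π₁.rangeRestrict.exists_rightInverse_of_surjective π₁.range_rangeRestrict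
  obtain ⟨s', hs'⟩ := LinearMap.exists_extend s
  let T : V →ₗ[ZMod p] W := (LinearMap.snd (ZMod p) V W).comp (H.subtype.comp s')
  have hT : ∀ g ∈ H, ((g.1, T g.1) : V × W) ∈ H := by
    intro g hg
    let y : LinearMap.range π₁ := ⟨g.1, ⟨⟨g, hg⟩, rfl⟩⟩
    have e1 : s' g.1 = s y := LinearMap.congr_fun hs' y
    have e2 : ((s y : H) : V × W).1 = g.1 :=
      congrArg Subtype.val (LinearMap.congr_fun hs y)
    have e3 : ((g.1, T g.1) : V × W) = (s y : H) := by
      refine Prod.ext e2.symm ?_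
      simp only [T, LinearMap.comp_apply, e1]
      rfl
    rw [e3]
    exact (s y).2
  let K : Submodule (ZMod p) W := H.comap (LinearMap.inr (ZMod p) V W)
  set X := S.filter fun x => (x, F x) - g₀ ∈ H with hX
  have hmem : ∀ x ∈ X, F x - g₀.2 - T (x - g₀.1) ∈ K := by
    intro x hx
    have h3 := (mem_filter.1 hx).2
    have h4 := H.sub_mem h3 (hT _ h3)
    change ((0 : V), F x - g₀.2 - T (x - g₀.1)) ∈ H
    convert h4 using 1
    exact Prod.ext (by simp) (by simp)
  -- the size of the vertical fibre
  have hcard : X.card * Nat.card K ≤ Nat.card H := by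
    rw [Nat.card_eq_fintype_card, Nat.card_eq_fintype_card, ← Fintype.card_coe X,
      ← Fintype.card_prod]
    refine Fintype.card_le_of_injective (fun t : X × K =>
      (⟨((t.1 : V) - g₀.1, T ((t.1 : V) - g₀.1) + t.2), ?_⟩ : H)) ?_
    · have h3 := hT _ (mem_filter.1 t.1.2).2
      have h4 : ((0 : V), (t.2 : W)) ∈ H := t.2.2
      have := H.add_mem h3 h4
      simpa using this
    · intro t t' h
      have h3 := Prod.mk.inj (Subtype.mk.inj h)
      have h4 : (t.1 : V) = t'.1 := sub_left_injective h3.1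
      have h5 := h3.2
      rw [h4] at h5
      exact Prod.ext (Subtype.ext h4) (Subtype.ext (add_left_cancel h5))
  have hKpos : (0 : ℝ) < Nat.card K := by exact_mod_cast Nat.card_pos
  have hXpos : (0 : ℝ) < X.card := lt_of_lt_of_le (by positivity) h1
  -- pigeonhole over the fibre
  obtain ⟨k, -, hk⟩ := exists_le_card_fiber_of_nsmul_le_card_of_maps_to (s := X)
    (t := univ.filter fun k => k ∈ K) (f := fun x => F x - g₀.2 - T (x - g₀.1))
    (b := (X.card : ℝ) / Nat.card K) (fun x hx => mem_filter.2 ⟨mem_univ _, hmem x hx⟩)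
    ⟨0, by simp⟩ (by
      rw [nsmul_eq_mul, show (univ.filter fun k => k ∈ K).card = Nat.card K by
        rw [Nat.card_eq_fintype_card, Fintype.card_subtype], mul_div_cancel₀ _ hKpos.ne'])
  refine ⟨T, k + g₀.2 - T g₀.1, ?_⟩
  have hsub : (X.filter fun x => F x - g₀.2 - T (x - g₀.1) = k) ⊆
      S.filter fun x => F x = T x + (k + g₀.2 - T g₀.1) := by
    intro x hx
    have := (mem_filter.1 hx).2
    refine mem_filter.2 ⟨(mem_filter.1 (mem_filter.1 hx).1).1, ?_⟩
    rw [← this, map_sub]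
    abel
  have h5 : ((X.filter fun x => F x - g₀.2 - T (x - g₀.1) = k).card : ℝ) ≤
      (S.filter fun x => F x = T x + (k + g₀.2 - T g₀.1)).card := by
    exact_mod_cast card_le_card hsub
  refine le_trans ?_ (hk.trans h5)
  have h6 : (X.card : ℝ) * Nat.card K ≤ M * N := le_trans (by exact_mod_cast hcard) h2
  rw [div_mul_eq_mul_div, div_le_div_iff₀ hM hKpos]
  have h7 : κ * N * Nat.card K ≤ M * N := (mul_le_mul_of_nonneg_right h1 hKpos.le).trans h6
  have h8 : κ * Nat.card K ≤ M := by
    have : N * (κ * Nat.card K) ≤ N * M := by linarith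
    exact le_of_mul_le_mul_left this hN0
  calc κ ^ 2 * N * Nat.card K = (κ * N) * (κ * Nat.card K) := by ring
    _ ≤ X.card * M := mul_le_mul h1 h8 (by positivity) hXpos.le

/-- The exponent in `exists_affine_of_dense_pairs`. -/
noncomputable def affExp (p : ℕ) : ℕ := 12 * ⌈pfrConst p⌉₊ + 8

/-- A relation `F₁ x + F₂ y = F₃ (x + y)` on a dense set of pairs forces `F₁` to agree with an
affine map on a dense set of points, with polynomial bounds. -/
theorem exists_affine_of_dense_pairs {E : Finset (V × V)} {S : Finset V} {F₁ F₂ F₃ : V → W}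
    {γ : ℝ} (hγ : 0 < γ) (hS : ∀ e ∈ E, e.1 ∈ S)
    (hE : γ * (Fintype.card V : ℝ) ^ 2 ≤ E.card)
    (h : ∀ e ∈ E, F₁ e.1 + F₂ e.2 = F₃ (e.1 + e.2)) :
    ∃ (T : V →ₗ[ZMod p] W) (c : W),
      γ ^ affExp p * Fintype.card V ≤ (S.filter fun x => F₁ x = T x + c).card := by
  obtain ⟨ν, ρ, hν, hρ, hd, hH, hsupp⟩ := exists_law_of_dense_pairs hγ hS hE h
  obtain ⟨H, hH1, hH2⟩ := entropic_marton (p := p) hν hρ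
  set N : ℝ := (Fintype.card V : ℝ) with hN
  have hN0 : 0 < N := by
    rw [hN]
    exact_mod_cast Fintype.card_pos
  set C := ⌈pfrConst p⌉₊
  have hC : pfrConst p ≤ C := Nat.le_ceil _
  have hd0 := rdist_nonneg hν hρ
  have hCd : pfrConst p * rdist ν ρ ≤ C * (4 * -Real.log γ) :=
    mul_le_mul hC hd hd0 (by positivity)
  have hνle : hent ν ≤ Real.log N := Hent_le_log_card_of_fst hν id F₁ fun g hg => (hsupp g hg).2
  let Γ : Finset (V × W) := S.image fun x => (x, F₁ x)
  obtain ⟨g₀, hg₀Γ, hg₀⟩ := exists_coset_card (p := p) hν H Γ fun g hg =>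
    mem_image.2 ⟨g.1, (hsupp g hg).1, Prod.ext rfl (hsupp g hg).2.symm⟩
  have hcard : (Γ.filter fun g => g - g₀ ∈ H).card =
      (S.filter fun x => (x, F₁ x) - g₀ ∈ H).card := by
    rw [filter_image, card_image_of_injective _ fun x y h => (Prod.mk.inj h).1]
  rw [hcard] at hg₀
  set X := S.filter fun x => (x, F₁ x) - g₀ ∈ H with hX
  have hlog : ∀ (a : ℕ), Real.log (γ ^ a * N) = a * Real.log γ + Real.log N := fun a => by
    rw [Real.log_mul (by positivity) hN0.ne', Real.log_pow]
  have hXpos : (0 : ℝ) < X.card := by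
    obtain ⟨x, hxS, hx⟩ := mem_image.1 hg₀Γ
    have : x ∈ X := mem_filter.2 ⟨hxS, by rw [hx, sub_self]; exact H.zero_mem⟩
    exact_mod_cast card_pos.2 ⟨x, this⟩
  have h1 : γ ^ (4 * C + 4) * N ≤ X.card := by
    rw [← Real.log_le_log_iff (by positivity) hXpos, hlog]
    push_cast
    linarith
  have hHpos : (0 : ℝ) < Nat.card H := by exact_mod_cast Nat.card_pos
  have h2 : (Nat.card H : ℝ) ≤ (γ ^ (4 * C))⁻¹ * N := by
    rw [← Real.log_le_log_iff hHpos (by positivity), Real.log_mul (by positivity) hN0.ne',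
      Real.log_inv, Real.log_pow]
    push_cast
    linarith
  obtain ⟨T, c, hT⟩ := exists_affine_of_coset H S F₁ g₀ (by positivity) (by positivity) h1 h2
  refine ⟨T, c, le_trans (le_of_eq ?_) hT⟩
  rw [affExp, div_inv_eq_mul, ← pow_mul, ← pow_add]
  congr 2
  ring

end Graph

section Character

variable {p : ℕ} [Fact p.Prime]

/-- The standard additive character of `ZMod p`. -/
noncomputable def ec (a : ZMod p) : ℂ := ZMod.stdAddChar a

lemma ec_add (a b : ZMod p) : ec (a + b) = ec a * ec b := AddChar.map_add_eq_mul _ _ _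

@[simp] lemma ec_zero : ec (0 : ZMod p) = 1 := AddChar.map_zero_eq_one _

@[simp] lemma norm_ec (a : ZMod p) : ‖ec a‖ = 1 := Circle.norm_coe _

lemma conj_ec (a : ZMod p) : (starRingEnd ℂ) (ec a) = ec (-a) := by
  rw [ec, ec, AddChar.map_neg_eq_inv, ZMod.stdAddChar_apply, ← Circle.coe_inv,
    Circle.coe_inv_eq_conj]

lemma ec_sub (a b : ZMod p) : ec (a - b) = ec a * (starRingEnd ℂ) (ec b) := by
  rw [conj_ec, sub_eq_add_neg, ec_add]

lemma ec_ne_one {a : ZMod p} (ha : a ≠ 0) : ec a ≠ 1 := fun h =>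
  ha (ZMod.injective_stdAddChar (h.trans (AddChar.map_zero_eq_one _).symm))

end Character

section Fourier

variable {p : ℕ} [Fact p.Prime] {V : Type*} [AddCommGroup V] [Module (ZMod p) V] [Fintype V]

lemma sum_ec_apply (ξ : V →ₗ[ZMod p] ZMod p) :
    ∑ x, ec (ξ x) = if ξ = 0 then (Fintype.card V : ℂ) else 0 := by
  split_ifs with h
  · simp [h]
  · obtain ⟨y, hy⟩ : ∃ y, ξ y ≠ 0 := by
      by_contra! hcon
      exact h (LinearMap.ext hcon)
    have h1 : ∑ x, ec (ξ x) = ec (ξ y) * ∑ x, ec (ξ x) := by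
      rw [mul_sum, ← Equiv.sum_comp (Equiv.addLeft y)]
      simp [ec_add]
    have h2 : (1 - ec (ξ y)) * ∑ x, ec (ξ x) = 0 := by
      rw [sub_mul, one_mul, ← h1, sub_self]
    exact (mul_eq_zero.1 h2).resolve_left (sub_ne_zero.2 (ec_ne_one hy).symm)

variable [Fintype (Module.Dual (ZMod p) V)]

lemma card_dual : Fintype.card (Module.Dual (ZMod p) V) = Fintype.card V := by
  rw [Module.card_eq_pow_finrank (K := ZMod p) (V := V),
    Module.card_eq_pow_finrank (K := ZMod p) (V := Module.Dual (ZMod p) V),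
    Subspace.dual_finrank_eq]

lemma sum_dual_ec (x : V) :
    ∑ ξ : Module.Dual (ZMod p) V, ec (ξ x) = if x = 0 then (Fintype.card V : ℂ) else 0 := by
  have h := sum_ec_apply (Module.Dual.eval (ZMod p) V x)
  rw [card_dual] at h
  simp only [Module.Dual.eval_apply] at h
  rw [h]
  congr 1
  rw [eq_iff_iff]
  rw [LinearMap.ext_iff]
  exact Module.forall_dual_apply_eq_zero_iff (ZMod p) x

/-- The unnormalised Fourier transform. -/
noncomputable def ft (g : V → ℂ) (ξ : Module.Dual (ZMod p) V) : ℂ := ∑ x, g x * ec (ξ x)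

/-- The complex-valued indicator function of a finset. -/
noncomputable def indC (R : Finset V) : V → ℂ := fun x => if x ∈ R then 1 else 0

lemma ofReal_normSq_sum {ι : Type*} [Fintype ι] (a : ι → ℂ) :
    ((‖∑ i, a i‖ ^ 2 : ℝ) : ℂ) = ∑ i, ∑ j, a i * (starRingEnd ℂ) (a j) := by
  rw [Complex.ofReal_pow, ← Complex.mul_conj', map_sum, sum_mul_sum]

/-- Parseval's identity. -/
lemma sum_norm_ft_sq (g : V → ℂ) :
    ∑ ξ : Module.Dual (ZMod p) V, ‖ft g ξ‖ ^ 2 = Fintype.card V * ∑ x, ‖g x‖ ^ 2 := by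
  have h : ((∑ ξ : Module.Dual (ZMod p) V, ‖ft g ξ‖ ^ 2 : ℝ) : ℂ) =
      ((Fintype.card V * ∑ x, ‖g x‖ ^ 2 : ℝ) : ℂ) := by
    rw [Complex.ofReal_sum]
    simp_rw [ft, ofReal_normSq_sum]
    rw [sum_comm]
    push_cast
    rw [mul_sum]
    refine sum_congr rfl fun x _ => ?_
    rw [sum_comm]
    have h1 : ∀ y, ∑ ξ : Module.Dual (ZMod p) V,
        g x * ec (ξ x) * (starRingEnd ℂ) (g y * ec (ξ y)) =
        if x = y then g x * (starRingEnd ℂ) (g y) * (Fintype.card V : ℂ) else 0 := by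
      intro y
      have h2 : ∀ ξ : Module.Dual (ZMod p) V,
          g x * ec (ξ x) * (starRingEnd ℂ) (g y * ec (ξ y)) =
            g x * (starRingEnd ℂ) (g y) * ec (ξ (x - y)) := fun ξ => by
        rw [map_sub, ec_sub, map_mul]
        ring
      simp_rw [h2, ← mul_sum, sum_dual_ec, sub_eq_zero, mul_ite, mul_zero]
    simp_rw [h1, sum_ite_eq, mem_univ, if_true]
    rw [Complex.mul_conj']
    ring
  exact_mod_cast h

/-- The Fourier transform of a correlation. -/
lemma ft_corr (g₁ g₂ : V → ℂ) (ξ : Module.Dual (ZMod p) V) :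
    ft (fun u => ∑ x, g₁ x * g₂ (x + u)) ξ = ft g₁ (-ξ) * ft g₂ ξ := by
  simp_rw [ft, sum_mul]
  rw [sum_comm]
  refine sum_congr rfl fun x _ => ?_
  rw [mul_sum, ← Equiv.sum_comp (Equiv.addLeft x) (fun y => g₁ x * ec ((-ξ) x) * (g₂ y * ec (ξ y)))]
  refine sum_congr rfl fun u _ => ?_
  simp only [Equiv.coe_addLeft, LinearMap.neg_apply, map_add, ec_add]
  have : ec (-ξ x) * ec (ξ x) = 1 := by rw [← ec_add, neg_add_cancel, ec_zero]
  linear_combination (-(g₁ x * g₂ (x + u) * ec (ξ u))) * this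

lemma sum_norm_corr_sq (g₁ g₂ : V → ℂ) :
    Fintype.card V * ∑ u, ‖∑ x, g₁ x * g₂ (x + u)‖ ^ 2 =
      ∑ ξ : Module.Dual (ZMod p) V, ‖ft g₁ (-ξ)‖ ^ 2 * ‖ft g₂ ξ‖ ^ 2 := by
  rw [← sum_norm_ft_sq (p := p)]
  simp_rw [ft_corr, norm_mul, mul_pow]

lemma norm_ft_le (R : Finset V) {g : V → ℂ} (hg : ∀ x, ‖g x‖ ≤ if x ∈ R then 1 else 0)
    (ξ : Module.Dual (ZMod p) V) : ‖ft g ξ‖ ≤ R.card := by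
  refine (norm_sum_le _ _).trans ?_
  simp_rw [norm_mul, norm_ec, mul_one]
  refine (sum_le_sum fun x _ => hg x).trans ?_
  simp

/-- The fourth moment of the Fourier transform of a function supported on `R`, in terms of the
Fourier transform of the indicator function of `R`. -/
lemma sum_norm_ft_pow_four_sq_le (R : Finset V) {g : V → ℂ}
    (hg : ∀ x, ‖g x‖ ≤ if x ∈ R then 1 else 0) :
    (∑ ξ : Module.Dual (ZMod p) V, ‖ft g ξ‖ ^ 4) ^ 2 ≤ R.card *
      ∑ ξ : Module.Dual (ZMod p) V, ∑ ξ' : Module.Dual (ZMod p) V,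
        ‖ft g ξ‖ ^ 3 * ‖ft g ξ'‖ ^ 3 * ‖ft (indC R) (ξ - ξ')‖ := by
  set d : Module.Dual (ZMod p) V → ℂ := fun ξ => ‖ft g ξ‖ ^ 2 * (starRingEnd ℂ) (ft g ξ) with hd
  have hdn : ∀ ξ, ‖d ξ‖ = ‖ft g ξ‖ ^ 3 := fun ξ => by
    simp only [hd, norm_mul, norm_pow, Complex.norm_real, norm_norm, RCLike.norm_conj]
    ring
  set D : V → ℂ := fun x => ∑ ξ, d ξ * ec (ξ x) with hD
  have h1 : ((∑ ξ : Module.Dual (ZMod p) V, ‖ft g ξ‖ ^ 4 : ℝ) : ℂ) = ∑ x, g x * D x := by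
    push_cast
    simp_rw [hD, mul_sum]
    rw [sum_comm]
    refine sum_congr rfl fun ξ _ => ?_
    have : ∑ x, g x * (d ξ * ec (ξ x)) = d ξ * ft g ξ := by
      rw [ft, mul_sum]
      exact sum_congr rfl fun x _ => by ring
    rw [this, hd]
    have h2 : ft g ξ * (starRingEnd ℂ) (ft g ξ) = (‖ft g ξ‖ : ℂ) ^ 2 := Complex.mul_conj' _
    linear_combination (-(‖ft g ξ‖ : ℂ) ^ 2) * h2
  have h2 : ∑ ξ : Module.Dual (ZMod p) V, ‖ft g ξ‖ ^ 4 ≤ ∑ x ∈ R, ‖D x‖ := by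
    have h3 : ‖((∑ ξ : Module.Dual (ZMod p) V, ‖ft g ξ‖ ^ 4 : ℝ) : ℂ)‖ =
        ∑ ξ : Module.Dual (ZMod p) V, ‖ft g ξ‖ ^ 4 := by
      rw [Complex.norm_real, Real.norm_of_nonneg (by positivity)]
    rw [← h3, h1]
    refine (norm_sum_le _ _).trans ?_
    rw [← sum_filter_add_sum_filter_not univ (· ∈ R)]
    rw [sum_eq_zero (s := filter (fun x => x ∉ R) univ) fun x hx => ?_, add_zero,
      filter_mem_eq_inter, univ_inter]
    · refine sum_le_sum fun x hx => ?_
      have := hg x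
      rw [if_pos hx] at this
      rw [norm_mul]
      exact mul_le_of_le_one_left (norm_nonneg _) this
    · have := hg x
      rw [if_neg (mem_filter.1 hx).2] at this
      rw [norm_mul, le_antisymm this (norm_nonneg _), zero_mul]
  have h3 : (∑ x ∈ R, ‖D x‖) ^ 2 ≤ R.card * ∑ x ∈ R, ‖D x‖ ^ 2 := sq_sum_le_card_mul_sum_sq
  have h4 : ((∑ x ∈ R, ‖D x‖ ^ 2 : ℝ) : ℂ) =
      ∑ ξ, ∑ ξ', d ξ * (starRingEnd ℂ) (d ξ') * ft (indC R) (ξ - ξ') := by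
    push_cast
    have h5 : ∀ x, ((‖D x‖ : ℂ) ^ 2) =
        ∑ ξ, ∑ ξ', d ξ * (starRingEnd ℂ) (d ξ') * ec ((ξ - ξ') x) := by
      intro x
      rw [← Complex.ofReal_pow, hD, ofReal_normSq_sum]
      refine sum_congr rfl fun ξ _ => sum_congr rfl fun ξ' _ => ?_
      rw [LinearMap.sub_apply, ec_sub, map_mul]
      ring
    simp_rw [h5]
    rw [sum_comm]
    refine sum_congr rfl fun ξ _ => ?_
    rw [sum_comm]
    refine sum_congr rfl fun ξ' _ => ?_
    rw [← mul_sum, ft]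
    congr 1
    simp [indC]
  have h5 : ∑ x ∈ R, ‖D x‖ ^ 2 ≤ ∑ ξ : Module.Dual (ZMod p) V, ∑ ξ' : Module.Dual (ZMod p) V,
        ‖ft g ξ‖ ^ 3 * ‖ft g ξ'‖ ^ 3 * ‖ft (indC R) (ξ - ξ')‖ := by
    have h6 : ‖((∑ x ∈ R, ‖D x‖ ^ 2 : ℝ) : ℂ)‖ = ∑ x ∈ R, ‖D x‖ ^ 2 := by
      rw [Complex.norm_real, Real.norm_of_nonneg (by positivity)]
    rw [← h6, h4]
    refine (norm_sum_le _ _).trans (sum_le_sum fun ξ _ => (norm_sum_le _ _).trans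
      (le_of_eq (sum_congr rfl fun ξ' _ => ?_)))
    rw [norm_mul, norm_mul, RCLike.norm_conj, hdn, hdn]
  calc _ ≤ (∑ x ∈ R, ‖D x‖) ^ 2 := pow_le_pow_left₀ (by positivity) h2 2
    _ ≤ _ := h3.trans (mul_le_mul_of_nonneg_left h5 (by positivity))

/-- If the Fourier transform of the indicator function of `R` is essentially supported on a
subspace, then a bounded function on `R` whose Fourier transform is pointwise small has small fourth
moment. -/
lemma sum_norm_ft_pow_four_le (R : Finset V) (U : Submodule (ZMod p) (Module.Dual (ZMod p) V))
    {r e m : ℝ} (hr : 0 ≤ r) (he : 0 ≤ e)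
    (hR : ∀ ζ : Module.Dual (ZMod p) V,
      ‖ft (indC R) ζ‖ ≤ r * (if ζ ∈ U then 1 else 0) + e * Fintype.card V)
    {g : V → ℂ} (hg : ∀ x, ‖g x‖ ≤ if x ∈ R then 1 else 0)
    (hm : ∀ ξ : Module.Dual (ZMod p) V, ‖ft g ξ‖ ^ 2 ≤ m) :
    (∑ ξ : Module.Dual (ZMod p) V, ‖ft g ξ‖ ^ 4) ^ 2 ≤
      R.card * (r * Nat.card U * m * ∑ ξ : Module.Dual (ZMod p) V, ‖ft g ξ‖ ^ 4 +
        e * (Fintype.card V : ℝ) ^ 7) := by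
  set N : ℝ := (Fintype.card V : ℝ) with hN
  refine (sum_norm_ft_pow_four_sq_le R hg).trans (mul_le_mul_of_nonneg_left ?_ (by positivity))
  set a : Module.Dual (ZMod p) V → ℝ := fun ξ => ‖ft g ξ‖ with ha
  have ha0 : ∀ ξ, 0 ≤ a ξ := fun ξ => norm_nonneg _
  have haN : ∀ ξ, a ξ ≤ N := fun ξ => (norm_ft_le R hg ξ).trans (by
    rw [hN]
    exact_mod_cast card_le_univ R)
  have hcube : ∑ ξ, a ξ ^ 3 ≤ N ^ 3 := by
    have h1 : ∑ ξ, a ξ ^ 2 ≤ N ^ 2 := by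
      rw [ha, sum_norm_ft_sq (p := p), ← hN, sq]
      refine mul_le_mul_of_nonneg_left ?_ (by positivity)
      rw [hN, ← card_univ, card_eq_sum_ones]
      push_cast
      refine sum_le_sum fun x _ => ?_
      refine pow_le_one₀ (norm_nonneg _) ((hg x).trans ?_)
      split_ifs <;> norm_num
    calc ∑ ξ, a ξ ^ 3 ≤ ∑ ξ, N * a ξ ^ 2 := sum_le_sum fun ξ _ => by
          nlinarith [haN ξ, sq_nonneg (a ξ)]
      _ ≤ N * N ^ 2 := by
          rw [← mul_sum]
          exact mul_le_mul_of_nonneg_left h1 (by positivity)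
      _ = N ^ 3 := by ring
  have hU : ∑ ξ, ∑ ξ', a ξ ^ 3 * a ξ' ^ 3 * (if ξ - ξ' ∈ U then (1 : ℝ) else 0) ≤
      Nat.card U * (m * ∑ ξ, a ξ ^ 4) := by
    have hcount : ∀ ξ, ∑ ξ', (if ξ - ξ' ∈ U then (1 : ℝ) else 0) = Nat.card U := by
      intro ξ
      rw [sum_boole, Nat.card_eq_fintype_card, Fintype.card_subtype]
      congr 1
      exact card_equiv (Equiv.subLeft ξ) fun ξ' => by simp
    have hcount' : ∀ ξ', ∑ ξ, (if ξ - ξ' ∈ U then (1 : ℝ) else 0) = Nat.card U := by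
      intro ξ'
      rw [sum_boole, Nat.card_eq_fintype_card, Fintype.card_subtype]
      congr 1
      exact card_equiv (Equiv.subRight ξ') fun ξ => by simp
    have h1 : ∑ ξ, ∑ ξ', a ξ ^ 3 * a ξ' ^ 3 * (if ξ - ξ' ∈ U then (1 : ℝ) else 0) ≤
        ∑ ξ, ∑ ξ', (a ξ ^ 6 / 2 * (if ξ - ξ' ∈ U then (1 : ℝ) else 0) +
          a ξ' ^ 6 / 2 * (if ξ - ξ' ∈ U then (1 : ℝ) else 0)) := by
      refine sum_le_sum fun ξ _ => sum_le_sum fun ξ' _ => ?_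
      rw [← add_mul]
      refine mul_le_mul_of_nonneg_right ?_ (by split_ifs <;> norm_num)
      nlinarith [sq_nonneg (a ξ ^ 3 - a ξ' ^ 3)]
    simp_rw [sum_add_distrib] at h1
    rw [sum_comm (f := fun ξ ξ' => a ξ' ^ 6 / 2 * (if ξ - ξ' ∈ U then (1 : ℝ) else 0))] at h1
    simp_rw [← mul_sum, hcount, hcount', ← sum_mul, ← sum_div] at h1
    have h2 : ∑ ξ, a ξ ^ 6 ≤ m * ∑ ξ, a ξ ^ 4 := by
      rw [mul_sum]
      refine sum_le_sum fun ξ _ => ?_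
      calc a ξ ^ 6 = a ξ ^ 2 * a ξ ^ 4 := by ring
        _ ≤ m * a ξ ^ 4 := mul_le_mul_of_nonneg_right (hm ξ) (by positivity)
    have h3 : (0 : ℝ) ≤ Nat.card U := by positivity
    nlinarith
  calc ∑ ξ, ∑ ξ', a ξ ^ 3 * a ξ' ^ 3 * ‖ft (indC R) (ξ - ξ')‖
      ≤ ∑ ξ, ∑ ξ', (r * (a ξ ^ 3 * a ξ' ^ 3 * (if ξ - ξ' ∈ U then (1 : ℝ) else 0)) +
          e * N * (a ξ ^ 3 * a ξ' ^ 3)) := by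
        refine sum_le_sum fun ξ _ => sum_le_sum fun ξ' _ => ?_
        have := mul_le_mul_of_nonneg_left (hR (ξ - ξ'))
          (show 0 ≤ a ξ ^ 3 * a ξ' ^ 3 from mul_nonneg (pow_nonneg (ha0 ξ) _)
            (pow_nonneg (ha0 ξ') _))
        linarith
    _ = r * ∑ ξ, ∑ ξ', a ξ ^ 3 * a ξ' ^ 3 * (if ξ - ξ' ∈ U then (1 : ℝ) else 0) +
          e * N * (∑ ξ, a ξ ^ 3) ^ 2 := by
        simp_rw [sum_add_distrib, ← mul_sum]
        rw [← sum_mul, ← sq]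
    _ ≤ r * (Nat.card U * (m * ∑ ξ, a ξ ^ 4)) + e * N * (N ^ 3) ^ 2 := by
        have h0 : 0 ≤ ∑ ξ, a ξ ^ 3 := sum_nonneg fun ξ _ => pow_nonneg (ha0 ξ) _
        gcongr
    _ = r * Nat.card U * m * ∑ ξ, a ξ ^ 4 + e * N ^ 7 := by ring

end Fourier

/-- A linear system of quadratic polynomials on `V`, parametrised by `Λ`. -/
structure QSys (p : ℕ) (V Λ : Type*) [Fact p.Prime] [AddCommGroup V] [Module (ZMod p) V]
    [AddCommGroup Λ] [Module (ZMod p) Λ] where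
  M : Λ →ₗ[ZMod p] V →ₗ[ZMod p] Module.Dual (ZMod p) V
  l : Λ →ₗ[ZMod p] Module.Dual (ZMod p) V
  c : Λ →ₗ[ZMod p] ZMod p
  symm : ∀ s x y, M s x y = M s y x

section GenericFamily

variable {Θ Θ' X X' D : Type*} [Fintype X] [Fintype X'] [AddCommGroup D]

/-- Every nontrivial member of the family takes each value rarely. -/
def IsGen [Zero Θ] (ε : ℝ) (U : Θ → X → D) : Prop :=
  ∀ s, s ≠ 0 → ∀ z, ((univ.filter fun t => U s t = z).card : ℝ) ≤ ε * Fintype.card X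

lemma IsGen.prod [Zero Θ] [Zero Θ'] {ε : ℝ} {U : Θ → X → D} {U' : Θ' → X' → D} (h : IsGen ε U)
    (h' : IsGen ε U') :
    IsGen ε fun (s : Θ × Θ') (t : X × X') => U s.1 t.1 + U' s.2 t.2 := by
  intro s hs z
  rw [← sum_boole, Fintype.sum_prod_type, Fintype.card_prod]
  by_cases h1 : s.1 = 0
  · have h2 : s.2 ≠ 0 := fun h2 => hs (Prod.ext h1 h2)
    calc _ ≤ ∑ _t : X, ε * Fintype.card X' := sum_le_sum fun t _ => by
          refine le_trans (le_of_eq ?_) (h' s.2 h2 (z - U s.1 t))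
          rw [sum_boole]
          simp only [eq_sub_iff_add_eq']
      _ = _ := by
          rw [sum_const, card_univ, nsmul_eq_mul]
          push_cast
          ring
  · rw [sum_comm]
    calc _ ≤ ∑ _t : X', ε * Fintype.card X := sum_le_sum fun t _ => by
          refine le_trans (le_of_eq ?_) (h s.1 h1 (z - U' s.2 t))
          rw [sum_boole]
          simp only [eq_sub_iff_add_eq]
      _ = _ := by
          rw [sum_const, card_univ, nsmul_eq_mul]
          push_cast
          ring

lemma IsGen.card_le [Zero Θ] [Fintype Θ] {ε : ℝ} {U : Θ → X → D} (h : IsGen ε U) (hε : 0 ≤ ε)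
    (z : Θ → D) :
    ((univ.filter fun t => ∃ s, s ≠ 0 ∧ U s t = z s).card : ℝ) ≤
      Fintype.card Θ * (ε * Fintype.card X) := by
  have h1 : (univ.filter fun t => ∃ s, s ≠ 0 ∧ U s t = z s) ⊆
      (univ.filter fun s : Θ => s ≠ 0).biUnion fun s => univ.filter fun t => U s t = z s := by
    intro t ht
    obtain ⟨s, hs, hst⟩ := (mem_filter.1 ht).2
    exact mem_biUnion.2 ⟨s, mem_filter.2 ⟨mem_univ _, hs⟩, mem_filter.2 ⟨mem_univ _, hst⟩⟩
  have h2 := (card_le_card h1).trans card_biUnion_le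
  have h3 : ((∑ s ∈ univ.filter fun s : Θ => s ≠ 0, (univ.filter fun t => U s t = z s).card : ℕ) :
      ℝ)
      ≤ ∑ _s : Θ, ε * Fintype.card X := by
    push_cast
    refine (sum_le_sum fun s hs => h s (mem_filter.1 hs).2 (z s)).trans ?_
    exact sum_le_sum_of_subset_of_nonneg (filter_subset _ _) fun _ _ _ => by positivity
  rw [sum_const, card_univ, nsmul_eq_mul] at h3
  exact le_trans (by exact_mod_cast h2) h3

end GenericFamily

namespace QSys

variable {p : ℕ} [Fact p.Prime] {V Λ : Type*} [AddCommGroup V] [Module (ZMod p) V] [Fintype V]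
  [AddCommGroup Λ] [Module (ZMod p) Λ] [Fintype Λ]

/-- The value at `x` of the polynomials of the system, as a linear form in the parameter. -/
noncomputable def valL (Q : QSys p V Λ) (x : V) : Λ →ₗ[ZMod p] ZMod p :=
  (2⁻¹ : ZMod p) • ((Q.M.flip x).flip x) + Q.l.flip x + Q.c

lemma valL_apply (Q : QSys p V Λ) (x : V) (s : Λ) :
    Q.valL x s = 2⁻¹ * Q.M s x x + Q.l s x + Q.c s := rfl

/-- The common zero set of the system. -/
noncomputable def zeros (Q : QSys p V Λ) : Finset V := univ.filter fun x => Q.valL x = 0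

lemma mem_zeros {Q : QSys p V Λ} {x : V} : x ∈ Q.zeros ↔ Q.valL x = 0 := by simp [zeros]

lemma valL_add (Q : QSys p V Λ) (h2 : (2 : ZMod p) ≠ 0) (x y : V) (s : Λ) :
    Q.valL (x + y) s = Q.valL x s + Q.valL y s - Q.c s + Q.M s x y := by
  simp only [valL_apply, map_add, LinearMap.add_apply, Q.symm s y x]
  field_simp
  ring

lemma valL_sub (Q : QSys p V Λ) (h2 : (2 : ZMod p) ≠ 0) (w x : V) (s : Λ) :
    Q.valL (w - x) s = Q.valL x s + (Q.valL w s - Q.c s) - (Q.M s w + (2 : ZMod p) • Q.l s) x := by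
  simp only [valL_apply, map_sub, LinearMap.sub_apply, LinearMap.add_apply, LinearMap.smul_apply,
    smul_eq_mul, Q.symm s x w]
  field_simp
  ring

/-- Every nontrivial member of the system has high rank. -/
def HighRank (Q : QSys p V Λ) (ε : ℝ) : Prop :=
  ∀ s, s ≠ 0 → ((univ.filter fun x => Q.M s x = 0).card : ℝ) ≤ ε * Fintype.card V

lemma HighRank.isGen {Q : QSys p V Λ} {ε : ℝ} (h : Q.HighRank ε) :
    IsGen ε fun s x => Q.M s x := by
  intro s hs z
  by_cases hz : ∃ x₀, Q.M s x₀ = z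
  · obtain ⟨x₀, rfl⟩ := hz
    refine le_trans (le_of_eq ?_) (h s hs)
    congr 1
    exact card_equiv (Equiv.subRight x₀) fun x => by simp [sub_eq_zero]
  · push Not at hz
    rw [filter_false_of_mem fun x _ => hz x, card_empty, Nat.cast_zero]
    exact le_trans (Nat.cast_nonneg _) (h s hs)

variable {Q : QSys p V Λ} {e : ℝ}

lemma norm_sum_ec_valL_le (h2 : (2 : ZMod p) ≠ 0) (he : 0 ≤ e) (hQ : Q.HighRank (e ^ 2)) {s : Λ}
    (hs : s ≠ 0) (ξ : Module.Dual (ZMod p) V) :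
    ‖∑ x, ec (Q.valL x s + ξ x)‖ ≤ e * Fintype.card V := by
  set N : ℝ := (Fintype.card V : ℝ) with hN
  have h1 : ((‖∑ x, ec (Q.valL x s + ξ x)‖ ^ 2 : ℝ) : ℂ) =
      ∑ h, ec (Q.valL h s - Q.c s + ξ h) * ∑ x, ec (Q.M s h x) := by
    rw [ofReal_normSq_sum, sum_comm]
    simp_rw [mul_sum]
    rw [sum_comm (f := fun h x => ec (Q.valL h s - Q.c s + ξ h) * ec (Q.M s h x))]
    refine sum_congr rfl fun x _ => ?_
    rw [← Equiv.sum_comp (Equiv.addLeft x)]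
    refine sum_congr rfl fun h _ => ?_
    rw [← ec_sub, ← ec_add, Equiv.coe_addLeft, Q.valL_add h2, map_add, Q.symm s x h]
    congr 1
    ring
  have h3 : ‖∑ x, ec (Q.valL x s + ξ x)‖ ^ 2 ≤ (e * N) ^ 2 := by
    have h4 : ‖((‖∑ x, ec (Q.valL x s + ξ x)‖ ^ 2 : ℝ) : ℂ)‖ =
        ‖∑ x, ec (Q.valL x s + ξ x)‖ ^ 2 := by
      rw [Complex.norm_real, Real.norm_of_nonneg (by positivity)]
    rw [← h4, h1]
    refine (norm_sum_le _ _).trans ?_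
    calc _ ≤ ∑ h, (if Q.M s h = 0 then 1 else 0) * N := sum_le_sum fun h _ => by
          rw [norm_mul, norm_ec, one_mul, sum_ec_apply]
          split_ifs <;> simp [hN]
      _ ≤ e ^ 2 * N * N := by
          rw [← sum_mul, sum_boole]
          exact mul_le_mul_of_nonneg_right (hQ s hs) (by positivity)
      _ = _ := by ring
  exact (pow_le_pow_iff_left₀ (norm_nonneg _) (by positivity) two_ne_zero).1 h3

lemma indC_zeros (Q : QSys p V Λ) (x : V) :
    indC Q.zeros x = (Fintype.card Λ : ℂ)⁻¹ * ∑ s, ec (Q.valL x s) := by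
  have h0 : (Fintype.card Λ : ℂ) ≠ 0 := by exact_mod_cast Fintype.card_ne_zero
  rw [sum_ec_apply, indC]
  simp only [mem_zeros]
  split_ifs <;> simp [h0]

lemma card_zeros_ge (h2 : (2 : ZMod p) ≠ 0) (he : 0 ≤ e) (hQ : Q.HighRank (e ^ 2)) :
    (Fintype.card V : ℝ) / Fintype.card Λ - e * Fintype.card V ≤ Q.zeros.card := by
  set N : ℝ := (Fintype.card V : ℝ) with hN
  have hL : (0 : ℝ) < Fintype.card Λ := by exact_mod_cast Fintype.card_pos
  have h1 : ((Q.zeros.card : ℝ) : ℂ) = (Fintype.card Λ : ℂ)⁻¹ * ∑ s, ∑ x, ec (Q.valL x s) := by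
    rw [sum_comm, mul_sum]
    simp_rw [← Q.indC_zeros]
    simp [indC]
  have h3 : ‖((Q.zeros.card : ℝ) : ℂ) - (Fintype.card Λ : ℂ)⁻¹ * N‖ ≤ e * N := by
    have h4 : ∑ x, ec (Q.valL x 0) = (N : ℂ) := by simp [hN]
    rw [h1, ← mul_sub, ← sum_erase_add _ _ (mem_univ (0 : Λ)), h4, add_sub_cancel_right, norm_mul,
      norm_inv, Complex.norm_natCast, inv_mul_le_iff₀ hL]
    refine (norm_sum_le _ _).trans ?_
    calc _ ≤ ∑ s ∈ univ.erase (0 : Λ), e * N := sum_le_sum fun s hs => by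
          simpa using norm_sum_ec_valL_le h2 he hQ (ne_of_mem_erase hs) 0
      _ ≤ Fintype.card Λ * (e * N) := by
          rw [sum_const, nsmul_eq_mul]
          refine mul_le_mul_of_nonneg_right ?_ (by positivity)
          exact_mod_cast card_le_univ _
  have h5 : ((Q.zeros.card : ℝ) : ℂ) - (Fintype.card Λ : ℂ)⁻¹ * N =
      (((Q.zeros.card : ℝ) - N / Fintype.card Λ : ℝ) : ℂ) := by
    push_cast
    ring
  rw [h5, Complex.norm_real] at h3
  linarith [(abs_le.1 h3).1]

/-- The points of the zero set satisfying a further system of affine equations. -/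
noncomputable def slice (Q : QSys p V Λ) {Θ : Type*} [AddCommGroup Θ] [Module (ZMod p) Θ]
    (u : Θ →ₗ[ZMod p] Module.Dual (ZMod p) V) (k : Θ →ₗ[ZMod p] ZMod p) : Finset V :=
  Q.zeros.filter fun x => u.flip x = k

variable [Fintype (Module.Dual (ZMod p) V)]

/-- The Fourier transform of a slice of the zero set is concentrated on the linear forms defining
the slice. -/
lemma norm_ft_slice_le (h2 : (2 : ZMod p) ≠ 0) (he : 0 ≤ e) (hQ : Q.HighRank (e ^ 2))
    {Θ : Type*} [AddCommGroup Θ] [Module (ZMod p) Θ] [Fintype Θ]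
    (u : Θ →ₗ[ZMod p] Module.Dual (ZMod p) V) (k : Θ →ₗ[ZMod p] ZMod p)
    (hu : Function.Injective u) (ζ : Module.Dual (ZMod p) V) :
    ‖ft (indC (Q.slice u k)) ζ‖ ≤
      Fintype.card V / (Fintype.card Λ * Fintype.card Θ) *
        (if ζ ∈ LinearMap.range u then 1 else 0) + e * Fintype.card V := by
  set N : ℝ := (Fintype.card V : ℝ) with hN
  have hL : (0 : ℝ) < Fintype.card Λ := by exact_mod_cast Fintype.card_pos
  have hT : (0 : ℝ) < Fintype.card Θ := by exact_mod_cast Fintype.card_pos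
  have hT' : (Fintype.card Θ : ℂ) ≠ 0 := by exact_mod_cast Fintype.card_ne_zero
  have h1 : ∀ x, indC (Q.slice u k) x =
      (Fintype.card Λ : ℂ)⁻¹ * (Fintype.card Θ : ℂ)⁻¹ *
        ∑ s, ∑ t, ec (-k t) * ec (Q.valL x s + u t x) := by
    intro x
    have h3 : indC (Q.slice u k) x =
        indC Q.zeros x * ((Fintype.card Θ : ℂ)⁻¹ * ∑ t, ec ((u.flip x - k) t)) := by
      rw [sum_ec_apply]
      simp only [indC, slice, mem_filter, sub_eq_zero]
      by_cases ha : x ∈ Q.zeros <;> by_cases hb : u.flip x = k <;> simp [ha, hb, hT']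
    rw [h3, indC_zeros, mul_mul_mul_comm, sum_mul_sum]
    congr 1
    refine sum_congr rfl fun s _ => sum_congr rfl fun t _ => ?_
    rw [LinearMap.sub_apply, LinearMap.flip_apply, ← ec_add, ← ec_add]
    congr 1
    ring
  have h3 : ft (indC (Q.slice u k)) ζ = (Fintype.card Λ : ℂ)⁻¹ * (Fintype.card Θ : ℂ)⁻¹ *
      ∑ s, ∑ t, ec (-k t) * ∑ x, ec (Q.valL x s + (u t + ζ) x) := by
    simp_rw [ft, h1, mul_assoc, sum_mul, ← mul_sum]
    congr 2
    rw [sum_comm]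
    refine sum_congr rfl fun s _ => ?_
    simp_rw [mul_sum]
    rw [sum_comm]
    refine sum_congr rfl fun t _ => sum_congr rfl fun x _ => ?_
    rw [mul_assoc, ← ec_add, LinearMap.add_apply, add_assoc]
  have h4 : ∀ s t, ‖ec (-k t) * ∑ x, ec (Q.valL x s + (u t + ζ) x)‖ ≤
      (if s = 0 then (if u t = -ζ then N else 0) else 0) + e * N := by
    intro s t
    rw [norm_mul, norm_ec, one_mul]
    split_ifs with hs ht
    · subst hs
      simp only [map_zero, zero_add, ht, neg_add_cancel, LinearMap.zero_apply, ec_zero, sum_const,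
        card_univ, nsmul_eq_mul, mul_one, Complex.norm_natCast]
      exact le_add_of_nonneg_right (by positivity)
    · subst hs
      simp only [map_zero, zero_add]
      rw [sum_ec_apply, if_neg fun h => ht (eq_neg_of_add_eq_zero_left h), norm_zero]
      positivity
    · rw [zero_add]
      exact norm_sum_ec_valL_le h2 he hQ hs _
  have h5 : ∑ t, (if u t = -ζ then N else 0) ≤
      N * (if ζ ∈ LinearMap.range u then 1 else 0) := by
    split_ifs with hζ
    · obtain ⟨t₀, ht₀⟩ := neg_mem hζ
      have : ∀ t, (if u t = -ζ then N else 0) = if t = t₀ then N else 0 := fun t => by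
        rw [← ht₀, hu.eq_iff]
      simp [this]
    · rw [sum_eq_zero fun t _ => if_neg fun h => hζ ?_, mul_zero]
      rw [← neg_neg ζ]
      exact neg_mem ⟨t, h⟩
  rw [h3, norm_mul, norm_mul, norm_inv, norm_inv, Complex.norm_natCast, Complex.norm_natCast,
    ← mul_inv, inv_mul_le_iff₀ (by positivity)]
  refine (norm_sum_le _ _).trans ((sum_le_sum fun s _ => (norm_sum_le _ _).trans
    (sum_le_sum fun t _ => h4 s t)).trans ?_)
  simp_rw [sum_add_distrib]
  have h6 : ∑ s : Λ, ∑ t, (if s = 0 then (if u t = -ζ then N else 0) else 0) =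
      ∑ t, (if u t = -ζ then N else 0) := by
    rw [sum_comm]
    simp
  rw [h6]
  simp only [sum_const, card_univ, nsmul_eq_mul]
  refine (add_le_add_left h5 _).trans (le_of_eq ?_)
  field_simp

lemma card_slice_le (h2 : (2 : ZMod p) ≠ 0) (he : 0 ≤ e) (hQ : Q.HighRank (e ^ 2))
    {Θ : Type*} [AddCommGroup Θ] [Module (ZMod p) Θ] [Fintype Θ]
    (u : Θ →ₗ[ZMod p] Module.Dual (ZMod p) V) (k : Θ →ₗ[ZMod p] ZMod p)
    (hu : Function.Injective u) :
    ((Q.slice u k).card : ℝ) ≤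
      Fintype.card V / (Fintype.card Λ * Fintype.card Θ) + e * Fintype.card V := by
  have h := norm_ft_slice_le h2 he hQ u k hu 0
  rw [if_pos (Submodule.zero_mem _), mul_one] at h
  refine le_trans (le_of_eq ?_) h
  simp [ft, indC]

lemma slice_zero (Q : QSys p V Λ) : Q.slice (0 : PUnit →ₗ[ZMod p] _) 0 = Q.zeros := by
  ext x
  simp only [slice, mem_filter, and_iff_left_iff_imp]
  exact fun _ => LinearMap.ext fun t => by simp

lemma norm_ft_zeros_le (h2 : (2 : ZMod p) ≠ 0) (he : 0 ≤ e) (hQ : Q.HighRank (e ^ 2))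
    (ζ : Module.Dual (ZMod p) V) :
    ‖ft (indC Q.zeros) ζ‖ ≤ Fintype.card V / Fintype.card Λ *
      (if ζ ∈ (⊥ : Submodule (ZMod p) (Module.Dual (ZMod p) V)) then 1 else 0) +
        e * Fintype.card V := by
  have h := norm_ft_slice_le h2 he hQ (0 : PUnit →ₗ[ZMod p] _) 0
    (Function.injective_of_subsingleton _) ζ
  rw [slice_zero] at h
  simpa using h

lemma card_zeros_le (h2 : (2 : ZMod p) ≠ 0) (he : 0 ≤ e) (hQ : Q.HighRank (e ^ 2)) :
    (Q.zeros.card : ℝ) ≤ Fintype.card V / Fintype.card Λ + e * Fintype.card V := by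
  have h := card_slice_le h2 he hQ (0 : PUnit →ₗ[ZMod p] _) 0
    (Function.injective_of_subsingleton _)
  rw [slice_zero] at h
  simpa using h

end QSys

lemma le_add_of_sq_le {S a c : ℝ} (ha : 0 ≤ a) (hc : 0 ≤ c) (h : S ^ 2 ≤ a * S + c ^ 2) :
    S ≤ a + c := by
  by_contra! hcon
  nlinarith

section Derivative

variable {p : ℕ} [Fact p.Prime] {V : Type*} [AddCommGroup V] [Module (ZMod p) V] [Fintype V]

/-- The Fourier transform of the multiplicative derivative `x ↦ f x * f (x + h)`. -/
noncomputable def ftD (f : V → ℝ) (h : V) (ξ : Module.Dual (ZMod p) V) : ℂ :=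
  ft (fun x => ((f x * f (x + h) : ℝ) : ℂ)) ξ

lemma norm_ft_neg (g : V → ℝ) (ξ : Module.Dual (ZMod p) V) :
    ‖ft (fun x => (g x : ℂ)) (-ξ)‖ = ‖ft (fun x => (g x : ℂ)) ξ‖ := by
  rw [← RCLike.norm_conj]
  congr 1
  simp [ft, map_sum, conj_ec]

lemma U3pow8_eq (f : V → ℝ) :
    U3pow8 f = ∑ h, ∑ u, (∑ x, (f x * f (x + h)) * (f (x + u) * f (x + u + h))) ^ 2 := by
  unfold U3pow8
  rw [sum_comm]
  refine sum_congr rfl fun h _ => ?_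
  rw [sum_comm]
  refine sum_congr rfl fun u _ => ?_
  rw [sq, sum_mul_sum]
  refine sum_congr rfl fun x _ => ?_
  rw [← Equiv.sum_comp (Equiv.addLeft x) fun y =>
    (f x * f (x + h)) * (f (x + u) * f (x + u + h)) *
      ((f y * f (y + h)) * (f (y + u) * f (y + u + h)))]
  refine sum_congr rfl fun k _ => ?_
  simp only [cubeProd, Equiv.coe_addLeft]
  rw [show x + h + u = x + u + h by abel, show x + h + k = x + k + h by abel,
    show x + u + k = x + k + u by abel, show x + u + h + k = x + k + u + h by abel]
  ring

variable [Fintype (Module.Dual (ZMod p) V)]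

lemma card_mul_U3pow8 (f : V → ℝ) :
    (Fintype.card V : ℝ) * U3pow8 f = ∑ h, ∑ ξ : Module.Dual (ZMod p) V, ‖ftD f h ξ‖ ^ 4 := by
  rw [U3pow8_eq, mul_sum]
  refine sum_congr rfl fun h _ => ?_
  have h1 := sum_norm_corr_sq (p := p) (fun x => ((f x * f (x + h) : ℝ) : ℂ))
    (fun x => ((f x * f (x + h) : ℝ) : ℂ))
  calc _ = _ := ?_
    _ = _ := h1
    _ = _ := ?_
  · congr 1
    refine sum_congr rfl fun u _ => ?_
    simp_rw [← Complex.ofReal_mul, ← Complex.ofReal_sum]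
    rw [Complex.norm_real, Real.norm_eq_abs, sq_abs]
  · refine sum_congr rfl fun ξ _ => ?_
    rw [norm_ft_neg]
    unfold ftD
    ring

end Derivative

namespace QSys

variable {p : ℕ} [Fact p.Prime] {V Λ : Type*} [AddCommGroup V] [Module (ZMod p) V] [Fintype V]
  [AddCommGroup Λ] [Module (ZMod p) Λ] [Fintype Λ] {Q : QSys p V Λ} {e : ℝ} {f : V → ℝ}

/-- The intersection of the zero set with its translate by `-h`. -/
noncomputable def shiftInter (Q : QSys p V Λ) (h : V) : Finset V :=
  Q.slice (Q.M.flip h) (Q.c - Q.valL h)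

lemma mem_shiftInter (h2 : (2 : ZMod p) ≠ 0) {h x : V} :
    x ∈ Q.shiftInter h ↔ x ∈ Q.zeros ∧ x + h ∈ Q.zeros := by
  rw [shiftInter, slice, mem_filter]
  refine and_congr_right fun hx => ?_
  rw [mem_zeros] at hx ⊢
  simp only [LinearMap.ext_iff, LinearMap.flip_apply, LinearMap.sub_apply, LinearMap.zero_apply,
    Q.valL_add h2, hx, Q.symm _ x h]
  refine forall_congr' fun s => ?_
  constructor <;> intro h <;> linear_combination h

lemma ftD_supp (h2 : (2 : ZMod p) ≠ 0) (hf : ∀ x, |f x| ≤ if x ∈ Q.zeros then 1 else 0) (h x : V) :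
    ‖((f x * f (x + h) : ℝ) : ℂ)‖ ≤ if x ∈ Q.shiftInter h then 1 else 0 := by
  rw [Complex.norm_real, norm_mul, Real.norm_eq_abs, Real.norm_eq_abs]
  simp only [mem_shiftInter h2]
  have h1 := hf x
  have h3 := hf (x + h)
  by_cases ha : x ∈ Q.zeros <;> by_cases hb : x + h ∈ Q.zeros <;>
    simp only [ha, hb, if_true, if_false, and_self, and_true, and_false] at h1 h3 ⊢
  · exact mul_le_one₀ h1 (abs_nonneg _) h3
  · rw [le_antisymm h3 (abs_nonneg _), mul_zero]
  · rw [le_antisymm h1 (abs_nonneg _), zero_mul]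
  · rw [le_antisymm h1 (abs_nonneg _), zero_mul]

lemma norm_ftD_add (h2 : (2 : ZMod p) ≠ 0) (hf : ∀ x, |f x| ≤ if x ∈ Q.zeros then 1 else 0)
    (h : V) (ξ : Module.Dual (ZMod p) V) (s : Λ) :
    ‖ftD f h (ξ + Q.M s h)‖ = ‖ftD f h ξ‖ := by
  have h1 : ftD f h (ξ + Q.M s h) = ftD f h ξ * ec ((Q.c - Q.valL h) s) := by
    unfold ftD ft
    rw [sum_mul]
    refine sum_congr rfl fun x _ => ?_
    by_cases hx : x ∈ Q.shiftInter h
    · rw [shiftInter, slice, mem_filter] at hx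
      rw [← hx.2, LinearMap.add_apply, ec_add]
      simp only [LinearMap.flip_apply]
      ring
    · have := ftD_supp h2 hf h x
      rw [if_neg hx, norm_le_zero_iff] at this
      simp only [this, zero_mul]
  rw [h1, norm_mul, norm_ec, mul_one]

lemma sum_card_shiftInter (h2 : (2 : ZMod p) ≠ 0) :
    ∑ h, ((Q.shiftInter h).card : ℝ) = (Q.zeros.card : ℝ) ^ 2 := by
  have h1 : ∀ h, ((Q.shiftInter h).card : ℝ) =
      ∑ x, (if x ∈ Q.zeros then (1 : ℝ) else 0) * (if x + h ∈ Q.zeros then 1 else 0) := by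
    intro h
    rw [card_eq_sum_ones]
    push_cast
    rw [← sum_filter_add_sum_filter_not univ (· ∈ Q.shiftInter h)]
    rw [sum_eq_zero (s := filter (fun x => x ∉ Q.shiftInter h) univ) fun x hx => ?_, add_zero,
      filter_mem_eq_inter, univ_inter]
    · refine sum_congr rfl fun x hx => ?_
      rw [mem_shiftInter h2] at hx
      rw [if_pos hx.1, if_pos hx.2, one_mul]
    · have := (mem_filter.1 hx).2
      rw [mem_shiftInter h2] at this
      by_cases ha : x ∈ Q.zeros <;> simp_all
  simp_rw [h1]
  rw [sum_comm]
  simp_rw [← mul_sum]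
  have h3 : ∀ x, ∑ h, (if x + h ∈ Q.zeros then (1 : ℝ) else 0) = Q.zeros.card := fun x => by
    refine (Equiv.sum_comp (Equiv.addLeft x) fun y => if y ∈ Q.zeros then (1 : ℝ) else 0).trans ?_
    simp
  simp_rw [h3, ← sum_mul]
  rw [sq]
  congr 1
  simp

/-- The directions in which the associated bilinear forms are independent. -/
def Generic (Q : QSys p V Λ) (h : V) : Prop := Function.Injective (Q.M.flip h)

lemma card_not_generic_le (hQ : Q.HighRank (e ^ 2)) :
    ((univ.filter fun h => ¬ Q.Generic h).card : ℝ) ≤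
      Fintype.card Λ * (e ^ 2 * Fintype.card V) := by
  refine le_trans ?_ (hQ.isGen.card_le (sq_nonneg e) fun _ => 0)
  refine Nat.cast_le.2 (card_le_card fun h hh => ?_)
  rw [mem_filter, Generic, injective_iff_map_eq_zero] at hh
  push Not at hh
  obtain ⟨s, hs, hs0⟩ := hh.2
  exact mem_filter.2 ⟨mem_univ _, s, hs0, hs⟩

variable [Fintype (Module.Dual (ZMod p) V)]

lemma card_mul_pow_le_sum_norm_ftD (h2 : (2 : ZMod p) ≠ 0) {h : V} (hh : Q.Generic h) :
    (Fintype.card Λ : ℝ) * ((Q.shiftInter h).card : ℝ) ^ 4 ≤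
      ∑ ξ : Module.Dual (ZMod p) V, ‖ftD (fun x => if x ∈ Q.zeros then 1 else 0) h ξ‖ ^ 4 := by
  set g : V → ℝ := fun x => if x ∈ Q.zeros then 1 else 0 with hg
  have hg1 : ∀ x, |g x| ≤ if x ∈ Q.zeros then 1 else 0 := fun x => by
    simp only [hg]
    split_ifs <;> simp
  have h0 : ‖ftD g h (0 : Module.Dual (ZMod p) V)‖ = (Q.shiftInter h).card := by
    have : ∀ x, ((g x * g (x + h) : ℝ) : ℂ) = if x ∈ Q.shiftInter h then 1 else 0 := fun x => by
      simp only [hg, mem_shiftInter h2]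
      by_cases ha : x ∈ Q.zeros <;> by_cases hb : x + h ∈ Q.zeros <;> simp [ha, hb]
    simp_rw [ftD, ft, this]
    simp
  have h1 : ∀ s, ‖ftD g h (Q.M s h)‖ = (Q.shiftInter h).card := fun s => by
    rw [← h0, ← norm_ftD_add h2 hg1 h 0 s, zero_add]
  calc _ = ∑ s, ‖ftD g h (Q.M.flip h s)‖ ^ 4 := by
        simp only [LinearMap.flip_apply, h1, sum_const, card_univ, nsmul_eq_mul]
    _ = ∑ ξ ∈ univ.image (Q.M.flip h), ‖ftD g h ξ‖ ^ 4 :=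
        (sum_image (f := fun ξ => ‖ftD g h ξ‖ ^ 4) fun x _ y _ h => hh h).symm
    _ ≤ _ := sum_le_sum_of_subset_of_nonneg (subset_univ _) fun _ _ _ => by positivity

/-- The zero set contains the expected number of cubes. -/
lemma le_card_mul_U3pow8_zeros (h2 : (2 : ZMod p) ≠ 0) (he : 0 ≤ e) (hQ : Q.HighRank (e ^ 2))
    {b : ℝ}
    (hb : b = (Fintype.card Λ : ℝ)⁻¹) (heb : e ≤ b ^ 4 / 16) :
    b ^ 7 * (Fintype.card V : ℝ) ^ 5 / 16 ≤
      Fintype.card V * U3pow8 (fun x : V => if x ∈ Q.zeros then (1 : ℝ) else 0) := by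
  set N : ℝ := (Fintype.card V : ℝ) with hN
  have hN0 : 0 < N := by
    rw [hN]
    exact_mod_cast Fintype.card_pos
  have hL : (1 : ℝ) ≤ Fintype.card Λ := by exact_mod_cast Fintype.card_pos
  have hb0 : 0 < b := by rw [hb]; positivity
  have hb1 : b ≤ 1 := by rw [hb]; exact inv_le_one_of_one_le₀ hL
  have hLb : (Fintype.card Λ : ℝ) = b⁻¹ := by rw [hb, inv_inv]
  have hbad := card_not_generic_le hQ
  have hP := card_zeros_ge h2 he hQ
  rw [div_eq_mul_inv, ← hb, ← hN] at hP
  rw [hLb, ← hN] at hbad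
  set A := univ.filter fun h => Q.Generic h with hA
  have hsplit : (Q.zeros.card : ℝ) ^ 2 ≤ ∑ h ∈ A, ((Q.shiftInter h).card : ℝ) +
      b⁻¹ * (e ^ 2 * N) * N := by
    rw [← sum_card_shiftInter h2, ← sum_filter_add_sum_filter_not univ (fun h => Q.Generic h)]
    refine add_le_add_right ?_ _
    calc _ ≤ ∑ h ∈ univ.filter fun h => ¬ Q.Generic h, N := sum_le_sum fun h _ => by
          rw [hN]
          exact_mod_cast card_le_univ _
      _ ≤ _ := by
          rw [sum_const, nsmul_eq_mul]
          exact mul_le_mul_of_nonneg_right hbad hN0.le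
  have hb4 : b ^ 4 ≤ b := by
    calc b ^ 4 ≤ b ^ 1 := pow_le_pow_of_le_one hb0.le hb1 (by norm_num)
      _ = b := pow_one b
  have h3 : b ^ 2 / 2 * N ^ 2 ≤ ∑ h ∈ A, ((Q.shiftInter h).card : ℝ) := by
    have h4 : (b - e) ^ 2 * N ^ 2 ≤ (Q.zeros.card : ℝ) ^ 2 := by
      rw [← mul_pow]
      refine pow_le_pow_left₀ (mul_nonneg (by linarith) hN0.le) ?_ 2
      linarith
    have h5 : b⁻¹ * e ^ 2 ≤ b ^ 2 / 16 := by
      rw [inv_mul_le_iff₀ hb0]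
      calc e ^ 2 ≤ (b ^ 4 / 16) ^ 2 := pow_le_pow_left₀ he heb 2
        _ = b ^ 3 * b ^ 5 / 256 := by ring
        _ ≤ b ^ 3 * 1 / 16 := by
          have : b ^ 5 ≤ 1 := pow_le_one₀ hb0.le hb1
          have h6 : 0 ≤ b ^ 3 := by positivity
          nlinarith
        _ = _ := by ring
    have h6 : b ^ 2 * (3 / 4) ≤ (b - e) ^ 2 := by
      have : e ≤ b / 16 := by linarith
      nlinarith
    have h7 : (0 : ℝ) ≤ N ^ 2 := by positivity
    nlinarith
  have hA0 : (A.card : ℝ) ≤ N := by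
    rw [hN]
    exact_mod_cast card_le_univ _
  have h4 : (b ^ 2 / 2 * N ^ 2) ^ 4 / N ^ 3 ≤ ∑ h ∈ A, ((Q.shiftInter h).card : ℝ) ^ 4 := by
    by_cases hA1 : A.card = 0
    · rw [card_eq_zero.1 hA1, sum_empty] at h3
      have : 0 < b ^ 2 / 2 * N ^ 2 := by positivity
      linarith
    · have hA2 : (0 : ℝ) < A.card := by exact_mod_cast Nat.pos_of_ne_zero hA1
      refine le_trans ?_ (pow_sum_div_card_le_sum_pow (s := A)
        (f := fun h => ((Q.shiftInter h).card : ℝ)) (n := 3) fun _ _ => Nat.cast_nonneg _)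
      exact div_le_div₀ (pow_nonneg (sum_nonneg fun _ _ => Nat.cast_nonneg _) _)
        (pow_le_pow_left₀ (mul_nonneg (div_nonneg (sq_nonneg b) two_pos.le) (sq_nonneg N)) h3 4)
        (pow_pos hA2 3) (pow_le_pow_left₀ hA2.le hA0 3)
  rw [card_mul_U3pow8 (p := p)]
  have hbb : b⁻¹ * b = 1 := inv_mul_cancel₀ hb0.ne'
  have hNN : (N ^ 3)⁻¹ * N ^ 3 = 1 := inv_mul_cancel₀ (pow_pos hN0 3).ne'
  calc b ^ 7 * N ^ 5 / 16 = b⁻¹ * ((b ^ 2 / 2 * N ^ 2) ^ 4 / N ^ 3) := by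
        rw [div_eq_mul_inv _ (N ^ 3)]
        linear_combination (-b ^ 7 * N ^ 5 / 16) * hbb -
          (b⁻¹ * b * b ^ 7 * N ^ 5 / 16) * hNN
    _ ≤ b⁻¹ * ∑ h ∈ A, ((Q.shiftInter h).card : ℝ) ^ 4 :=
        mul_le_mul_of_nonneg_left h4 (by positivity)
    _ ≤ ∑ h ∈ A, ∑ ξ : Module.Dual (ZMod p) V,
        ‖ftD (fun x => if x ∈ Q.zeros then (1 : ℝ) else 0) h ξ‖ ^ 4 := by
        rw [mul_sum, ← hLb]
        exact sum_le_sum fun h hh => card_mul_pow_le_sum_norm_ftD h2 (mem_filter.1 hh).2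
    _ ≤ _ := sum_le_sum_of_subset_of_nonneg (subset_univ _) fun _ _ _ => by positivity

end QSys

namespace QSys

variable {p : ℕ} [Fact p.Prime] {V Λ : Type*} [AddCommGroup V] [Module (ZMod p) V] [Fintype V]
  [AddCommGroup Λ] [Module (ZMod p) Λ] [Fintype Λ] {Q : QSys p V Λ} {e b η : ℝ} {f : V → ℝ}
  [Fintype (Module.Dual (ZMod p) V)]

lemma inv_card_pos (hb : b = (Fintype.card Λ : ℝ)⁻¹) : 0 < b := by
  have hL : (0 : ℝ) < Fintype.card Λ := by exact_mod_cast Fintype.card_pos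
  rw [hb]
  exact inv_pos.2 hL

lemma inv_card_le_one (hb : b = (Fintype.card Λ : ℝ)⁻¹) : b ≤ 1 := by
  have hL : (1 : ℝ) ≤ Fintype.card Λ := by exact_mod_cast Fintype.card_pos
  rw [hb]
  exact inv_le_one_of_one_le₀ hL

lemma card_shiftInter_le (h2 : (2 : ZMod p) ≠ 0) (he : 0 ≤ e) (hQ : Q.HighRank (e ^ 2))
    (hb : b = (Fintype.card Λ : ℝ)⁻¹) (heb : e ≤ b ^ 2) {h : V} (hh : Q.Generic h) :
    ((Q.shiftInter h).card : ℝ) ≤ 2 * b ^ 2 * Fintype.card V := by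
  have h1 := card_slice_le h2 he hQ (Q.M.flip h) (Q.c - Q.valL h) hh
  rw [div_eq_mul_inv, mul_inv, ← hb] at h1
  have hN0 : (0 : ℝ) ≤ Fintype.card V := Nat.cast_nonneg _
  rw [shiftInter]
  nlinarith

lemma card_zeros_le_two_mul (h2 : (2 : ZMod p) ≠ 0) (he : 0 ≤ e) (hQ : Q.HighRank (e ^ 2))
    (hb : b = (Fintype.card Λ : ℝ)⁻¹) (heb : e ≤ b) :
    (Q.zeros.card : ℝ) ≤ 2 * b * Fintype.card V := by
  have h1 := card_zeros_le h2 he hQ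
  rw [div_eq_mul_inv, ← hb] at h1
  have hN0 : (0 : ℝ) ≤ Fintype.card V := Nat.cast_nonneg _
  nlinarith

lemma sum_norm_ftD_pow_four_le_card_pow (f : V → ℝ) (hf : ∀ x, |f x| ≤ 1) (h : V) :
    ∑ ξ : Module.Dual (ZMod p) V, ‖ftD f h ξ‖ ^ 4 ≤ (Fintype.card V : ℝ) ^ 4 := by
  set N : ℝ := (Fintype.card V : ℝ) with hN
  have h1 : ∀ x, ‖((f x * f (x + h) : ℝ) : ℂ)‖ ≤ 1 := fun x => by
    rw [Complex.norm_real, norm_mul]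
    exact mul_le_one₀ (hf x) (norm_nonneg _) (hf _)
  have h3 : ∀ ξ : Module.Dual (ZMod p) V, ‖ftD f h ξ‖ ≤ N := fun ξ => by
    have := norm_ft_le (p := p) univ (g := fun x => ((f x * f (x + h) : ℝ) : ℂ))
      (fun x => by simpa using h1 x) ξ
    simpa [hN, ftD] using this
  calc _ ≤ ∑ ξ : Module.Dual (ZMod p) V, N ^ 2 * ‖ftD f h ξ‖ ^ 2 := sum_le_sum fun ξ _ => by
        rw [show ‖ftD f h ξ‖ ^ 4 = ‖ftD f h ξ‖ ^ 2 * ‖ftD f h ξ‖ ^ 2 by ring]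
        exact mul_le_mul_of_nonneg_right (pow_le_pow_left₀ (norm_nonneg _) (h3 ξ) 2) (sq_nonneg _)
    _ = N ^ 2 * (N * ∑ x, ‖((f x * f (x + h) : ℝ) : ℂ)‖ ^ 2) := by
        rw [← mul_sum]
        simp_rw [ftD]
        rw [sum_norm_ft_sq]
    _ ≤ N ^ 2 * (N * ∑ _x : V, 1) := by
        refine mul_le_mul_of_nonneg_left (mul_le_mul_of_nonneg_left ?_ (Nat.cast_nonneg _))
          (sq_nonneg _)
        exact sum_le_sum fun x _ => pow_le_one₀ (norm_nonneg _) (h1 x)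
    _ = N ^ 4 := by
        simp only [sum_const, card_univ, nsmul_eq_mul, mul_one, ← hN]
        ring

lemma sum_norm_ftD_pow_four_le (h2 : (2 : ZMod p) ≠ 0) (he : 0 ≤ e) (hQ : Q.HighRank (e ^ 2))
    (hb : b = (Fintype.card Λ : ℝ)⁻¹) (heb : e ≤ b ^ 2)
    (hf : ∀ x, |f x| ≤ if x ∈ Q.zeros then 1 else 0) {h : V} (hh : Q.Generic h) {m κ : ℝ}
    (hm : ∀ ξ : Module.Dual (ZMod p) V, ‖ftD f h ξ‖ ^ 2 ≤ m) (hκ : 0 ≤ κ)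
    (heκ : 2 * b ^ 2 * e ≤ κ ^ 2) :
    ∑ ξ : Module.Dual (ZMod p) V, ‖ftD f h ξ‖ ^ 4 ≤
      2 * b ^ 3 * (Fintype.card V : ℝ) ^ 2 * m + κ * (Fintype.card V : ℝ) ^ 4 := by
  set N : ℝ := (Fintype.card V : ℝ) with hN
  have hN0 : 0 ≤ N := Nat.cast_nonneg _
  have hb0 := inv_card_pos hb
  have hm0 : 0 ≤ m := (sq_nonneg _).trans (hm 0)
  have hcard : Nat.card (LinearMap.range (Q.M.flip h)) * b = 1 := by
    have h1 : Nat.card (LinearMap.range (Q.M.flip h)) = Fintype.card Λ := by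
      rw [← Nat.card_eq_fintype_card]
      exact Nat.card_congr (LinearEquiv.ofInjective _ hh).toEquiv.symm
    have hL : (Fintype.card Λ : ℝ) ≠ 0 := by exact_mod_cast Fintype.card_ne_zero
    rw [h1, hb, mul_inv_cancel₀ hL]
  have h1 := sum_norm_ft_pow_four_le (Q.shiftInter h) (LinearMap.range (Q.M.flip h))
    (r := b * b * N) (m := m) (by positivity) he (fun ζ => by
      refine (norm_ft_slice_le h2 he hQ (Q.M.flip h) (Q.c - Q.valL h) hh ζ).trans (le_of_eq ?_)
      rw [div_eq_mul_inv, mul_inv, ← hb]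
      ring) (ftD_supp h2 hf h) hm
  refine le_add_of_sq_le (by positivity) (by positivity) (h1.trans ?_)
  have hS : 0 ≤ ∑ ξ : Module.Dual (ZMod p) V, ‖ftD f h ξ‖ ^ 4 := sum_nonneg fun _ _ => by positivity
  refine (mul_le_mul_of_nonneg_right (card_shiftInter_le h2 he hQ hb heb hh)
    (by unfold ftD at hS; positivity)).trans ?_
  change 2 * b ^ 2 * N * (b * b * N * (Nat.card (LinearMap.range (Q.M.flip h))) * m *
    ∑ ξ : Module.Dual (ZMod p) V, ‖ftD f h ξ‖ ^ 4 + e * N ^ 7) ≤ _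
  have h3 : 0 ≤ N ^ 8 := by positivity
  have h4 := mul_le_mul_of_nonneg_right heκ h3
  set S := ∑ ξ : Module.Dual (ZMod p) V, ‖ftD f h ξ‖ ^ 4
  linear_combination 2 * b ^ 3 * N ^ 2 * m * S * hcard + h4

/-- A bounded function on the zero set with large `U³` norm has many multiplicative derivatives
with a large Fourier coefficient. -/
lemma exists_large_ftD (h2 : (2 : ZMod p) ≠ 0) (he : 0 ≤ e) (hQ : Q.HighRank (e ^ 2))
    (hb : b = (Fintype.card Λ : ℝ)⁻¹) (hη : 0 < η) (hη1 : η ≤ 1 / 4) (heb : e ≤ η ^ 2 * b ^ 12)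
    (hf : ∀ x, |f x| ≤ if x ∈ Q.zeros then 1 else 0)
    (hU : 1024 * η * U3pow8 (fun x : V => if x ∈ Q.zeros then (1 : ℝ) else 0) ≤ U3pow8 f) :
    ∃ (ξ : V → Module.Dual (ZMod p) V) (S : Finset V), (∀ h ∈ S, Q.Generic h) ∧
      (∀ h ∈ S, η * b ^ 4 * (Fintype.card V : ℝ) ^ 2 ≤ ‖ftD f h (ξ h)‖ ^ 2) ∧
      η * Fintype.card V ≤ S.card := by
  set N : ℝ := (Fintype.card V : ℝ) with hN
  have hN0 : 0 < N := by
    rw [hN]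
    exact_mod_cast Fintype.card_pos
  have hb0 := inv_card_pos hb
  have hb1 := inv_card_le_one hb
  have hbk : ∀ k, b ^ k ≤ 1 := fun k => pow_le_one₀ hb0.le hb1
  have hη2 : η ^ 2 ≤ 1 / 16 := by nlinarith
  have heb2 : e ≤ b ^ 2 := heb.trans (by
    calc η ^ 2 * b ^ 12 = η ^ 2 * b ^ 10 * b ^ 2 := by ring
      _ ≤ 1 * b ^ 2 := mul_le_mul_of_nonneg_right
          (mul_le_one₀ (by linarith) (by positivity) (hbk 10)) (by positivity)
      _ = _ := one_mul _)
  have heb4 : e ≤ b ^ 4 / 16 := heb.trans (by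
    calc η ^ 2 * b ^ 12 = η ^ 2 * b ^ 8 * b ^ 4 := by ring
      _ ≤ 1 / 16 * 1 * b ^ 4 := by
          refine mul_le_mul_of_nonneg_right (mul_le_mul hη2 (hbk 8) ?_ ?_) ?_ <;> positivity
      _ = _ := by ring)
  have hmain := le_card_mul_U3pow8_zeros h2 he hQ hb heb4
  have hUN : 64 * η * b ^ 7 * N ^ 5 ≤ N * U3pow8 f := by
    have h1 := mul_le_mul_of_nonneg_left hU hN0.le
    have h3 := mul_le_mul_of_nonneg_left hmain (by positivity : 0 ≤ 1024 * η)
    rw [← hN] at h3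
    linarith
  rw [hN, card_mul_U3pow8 (p := p), ← hN] at hUN
  choose ξ hξ using fun h => Finite.exists_max fun ξ : Module.Dual (ZMod p) V => ‖ftD f h ξ‖ ^ 2
  refine ⟨ξ, univ.filter fun h => Q.Generic h ∧ η * b ^ 4 * N ^ 2 ≤ ‖ftD f h (ξ h)‖ ^ 2,
    fun h hh => (mem_filter.1 hh).2.1, fun h hh => (mem_filter.1 hh).2.2, ?_⟩
  set S := univ.filter fun h => Q.Generic h ∧ η * b ^ 4 * N ^ 2 ≤ ‖ftD f h (ξ h)‖ ^ 2 with hS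
  have hf1 : ∀ x, |f x| ≤ 1 := fun x => (hf x).trans (by split_ifs <;> norm_num)
  set κ : ℝ := 2 * η * b ^ 7 with hκ
  have hκ0 : 0 ≤ κ := by positivity
  have heκ : 2 * b ^ 2 * e ≤ κ ^ 2 := by
    calc 2 * b ^ 2 * e ≤ 2 * b ^ 2 * (η ^ 2 * b ^ 12) :=
          mul_le_mul_of_nonneg_left heb (by positivity)
      _ ≤ κ ^ 2 := by
          rw [hκ]
          have : 0 ≤ η ^ 2 * b ^ 14 := by positivity
          linarith
  have hterm : ∀ h, ∑ ξ : Module.Dual (ZMod p) V, ‖ftD f h ξ‖ ^ 4 ≤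
      (if h ∈ S then 8 * b ^ 7 * N ^ 4 else 0) + (if ¬ Q.Generic h then N ^ 4 else 0) +
        (2 * η * b ^ 7 * N ^ 4 + κ * N ^ 4) := by
    intro h
    have hpos : 0 ≤ 2 * η * b ^ 7 * N ^ 4 + κ * N ^ 4 := by positivity
    have hpos1 : 0 ≤ 8 * b ^ 7 * N ^ 4 := by positivity
    have hpos2 : 0 ≤ 2 * η * b ^ 7 * N ^ 4 := by positivity
    by_cases hh : Q.Generic h
    · have h1 := sum_norm_ftD_pow_four_le h2 he hQ hb heb2 hf hh (hξ h) hκ0 heκ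
      rw [← hN] at h1
      rw [if_neg (not_not.2 hh), add_zero]
      by_cases hm : η * b ^ 4 * N ^ 2 ≤ ‖ftD f h (ξ h)‖ ^ 2
      · rw [if_pos (mem_filter.2 ⟨mem_univ _, hh, hm⟩)]
        have h3 : ‖ftD f h (ξ h)‖ ≤ 2 * b ^ 2 * N :=
          (norm_ft_le (Q.shiftInter h) (ftD_supp h2 hf h) (ξ h)).trans
            (card_shiftInter_le h2 he hQ hb heb2 hh)
        have h4 : ‖ftD f h (ξ h)‖ ^ 2 ≤ (2 * b ^ 2 * N) ^ 2 :=
          pow_le_pow_left₀ (norm_nonneg _) h3 2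
        have h5 := mul_le_mul_of_nonneg_left h4 (by positivity : 0 ≤ 2 * b ^ 3 * N ^ 2)
        linarith
      · rw [if_neg fun h' => hm (mem_filter.1 h').2.2]
        have h5 := mul_le_mul_of_nonneg_left (not_le.1 hm).le
          (by positivity : 0 ≤ 2 * b ^ 3 * N ^ 2)
        linarith
    · rw [if_pos hh]
      have h1 := sum_norm_ftD_pow_four_le_card_pow (p := p) f hf1 h
      rw [← hN] at h1
      split_ifs <;> linarith
  have hbad := card_not_generic_le hQ
  rw [show (Fintype.card Λ : ℝ) = b⁻¹ by rw [hb, inv_inv], ← hN] at hbad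
  have hbe : b⁻¹ * e ^ 2 ≤ η * b ^ 7 := by
    rw [inv_mul_le_iff₀ hb0]
    calc e ^ 2 ≤ (η ^ 2 * b ^ 12) ^ 2 := pow_le_pow_left₀ he heb 2
      _ = η ^ 3 * b ^ 16 * (b * (η * b ^ 7)) := by ring
      _ ≤ 1 * (b * (η * b ^ 7)) := by
          refine mul_le_mul_of_nonneg_right (mul_le_one₀ (pow_le_one₀ hη.le (by linarith))
            (by positivity) (hbk 16)) (by positivity)
      _ = _ := one_mul _
  have hsum := hUN.trans (sum_le_sum fun h _ => hterm h)
  rw [sum_add_distrib, sum_add_distrib, ← sum_filter, ← sum_filter, sum_const, sum_const,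
    sum_const, card_univ, nsmul_eq_mul, nsmul_eq_mul, nsmul_eq_mul, ← hN, filter_mem_eq_inter,
    univ_inter] at hsum
  have h6 := mul_le_mul_of_nonneg_right hbad (by positivity : 0 ≤ N ^ 4)
  have h7 := mul_le_mul_of_nonneg_right hbe (by positivity : 0 ≤ N ^ 5)
  have h8 : 0 < b ^ 7 * N ^ 4 := by positivity
  have h9 : 0 ≤ η * b ^ 7 * N ^ 5 := by positivity
  refine le_of_mul_le_mul_left ?_ h8
  simp only [hκ] at hsum
  linarith

end QSys

section CauchySchwarz

variable {X Y W : Type*} [Fintype X] [Fintype Y] [Fintype W]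

lemma norm_sum_mul_sq_le (R : Finset X) {g : X → ℂ} (hg : ∀ x, ‖g x‖ ≤ if x ∈ R then 1 else 0)
    (c : X → ℂ) : ‖∑ x, g x * c x‖ ^ 2 ≤ R.card * ∑ x ∈ R, ‖c x‖ ^ 2 := by
  have h1 : ‖∑ x, g x * c x‖ ≤ ∑ x ∈ R, ‖c x‖ := by
    rw [← sum_filter_add_sum_filter_not univ (· ∈ R), sum_eq_zero (s := univ.filter (· ∉ R)),
      add_zero, filter_mem_eq_inter, univ_inter]
    · refine (norm_sum_le _ _).trans (sum_le_sum fun x hx => ?_)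
      have := hg x
      rw [if_pos hx] at this
      rw [norm_mul]
      exact mul_le_of_le_one_left (norm_nonneg _) this
    · intro x hx
      have := hg x
      rw [if_neg (mem_filter.1 hx).2, norm_le_zero_iff] at this
      rw [this, zero_mul]
  exact (pow_le_pow_left₀ (norm_nonneg _) h1 2).trans sq_sum_le_card_mul_sum_sq

lemma sum_norm_sum_sq_le (R : Finset X) (R' : Finset Y) {h : Y → ℂ}
    (hh : ∀ y, ‖h y‖ ≤ if y ∈ R' then 1 else 0) (K : X → Y → ℂ) :
    ∑ x ∈ R, ‖∑ y, h y * K x y‖ ^ 2 ≤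
      ∑ y ∈ R', ∑ y' ∈ R', ‖∑ x ∈ R, K x y * (starRingEnd ℂ) (K x y')‖ := by
  have h1 : ∀ x, ∑ y, h y * K x y = ∑ y ∈ R', h y * K x y := fun x => by
    symm
    refine sum_subset (subset_univ _) fun y _ hy => ?_
    have := hh y
    rw [if_neg hy, norm_le_zero_iff] at this
    rw [this, zero_mul]
  have h2 : ((∑ x ∈ R, ‖∑ y, h y * K x y‖ ^ 2 : ℝ) : ℂ) = ∑ y ∈ R', ∑ y' ∈ R',
      h y * (starRingEnd ℂ) (h y') * ∑ x ∈ R, K x y * (starRingEnd ℂ) (K x y') := by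
    simp_rw [h1, mul_sum]
    rw [Complex.ofReal_sum]
    simp_rw [sum_comm (t := R)]
    refine sum_congr rfl fun x _ => ?_
    rw [Complex.ofReal_pow, ← Complex.mul_conj', map_sum, sum_mul_sum]
    refine sum_congr rfl fun y _ => sum_congr rfl fun y' _ => ?_
    rw [map_mul]
    ring
  have h3 : 0 ≤ ∑ x ∈ R, ‖∑ y, h y * K x y‖ ^ 2 := sum_nonneg fun _ _ => sq_nonneg _
  rw [← Real.norm_of_nonneg h3, ← Complex.norm_real, h2]
  refine (norm_sum_le _ _).trans (sum_le_sum fun y hy => (norm_sum_le _ _).trans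
    (sum_le_sum fun y' hy' => ?_))
  have h4 := hh y
  have h5 := hh y'
  rw [if_pos hy] at h4
  rw [if_pos hy'] at h5
  rw [norm_mul, norm_mul, RCLike.norm_conj]
  exact mul_le_of_le_one_left (norm_nonneg _) (mul_le_one₀ h4 (norm_nonneg _) h5)

lemma norm_sum_sum_pow_four_le (R : Finset X) (R' : Finset Y) {g : X → ℂ} {h : Y → ℂ}
    (hg : ∀ x, ‖g x‖ ≤ if x ∈ R then 1 else 0) (hh : ∀ y, ‖h y‖ ≤ if y ∈ R' then 1 else 0)
    (K : X → Y → ℂ) :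
    ‖∑ x, ∑ y, g x * h y * K x y‖ ^ 4 ≤ (R.card : ℝ) ^ 2 * (R'.card : ℝ) ^ 2 *
      ∑ y ∈ R', ∑ y' ∈ R', ‖∑ x ∈ R, K x y * (starRingEnd ℂ) (K x y')‖ ^ 2 := by
  have h1 := norm_sum_mul_sq_le R hg fun x => ∑ y, h y * K x y
  have h2 := sum_norm_sum_sq_le R R' hh K
  simp_rw [mul_sum, ← mul_assoc] at h1
  have h3 : (∑ y ∈ R', ∑ y' ∈ R', ‖∑ x ∈ R, K x y * (starRingEnd ℂ) (K x y')‖) ^ 2 ≤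
      (R'.card : ℝ) ^ 2 *
        ∑ y ∈ R', ∑ y' ∈ R', ‖∑ x ∈ R, K x y * (starRingEnd ℂ) (K x y')‖ ^ 2 := by
    rw [← sum_product', ← sum_product', sq (R'.card : ℝ), ← Nat.cast_mul, ← card_product]
    exact sq_sum_le_card_mul_sum_sq
  rw [← mul_sum] at h1
  calc _ = (‖∑ x, ∑ y, g x * h y * K x y‖ ^ 2) ^ 2 := by ring
    _ ≤ (R.card * ∑ y ∈ R', ∑ y' ∈ R', ‖∑ x ∈ R, K x y * (starRingEnd ℂ) (K x y')‖) ^ 2 := by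
        refine pow_le_pow_left₀ (sq_nonneg _) (h1.trans ?_) 2
        exact mul_le_mul_of_nonneg_left h2 (Nat.cast_nonneg _)
    _ ≤ _ := by
        rw [mul_pow, mul_assoc]
        exact mul_le_mul_of_nonneg_left h3 (sq_nonneg _)

/-- A weighted bipartite graph contains at least as many four-cycles as a random one. -/
lemma sum_pow_four_le_sum_four_cycle (r : X → Y → ℝ) :
    (∑ x, ∑ y, r x y) ^ 4 ≤ (Fintype.card X : ℝ) ^ 2 * (Fintype.card Y : ℝ) ^ 2 *
      ∑ x, ∑ x', ∑ y, ∑ y', r x y * r x y' * (r x' y * r x' y') := by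
  have h1 : (∑ x, ∑ y, r x y) ^ 2 ≤ Fintype.card X * ∑ x, (∑ y, r x y) ^ 2 := by
    rw [← card_univ]
    exact sq_sum_le_card_mul_sum_sq
  have h2 : (∑ y, ∑ y', ∑ x, r x y * r x y') ^ 2 ≤
      (Fintype.card Y : ℝ) ^ 2 * ∑ y, ∑ y', (∑ x, r x y * r x y') ^ 2 := by
    have := sq_sum_le_card_mul_sum_sq (s := (univ : Finset (Y × Y)))
      (f := fun y => ∑ x, r x y.1 * r x y.2)
    rw [card_univ, Fintype.card_prod, Fintype.sum_prod_type, Fintype.sum_prod_type] at this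
    rw [sq (Fintype.card Y : ℝ), ← Nat.cast_mul]
    exact this
  have h3 : ∑ x, (∑ y, r x y) ^ 2 = ∑ y, ∑ y', ∑ x, r x y * r x y' := by
    simp_rw [sq, sum_mul_sum]
    rw [sum_comm]
    refine sum_congr rfl fun y _ => ?_
    rw [sum_comm]
  have h4 : ∑ y, ∑ y', (∑ x, r x y * r x y') ^ 2 =
      ∑ x, ∑ x', ∑ y, ∑ y', r x y * r x y' * (r x' y * r x' y') := by
    simp_rw [sq, sum_mul_sum]
    simp_rw [sum_comm (s := (univ : Finset Y)) (t := (univ : Finset X))]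
  rw [h3] at h1
  calc _ = ((∑ x, ∑ y, r x y) ^ 2) ^ 2 := by ring
    _ ≤ (Fintype.card X * ∑ y, ∑ y', ∑ x, r x y * r x y') ^ 2 :=
        pow_le_pow_left₀ (sq_nonneg _) h1 2
    _ ≤ _ := by
        rw [mul_pow, mul_assoc, ← h4]
        exact mul_le_mul_of_nonneg_left h2 (sq_nonneg _)

lemma sum_pow_four_le_card_mul (f : W → ℝ) :
    (∑ w, f w) ^ 4 ≤ (Fintype.card W : ℝ) ^ 3 * ∑ w, f w ^ 4 := by
  have h1 : (∑ w, f w) ^ 2 ≤ Fintype.card W * ∑ w, f w ^ 2 := by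
    rw [← card_univ]
    exact sq_sum_le_card_mul_sum_sq
  have h2 : (∑ w, f w ^ 2) ^ 2 ≤ Fintype.card W * ∑ w, (f w ^ 2) ^ 2 := by
    rw [← card_univ]
    exact sq_sum_le_card_mul_sum_sq
  calc _ = ((∑ w, f w) ^ 2) ^ 2 := by ring
    _ ≤ (Fintype.card W * ∑ w, f w ^ 2) ^ 2 := pow_le_pow_left₀ (sq_nonneg _) h1 2
    _ = (Fintype.card W : ℝ) ^ 2 * (∑ w, f w ^ 2) ^ 2 := mul_pow _ _ _
    _ ≤ (Fintype.card W : ℝ) ^ 2 * (Fintype.card W * ∑ w, (f w ^ 2) ^ 2) :=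
        mul_le_mul_of_nonneg_left h2 (sq_nonneg _)
    _ = _ := by
        simp_rw [← pow_mul]
        ring

lemma sum_pow_four_le_sum_sum_four_cycle (r : W → X → Y → ℝ) :
    (∑ w, ∑ x, ∑ y, r w x y) ^ 4 ≤
      (Fintype.card W : ℝ) ^ 3 * ((Fintype.card X : ℝ) ^ 2 * (Fintype.card Y : ℝ) ^ 2) *
        ∑ w, ∑ x, ∑ x', ∑ y, ∑ y', r w x y * r w x y' * (r w x' y * r w x' y') := by
  refine (sum_pow_four_le_card_mul _).trans ?_
  rw [mul_assoc]
  refine mul_le_mul_of_nonneg_left ?_ (by positivity)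
  rw [mul_sum]
  exact sum_le_sum fun w _ => sum_pow_four_le_sum_four_cycle _

end CauchySchwarz

lemma IsGen.card_not_injective_le {R Θ X D : Type*} [Ring R] [Fintype X] [Fintype Θ]
    [AddCommGroup Θ] [AddCommGroup D] [Module R Θ] [Module R D] {u : X → Θ →ₗ[R] D} {ε : ℝ}
    (h : IsGen ε fun s t => u t s) (hε : 0 ≤ ε) :
    ((univ.filter fun t => ¬ Function.Injective (u t)).card : ℝ) ≤
      Fintype.card Θ * (ε * Fintype.card X) := by
  refine le_trans ?_ (h.card_le hε fun _ => 0)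
  refine Nat.cast_le.2 (card_le_card fun t ht => ?_)
  rw [mem_filter, injective_iff_map_eq_zero] at ht
  push Not at ht
  obtain ⟨s, hs, hs0⟩ := ht.2
  exact mem_filter.2 ⟨mem_univ _, s, hs0, hs⟩

namespace QSys

variable {p : ℕ} [Fact p.Prime] {V Λ : Type*} [AddCommGroup V] [Module (ZMod p) V] [Fintype V]
  [AddCommGroup Λ] [Module (ZMod p) Λ] [Fintype Λ] {Q : QSys p V Λ} {e b η : ℝ} {f : V → ℝ}

/-- The linear forms attached to a triple of directions. -/
noncomputable def form₃ (Q : QSys p V Λ) (x y z : V) :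
    Λ × Λ × Λ →ₗ[ZMod p] Module.Dual (ZMod p) V :=
  (Q.M.flip x).coprod ((Q.M.flip y).coprod (Q.M.flip z))

lemma form₃_apply (Q : QSys p V Λ) (x y z : V) (s : Λ × Λ × Λ) :
    Q.form₃ x y z s = Q.M s.1 x + (Q.M s.2.1 y + Q.M s.2.2 z) := rfl

/-- The intersection of the zero set with three of its translates. -/
noncomputable def shiftInter₃ (Q : QSys p V Λ) (x y z : V) : Finset V :=
  Q.slice (Q.form₃ x y z)
    ((Q.c - Q.valL x).coprod ((Q.c - Q.valL y).coprod (Q.c - Q.valL z)))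

lemma mem_shiftInter₃ (h2 : (2 : ZMod p) ≠ 0) {x y z t : V} :
    t ∈ Q.shiftInter₃ x y z ↔
      t ∈ Q.zeros ∧ t + x ∈ Q.zeros ∧ t + y ∈ Q.zeros ∧ t + z ∈ Q.zeros := by
  have key : ∀ h, t ∈ Q.shiftInter h ↔ t ∈ Q.zeros ∧ (Q.M.flip h).flip t = Q.c - Q.valL h :=
    fun h => by rw [shiftInter, slice, mem_filter]
  have h1 : t ∈ Q.shiftInter₃ x y z ↔ t ∈ Q.zeros ∧ (Q.M.flip x).flip t = Q.c - Q.valL x ∧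
      (Q.M.flip y).flip t = Q.c - Q.valL y ∧ (Q.M.flip z).flip t = Q.c - Q.valL z := by
    rw [shiftInter₃, slice, mem_filter]
    refine and_congr_right fun _ => ?_
    constructor
    · intro h
      refine ⟨LinearMap.ext fun s => ?_, LinearMap.ext fun s => ?_, LinearMap.ext fun s => ?_⟩
      · simpa [form₃] using LinearMap.congr_fun h (s, 0, 0)
      · simpa [form₃] using LinearMap.congr_fun h (0, s, 0)
      · simpa [form₃] using LinearMap.congr_fun h (0, 0, s)
    · rintro ⟨h3, h4, h5⟩
      refine LinearMap.ext fun s => ?_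
      have h6 := LinearMap.congr_fun h3 s.1
      have h7 := LinearMap.congr_fun h4 s.2.1
      have h8 := LinearMap.congr_fun h5 s.2.2
      simp only [LinearMap.flip_apply] at h6 h7 h8
      simp [form₃, h6, h7, h8]
  have e1 := key x
  have e2 := key y
  have e3 := key z
  rw [mem_shiftInter h2] at e1 e2 e3
  rw [h1]
  constructor
  · rintro ⟨h, h3, h4, h5⟩
    exact ⟨h, (e1.2 ⟨h, h3⟩).2, (e2.2 ⟨h, h4⟩).2, (e3.2 ⟨h, h5⟩).2⟩
  · rintro ⟨h, h3, h4, h5⟩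
    exact ⟨h, (e1.1 ⟨h, h3⟩).2, (e2.1 ⟨h, h4⟩).2, (e3.1 ⟨h, h5⟩).2⟩

lemma isGen_form₃ (hQ : Q.HighRank e) :
    IsGen e fun (s : Λ × Λ × Λ) (t : V × V × V) => Q.form₃ t.1 t.2.1 t.2.2 s := by
  intro s hs z
  simp only [form₃_apply]
  exact hQ.isGen.prod (hQ.isGen.prod hQ.isGen) s hs z

lemma card_not_injective_form₃_le (hQ : Q.HighRank (e ^ 2)) :
    ((univ.filter fun t : V × V × V =>
      ¬ Function.Injective (Q.form₃ t.1 t.2.1 t.2.2)).card : ℝ) ≤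
      (Fintype.card Λ : ℝ) ^ 3 * (e ^ 2 * (Fintype.card V : ℝ) ^ 3) := by
  refine ((isGen_form₃ hQ).card_not_injective_le (sq_nonneg e)).trans (le_of_eq ?_)
  simp only [Fintype.card_prod]
  push_cast
  ring

lemma indC_shiftInter (h2 : (2 : ZMod p) ≠ 0) (k x : V) :
    indC (Q.shiftInter k) x = indC Q.zeros x * indC Q.zeros (x + k) := by
  simp only [indC, mem_shiftInter h2]
  by_cases ha : x ∈ Q.zeros <;> by_cases hb : x + k ∈ Q.zeros <;> simp [ha, hb]

lemma indC_shiftInter₃ (h2 : (2 : ZMod p) ≠ 0) (x y z t : V) :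
    indC (Q.shiftInter₃ x y z) t =
      indC Q.zeros t * indC Q.zeros (t + x) * indC Q.zeros (t + y) * indC Q.zeros (t + z) := by
  simp only [indC, mem_shiftInter₃ h2]
  by_cases ha : t ∈ Q.zeros <;> by_cases hb : t + x ∈ Q.zeros <;> by_cases hc : t + y ∈ Q.zeros <;>
    by_cases hd : t + z ∈ Q.zeros <;> simp [ha, hb, hc, hd]

end QSys

section

variable {V : Type*} [Fintype V]

lemma sum_finset_eq_sum_indC (R : Finset V) (g : V → ℂ) :
    ∑ x ∈ R, g x = ∑ x, indC R x * g x := by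
  simp [indC]

lemma conj_indC (R : Finset V) (x : V) : (starRingEnd ℂ) (indC R x) = indC R x := by
  simp only [indC]
  split_ifs <;> simp

end

section Kernel

variable {p : ℕ} [Fact p.Prime] {V : Type*} [AddCommGroup V] [Module (ZMod p) V] [Fintype V]

/-- The phase kernel attached to a choice of frequencies. -/
noncomputable def phaseK (S : Finset V) (ξ : V → Module.Dual (ZMod p) V) (k x y : V) : ℂ :=
  indC S (y - x) * ec (ξ (y - x) k)

lemma sum_norm_sq_ftD (f : V → ℝ) (S : Finset V) (ξ : V → Module.Dual (ZMod p) V) :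
    ((∑ h ∈ S, ‖ftD f h (ξ h)‖ ^ 2 : ℝ) : ℂ) =
      ∑ k, ∑ x, ∑ y, ((f x * f (x + k) : ℝ) : ℂ) * ((f y * f (y + k) : ℝ) : ℂ) *
        phaseK S ξ k x y := by
  rw [Complex.ofReal_sum, sum_finset_eq_sum_indC]
  simp_rw [ftD, ft, ofReal_normSq_sum, mul_sum]
  have h1 : ∀ h : V, ∑ i, ∑ j, indC S h * (((f i * f (i + h) : ℝ) : ℂ) * ec (ξ h i) *
      (starRingEnd ℂ) (((f j * f (j + h) : ℝ) : ℂ) * ec (ξ h j))) =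
      ∑ k, ∑ x, ((f x * f (x + k) : ℝ) : ℂ) * ((f (x + h) * f (x + h + k) : ℝ) : ℂ) *
        (indC S h * ec (ξ h k)) := fun h => by
    rw [sum_comm]
    rw [sum_comm (s := (univ : Finset V)) (f := fun k x => ((f x * f (x + k) : ℝ) : ℂ) *
      ((f (x + h) * f (x + h + k) : ℝ) : ℂ) * (indC S h * ec (ξ h k)))]
    refine sum_congr rfl fun x _ => ?_
    rw [← Equiv.sum_comp (Equiv.addLeft x)]
    refine sum_congr rfl fun k _ => ?_
    rw [Equiv.coe_addLeft, map_mul, Complex.conj_ofReal, conj_ec, map_add, ec_add,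
      show x + k + h = x + h + k by abel]
    have : ec (ξ h x) * ec (-ξ h x) = 1 := by rw [← ec_add, add_neg_cancel, ec_zero]
    push_cast
    linear_combination (indC S h * f (x + k) * f (x + h + k) * f x * f (x + h) * ec (ξ h k)) * this
  simp_rw [h1]
  rw [sum_comm]
  refine sum_congr rfl fun k _ => ?_
  rw [sum_comm]
  refine sum_congr rfl fun x _ => ?_
  rw [← Equiv.sum_comp (Equiv.addLeft x) fun y => ((f x * f (x + k) : ℝ) : ℂ) *
    ((f y * f (y + k) : ℝ) : ℂ) * phaseK S ξ k x y]
  refine sum_congr rfl fun h _ => ?_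
  simp only [phaseK, Equiv.coe_addLeft, add_sub_cancel_left]

/-- The additive quadruple defect of a choice of frequencies. -/
noncomputable def quadDefect (ξ : V → Module.Dual (ZMod p) V) (a c d : V) :
    Module.Dual (ZMod p) V :=
  ξ a - ξ c - ξ (a - d) + ξ (c - d)

lemma sum_four_cycle_phaseK {Λ : Type*} [AddCommGroup Λ] [Module (ZMod p) Λ] [Fintype Λ]
    (Q : QSys p V Λ) (h2 : (2 : ZMod p) ≠ 0) (S : Finset V) (ξ : V → Module.Dual (ZMod p) V) :
    ∑ k, ∑ y ∈ Q.shiftInter k, ∑ y' ∈ Q.shiftInter k, ‖∑ x ∈ Q.shiftInter k,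
        phaseK S ξ k x y * (starRingEnd ℂ) (phaseK S ξ k x y')‖ ^ 2 =
      ∑ a, ∑ c, ∑ d, if a ∈ S ∧ c ∈ S ∧ a - d ∈ S ∧ c - d ∈ S then
        ‖ft (indC (Q.shiftInter₃ a c d)) (quadDefect ξ a c d)‖ ^ 2 else 0 := by
  have hR : ∀ a c d : V, (((if a ∈ S ∧ c ∈ S ∧ a - d ∈ S ∧ c - d ∈ S then
      ‖ft (indC (Q.shiftInter₃ a c d)) (quadDefect ξ a c d)‖ ^ 2 else 0 : ℝ)) : ℂ) =
      ∑ x, ∑ z, indC S a * indC S c * indC S (a - d) * indC S (c - d) *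
        ((indC (Q.shiftInter₃ a c d) z * ec (quadDefect ξ a c d z)) *
          (indC (Q.shiftInter₃ a c d) x * ec (-quadDefect ξ a c d x))) := fun a c d => by
    have h1 : (((if a ∈ S ∧ c ∈ S ∧ a - d ∈ S ∧ c - d ∈ S then
      ‖ft (indC (Q.shiftInter₃ a c d)) (quadDefect ξ a c d)‖ ^ 2 else 0 : ℝ)) : ℂ) =
      indC S a * indC S c * indC S (a - d) * indC S (c - d) *
        ((‖ft (indC (Q.shiftInter₃ a c d)) (quadDefect ξ a c d)‖ ^ 2 : ℝ) : ℂ) := by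
      simp only [indC]
      by_cases ha : a ∈ S <;> by_cases hc : c ∈ S <;> by_cases had : a - d ∈ S <;>
        by_cases hcd : c - d ∈ S <;> simp [ha, hc, had, hcd]
    rw [h1, ft, ofReal_normSq_sum, sum_comm, mul_sum]
    simp_rw [mul_sum, map_mul, conj_indC, conj_ec]
  have hL : ∀ k, ((∑ y ∈ Q.shiftInter k, ∑ y' ∈ Q.shiftInter k, ‖∑ x ∈ Q.shiftInter k,
        phaseK S ξ k x y * (starRingEnd ℂ) (phaseK S ξ k x y')‖ ^ 2 : ℝ) : ℂ) =
      ∑ x, ∑ y, ∑ y', ∑ x', indC (Q.shiftInter k) y * indC (Q.shiftInter k) y' *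
        indC (Q.shiftInter k) x * indC (Q.shiftInter k) x' *
        (phaseK S ξ k x y * (starRingEnd ℂ) (phaseK S ξ k x y') *
          ((starRingEnd ℂ) (phaseK S ξ k x' y) * phaseK S ξ k x' y')) := fun k => by
    rw [Complex.ofReal_sum]
    simp_rw [Complex.ofReal_sum]
    rw [sum_finset_eq_sum_indC]
    simp_rw [sum_finset_eq_sum_indC (Q.shiftInter k), ofReal_normSq_sum, mul_sum]
    conv_rhs => rw [sum_comm]
    refine sum_congr rfl fun y _ => ?_
    conv_rhs => rw [sum_comm]
    refine sum_congr rfl fun y' _ => sum_congr rfl fun x _ => sum_congr rfl fun x' _ => ?_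
    simp only [map_mul, conj_indC, Complex.conj_conj]
    ring
  rw [← Complex.ofReal_inj, Complex.ofReal_sum, Complex.ofReal_sum]
  simp_rw [hL, Complex.ofReal_sum, hR]
  rw [sum_comm]
  calc _ = ∑ x, ∑ a, ∑ c, ∑ d, ∑ z, indC S a * indC S c * indC S (a - d) * indC S (c - d) *
        ((indC (Q.shiftInter₃ a c d) z * ec (quadDefect ξ a c d z)) *
          (indC (Q.shiftInter₃ a c d) x * ec (-quadDefect ξ a c d x))) := ?_
    _ = _ := by
      rw [sum_comm]
      refine sum_congr rfl fun a _ => ?_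
      rw [sum_comm]
      refine sum_congr rfl fun c _ => ?_
      rw [sum_comm]
  refine sum_congr rfl fun x _ => ?_
  have hrot : ∀ F : V → V → V → V → ℂ, ∑ a, ∑ c, ∑ d, ∑ z, F a c d z =
      ∑ z, ∑ a, ∑ c, ∑ d, F a c d z :=
    fun F => by
      rw [sum_comm (s := (univ : Finset V)) (t := (univ : Finset V))
          (f := fun z a => ∑ c, ∑ d, F a c d z)]
      refine sum_congr rfl fun a _ => ?_
      rw [sum_comm (s := (univ : Finset V)) (t := (univ : Finset V))
          (f := fun z c => ∑ d, F a c d z)]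
      exact sum_congr rfl fun c _ => sum_comm
  conv_rhs => rw [hrot]
  refine Fintype.sum_equiv (Equiv.addLeft x) _ _ fun k => Eq.symm ?_
  refine Fintype.sum_equiv (Equiv.addLeft x) _ _ fun a => ?_
  refine Fintype.sum_equiv (Equiv.addLeft x) _ _ fun c => ?_
  refine Fintype.sum_equiv (Equiv.addLeft x) _ _ fun d => ?_
  have hec : ec (quadDefect ξ a c d (x + k)) * ec (-quadDefect ξ a c d x) =
      ec (ξ a k) * ec (-ξ c k) * ec (-ξ (a - d) k) * ec (ξ (c - d) k) := by
    simp only [← ec_add]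
    congr 1
    simp only [quadDefect, map_add, LinearMap.add_apply, LinearMap.sub_apply]
    ring
  simp only [Equiv.coe_addLeft, phaseK, QSys.indC_shiftInter h2, QSys.indC_shiftInter₃ h2, map_mul,
      conj_indC,
    add_sub_cancel_left, add_sub_add_left_eq_sub, conj_ec]
  rw [show x + a + k = x + k + a by abel, show x + c + k = x + k + c by abel,
    show x + d + k = x + k + d by abel]
  linear_combination (indC S a * indC S c * indC S (a - d) * indC S (c - d) *
    (indC Q.zeros (x + k) * indC Q.zeros (x + k + a) * indC Q.zeros (x + k + c) *
      indC Q.zeros (x + k + d)) * (indC Q.zeros x * indC Q.zeros (x + a) * indC Q.zeros (x + c) *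
      indC Q.zeros (x + d))) * hec

end Kernel

lemma norm_sum_sum_le_card_sq {X : Type*} [Fintype X] {F : X → X → ℂ} (hF : ∀ x y, ‖F x y‖ ≤ 1) :
    ‖∑ x, ∑ y, F x y‖ ≤ (Fintype.card X : ℝ) ^ 2 := by
  refine (norm_sum_le _ _).trans ((sum_le_sum fun x _ => (norm_sum_le _ _).trans
    (sum_le_sum fun y _ => hF x y)).trans (le_of_eq ?_))
  simp [sq]

namespace QSys

variable {p : ℕ} [Fact p.Prime] {V Λ : Type*} [AddCommGroup V] [Module (ZMod p) V] [Fintype V]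
  [AddCommGroup Λ] [Module (ZMod p) Λ] [Fintype Λ] {Q : QSys p V Λ} {e b η : ℝ} {f : V → ℝ}
  [Fintype (Module.Dual (ZMod p) V)]

lemma le_sum_four_cycle_phaseK (h2 : (2 : ZMod p) ≠ 0) (he : 0 ≤ e) (hQ : Q.HighRank (e ^ 2))
    (hb : b = (Fintype.card Λ : ℝ)⁻¹) (hη : 0 < η) (hη1 : η ≤ 1 / 4) (heb : e ≤ η ^ 4 * b ^ 6 / 32)
    (hf : ∀ x, |f x| ≤ if x ∈ Q.zeros then 1 else 0) {S : Finset V}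
    {ξ : V → Module.Dual (ZMod p) V}
    (hS : ∀ h ∈ S, η * b ^ 4 * (Fintype.card V : ℝ) ^ 2 ≤ ‖ftD f h (ξ h)‖ ^ 2)
    (hcard : η * Fintype.card V ≤ S.card) :
    η ^ 8 * b ^ 8 * (Fintype.card V : ℝ) ^ 5 / 256 ≤
      ∑ k, ∑ y ∈ Q.shiftInter k, ∑ y' ∈ Q.shiftInter k, ‖∑ x ∈ Q.shiftInter k,
        phaseK S ξ k x y * (starRingEnd ℂ) (phaseK S ξ k x y')‖ ^ 2 := by
  set N : ℝ := (Fintype.card V : ℝ) with hN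
  set T : V → ℝ := fun k => ∑ y ∈ Q.shiftInter k, ∑ y' ∈ Q.shiftInter k, ‖∑ x ∈ Q.shiftInter k,
        phaseK S ξ k x y * (starRingEnd ℂ) (phaseK S ξ k x y')‖ ^ 2 with hT
  have hN1 : (1 : ℝ) ≤ N := Nat.one_le_cast.2 Fintype.card_pos
  have hb0 := inv_card_pos hb
  have hb1 := inv_card_le_one hb
  have hT0 : ∀ k, 0 ≤ T k := fun k => sum_nonneg fun _ _ => sum_nonneg fun _ _ => sq_nonneg _
  set W : V → ℂ := fun k => ∑ x, ∑ y, ((f x * f (x + k) : ℝ) : ℂ) * ((f y * f (y + k) : ℝ) : ℂ) *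
        phaseK S ξ k x y with hW
  have hη3 : η ^ 4 ≤ 1 := pow_le_one₀ hη.le (by linarith)
  have hb6 : b ^ 6 ≤ b ^ 2 := pow_le_pow_of_le_one hb0.le hb1 (by norm_num)
  have hb2 : b ^ 2 ≤ 1 := pow_le_one₀ hb0.le hb1
  have heb2 : e ≤ b ^ 2 := by
    have := mul_le_mul hη3 hb6 (by positivity) zero_le_one
    have : 0 ≤ b ^ 2 := by positivity
    linarith
  have hlow : η ^ 2 * b ^ 4 * N ^ 3 ≤ ∑ k, ‖W k‖ := by
    have h1 : η ^ 2 * b ^ 4 * N ^ 3 ≤ ∑ h ∈ S, ‖ftD f h (ξ h)‖ ^ 2 := by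
      have h3 := sum_le_sum hS
      rw [sum_const, nsmul_eq_mul] at h3
      refine le_trans ?_ h3
      have := mul_le_mul_of_nonneg_right hcard (show 0 ≤ η * b ^ 4 * N ^ 2 by positivity)
      linarith
    refine h1.trans ?_
    have h4 := sum_norm_sq_ftD f S ξ
    have h5 : ‖((∑ h ∈ S, ‖ftD f h (ξ h)‖ ^ 2 : ℝ) : ℂ)‖ = ∑ h ∈ S, ‖ftD f h (ξ h)‖ ^ 2 := by
      rw [Complex.norm_real, Real.norm_of_nonneg (sum_nonneg fun _ _ => sq_nonneg _)]
    rw [← h5, h4]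
    exact norm_sum_le _ _
  have hind : ∀ x : V, ‖indC S x‖ ≤ 1 := fun x => by
    simp only [indC]
    split_ifs <;> simp
  have hW1 : ∀ k, ‖W k‖ ≤ N ^ 2 := fun k => by
    refine norm_sum_sum_le_card_sq fun x y => ?_
    have h6 : ∀ x, ‖((f x * f (x + k) : ℝ) : ℂ)‖ ≤ 1 := fun x =>
      (ftD_supp h2 hf k x).trans (by split_ifs <;> norm_num)
    rw [norm_mul, norm_mul, phaseK, norm_mul, norm_ec, mul_one]
    exact mul_le_one₀ (mul_le_one₀ (h6 x) (norm_nonneg _) (h6 y)) (norm_nonneg _) (hind _)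
  have hW2 : ∀ k, Q.Generic k → ‖W k‖ ^ 4 ≤ 16 * b ^ 8 * N ^ 4 * T k := fun k hk => by
    have h7 := norm_sum_sum_pow_four_le (Q.shiftInter k) (Q.shiftInter k) (ftD_supp h2 hf k)
      (ftD_supp h2 hf k) (phaseK S ξ k)
    refine h7.trans (mul_le_mul_of_nonneg_right ?_ (hT0 k))
    have h8 := pow_le_pow_left₀ (Nat.cast_nonneg _) (card_shiftInter_le h2 he hQ hb heb2 hk) 4
    calc _ = ((Q.shiftInter k).card : ℝ) ^ 4 := by ring
      _ ≤ _ := h8.trans (le_of_eq (by ring))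
  have hbad := card_not_generic_le hQ
  rw [show (Fintype.card Λ : ℝ) = b⁻¹ by rw [hb, inv_inv]] at hbad
  rw [← sum_filter_add_sum_filter_not univ (fun k => Q.Generic k)] at hlow
  have h9 : ∑ k ∈ univ.filter (fun k => ¬ Q.Generic k), ‖W k‖ ≤ η ^ 2 * b ^ 4 * N ^ 3 / 2 := by
    refine (sum_le_sum fun k _ => hW1 k).trans ?_
    rw [sum_const, nsmul_eq_mul]
    refine (mul_le_mul_of_nonneg_right hbad (by positivity)).trans ?_
    have h10 : e ^ 2 ≤ (η ^ 4 * b ^ 6 / 32) ^ 2 := pow_le_pow_left₀ he heb 2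
    have h11 : b⁻¹ * e ^ 2 ≤ η ^ 2 * b ^ 4 / 2 := by
      rw [inv_mul_le_iff₀ hb0]
      have h12 : η ^ 8 ≤ η ^ 2 := pow_le_pow_of_le_one hη.le (by linarith) (by norm_num)
      have h13 : b ^ 12 ≤ b ^ 5 := pow_le_pow_of_le_one hb0.le hb1 (by norm_num)
      have h14 := mul_le_mul h12 h13 (by positivity) (by positivity)
      have h15 : 0 ≤ η ^ 2 * b ^ 5 := by positivity
      nlinarith
    have := mul_le_mul_of_nonneg_right h11 (show 0 ≤ N ^ 3 by positivity)
    linarith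
  have h16 : η ^ 2 * b ^ 4 * N ^ 3 / 2 ≤ ∑ k ∈ univ.filter (fun k => Q.Generic k), ‖W k‖ := by
    linarith
  have h18 : (∑ k ∈ univ.filter (fun k => Q.Generic k), ‖W k‖) ^ 4 ≤
      N ^ 3 * (16 * b ^ 8 * N ^ 4 * ∑ k, T k) := by
    rw [sum_filter]
    refine (sum_pow_four_le_card_mul _).trans ?_
    rw [mul_sum (a := 16 * b ^ 8 * N ^ 4)]
    refine mul_le_mul_of_nonneg_left (sum_le_sum fun k _ => ?_) (by positivity)
    by_cases hk : Q.Generic k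
    · rw [if_pos hk]
      exact hW2 k hk
    · rw [if_neg hk, zero_pow (by norm_num)]
      exact mul_nonneg (by positivity) (hT0 k)
  have h19 := (pow_le_pow_left₀ (by positivity) h16 4).trans h18
  have h20 : 0 < 16 * b ^ 8 * N ^ 7 := by positivity
  refine le_of_mul_le_mul_left ?_ h20
  calc _ = (η ^ 2 * b ^ 4 * N ^ 3 / 2) ^ 4 := by ring
    _ ≤ _ := h19.trans (le_of_eq (by ring))

/-- The parallelograms in `S` on which the frequencies are additive up to the quadratic forms. -/
noncomputable def goodTriples (Q : QSys p V Λ) (S : Finset V) (ξ : V → Module.Dual (ZMod p) V) :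
    Finset (V × V × V) :=
  univ.filter fun t => (t.1 ∈ S ∧ t.2.1 ∈ S ∧ t.1 - t.2.2 ∈ S ∧ t.2.1 - t.2.2 ∈ S) ∧
    quadDefect ξ t.1 t.2.1 t.2.2 ∈ LinearMap.range (Q.form₃ t.1 t.2.1 t.2.2)

theorem le_card_goodTriples (h2 : (2 : ZMod p) ≠ 0) (he : 0 ≤ e) (hQ : Q.HighRank (e ^ 2))
    (hb : b = (Fintype.card Λ : ℝ)⁻¹) (hη : 0 < η) (hη1 : η ≤ 1 / 4) (heb : e ≤ η ^ 4 * b ^ 6 / 32)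
    (hf : ∀ x, |f x| ≤ if x ∈ Q.zeros then 1 else 0) {S : Finset V}
    {ξ : V → Module.Dual (ZMod p) V}
    (hS : ∀ h ∈ S, η * b ^ 4 * (Fintype.card V : ℝ) ^ 2 ≤ ‖ftD f h (ξ h)‖ ^ 2)
    (hcard : η * Fintype.card V ≤ S.card) :
    η ^ 8 / 2048 * (Fintype.card V : ℝ) ^ 3 ≤ (Q.goodTriples S ξ).card := by
  have hlow := le_sum_four_cycle_phaseK h2 he hQ hb hη hη1 heb hf hS hcard
  rw [sum_four_cycle_phaseK Q h2 S ξ] at hlow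
  set N : ℝ := (Fintype.card V : ℝ) with hN
  have hN1 : (1 : ℝ) ≤ N := Nat.one_le_cast.2 Fintype.card_pos
  have hb0 := inv_card_pos hb
  have hb1 := inv_card_le_one hb
  have hLb : (Fintype.card Λ : ℝ) = b⁻¹ := by rw [hb, inv_inv]
  have hη3 : η ^ 4 ≤ 1 := pow_le_one₀ hη.le (by linarith)
  have heb4 : e ≤ b ^ 4 := by
    have hb6 : b ^ 6 ≤ b ^ 4 := pow_le_pow_of_le_one hb0.le hb1 (by norm_num)
    have := mul_le_mul hη3 hb6 (by positivity) zero_le_one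
    have : 0 ≤ b ^ 4 := by positivity
    linarith
  have hterm : ∀ t : V × V × V, (if t.1 ∈ S ∧ t.2.1 ∈ S ∧ t.1 - t.2.2 ∈ S ∧ t.2.1 - t.2.2 ∈ S then
        ‖ft (indC (Q.shiftInter₃ t.1 t.2.1 t.2.2)) (quadDefect ξ t.1 t.2.1 t.2.2)‖ ^ 2 else 0) ≤
      (if t ∈ Q.goodTriples S ξ then 4 * b ^ 8 * N ^ 2 else 0) + e ^ 2 * N ^ 2 +
        (if ¬ Function.Injective (Q.form₃ t.1 t.2.1 t.2.2) then N ^ 2 else 0) := fun t => by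
    have hg0 : 0 ≤ if t ∈ Q.goodTriples S ξ then 4 * b ^ 8 * N ^ 2 else 0 := by
      split_ifs
      · positivity
      · exact le_rfl
    have he0 : 0 ≤ e ^ 2 * N ^ 2 := by positivity
    by_cases hs : t.1 ∈ S ∧ t.2.1 ∈ S ∧ t.1 - t.2.2 ∈ S ∧ t.2.1 - t.2.2 ∈ S
    swap
    · rw [if_neg hs]
      refine add_nonneg (add_nonneg hg0 he0) ?_
      by_cases hi : Function.Injective (Q.form₃ t.1 t.2.1 t.2.2)
      · rw [if_neg (not_not.2 hi)]
      · rw [if_pos hi]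
        positivity
    rw [if_pos hs]
    by_cases hi : Function.Injective (Q.form₃ t.1 t.2.1 t.2.2)
    · rw [if_neg (not_not.2 hi), add_zero]
      have h1 := norm_ft_slice_le h2 he hQ (Q.form₃ t.1 t.2.1 t.2.2)
        ((Q.c - Q.valL t.1).coprod ((Q.c - Q.valL t.2.1).coprod (Q.c - Q.valL t.2.2))) hi
        (quadDefect ξ t.1 t.2.1 t.2.2)
      rw [← shiftInter₃, Fintype.card_prod, Fintype.card_prod] at h1
      push_cast at h1
      rw [hLb, ← hN, show N / (b⁻¹ * (b⁻¹ * (b⁻¹ * b⁻¹))) = b ^ 4 * N by field_simp] at h1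
      by_cases hr : quadDefect ξ t.1 t.2.1 t.2.2 ∈ LinearMap.range (Q.form₃ t.1 t.2.1 t.2.2)
      · have hm : t ∈ Q.goodTriples S ξ := mem_filter.2 ⟨mem_univ _, hs, hr⟩
        rw [if_pos hm]
        rw [if_pos hr, mul_one] at h1
        have h3 := mul_le_mul_of_nonneg_right heb4 (show 0 ≤ N by positivity)
        have h4 := pow_le_pow_left₀ (norm_nonneg _) (h1.trans (add_le_add le_rfl h3)) 2
        refine h4.trans ?_
        have : (b ^ 4 * N + b ^ 4 * N) ^ 2 = 4 * b ^ 8 * N ^ 2 := by ring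
        linarith
      · rw [if_neg hr, mul_zero, zero_add] at h1
        have h4 := pow_le_pow_left₀ (norm_nonneg _) h1 2
        rw [mul_pow] at h4
        linarith
    · rw [if_pos hi]
      have h5 : ‖ft (indC (Q.shiftInter₃ t.1 t.2.1 t.2.2)) (quadDefect ξ t.1 t.2.1 t.2.2)‖ ≤ N := by
        refine (norm_ft_le (Q.shiftInter₃ t.1 t.2.1 t.2.2) (fun x => ?_) _).trans ?_
        · simp only [indC]
          split_ifs <;> simp
        · exact Nat.cast_le.2 (card_le_univ _)
      have h6 := pow_le_pow_left₀ (norm_nonneg _) h5 2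
      linarith
  have hsum := sum_le_sum fun t (_ : t ∈ (univ : Finset (V × V × V))) => hterm t
  rw [sum_add_distrib, sum_add_distrib, ← sum_filter (fun t => t ∈ Q.goodTriples S ξ),
    ← sum_filter (fun t : V × V × V => ¬ Function.Injective (Q.form₃ t.1 t.2.1 t.2.2)), sum_const,
    sum_const, sum_const, nsmul_eq_mul, nsmul_eq_mul, nsmul_eq_mul] at hsum
  simp_rw [Fintype.sum_prod_type] at hsum
  have hinj := card_not_injective_form₃_le hQ
  rw [hLb, ← hN] at hinj
  have hcg : ((univ.filter fun t => t ∈ Q.goodTriples S ξ).card : ℝ) =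
      (Q.goodTriples S ξ).card := by
    rw [filter_mem_eq_inter, univ_inter]
  rw [hcg] at hsum
  have hcu : ((univ : Finset (V × V × V)).card : ℝ) = N ^ 3 := by
    rw [card_univ, Fintype.card_prod, Fintype.card_prod]
    push_cast
    ring
  rw [hcu] at hsum
  have h7 := hlow.trans hsum
  have h8 := mul_le_mul_of_nonneg_right hinj (show 0 ≤ N ^ 2 by positivity)
  have h10 : e ^ 2 ≤ (η ^ 4 * b ^ 6 / 32) ^ 2 := pow_le_pow_left₀ he heb 2
  have h11 : e ^ 2 + b⁻¹ ^ 3 * e ^ 2 ≤ η ^ 8 * b ^ 8 / 512 := by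
    have h12 : b⁻¹ ^ 3 * e ^ 2 ≤ η ^ 8 * b ^ 8 / 1024 := by
      rw [inv_pow, inv_mul_le_iff₀ (by positivity)]
      have h13 : b ^ 12 ≤ b ^ 11 := pow_le_pow_of_le_one hb0.le hb1 (by norm_num)
      have h14 := mul_le_mul_of_nonneg_left h13 (show 0 ≤ η ^ 8 by positivity)
      nlinarith
    have h13 : b ^ 12 ≤ b ^ 8 := pow_le_pow_of_le_one hb0.le hb1 (by norm_num)
    have h14 := mul_le_mul_of_nonneg_left h13 (show 0 ≤ η ^ 8 by positivity)
    nlinarith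
  have h15 := mul_le_mul_of_nonneg_right h11 (show 0 ≤ N ^ 5 by positivity)
  have h16 : 0 < 4 * b ^ 8 * N ^ 2 := by positivity
  refine le_of_mul_le_mul_right ?_ h16
  calc η ^ 8 / 2048 * N ^ 3 * (4 * b ^ 8 * N ^ 2) = η ^ 8 * b ^ 8 * N ^ 5 / 512 := by ring
    _ ≤ _ := by linarith

end QSys

lemma exists_choice_of_le_card {W X Y : Type*} [Fintype W] [Fintype X] [Fintype Y] [Nonempty Y]
    (P : W → X → Y → Prop) {κ : ℝ}
    (h : κ * Fintype.card Y ≤ (univ.filter fun t : W × X × Y => P t.1 t.2.1 t.2.2).card) :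
    ∃ y : W → Y, κ ≤ (univ.filter fun t : W × X => P t.1 t.2 (y t.1)).card := by
  have h1 : ∀ w, ∃ y : Y, ∀ z, (∑ x, if P w x z then (1 : ℝ) else 0) ≤
      ∑ x, if P w x y then 1 else 0 :=
    fun w => Finite.exists_max _
  choose y hy using h1
  refine ⟨y, ?_⟩
  have hY : (0 : ℝ) < Fintype.card Y := Nat.cast_pos.2 Fintype.card_pos
  refine le_of_mul_le_mul_right (h.trans ?_) hY
  rw [← sum_boole, ← sum_boole, Fintype.sum_prod_type, Fintype.sum_prod_type, sum_mul]
  refine sum_le_sum fun w _ => ?_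
  rw [Fintype.sum_prod_type, sum_comm]
  refine (sum_le_sum fun z _ => hy w z).trans (le_of_eq ?_)
  rw [sum_const, nsmul_eq_mul, card_univ, mul_comm]

section RectConfigs

variable {V : Type*} [AddCommGroup V] [Fintype V]

lemma pow_mul_le_card_four_cycles {W X Y : Type*} [Fintype W] [Fintype X] [Fintype Y]
    [Nonempty W] [Nonempty X] [Nonempty Y] {T : W → X → Y → Prop} {γ : ℝ} (hγ : 0 ≤ γ)
    (hT : γ * (Fintype.card W * Fintype.card X * Fintype.card Y) ≤
      (univ.filter fun t : W × X × Y => T t.1 t.2.1 t.2.2).card) :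
    γ ^ 4 * (Fintype.card W * Fintype.card X ^ 2 * Fintype.card Y ^ 2) ≤
      (univ.filter fun t : W × X × X × Y × Y => T t.1 t.2.1 t.2.2.2.1 ∧ T t.1 t.2.1 t.2.2.2.2 ∧
        T t.1 t.2.2.1 t.2.2.2.1 ∧ T t.1 t.2.2.1 t.2.2.2.2).card := by
  have hW : (0 : ℝ) < Fintype.card W := Nat.cast_pos.2 Fintype.card_pos
  have hX : (0 : ℝ) < Fintype.card X := Nat.cast_pos.2 Fintype.card_pos
  have hY : (0 : ℝ) < Fintype.card Y := Nat.cast_pos.2 Fintype.card_pos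
  have h1 := sum_pow_four_le_sum_sum_four_cycle fun w x y => if T w x y then (1 : ℝ) else 0
  rw [← sum_boole] at hT ⊢
  simp_rw [Fintype.sum_prod_type] at hT ⊢
  have h2 := (pow_le_pow_left₀ (by positivity) hT 4).trans h1
  refine le_of_mul_le_mul_left (a := (Fintype.card W : ℝ) ^ 3 *
    (Fintype.card X ^ 2 * Fintype.card Y ^ 2)) ?_ (by positivity)
  refine (le_of_eq (by ring)).trans (h2.trans (mul_le_mul_of_nonneg_left ?_ (by positivity)))
  refine le_of_eq (sum_congr rfl fun w _ => sum_congr rfl fun x _ => sum_congr rfl fun x' _ =>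
    sum_congr rfl fun y _ => sum_congr rfl fun y' _ => ?_)
  by_cases h3 : T w x y <;> by_cases h4 : T w x y' <;> by_cases h5 : T w x' y <;>
    by_cases h6 : T w x' y' <;> simp [h3, h4, h5, h6]

/-- The four points `(x_i, y_j)` with `x_0 = X`, `x_0 + y_0 = p`, `x_0 + y_1 = q` and total `w`. -/
def IsRect (E : Finset (V × V)) (w p q X : V) : Prop :=
  (X, p - X) ∈ E ∧ (X, q - X) ∈ E ∧ (w - q - p + X, p - X) ∈ E ∧ (w - q - p + X, q - X) ∈ E

lemma pow_four_mul_le_sum_isRect {E : Finset (V × V)} {γ : ℝ} (hγ : 0 ≤ γ)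
    (hE : γ * (Fintype.card V : ℝ) ^ 2 ≤ E.card) :
    γ ^ 4 * (Fintype.card V : ℝ) ^ 4 ≤ ∑ w, ∑ p, ∑ q, ∑ X,
      if IsRect E w p q X then (1 : ℝ) else 0 := by
  have h1 := pow_mul_le_card_four_cycles (W := Unit) (T := fun _ x y => (x, y) ∈ E) hγ (by
    refine le_trans (le_of_eq ?_) (hE.trans (Nat.cast_le.2 (card_le_card_of_injOn
      (fun e => ((), e)) (fun e he => by simpa using he) fun e _ e' _ h => by simpa using h)))
    simp [sq])
  rw [Fintype.card_unit, Nat.cast_one, one_mul, ← pow_add, ← sum_boole] at h1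
  simp_rw [Fintype.sum_prod_type] at h1
  refine h1.trans (le_of_eq ?_)
  rw [Fintype.sum_unique]
  have hrot : ∀ F : V → V → V → V → ℝ, ∑ w, ∑ p, ∑ q, ∑ X, F w p q X =
      ∑ X, ∑ p, ∑ q, ∑ w, F w p q X :=
    fun F => by
      let σ : V × V × V × V → V × V × V × V := fun t => (t.2.2.2, t.2.1, t.2.2.1, t.1)
      calc _ = ∑ t : V × V × V × V, F t.1 t.2.1 t.2.2.1 t.2.2.2 := by
            simp_rw [Fintype.sum_prod_type]
        _ = ∑ t : V × V × V × V, F t.2.2.2 t.2.1 t.2.2.1 t.1 :=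
            Fintype.sum_equiv ⟨σ, σ, fun _ => rfl, fun _ => rfl⟩ _ _ fun _ => rfl
        _ = _ := by
            simp_rw [Fintype.sum_prod_type]
  conv_rhs => rw [hrot]
  refine sum_congr rfl fun x _ => ?_
  rw [sum_comm]
  refine Fintype.sum_equiv (Equiv.addLeft x) _ _ fun y => ?_
  rw [sum_comm]
  refine Fintype.sum_equiv (Equiv.addLeft x) _ _ fun y' => ?_
  refine Fintype.sum_equiv (Equiv.addRight (x + y' + y)) _ _ fun x' => ?_
  have hiff : ((x, y) ∈ E ∧ (x, y') ∈ E ∧ (x', y) ∈ E ∧ (x', y') ∈ E) ↔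
      IsRect E (x' + (x + y' + y)) (x + y) (x + y') x := by
    rw [IsRect, show x' + (x + y' + y) - (x + y') - (x + y) + x = x' by abel,
      add_sub_cancel_left, add_sub_cancel_left]
  by_cases h : (x, y) ∈ E ∧ (x, y') ∈ E ∧ (x', y) ∈ E ∧ (x', y') ∈ E
  · exact (if_pos h).trans (if_pos (hiff.1 h)).symm
  · exact (if_neg h).trans (if_neg fun h' => h (hiff.2 h')).symm

lemma pow_mul_le_card_isRect {E : Finset (V × V)} {γ : ℝ} (hγ : 0 ≤ γ)
    (hE : γ * (Fintype.card V : ℝ) ^ 2 ≤ E.card) :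
    γ ^ 16 * (Fintype.card V : ℝ) ^ 9 ≤ (univ.filter
      fun t : (V × V × V × V × V) × V × V × V × V =>
        IsRect E t.1.1 t.1.2.1 t.1.2.2.2.1 t.2.1 ∧ IsRect E t.1.1 t.1.2.1 t.1.2.2.2.2 t.2.2.1 ∧
        IsRect E t.1.1 t.1.2.2.1 t.1.2.2.2.1 t.2.2.2.1 ∧
        IsRect E t.1.1 t.1.2.2.1 t.1.2.2.2.2 t.2.2.2.2).card := by
  have h1 := pow_four_mul_le_sum_isRect hγ hE
  have h2 := sum_pow_four_le_sum_sum_four_cycle fun w p q : V =>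
    ∑ X, if IsRect E w p q X then (1 : ℝ) else 0
  have h3 := (pow_le_pow_left₀ (by positivity) h1 4).trans h2
  have hN : (0 : ℝ) < Fintype.card V := Nat.cast_pos.2 Fintype.card_pos
  refine le_of_mul_le_mul_left (a := (Fintype.card V : ℝ) ^ 3 *
    (Fintype.card V ^ 2 * Fintype.card V ^ 2)) ?_ (by positivity)
  refine (le_of_eq (by ring)).trans (h3.trans (mul_le_mul_of_nonneg_left ?_ (by positivity)))
  rw [← sum_boole]
  simp_rw [Fintype.sum_prod_type]
  refine le_of_eq (sum_congr rfl fun w _ => sum_congr rfl fun p _ => sum_congr rfl fun p' _ =>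
    sum_congr rfl fun q _ => sum_congr rfl fun q' _ => ?_)
  simp_rw [sum_mul_sum]
  refine sum_congr rfl fun a _ => ?_
  rw [sum_comm]
  refine sum_congr rfl fun b _ => sum_congr rfl fun c _ => sum_congr rfl fun d _ => ?_
  by_cases h3 : IsRect E w p q a <;> by_cases h4 : IsRect E w p q' b <;>
    by_cases h5 : IsRect E w p' q c <;> by_cases h6 : IsRect E w p' q' d <;> simp [h3, h4, h5, h6]

end RectConfigs

namespace QSys

variable {p : ℕ} [Fact p.Prime] {V Λ : Type*} [AddCommGroup V] [Module (ZMod p) V] [Fintype V]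
  [AddCommGroup Λ] [Module (ZMod p) Λ] [Fintype Λ] {Q : QSys p V Λ} {e b γ : ℝ}

lemma isGen_five {ε : ℝ} (hQ : Q.HighRank ε) :
    IsGen ε fun (s : Λ × Λ × Λ × Λ × Λ) (t : V × V × V × V × V) =>
      Q.M s.1 t.1 + (Q.M s.2.1 t.2.1 + (Q.M s.2.2.1 t.2.2.1 + (Q.M s.2.2.2.1 t.2.2.2.1 +
        Q.M s.2.2.2.2 t.2.2.2.2))) := by
  have h2 := hQ.isGen.prod hQ.isGen
  have h3 := hQ.isGen.prod h2
  have h4 := hQ.isGen.prod h3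
  have h5 := hQ.isGen.prod h4
  exact h5

lemma isGen_nine {ε : ℝ} (hQ : Q.HighRank ε) :
    IsGen ε fun (s : (Λ × Λ × Λ × Λ × Λ) × Λ × Λ × Λ × Λ)
      (t : (V × V × V × V × V) × V × V × V × V) =>
      (Q.M s.1.1 t.1.1 + (Q.M s.1.2.1 t.1.2.1 + (Q.M s.1.2.2.1 t.1.2.2.1 +
        (Q.M s.1.2.2.2.1 t.1.2.2.2.1 + Q.M s.1.2.2.2.2 t.1.2.2.2.2)))) +
      (Q.M s.2.1 t.2.1 + (Q.M s.2.2.1 t.2.2.1 + (Q.M s.2.2.2.1 t.2.2.2.1 +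
        Q.M s.2.2.2.2 t.2.2.2.2))) := by
  have h2 := hQ.isGen.prod hQ.isGen
  have h3 := hQ.isGen.prod h2
  have h4 := hQ.isGen.prod h3
  have h5 := hQ.isGen.prod h4
  have h9 := h5.prod h4
  exact h9

/-- After removing the degenerate configurations at most half of a dense family is lost. -/
lemma IsGen.half_le_card {Θ X D : Type*} [Fintype X] [AddCommGroup D] [Zero Θ] [Fintype Θ]
    {ε κ : ℝ} {U : Θ → X → D} (h : IsGen ε U) (hε : 0 ≤ ε) {P R : X → Prop}
    [DecidablePred P] [DecidablePred R]
    (hεκ : Fintype.card Θ * ε ≤ κ / 2) (hP : κ * Fintype.card X ≤ (univ.filter P).card)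
    (hPR : ∀ t, P t → (∀ s, U s t = 0 → s = 0) → R t) :
    κ / 2 * Fintype.card X ≤ (univ.filter R).card := by
  have h1 := h.card_le hε fun _ => 0
  have h2 : univ.filter P ⊆ univ.filter R ∪ univ.filter fun t => ∃ s, s ≠ 0 ∧ U s t = 0 := by
    intro t ht
    rw [mem_union, mem_filter, mem_filter]
    by_cases h3 : ∃ s, s ≠ 0 ∧ U s t = 0
    · exact Or.inr ⟨mem_univ _, h3⟩
    · exact Or.inl ⟨mem_univ _, hPR t (mem_filter.1 ht).2 fun s hs =>
        by_contra fun h4 => h3 ⟨s, h4, hs⟩⟩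
  have h3 : ((univ.filter P).card : ℝ) ≤ (univ.filter R).card +
      (univ.filter fun t => ∃ s, s ≠ 0 ∧ U s t = 0).card := by
    exact_mod_cast (card_le_card h2).trans (card_union_le _ _)
  have h4 := mul_le_mul_of_nonneg_right hεκ (Nat.cast_nonneg (α := ℝ) (Fintype.card X))
  linarith

theorem exists_dense_pairs (hQ : Q.HighRank (e ^ 2)) (hb : b = (Fintype.card Λ : ℝ)⁻¹)
    (hγ : 0 < γ) (heb : e ^ 2 ≤ γ ^ 4 * b ^ 5 / 2) {S : Finset V} {ξ : V → Module.Dual (ZMod p) V}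
    (hS : γ * (Fintype.card V : ℝ) ^ 3 ≤ (Q.goodTriples S ξ).card) :
    ∃ c : V → Module.Dual (ZMod p) V, γ ^ 4 / 2 * (Fintype.card V : ℝ) ^ 2 ≤
      (univ.filter fun t : V × V => t.1 ∈ S ∧ t.2 ∈ S ∧ ∃ α β,
        ξ t.1 + ξ t.2 - c (t.1 + t.2) = Q.M α t.1 + Q.M β t.2).card := by
  have hL : (0 : ℝ) < Fintype.card Λ := Nat.cast_pos.2 Fintype.card_pos
  have hN : (0 : ℝ) < Fintype.card V := Nat.cast_pos.2 Fintype.card_pos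
  obtain ⟨T, hTdef⟩ : ∃ T : V → V → V → Prop, ∀ w x x', T w x x' ↔
      (x ∈ S ∧ x' ∈ S ∧ w - x ∈ S ∧ w - x' ∈ S) ∧
        ∃ s : Λ × Λ × Λ, ξ x + ξ (w - x) - (ξ x' + ξ (w - x')) =
          Q.M s.1 x + Q.M s.2.1 x' + Q.M s.2.2 w := ⟨_, fun _ _ _ => Iff.rfl⟩
  have h1 : γ * ((Fintype.card V : ℝ) * Fintype.card V * Fintype.card V) ≤
      (univ.filter fun t : V × V × V => T t.1 t.2.1 t.2.2).card := by
    refine le_trans (le_of_eq (by ring)) (hS.trans (Nat.cast_le.2 (card_le_card_of_injOn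
      (fun t => (t.1 + t.2.1 - t.2.2, t.1, t.2.1)) ?_ ?_)))
    · rintro ⟨a, c, d⟩ ht
      obtain ⟨⟨ha, hc, had, hcd⟩, s, hs⟩ := (mem_filter.1 (mem_coe.1 ht)).2
      refine mem_coe.2 (mem_filter.2 ⟨mem_univ _, (hTdef _ _ _).2
        ⟨⟨ha, hc, ?_, ?_⟩, (s.1 + s.2.2, s.2.1 + s.2.2, -s.2.2), ?_⟩⟩)
      · show a + c - d - a ∈ S
        rwa [show a + c - d - a = c - d by abel]
      · show a + c - d - c ∈ S
        rwa [show a + c - d - c = a - d by abel]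
      · show ξ a + ξ (a + c - d - a) - (ξ c + ξ (a + c - d - c)) = _
        rw [show a + c - d - a = c - d by abel, show a + c - d - c = a - d by abel]
        simp only [form₃_apply, quadDefect] at hs
        simp only [map_add, map_neg, map_sub, LinearMap.add_apply, LinearMap.neg_apply]
        rw [show ξ a + ξ (c - d) - (ξ c + ξ (a - d)) = ξ a - ξ c - ξ (a - d) + ξ (c - d) by abel,
          ← hs]
        abel
    · rintro ⟨a, c, d⟩ - ⟨a', c', d'⟩ - h
      simp only [Prod.mk.injEq] at h
      obtain ⟨h1, rfl, rfl⟩ := h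
      simpa using h1
  have h2 := pow_mul_le_card_four_cycles (T := T) hγ.le h1
  have h3 : ∀ w x x', ∃ s : Λ × Λ × Λ, T w x x' → ξ x + ξ (w - x) - (ξ x' + ξ (w - x')) =
      Q.M s.1 x + Q.M s.2.1 x' + Q.M s.2.2 w := fun w x x' => by
    by_cases h : T w x x'
    · obtain ⟨s, hs⟩ := ((hTdef _ _ _).1 h).2
      exact ⟨s, fun _ => hs⟩
    · exact ⟨0, fun h' => absurd h' h⟩
  choose s hs using h3
  obtain ⟨P, hP⟩ : ∃ P : V → V → V × V × V → Prop, ∀ w x y, P w x y ↔ T w x y.2.1 ∧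
      T w y.1 y.2.1 ∧ (s w x y.2.1).2.1 = (s w y.1 y.2.1).2.1 := ⟨_, fun _ _ _ => Iff.rfl⟩
  have h4 := IsGen.half_le_card (isGen_five hQ) (sq_nonneg e) (κ := γ ^ 4)
    (P := fun t : V × V × V × V × V => T t.1 t.2.1 t.2.2.2.1 ∧ T t.1 t.2.1 t.2.2.2.2 ∧
        T t.1 t.2.2.1 t.2.2.2.1 ∧ T t.1 t.2.2.1 t.2.2.2.2)
    (R := fun t => P t.1 t.2.1 t.2.2)
    (by
      simp only [Fintype.card_prod]
      push_cast
      rw [show (Fintype.card Λ : ℝ) = b⁻¹ by rw [hb, inv_inv]]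
      have hb0 : 0 < b := hb ▸ inv_pos.2 hL
      rw [show b⁻¹ * (b⁻¹ * (b⁻¹ * (b⁻¹ * b⁻¹))) * e ^ 2 = (b ^ 5)⁻¹ * e ^ 2 by
        rw [← inv_pow]; ring, inv_mul_le_iff₀ (by positivity)]
      linarith)
    (by
      refine le_trans (le_of_eq ?_) h2
      simp only [Fintype.card_prod]
      push_cast
      ring)
    (by
      rintro ⟨w, x, x₂, x', x₂'⟩ ⟨t1, t2, t3, t4⟩ hgen
      refine (hP _ _ _).2 ⟨t1, t3, ?_⟩
      have e1 := hs _ _ _ t1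
      have e2 := hs _ _ _ t2
      have e3 := hs _ _ _ t3
      have e4 := hs _ _ _ t4
      simp only [] at e1 e2 e3 e4 hgen ⊢
      have h5 := hgen ((s w x x').2.2 - (s w x x₂').2.2 - (s w x₂ x').2.2 + (s w x₂ x₂').2.2,
        (s w x x').1 - (s w x x₂').1, - (s w x₂ x').1 + (s w x₂ x₂').1,
        (s w x x').2.1 - (s w x₂ x').2.1, - (s w x x₂').2.1 + (s w x₂ x₂').2.1) (by
          simp only [map_add, map_sub, map_neg, LinearMap.add_apply, LinearMap.sub_apply,
            LinearMap.neg_apply]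
          linear_combination (norm := module) -e1 + e2 + e3 - e4)
      have h6 := congrArg (fun t => t.2.2.2.1) h5
      exact sub_eq_zero.1 h6)
  obtain ⟨y, hy⟩ := exists_choice_of_le_card (κ := γ ^ 4 / 2 * (Fintype.card V : ℝ) ^ 2)
    P (by
      refine le_trans (le_of_eq ?_) h4
      simp only [Fintype.card_prod]
      push_cast
      ring)
  refine ⟨fun w => ξ (y w).2.1 + ξ (w - (y w).2.1) + Q.M (s w (y w).1 (y w).2.1).2.1 (y w).2.1,
    hy.trans (Nat.cast_le.2 (card_le_card_of_injOn (fun t => (t.2, t.1 - t.2)) ?_ ?_))⟩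
  · rintro ⟨w, x⟩ ht
    obtain ⟨t1, -, t3⟩ := (hP _ _ _).1 (mem_filter.1 (mem_coe.1 ht)).2
    simp only [] at t1 t3
    refine mem_coe.2 (mem_filter.2 ⟨mem_univ _, ((hTdef _ _ _).1 t1).1.1,
        ((hTdef _ _ _).1 t1).1.2.2.1,
      (s w x (y w).2.1).1 + (s w x (y w).2.1).2.2, (s w x (y w).2.1).2.2, ?_⟩)
    have e1 := hs _ _ _ t1
    simp only [add_sub_cancel]
    rw [← t3]
    simp only [map_add, map_sub, LinearMap.add_apply]
    linear_combination (norm := module) e1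
  · rintro ⟨w, x⟩ - ⟨w', x'⟩ - h
    simp only [Prod.mk.injEq] at h
    obtain ⟨rfl, h1⟩ := h
    simpa using h1

end QSys

namespace QSys

variable {p : ℕ} [Fact p.Prime] {V Λ : Type*} [AddCommGroup V] [Module (ZMod p) V] [Fintype V]
  [AddCommGroup Λ] [Module (ZMod p) Λ] [Fintype Λ] {Q : QSys p V Λ} {e b γ : ℝ}

lemma isRect_relation {F₁ F₂ F₃ : V → Module.Dual (ZMod p) V} {E : Finset (V × V)}
    {α β : V → V → Λ} (hE : ∀ x y, (x, y) ∈ E →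
      F₁ x + F₂ y - F₃ (x + y) = Q.M (α x y) x + Q.M (β x y) y) {w u v x z y y' : V}
    (h : IsRect E w u v x) (hz : w - v - u + x = z) (hy : u - x = y) (hy' : v - x = y') :
    F₃ v + F₃ (w - v) - F₃ u - F₃ (w - u) =
      Q.M (α z y' - α z y) w +
      Q.M (β x y - β z y - (α z y' - α z y)) u +
      Q.M (β z y' - β x y' - (α z y' - α z y)) v +
      Q.M (α x y - α x y' + (α z y' - α z y) - (β x y - β z y) - (β z y' - β x y')) x := by
  obtain ⟨h1, h2, h3, h4⟩ := h
  rw [hz, hy] at h3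
  rw [hz, hy'] at h4
  rw [hy] at h1
  rw [hy'] at h2
  have e1 := hE _ _ h1
  have e2 := hE _ _ h2
  have e3 := hE _ _ h3
  have e4 := hE _ _ h4
  rw [show x + y = u by rw [← hy]; abel] at e1
  rw [show x + y' = v by rw [← hy']; abel] at e2
  rw [show z + y = w - v by rw [← hy, ← hz]; abel] at e3
  rw [show z + y' = w - u by rw [← hy', ← hz]; abel] at e4
  have e5 : ∀ s, Q.M s z = Q.M s w - Q.M s v - Q.M s u + Q.M s x := fun s => by
    rw [← hz, map_add, map_sub, map_sub]
  have e6 : ∀ s, Q.M s y = Q.M s u - Q.M s x := fun s => by rw [← hy, map_sub]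
  have e7 : ∀ s, Q.M s y' = Q.M s v - Q.M s x := fun s => by rw [← hy', map_sub]
  rw [e6] at e1
  rw [e7] at e2
  rw [e5, e6] at e3
  rw [e5, e7] at e4
  simp only [map_add, map_sub, LinearMap.add_apply, LinearMap.sub_apply]
  linear_combination (norm := module) e1 - e2 - e3 + e4

theorem exists_dense_additive (hQ : Q.HighRank (e ^ 2)) (hb : b = (Fintype.card Λ : ℝ)⁻¹)
    (hγ : 0 < γ) (heb : e ^ 2 ≤ γ ^ 16 * b ^ 9 / 2) {F₁ F₂ F₃ : V → Module.Dual (ZMod p) V}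
    {E : Finset (V × V)} (hE : γ * (Fintype.card V : ℝ) ^ 2 ≤ E.card)
    (hF : ∀ t ∈ E, ∃ α β, F₁ t.1 + F₂ t.2 - F₃ (t.1 + t.2) = Q.M α t.1 + Q.M β t.2) :
    ∃ (a b k : V → Λ) (E' : Finset (V × V)), E' ⊆ E ∧
      γ ^ 16 / 2 * (Fintype.card V : ℝ) ^ 2 ≤ E'.card ∧ ∀ t ∈ E',
        (F₁ t.1 - Q.M (a t.1) t.1) + (F₂ t.2 - Q.M (b t.2) t.2) =
          F₃ (t.1 + t.2) + Q.M (k (t.1 + t.2)) (t.1 + t.2) := by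
  have hL : (0 : ℝ) < Fintype.card Λ := Nat.cast_pos.2 Fintype.card_pos
  have hN : (0 : ℝ) < Fintype.card V := Nat.cast_pos.2 Fintype.card_pos
  have h1 : ∀ x y, ∃ s : Λ × Λ, (x, y) ∈ E →
      F₁ x + F₂ y - F₃ (x + y) = Q.M s.1 x + Q.M s.2 y := fun x y => by
    by_cases h : (x, y) ∈ E
    · obtain ⟨α, β, h'⟩ := hF _ h
      exact ⟨(α, β), fun _ => h'⟩
    · exact ⟨0, fun h' => absurd h' h⟩
  choose s hs using h1
  obtain ⟨α, hα⟩ : ∃ α : V → V → Λ, ∀ x y, α x y = (s x y).1 := ⟨_, fun _ _ => rfl⟩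
  obtain ⟨β, hβ⟩ : ∃ β : V → V → Λ, ∀ x y, β x y = (s x y).2 := ⟨_, fun _ _ => rfl⟩
  have hrel : ∀ x y, (x, y) ∈ E → F₁ x + F₂ y - F₃ (x + y) = Q.M (α x y) x + Q.M (β x y) y :=
    fun x y h => by rw [hα, hβ]; exact hs x y h
  clear hs hα hβ
  obtain ⟨B, hB⟩ : ∃ B : V → V → V → V → Λ, ∀ w u v x, B w u v x =
      β x (u - x) - β (w - v - u + x) (u - x) -
        (α (w - v - u + x) (v - x) - α (w - v - u + x) (u - x)) := ⟨_, fun _ _ _ _ => rfl⟩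
  obtain ⟨R, hR⟩ : ∃ R : (V × V × V × V × V) × V × V × V × V → Prop, ∀ w u u' v v' x x₁ x₂ x₃,
      R ((w, u, u', v, v'), x, x₁, x₂, x₃) ↔ IsRect E w u v x ∧ B w u v x = B w u v' x₁ ∧
        α x (u - x) = β x (u - x) + (α x (v - x) - β x (v - x)) +
          (α (w - v - u + x) (u - x) - β (w - v - u + x) (u - x)) -
          (α (w - v - u + x) (v - x) - β (w - v - u + x) (v - x)) :=
    ⟨fun t => IsRect E t.1.1 t.1.2.1 t.1.2.2.2.1 t.2.1 ∧
      B t.1.1 t.1.2.1 t.1.2.2.2.1 t.2.1 = B t.1.1 t.1.2.1 t.1.2.2.2.2 t.2.2.1 ∧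
      α t.2.1 (t.1.2.1 - t.2.1) = β t.2.1 (t.1.2.1 - t.2.1) +
        (α t.2.1 (t.1.2.2.2.1 - t.2.1) - β t.2.1 (t.1.2.2.2.1 - t.2.1)) +
        (α (t.1.1 - t.1.2.2.2.1 - t.1.2.1 + t.2.1) (t.1.2.1 - t.2.1) -
          β (t.1.1 - t.1.2.2.2.1 - t.1.2.1 + t.2.1) (t.1.2.1 - t.2.1)) -
        (α (t.1.1 - t.1.2.2.2.1 - t.1.2.1 + t.2.1) (t.1.2.2.2.1 - t.2.1) -
          β (t.1.1 - t.1.2.2.2.1 - t.1.2.1 + t.2.1) (t.1.2.2.2.1 - t.2.1)),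
      fun _ _ _ _ _ _ _ _ _ => Iff.rfl⟩
  have h2 := IsGen.half_le_card (isGen_nine hQ) (sq_nonneg e) (κ := γ ^ 16) (R := R)
    (by
      simp only [Fintype.card_prod]
      push_cast
      rw [show (Fintype.card Λ : ℝ) = b⁻¹ by rw [hb, inv_inv]]
      have hb0 : 0 < b := hb ▸ inv_pos.2 hL
      rw [show b⁻¹ * (b⁻¹ * (b⁻¹ * (b⁻¹ * b⁻¹))) * (b⁻¹ * (b⁻¹ * (b⁻¹ * b⁻¹))) * e ^ 2 =
        (b ^ 9)⁻¹ * e ^ 2 by rw [← inv_pow]; ring, inv_mul_le_iff₀ (by positivity)]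
      linarith)
    (by
      refine le_trans (le_of_eq ?_) (pow_mul_le_card_isRect hγ.le hE)
      simp only [Fintype.card_prod]
      push_cast
      ring)
    (by
      rintro ⟨⟨w, u, u', v, v'⟩, x, x₁, x₂, x₃⟩ ⟨t1, t2, t3, t4⟩ hgen
      refine (hR _ _ _ _ _ _ _ _ _).2 ⟨t1, ?_⟩
      simp only [] at t1 t2 t3 t4 hgen
      have e1 := isRect_relation hrel t1 rfl rfl rfl
      have e2 := isRect_relation hrel t2 rfl rfl rfl
      have e3 := isRect_relation hrel t3 rfl rfl rfl
      have e4 := isRect_relation hrel t4 rfl rfl rfl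
      rw [← hB] at e1 e2 e3 e4
      set C := fun w u v x => β (w - v - u + x) (v - x) - β x (v - x) -
        (α (w - v - u + x) (v - x) - α (w - v - u + x) (u - x)) with hC
      set D := fun w u v x => α x (u - x) - α x (v - x) + (α (w - v - u + x) (v - x) -
        α (w - v - u + x) (u - x)) - (β x (u - x) - β (w - v - u + x) (u - x)) -
        (β (w - v - u + x) (v - x) - β x (v - x)) with hD
      set A := fun w u v x => α (w - v - u + x) (v - x) - α (w - v - u + x) (u - x) with hA
      have e1' : _ = Q.M (A w u v x) w + Q.M (B w u v x) u + Q.M (C w u v x) v +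
        Q.M (D w u v x) x := e1
      have e2' : _ = Q.M (A w u v' x₁) w + Q.M (B w u v' x₁) u + Q.M (C w u v' x₁) v' +
        Q.M (D w u v' x₁) x₁ := e2
      have e3' : _ = Q.M (A w u' v x₂) w + Q.M (B w u' v x₂) u' + Q.M (C w u' v x₂) v +
        Q.M (D w u' v x₂) x₂ := e3
      have e4' : _ = Q.M (A w u' v' x₃) w + Q.M (B w u' v' x₃) u' + Q.M (C w u' v' x₃) v' +
        Q.M (D w u' v' x₃) x₃ := e4
      have h5 := hgen ((A w u v x - A w u v' x₁ - A w u' v x₂ + A w u' v' x₃,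
        B w u v x - B w u v' x₁, -B w u' v x₂ + B w u' v' x₃, C w u v x - C w u' v x₂,
        -C w u v' x₁ + C w u' v' x₃), D w u v x, -D w u v' x₁, -D w u' v x₂, D w u' v' x₃) (by
          simp only [map_add, map_sub, map_neg, LinearMap.add_apply, LinearMap.sub_apply,
            LinearMap.neg_apply]
          linear_combination (norm := module) -e1' + e2' + e3' - e4')
      have h6 := congrArg (fun t => t.1.2.1) h5
      have h7 := congrArg (fun t => t.2.1) h5
      refine ⟨sub_eq_zero.1 h6, sub_eq_zero.1 (Eq.trans ?_ h7)⟩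
      simp only [hD]
      abel)
  let φ : (V × V × V × V × V) × V × V × V × V → V × V × V × V × V × V × V := fun t =>
    (t.1.1 - t.1.2.2.2.1 - t.1.2.1 + t.2.1, t.1.2.2.2.1 - t.2.1, t.1.2.2.2.2, t.2.2.1, t.1.2.2.1,
      t.2.2.2.1, t.2.2.2.2)
  obtain ⟨⟨z, y', v', x₁, r⟩, -, hr⟩ := exists_le_card_fiber_of_nsmul_le_card_of_maps_to
    (s := univ.filter R) (t := univ) (f := φ) (b := γ ^ 16 / 2 * (Fintype.card V : ℝ) ^ 2)
    (fun _ _ => mem_univ _) univ_nonempty (by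
      refine le_trans (le_of_eq ?_) h2
      rw [nsmul_eq_mul, card_univ]
      simp only [Fintype.card_prod]
      push_cast
      ring)
  set F := (univ.filter R).filter fun t => φ t = (z, y', v', x₁, r) with hFdef
  have hmem : ∀ w u u' v v'' x x₁' x₂ x₃, ((w, u, u', v, v''), x, x₁', x₂, x₃) ∈ F →
      IsRect E w u v x ∧ B w u v x = B w u v' x₁ ∧ w = z + y' + u ∧ v = y' + x ∧ v'' = v' ∧
        x₁' = x₁ ∧
      (u', x₂, x₃) = r ∧ w - v - u + x = z ∧ v - x = y' ∧
        α x (u - x) = β x (u - x) + (α x y' - β x y') + (α z (u - x) - β z (u - x)) -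
          (α z y' - β z y') := by
    intro w u u' v v'' x x₁' x₂ x₃ ht
    rw [hFdef, mem_filter, mem_filter, hR] at ht
    obtain ⟨⟨-, h3, h4, h5⟩, h6⟩ := ht
    simp only [φ, Prod.mk.injEq] at h6
    obtain ⟨h7, h8, rfl, rfl, h9⟩ := h6
    rw [h7, h8] at h5
    refine ⟨h3, h4, ?_, ?_, rfl, rfl, ?_, h7, h8, h5⟩
    · rw [← h7, ← h8]
      abel
    · rw [← h8]
      abel
    · rw [← h9]
  refine ⟨fun x => α x y' - β x y' + β z y', fun y => β z y - α z y + α z y',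
    fun u => B (z + y' + u) u v' x₁, F.image fun t => (t.2.1, t.1.2.1 - t.2.1), ?_, ?_, ?_⟩
  · intro t ht
    obtain ⟨⟨⟨w, u, u', v, v''⟩, x, x₁', x₂, x₃⟩, h3, rfl⟩ := mem_image.1 ht
    exact (hmem _ _ _ _ _ _ _ _ _ h3).1.1
  · rw [card_image_of_injOn]
    · exact hr
    · rintro ⟨⟨w, u, u', v, v''⟩, x, x₁', x₂, x₃⟩ h3 ⟨⟨w', u₁, u₁', v₁, v₁''⟩, x', x₁'',
        x₂', x₃'⟩ h4 h
      simp only [Prod.mk.injEq] at h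
      obtain ⟨rfl, h5⟩ := h
      obtain ⟨-, -, rfl, rfl, rfl, rfl, rfl, -⟩ := hmem _ _ _ _ _ _ _ _ _ (mem_coe.1 h3)
      obtain ⟨-, -, rfl, rfl, rfl, rfl, h6, -⟩ := hmem _ _ _ _ _ _ _ _ _ (mem_coe.1 h4)
      simp only [Prod.mk.injEq] at h6
      obtain ⟨rfl, rfl, rfl⟩ := h6
      have h7 : u = u₁ := by simpa using h5
      rw [h7]
  · intro t ht
    obtain ⟨⟨⟨w, u, u', v, v''⟩, x, x₁', x₂, x₃⟩, h3, rfl⟩ := mem_image.1 ht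
    obtain ⟨h4, h5, h6, -, -, -, -, h7, h8, h9⟩ := hmem _ _ _ _ _ _ _ _ _ h3
    have e1 := hrel _ _ h4.1
    simp only [add_sub_cancel] at e1 ⊢
    rw [← h6, ← h5, hB, h7, h8]
    rw [h9] at e1
    have e2 : ∀ s, Q.M s u = Q.M s x + Q.M s (u - x) := fun s => by rw [← map_add, add_sub_cancel]
    rw [e2]
    simp only [map_add, map_sub (Q.M), LinearMap.add_apply, LinearMap.sub_apply] at e1 ⊢
    linear_combination (norm := module) e1

end QSys

lemma mul_pow_le_pow_mul_pow {x y : ℝ} (hx : 0 ≤ x) (hx1 : x ≤ 1) (hy : 0 ≤ y) (hy1 : y ≤ 1)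
    {K i j : ℕ} (hi : i ≤ K) (hj : j ≤ K) : (x * y) ^ K ≤ x ^ i * y ^ j := by
  rw [mul_pow]
  exact mul_le_mul (pow_le_pow_of_le_one hx hx1 hi) (pow_le_pow_of_le_one hy hy1 hj)
    (by positivity) (by positivity)

namespace QSys

variable {p : ℕ} [Fact p.Prime] {V Λ : Type*} [AddCommGroup V] [Module (ZMod p) V] [Fintype V]
  [AddCommGroup Λ] [Module (ZMod p) Λ] [Fintype Λ] {Q : QSys p V Λ} {e b η : ℝ} {f : V → ℝ}
  [Fintype (Module.Dual (ZMod p) V)]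

/-- For a function with large local `U³` norm, the derivatives correlate with characters whose
frequency depends affinely on the direction. -/
theorem exists_affine_large_ftD (h2 : (2 : ZMod p) ≠ 0) (he : 0 ≤ e) (hQ : Q.HighRank (e ^ 2))
    (hb : b = (Fintype.card Λ : ℝ)⁻¹) (hη : 0 < η) (hη1 : η ≤ 1 / 4) (heb : e ≤ (η * b) ^ 1000)
    (hf : ∀ x, |f x| ≤ if x ∈ Q.zeros then 1 else 0)
    (hU : 1024 * η * U3pow8 (fun x => if x ∈ Q.zeros then (1 : ℝ) else 0) ≤ U3pow8 f) :
    ∃ (T : V →ₗ[ZMod p] Module.Dual (ZMod p) V) (c : Module.Dual (ZMod p) V) (S : Finset V),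
      (∀ h ∈ S, η * b ^ 4 * (Fintype.card V : ℝ) ^ 2 ≤ ‖ftD f h (T h + c)‖ ^ 2) ∧
      η ^ (913 * affExp p) * Fintype.card V ≤ S.card := by
  have hb0 := inv_card_pos hb
  have hb1 := inv_card_le_one hb
  have hη1' : η ≤ 1 := by linarith
  have hle : ∀ i j : ℕ, i ≤ 1000 → j ≤ 1000 → e ≤ η ^ i * b ^ j := fun i j hi hj =>
    heb.trans (mul_pow_le_pow_mul_pow hη.le hη1' hb0.le hb1 hi hj)
  have he1 : e ^ 2 ≤ e := by
    have := hle 0 0 (by norm_num) (by norm_num)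
    nlinarith
  have hsucc : ∀ k : ℕ, η ^ (k + 1) ≤ η ^ k / 2 := fun k => by
    rw [pow_succ]
    nlinarith [pow_pos hη k]
  have hgain : ∀ {r : ℝ}, 0 ≤ r → η ^ 6 * r ≤ r / 2048 := fun {r} hr => by
    have : η ^ 6 ≤ (1 / 4) ^ 6 := pow_le_pow_left₀ hη.le hη1 6
    nlinarith
  have hN : (0 : ℝ) < Fintype.card V := Nat.cast_pos.2 Fintype.card_pos
  have hsm : ∀ {r : ℝ}, 0 ≤ r → η ^ 6 * r ≤ r / 32 := fun {r} hr =>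
    (hgain hr).trans (by linarith)
  obtain ⟨ξ, S, -, hξ, hS⟩ := exists_large_ftD h2 he hQ hb hη hη1
    (hle 2 12 (by norm_num) (by norm_num)) hf hU
  have h3 := le_card_goodTriples h2 he hQ hb hη hη1 (by
    refine (hle 10 6 (by norm_num) (by norm_num)).trans ?_
    have := hsm (r := η ^ 4 * b ^ 6) (by positivity)
    rw [show η ^ 10 * b ^ 6 = η ^ 6 * (η ^ 4 * b ^ 6) by ring]
    exact this) hf hξ hS
  have h3' : η ^ 14 * (Fintype.card V : ℝ) ^ 3 ≤ (Q.goodTriples S ξ).card :=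
    le_trans (mul_le_mul_of_nonneg_right (by
      rw [show η ^ 14 = η ^ 6 * η ^ 8 by ring]
      exact hgain (by positivity)) (by positivity)) h3
  obtain ⟨c, hc⟩ := exists_dense_pairs hQ hb (pow_pos hη 14) (by
    refine he1.trans ((hle 57 5 (by norm_num) (by norm_num)).trans ?_)
    have := hsucc 56
    rw [← pow_mul, mul_div_right_comm]
    exact mul_le_mul_of_nonneg_right this (by positivity)) h3'
  set E := univ.filter fun t : V × V => t.1 ∈ S ∧ t.2 ∈ S ∧
    ∃ α β : Λ, ξ t.1 + ξ t.2 - c (t.1 + t.2) = Q.M α t.1 + Q.M β t.2 with hE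
  have hc' : η ^ 57 * (Fintype.card V : ℝ) ^ 2 ≤ E.card :=
    le_trans (mul_le_mul_of_nonneg_right (by rw [← pow_mul]; exact hsucc 56) (by positivity)) hc
  obtain ⟨a, a', k, E', hE', hcard, hadd⟩ := exists_dense_additive hQ hb (pow_pos hη 57) (by
    refine he1.trans ((hle 913 9 (by norm_num) (by norm_num)).trans ?_)
    have := hsucc 912
    rw [← pow_mul, mul_div_right_comm]
    exact mul_le_mul_of_nonneg_right this (by positivity)) hc'
    (fun t ht => (mem_filter.1 ht).2.2.2)
  have hcard' : η ^ 913 * (Fintype.card V : ℝ) ^ 2 ≤ E'.card :=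
    le_trans (mul_le_mul_of_nonneg_right (by rw [← pow_mul]; exact hsucc 912) (by positivity)) hcard
  obtain ⟨T, c', hT⟩ := exists_affine_of_dense_pairs (p := p) (S := S)
    (F₁ := fun x => ξ x - Q.M (a x) x) (F₂ := fun x => ξ x - Q.M (a' x) x)
    (F₃ := fun x => c x + Q.M (k x) x) (pow_pos hη 913)
    (fun t ht => (mem_filter.1 (hE' ht)).2.1) hcard' hadd
  refine ⟨T, c', _, fun h hh => ?_, by rw [pow_mul]; exact hT⟩
  obtain ⟨h4, h5⟩ := mem_filter.1 hh
  rw [← norm_ftD_add h2 hf h (T h + c') (a h), ← h5, sub_add_cancel]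
  exact hξ h h4

end QSys

namespace QSys

variable {p : ℕ} [Fact p.Prime] {V Λ : Type*} [AddCommGroup V] [Module (ZMod p) V] [Fintype V]
  [AddCommGroup Λ] [Module (ZMod p) Λ] [Fintype Λ] {Q : QSys p V Λ} {e b η : ℝ} {f : V → ℝ}

/-- The linear forms cutting out the intersection of the zero set with its reflection. -/
noncomputable def reflMap (Q : QSys p V Λ) (w : V) : Λ →ₗ[ZMod p] Module.Dual (ZMod p) V :=
  Q.M.flip w + (2 : ZMod p) • Q.l

lemma reflMap_apply (w : V) (s : Λ) : Q.reflMap w s = Q.M s w + (2 : ZMod p) • Q.l s := rfl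

/-- The intersection of the zero set with its image under `x ↦ w - x`. -/
noncomputable def reflInter (Q : QSys p V Λ) (w : V) : Finset V :=
  Q.slice (Q.reflMap w) (Q.valL w - Q.c)

lemma mem_reflInter (h2 : (2 : ZMod p) ≠ 0) {w x : V} :
    x ∈ Q.reflInter w ↔ x ∈ Q.zeros ∧ w - x ∈ Q.zeros := by
  rw [reflInter, slice, mem_filter]
  refine and_congr_right fun hx => ?_
  rw [mem_zeros] at hx ⊢
  simp only [LinearMap.ext_iff, LinearMap.flip_apply, LinearMap.sub_apply, LinearMap.zero_apply,
    Q.valL_sub h2, hx, reflMap_apply]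
  refine forall_congr' fun s => ?_
  constructor <;> intro h <;> linear_combination -h

lemma isGen_reflMap (hQ : Q.HighRank (e ^ 2)) : IsGen (e ^ 2) fun s w => Q.reflMap w s := by
  intro s hs z
  refine le_trans (Nat.cast_le.2 (card_le_card fun w hw => ?_))
    (hQ.isGen s hs (z - (2 : ZMod p) • Q.l s))
  exact mem_filter.2 ⟨mem_univ _, eq_sub_of_add_eq (mem_filter.1 hw).2⟩

lemma sum_norm_sq_ftD_linear (f : V → ℝ) (T : V →ₗ[ZMod p] Module.Dual (ZMod p) V)
    (c : Module.Dual (ZMod p) V) :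
    ((∑ h, ‖ftD f h (T h + c)‖ ^ 2 : ℝ) : ℂ) =
      ∑ w, ∑ x, (((f x * f (w - x) : ℝ) : ℂ) * ec (T w x - T x x + c x)) *
        ∑ y, (starRingEnd ℂ) (((f y * f (w - y) : ℝ) : ℂ) * ec (T w y - T y y + c y)) *
          ec ((T.flip - T) y x) := by
  have h1 : ∀ h, ((‖ftD f h (T h + c)‖ ^ 2 : ℝ) : ℂ) = ∑ x, ∑ y,
      ((f x * f (x + h) : ℝ) : ℂ) * ((f y * f (y + h) : ℝ) : ℂ) * ec ((T h + c) (x - y)) := by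
    intro h
    rw [ftD, ft, ofReal_normSq_sum]
    refine sum_congr rfl fun x _ => sum_congr rfl fun y _ => ?_
    rw [map_mul, Complex.conj_ofReal, map_sub, ec_sub]
    ring
  rw [Complex.ofReal_sum]
  simp_rw [h1, mul_sum]
  rw [sum_comm]
  conv_rhs => rw [sum_comm]
  refine sum_congr rfl fun x _ => ?_
  rw [sum_comm]
  conv_rhs => rw [sum_comm]
  refine sum_congr rfl fun y _ => ?_
  refine Fintype.sum_equiv (Equiv.addLeft (x + y)) _ _ fun h => ?_
  simp only [Equiv.coe_addLeft]
  rw [map_mul, Complex.conj_ofReal, conj_ec, show x + y + h - x = y + h by abel,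
    show x + y + h - y = x + h by abel]
  rw [show (T h + c) (x - y) = (T (x + y + h) x - T x x + c x) +
    (-(T (x + y + h) y - T y y + c y) + (T.flip - T) y x) by
      simp only [map_add, map_sub, LinearMap.add_apply, LinearMap.sub_apply, LinearMap.flip_apply]
      ring, ec_add (T (x + y + h) x - T x x + c x), ec_add (-(T (x + y + h) y - T y y + c y))]
  push_cast
  ring

lemma norm_sum_sum_sq_le (R : Finset V) {a a' : V → ℂ} (ha : ∀ x, ‖a x‖ ≤ if x ∈ R then 1 else 0)
    (ha' : ∀ x, ‖a' x‖ ≤ if x ∈ R then 1 else 0) (D : V →ₗ[ZMod p] Module.Dual (ZMod p) V) :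
    ‖∑ x, a x * ∑ y, a' y * ec (D y x)‖ ^ 2 ≤
      R.card * ∑ y ∈ R, ∑ y' ∈ R, ‖ft (indC R) (D (y - y'))‖ := by
  refine (norm_sum_mul_sq_le R ha _).trans (mul_le_mul_of_nonneg_left ?_ (Nat.cast_nonneg _))
  refine (sum_norm_sum_sq_le R R ha' fun x y => ec (D y x)).trans (le_of_eq ?_)
  refine sum_congr rfl fun y _ => sum_congr rfl fun y' _ => ?_
  rw [sum_finset_eq_sum_indC]
  simp only [ft, map_sub, LinearMap.sub_apply, ec_sub]

lemma sum_sum_sum_reflInter_le (h2 : (2 : ZMod p) ≠ 0) (he : 0 ≤ e) (hQ : Q.HighRank (e ^ 2))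
    (hb : b = (Fintype.card Λ : ℝ)⁻¹) (heb : e ≤ b ^ 2) [Fintype (Module.Dual (ZMod p) V)]
    (K : Finset V) :
    ∑ w, ∑ y ∈ Q.reflInter w, ∑ y' ∈ Q.reflInter w, (if y - y' ∈ K then (1 : ℝ) else 0) ≤
      K.card * (2 * b ^ 2 * Fintype.card V) ^ 2 +
        b⁻¹ * (e ^ 2 * Fintype.card V) * (Fintype.card V : ℝ) ^ 2 := by
  obtain ⟨i, hi⟩ : ∃ i : V → ℝ, ∀ x, i x = if x ∈ Q.zeros then 1 else 0 := ⟨_, fun _ => rfl⟩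
  have hR : ∀ (w : V) (g : V → ℝ), ∑ y ∈ Q.reflInter w, g y = ∑ y, i y * i (w - y) * g y := by
    intro w g
    rw [← sum_filter_add_sum_filter_not univ (· ∈ Q.reflInter w) fun y => i y * i (w - y) * g y,
      filter_mem_eq_inter, univ_inter, sum_eq_zero (s := univ.filter (· ∉ Q.reflInter w)), add_zero]
    · refine sum_congr rfl fun y hy => ?_
      rw [mem_reflInter h2] at hy
      simp [hi, hy]
    · intro y hy
      have := (mem_filter.1 hy).2
      rw [mem_reflInter h2] at this
      by_cases h : y ∈ Q.zeros <;> simp_all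
  have hS : ∀ k, ((Q.shiftInter k).card : ℝ) = ∑ y, i y * i (y + k) := by
    intro k
    rw [card_eq_sum_ones]
    push_cast
    rw [← sum_filter_add_sum_filter_not univ (· ∈ Q.shiftInter k) fun y => i y * i (y + k),
      filter_mem_eq_inter, univ_inter, sum_eq_zero (s := univ.filter (· ∉ Q.shiftInter k)),
        add_zero]
    · refine sum_congr rfl fun y hy => ?_
      rw [mem_shiftInter h2] at hy
      simp [hi, hy]
    · intro y hy
      have := (mem_filter.1 hy).2
      rw [mem_shiftInter h2] at this
      by_cases h : y ∈ Q.zeros <;> simp_all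
  have h3 : ∑ w, ∑ y ∈ Q.reflInter w, ∑ y' ∈ Q.reflInter w, (if y - y' ∈ K then (1 : ℝ) else 0) =
      ∑ k ∈ K, ((Q.shiftInter k).card : ℝ) ^ 2 := by
    have h5 : ∀ k, ((Q.shiftInter k).card : ℝ) ^ 2 =
        ∑ y, ∑ v, i y * i (y + k) * (i v * i (v + k)) := fun k => by
      rw [hS, sq, sum_mul_sum]
    obtain ⟨κ, hκ⟩ : ∃ κ : V → ℝ, ∀ k, (if k ∈ K then (1 : ℝ) else 0) = κ k := ⟨_, fun _ => rfl⟩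
    simp_rw [hR, h5, mul_sum, hκ]
    trans ∑ k, ∑ y, ∑ v, i y * i (y + k) * (i v * i (v + k)) * κ k
    · rw [sum_comm, sum_congr rfl fun y _ => sum_comm, sum_comm, sum_comm (s := univ (α := V))]
      conv_rhs => rw [sum_comm]
      rw [sum_comm]
      refine sum_congr rfl fun y' _ => ?_
      refine (Fintype.sum_equiv (Equiv.addLeft y') _ _ fun k => ?_).symm
      refine Fintype.sum_equiv (Equiv.addLeft (y' + k)) _ _ fun v => ?_
      simp only [Equiv.coe_addLeft]
      rw [show y' + k + v - (y' + k) = v by abel, show y' + k + v - y' = v + k by abel,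
        show y' + k - y' = k by abel]
      ring
    · simp only [← sum_mul, ← hκ]
      simp
  rw [h3, ← sum_filter_add_sum_filter_not K Q.Generic]
  have h4 : ∀ k, ((Q.shiftInter k).card : ℝ) ≤ Fintype.card V := fun k =>
    Nat.cast_le.2 (card_le_univ _)
  refine add_le_add ?_ ?_
  · refine (sum_le_card_nsmul _ _ ((2 * b ^ 2 * Fintype.card V) ^ 2) fun k hk =>
      pow_le_pow_left₀ (Nat.cast_nonneg _) (card_shiftInter_le h2 he hQ hb heb
        (mem_filter.1 hk).2) 2).trans ?_
    rw [nsmul_eq_mul]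
    exact mul_le_mul_of_nonneg_right (Nat.cast_le.2 (card_le_card (filter_subset _ _)))
      (sq_nonneg _)
  · refine (sum_le_card_nsmul _ _ ((Fintype.card V : ℝ) ^ 2) fun k _ =>
      pow_le_pow_left₀ (Nat.cast_nonneg _) (h4 k) 2).trans ?_
    rw [nsmul_eq_mul]
    refine mul_le_mul_of_nonneg_right ?_ (sq_nonneg _)
    refine le_trans (Nat.cast_le.2 (card_le_card fun k hk => ?_))
      ((card_not_generic_le hQ).trans (le_of_eq ?_))
    · exact mem_filter.2 ⟨mem_univ _, (mem_filter.1 hk).2⟩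
    · rw [hb, inv_inv]

end QSys

namespace QSys

variable {p : ℕ} [Fact p.Prime] {V Λ : Type*} [AddCommGroup V] [Module (ZMod p) V] [Fintype V]
  [AddCommGroup Λ] [Module (ZMod p) Λ] [Fintype Λ] {Q : QSys p V Λ} {e b η : ℝ} {f : V → ℝ}
  [Fintype (Module.Dual (ZMod p) V)]

lemma sum_sum_norm_ft_reflInter_le (h2 : (2 : ZMod p) ≠ 0) (he : 0 ≤ e) (hQ : Q.HighRank (e ^ 2))
    (hb : b = (Fintype.card Λ : ℝ)⁻¹) (heb : e ≤ b ^ 2) {w : V}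
    (hw : Function.Injective (Q.reflMap w)) (D : V →ₗ[ZMod p] Module.Dual (ZMod p) V) {K : Finset V}
    (hK : ∀ x, D x = 0 → x ∈ K) :
    (Q.reflInter w).card * ∑ y ∈ Q.reflInter w, ∑ y' ∈ Q.reflInter w,
        ‖ft (indC (Q.reflInter w)) (D (y - y'))‖ ≤
      2 * b ^ 4 * (Fintype.card V : ℝ) ^ 2 *
        (∑ y ∈ Q.reflInter w, ∑ y' ∈ Q.reflInter w, (if y - y' ∈ K then (1 : ℝ) else 0) +
          ∑ y, ∑ y', (if ∃ s, s ≠ 0 ∧ Q.reflMap w s = D (y - y') then (1 : ℝ) else 0)) +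
        2 * b ^ 2 * e * (Fintype.card V : ℝ) ^ 4 := by
  have hb0 := inv_card_pos hb
  set N := (Fintype.card V : ℝ) with hN
  have hN0 : 0 < N := Nat.cast_pos.2 Fintype.card_pos
  set R := Q.reflInter w with hR
  have h1 : (R.card : ℝ) ≤ 2 * b ^ 2 * N := by
    have h1 := card_slice_le h2 he hQ (Q.reflMap w) (Q.valL w - Q.c) hw
    rw [div_eq_mul_inv, mul_inv, ← hb] at h1
    refine h1.trans ?_
    nlinarith
  have h1' : (R.card : ℝ) ≤ N := Nat.cast_le.2 (card_le_univ _)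
  have h3 : ∀ d, ‖ft (indC R) (D d)‖ ≤ b ^ 2 * N * ((if d ∈ K then (1 : ℝ) else 0) +
      (if ∃ s, s ≠ 0 ∧ Q.reflMap w s = D d then (1 : ℝ) else 0)) + e * N := by
    intro d
    refine (norm_ft_slice_le h2 he hQ (Q.reflMap w) (Q.valL w - Q.c) hw (D d)).trans ?_
    rw [div_eq_mul_inv, mul_inv, ← hb, show N * (b * b) = b ^ 2 * N by ring]
    refine add_le_add (mul_le_mul_of_nonneg_left ?_ (by positivity)) le_rfl
    split_ifs with i1 i2 i3 i3 i2 i3 i3 <;> try norm_num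
    obtain ⟨s, hs⟩ := i1
    refine i3 ⟨s, fun h0 => i2 (hK d ?_), hs⟩
    rw [← hs, h0, map_zero]
  calc (R.card : ℝ) * ∑ y ∈ R, ∑ y' ∈ R, ‖ft (indC R) (D (y - y'))‖
      ≤ 2 * b ^ 2 * N * ∑ y ∈ R, ∑ y' ∈ R, (b ^ 2 * N * ((if y - y' ∈ K then (1 : ℝ) else 0) +
      (if ∃ s, s ≠ 0 ∧ Q.reflMap w s = D (y - y') then (1 : ℝ) else 0)) + e * N) :=
        mul_le_mul h1 (sum_le_sum fun y _ => sum_le_sum fun y' _ => h3 _)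
          (sum_nonneg fun _ _ => sum_nonneg fun _ _ => norm_nonneg _) (by positivity)
    _ = 2 * b ^ 4 * N ^ 2 * (∑ y ∈ R, ∑ y' ∈ R, (if y - y' ∈ K then (1 : ℝ) else 0) +
          ∑ y ∈ R, ∑ y' ∈ R, (if ∃ s, s ≠ 0 ∧ Q.reflMap w s = D (y - y') then (1 : ℝ) else 0)) +
        2 * b ^ 2 * e * N ^ 2 * (R.card * R.card) := by
      simp only [sum_add_distrib, ← mul_sum, sum_const, nsmul_eq_mul]
      ring
    _ ≤ _ := by
      refine add_le_add (mul_le_mul_of_nonneg_left (add_le_add le_rfl ?_) (by positivity)) ?_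
      · refine (sum_le_sum fun y _ => sum_le_sum_of_subset_of_nonneg (subset_univ R)
          fun _ _ _ => by positivity).trans (sum_le_sum_of_subset_of_nonneg (subset_univ R)
          fun _ _ _ => sum_nonneg fun _ _ => by positivity)
      · rw [show 2 * b ^ 2 * e * N ^ 4 = 2 * b ^ 2 * e * N ^ 2 * (N * N) by ring]
        exact mul_le_mul_of_nonneg_left (mul_le_mul h1' h1' (Nat.cast_nonneg _) hN0.le)
          (by positivity)

set_option maxHeartbeats 800000 in
/-- If the derivatives of a function on a quadratic zero set correlate with characters depending
linearly on the direction, then the bilinear form involved is symmetric on a large subspace. -/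
theorem le_card_ker_flip_sub (h2 : (2 : ZMod p) ≠ 0) (he : 0 ≤ e) (hQ : Q.HighRank (e ^ 2))
    (hb : b = (Fintype.card Λ : ℝ)⁻¹) (hη : 0 < η) (hη1 : η ≤ 1)
    (heb : 14 * e ≤ η ^ 2 * b ^ 9) (hf : ∀ x, |f x| ≤ if x ∈ Q.zeros then 1 else 0)
    {T : V →ₗ[ZMod p] Module.Dual (ZMod p) V} {c : Module.Dual (ZMod p) V}
    (hT : η * b ^ 4 * (Fintype.card V : ℝ) ^ 3 ≤ ∑ h, ‖ftD f h (T h + c)‖ ^ 2) {K : Finset V}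
    (hK : ∀ x, (T.flip - T) x = 0 → x ∈ K) :
    η ^ 2 / 16 * Fintype.card V ≤ K.card := by
  have hb0 := inv_card_pos hb
  have hb1 := inv_card_le_one hb
  set N := (Fintype.card V : ℝ) with hN
  have hN0 : 0 < N := Nat.cast_pos.2 Fintype.card_pos
  have h9 : η ^ 2 * b ^ 9 ≤ b ^ 2 := by
    calc η ^ 2 * b ^ 9 ≤ 1 * b ^ 2 := mul_le_mul (pow_le_one₀ hη.le hη1)
          (pow_le_pow_of_le_one hb0.le hb1 (by norm_num)) (by positivity) zero_le_one
      _ = b ^ 2 := one_mul _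
  have he2 : e ≤ b ^ 2 := by linarith
  have he1 : e ≤ 1 := he2.trans (pow_le_one₀ hb0.le hb1)
  set D := T.flip - T with hD
  set a : V → V → ℂ := fun w x => ((f x * f (w - x) : ℝ) : ℂ) * ec (T w x - T x x + c x) with ha
  set I : V → ℂ := fun w => ∑ x, a w x * ∑ y, (starRingEnd ℂ) (a w y) * ec (D y x) with hI
  have haR : ∀ w x, ‖a w x‖ ≤ if x ∈ Q.reflInter w then 1 else 0 := by
    intro w x
    rw [ha]
    simp only
    rw [norm_mul, norm_ec, mul_one, Complex.norm_real, Real.norm_eq_abs, abs_mul]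
    refine (mul_le_mul (hf x) (hf (w - x)) (abs_nonneg _) (by positivity)).trans (le_of_eq ?_)
    simp only [mem_reflInter h2]
    by_cases i1 : x ∈ Q.zeros <;> by_cases i2 : w - x ∈ Q.zeros <;> simp [i1, i2]
  have h3 : η * b ^ 4 * N ^ 3 ≤ ∑ w, ‖I w‖ := by
    refine hT.trans ?_
    have h3 := sum_norm_sq_ftD_linear f T c
    calc ∑ h, ‖ftD f h (T h + c)‖ ^ 2 = ‖((∑ h, ‖ftD f h (T h + c)‖ ^ 2 : ℝ) : ℂ)‖ := by
          rw [Complex.norm_real, Real.norm_eq_abs, abs_of_nonneg (by positivity)]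
      _ ≤ _ := by
          rw [h3]
          exact norm_sum_le _ _
  have h4 : (∑ w, ‖I w‖) ^ 2 ≤ N * ∑ w, ‖I w‖ ^ 2 := by
    have := sq_sum_le_card_mul_sum_sq (s := univ) (f := fun w => ‖I w‖)
    rwa [card_univ] at this
  have h5 : ∀ w, ‖I w‖ ^ 2 ≤ (Q.reflInter w).card * ∑ y ∈ Q.reflInter w, ∑ y' ∈ Q.reflInter w,
      ‖ft (indC (Q.reflInter w)) (D (y - y'))‖ := fun w =>
    norm_sum_sum_sq_le (Q.reflInter w) (haR w) (fun x => by
      rw [RCLike.norm_conj]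
      exact haR w x) D
  set C : V → ℝ := fun w => ∑ y ∈ Q.reflInter w, ∑ y' ∈ Q.reflInter w,
    (if y - y' ∈ K then (1 : ℝ) else 0) with hC
  set B : V → ℝ := fun w => ∑ y, ∑ y',
    (if ∃ s, s ≠ 0 ∧ Q.reflMap w s = D (y - y') then (1 : ℝ) else 0) with hB
  have hC0 : ∀ w, 0 ≤ C w := fun w => sum_nonneg fun _ _ => sum_nonneg fun _ _ => by positivity
  have hB0 : ∀ w, 0 ≤ B w := fun w => sum_nonneg fun _ _ => sum_nonneg fun _ _ => by positivity
  have h6 : ∀ w, ‖I w‖ ^ 2 ≤ 2 * b ^ 4 * N ^ 2 * (C w + B w) + 2 * b ^ 2 * e * N ^ 4 +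
      N ^ 4 * (if ¬ Function.Injective (Q.reflMap w) then 1 else 0) := by
    intro w
    by_cases hw : Function.Injective (Q.reflMap w)
    · rw [if_neg (not_not.2 hw), mul_zero, add_zero]
      exact (h5 w).trans (sum_sum_norm_ft_reflInter_le h2 he hQ hb he2 hw D hK)
    · rw [if_pos hw, mul_one]
      have h1' : ((Q.reflInter w).card : ℝ) ≤ N := Nat.cast_le.2 (card_le_univ _)
      have h7 : ∑ y ∈ Q.reflInter w, ∑ y' ∈ Q.reflInter w,
          ‖ft (indC (Q.reflInter w)) (D (y - y'))‖ ≤ N * (N * N) := by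
        refine (sum_le_card_nsmul _ _ (N * N) fun y _ =>
          (sum_le_card_nsmul _ _ N fun y' _ => ?_).trans ?_).trans ?_
        · refine (norm_ft_le (Q.reflInter w) (fun x => ?_) _).trans h1'
          simp only [indC]
          split_ifs <;> simp
        · rw [nsmul_eq_mul]
          exact mul_le_mul_of_nonneg_right h1' hN0.le
        · rw [nsmul_eq_mul]
          exact mul_le_mul_of_nonneg_right h1' (by positivity)
      have h8 := (h5 w).trans (mul_le_mul h1' h7 (sum_nonneg fun _ _ => sum_nonneg fun _ _ =>
        norm_nonneg _) hN0.le)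
      have h10 : 0 ≤ 2 * b ^ 4 * N ^ 2 * (C w + B w) + 2 * b ^ 2 * e * N ^ 4 :=
        add_nonneg (mul_nonneg (by positivity) (add_nonneg (hC0 w) (hB0 w))) (by positivity)
      nlinarith
  have h7 : ∑ w, C w ≤ K.card * (2 * b ^ 2 * N) ^ 2 + b⁻¹ * (e ^ 2 * N) * N ^ 2 :=
    sum_sum_sum_reflInter_le h2 he hQ hb he2 K
  have h8 : ∑ w, B w ≤ b⁻¹ * (e ^ 2 * N) * N ^ 2 := by
    rw [hB, sum_comm, sum_congr rfl fun y _ => sum_comm]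
    refine (sum_le_card_nsmul _ _ (N * (b⁻¹ * (e ^ 2 * N))) fun y _ =>
      (sum_le_card_nsmul _ _ (b⁻¹ * (e ^ 2 * N)) fun y' _ => ?_).trans ?_).trans ?_
    · rw [← sum_filter, sum_const, nsmul_eq_mul, mul_one]
      refine ((isGen_reflMap hQ).card_le (sq_nonneg e) fun _ => D (y - y')).trans (le_of_eq ?_)
      rw [hb, inv_inv]
    · rw [nsmul_eq_mul, card_univ]
    · rw [nsmul_eq_mul, card_univ]
      exact le_of_eq (by ring)
  have h10 : ∑ w, (if ¬ Function.Injective (Q.reflMap w) then (1 : ℝ) else 0) ≤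
      b⁻¹ * (e ^ 2 * N) := by
    rw [← sum_filter, sum_const, nsmul_eq_mul, mul_one]
    refine ((isGen_reflMap hQ).card_not_injective_le (sq_nonneg e)).trans (le_of_eq ?_)
    rw [hb, inv_inv]
  have h11 : ∑ w, ‖I w‖ ^ 2 ≤ 2 * b ^ 4 * N ^ 2 * (∑ w, C w + ∑ w, B w) +
      2 * b ^ 2 * e * N ^ 5 + N ^ 4 * (b⁻¹ * (e ^ 2 * N)) := by
    refine (sum_le_sum fun w _ => h6 w).trans ?_
    simp only [sum_add_distrib, ← mul_sum, sum_const, nsmul_eq_mul, card_univ]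
    rw [← hN]
    have := mul_le_mul_of_nonneg_left h10 (by positivity : 0 ≤ N ^ 4)
    nlinarith
  have h12 : (η * b ^ 4 * N ^ 3) ^ 2 ≤
      N * (8 * b ^ 8 * N ^ 4 * K.card + 7 * (e * b⁻¹) * N ^ 5) := by
    refine (pow_le_pow_left₀ (by positivity) h3 2).trans (h4.trans ?_)
    refine mul_le_mul_of_nonneg_left (h11.trans ?_) hN0.le
    have h13 : ∑ w, C w + ∑ w, B w ≤ K.card * (2 * b ^ 2 * N) ^ 2 +
      2 * (b⁻¹ * (e ^ 2 * N) * N ^ 2) := by linarith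
    have h14 := mul_le_mul_of_nonneg_left h13 (by positivity : 0 ≤ 2 * b ^ 4 * N ^ 2)
    have hb' : 1 ≤ b⁻¹ := (one_le_inv₀ hb0).2 hb1
    have e1 : e ^ 2 ≤ e := by nlinarith
    have e2 : b⁻¹ * e ^ 2 ≤ e * b⁻¹ := by rw [mul_comm]; gcongr
    have e3 : b ^ 4 * (b⁻¹ * e ^ 2) ≤ e * b⁻¹ := by
      calc b ^ 4 * (b⁻¹ * e ^ 2) ≤ 1 * (b⁻¹ * e ^ 2) :=
            mul_le_mul_of_nonneg_right (pow_le_one₀ hb0.le hb1) (by positivity)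
        _ ≤ e * b⁻¹ := by rw [one_mul]; exact e2
    have e4 : b ^ 2 * e ≤ e * b⁻¹ := by
      rw [mul_comm]
      exact mul_le_mul_of_nonneg_left ((pow_le_one₀ hb0.le hb1).trans hb') he
    have e5 : (4 * (b ^ 4 * (b⁻¹ * e ^ 2)) + 2 * (b ^ 2 * e) + b⁻¹ * e ^ 2) * N ^ 5 ≤
        7 * (e * b⁻¹) * N ^ 5 := mul_le_mul_of_nonneg_right (by linarith) (by positivity)
    calc _ ≤ 2 * b ^ 4 * N ^ 2 * (K.card * (2 * b ^ 2 * N) ^ 2 + 2 * (b⁻¹ * (e ^ 2 * N) * N ^ 2)) +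
          2 * b ^ 2 * e * N ^ 5 + N ^ 4 * (b⁻¹ * (e ^ 2 * N)) :=
          add_le_add (add_le_add h14 le_rfl) le_rfl
      _ = 8 * b ^ 8 * N ^ 4 * K.card +
          (4 * (b ^ 4 * (b⁻¹ * e ^ 2)) + 2 * (b ^ 2 * e) + b⁻¹ * e ^ 2) * N ^ 5 := by ring
      _ ≤ _ := add_le_add le_rfl e5
  have h13 : 7 * (e * b⁻¹) ≤ η ^ 2 * b ^ 8 / 2 := by
    rw [← div_eq_mul_inv, ← mul_div_assoc, div_le_iff₀ hb0]
    nlinarith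
  have h14 : 7 * (e * b⁻¹) * N ^ 5 ≤ η ^ 2 * b ^ 8 / 2 * N ^ 5 :=
    mul_le_mul_of_nonneg_right h13 (by positivity)
  have h15 : (8 * b ^ 8 * N ^ 5) * (η ^ 2 / 16 * N) ≤ (8 * b ^ 8 * N ^ 5) * K.card := by
    nlinarith
  exact le_of_mul_le_mul_left h15 (by positivity)

end QSys

namespace QSys

variable {p : ℕ} [Fact p.Prime] {V Λ : Type*} [AddCommGroup V] [Module (ZMod p) V] [Fintype V]
  [AddCommGroup Λ] [Module (ZMod p) Λ] [Fintype Λ] {Q : QSys p V Λ} {e b η : ℝ} {f : V → ℝ}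

lemma norm_ftD_eq_norm_corr (h2 : (2 : ZMod p) ≠ 0) (f : V → ℝ)
    (T : V →ₗ[ZMod p] Module.Dual (ZMod p) V) (c : Module.Dual (ZMod p) V) (h₀ : V) {k : V}
    (hk : (T.flip - T) k = 0) :
    ‖ftD f (h₀ + k) (T (h₀ + k) + c)‖ =
      ‖∑ x, ((f x : ℂ) * ec (T h₀ x + c x - 2⁻¹ * T x x)) *
        ((f (x + k + h₀) : ℂ) * ec (2⁻¹ * T (x + k) (x + k)))‖ := by
  have h1 : ftD f (h₀ + k) (T (h₀ + k) + c) * ec (2⁻¹ * T k k) =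
      ∑ x, ((f x : ℂ) * ec (T h₀ x + c x - 2⁻¹ * T x x)) *
        ((f (x + k + h₀) : ℂ) * ec (2⁻¹ * T (x + k) (x + k))) := by
    rw [ftD, ft, sum_mul]
    refine sum_congr rfl fun x _ => ?_
    have h3 : T x k = T k x := sub_eq_zero.1 (LinearMap.congr_fun hk x)
    rw [show x + (h₀ + k) = x + k + h₀ by abel]
    have h4 : (T (h₀ + k) + c) x + 2⁻¹ * T k k =
        (T h₀ x + c x - 2⁻¹ * T x x) + 2⁻¹ * T (x + k) (x + k) := by
      simp only [map_add, LinearMap.add_apply, h3]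
      field_simp
      ring
    have h5 := congrArg ec h4
    rw [ec_add, ec_add] at h5
    push_cast
    linear_combination (f x * f (x + k + h₀) : ℂ) * h5
  rw [← h1, norm_mul, norm_ec, mul_one]

variable [Fintype (Module.Dual (ZMod p) V)]

lemma sum_norm_ft_pow_four_zeros_le (h2 : (2 : ZMod p) ≠ 0) (he : 0 ≤ e) (hQ : Q.HighRank (e ^ 2))
    (hb : b = (Fintype.card Λ : ℝ)⁻¹) (heb : e ≤ b) (h₀ : V) {g : V → ℂ}
    (hg : ∀ x, ‖g x‖ ≤ if x + h₀ ∈ Q.zeros then 1 else 0) {m t : ℝ}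
    (hm : ∀ ξ : Module.Dual (ZMod p) V, ‖ft g ξ‖ ^ 2 ≤ m) (ht : 0 ≤ t) (het : 2 * b * e ≤ t ^ 2) :
    ∑ ξ : Module.Dual (ZMod p) V, ‖ft g ξ‖ ^ 4 ≤
      2 * b ^ 2 * (Fintype.card V : ℝ) ^ 2 * m + t * (Fintype.card V : ℝ) ^ 4 := by
  have hb0 := inv_card_pos hb
  set N := (Fintype.card V : ℝ) with hN
  have hN0 : 0 < N := Nat.cast_pos.2 Fintype.card_pos
  have hm0 : 0 ≤ m := (sq_nonneg _).trans (hm 0)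
  set R := univ.filter fun x => x + h₀ ∈ Q.zeros with hR
  have hRc : (R.card : ℝ) ≤ 2 * b * N := by
    refine le_trans (le_of_eq ?_) (card_zeros_le_two_mul h2 he hQ hb heb)
    rw [← card_image_of_injective R (add_left_injective h₀)]
    congr 2
    ext x
    simp only [hR, mem_image, mem_filter, mem_univ, true_and]
    exact ⟨fun ⟨y, hy, h⟩ => h ▸ hy, fun h => ⟨x - h₀, by simpa using h, by simp⟩⟩
  have hft : ∀ ζ : Module.Dual (ZMod p) V, ‖ft (indC R) ζ‖ ≤
      b * N * (if ζ ∈ (⊥ : Submodule (ZMod p) (Module.Dual (ZMod p) V)) then 1 else 0) + e * N := by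
    intro ζ
    refine le_trans (le_of_eq ?_) ((norm_ft_zeros_le h2 he hQ ζ).trans (le_of_eq ?_))
    · have h3 : ft (indC R) ζ = ft (indC Q.zeros) ζ * ec (-ζ h₀) := by
        rw [ft, ft, sum_mul]
        refine Fintype.sum_equiv (Equiv.addRight h₀) _ _ fun x => ?_
        simp only [Equiv.coe_addRight, indC, hR, mem_filter, mem_univ, true_and]
        rw [mul_assoc, ← ec_add, map_add, add_neg_cancel_right]
        by_cases hx : x + h₀ ∈ Q.zeros <;> simp [hx]
      rw [h3, norm_mul, norm_ec, mul_one]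
    · rw [div_eq_mul_inv, ← hb, mul_comm N b]
  have h4 := sum_norm_ft_pow_four_le R ⊥ (by positivity) he hft (g := g)
    (fun x => (hg x).trans (le_of_eq (by simp [hR]))) hm
  rw [Nat.card_unique, Nat.cast_one, mul_one] at h4
  set X := ∑ ξ : Module.Dual (ZMod p) V, ‖ft g ξ‖ ^ 4 with hX
  have hX0 : 0 ≤ X := sum_nonneg fun _ _ => by positivity
  refine le_add_of_sq_le (by positivity) (by positivity) (h4.trans ?_)
  calc R.card * (b * N * m * X + e * N ^ 7) ≤ 2 * b * N * (b * N * m * X + e * N ^ 7) :=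
        mul_le_mul_of_nonneg_right hRc (by positivity)
    _ = 2 * b ^ 2 * N ^ 2 * m * X + 2 * b * e * N ^ 8 := by ring
    _ ≤ 2 * b ^ 2 * N ^ 2 * m * X + t ^ 2 * N ^ 8 := by gcongr
    _ = _ := by ring

/-- A function on a quadratic zero set whose derivatives correlate with characters depending on the
direction via a bilinear form which is symmetric on a large subspace correlates with a quadratic
phase. -/
theorem exists_large_quadratic_ft (h2 : (2 : ZMod p) ≠ 0) (he : 0 ≤ e) (hQ : Q.HighRank (e ^ 2))
    (hb : b = (Fintype.card Λ : ℝ)⁻¹) (hη : 0 < η) (hη1 : η ≤ 1) (heb : 800 * e ≤ η ^ 4 * b ^ 7)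
    (hf : ∀ x, |f x| ≤ if x ∈ Q.zeros then 1 else 0)
    {T : V →ₗ[ZMod p] Module.Dual (ZMod p) V} {c : Module.Dual (ZMod p) V} {K : Finset V}
    (hK : ∀ x ∈ K, (T.flip - T) x = 0) {h₀ : V}
    (hT : η * b ^ 4 * (Fintype.card V : ℝ) ^ 3 ≤
      ∑ k ∈ K, ‖ftD f (h₀ + k) (T (h₀ + k) + c)‖ ^ 2) :
    ∃ ζ : Module.Dual (ZMod p) V, η ^ 2 * b ^ 2 * (Fintype.card V : ℝ) ^ 2 / 40 ≤
      ‖∑ x, (f x : ℂ) * ec (ζ x - 2⁻¹ * T x x)‖ ^ 2 := by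
  have hb0 := inv_card_pos hb
  have hb1 := inv_card_le_one hb
  have heb1 : 800 * e ≤ b ^ 7 := heb.trans (by
    have := pow_le_one₀ (n := 4) hη.le hη1
    have := pow_pos hb0 7
    nlinarith)
  have heb2 : e ≤ b := by
    have := pow_le_of_le_one hb0.le hb1 (n := 7) (by norm_num)
    linarith
  set N := (Fintype.card V : ℝ) with hN
  have hN0 : 0 < N := Nat.cast_pos.2 Fintype.card_pos
  set g₁ : V → ℂ := fun x => (f x : ℂ) * ec (T h₀ x + c x - 2⁻¹ * T x x) with hg₁
  set g₂ : V → ℂ := fun y => (f (y + h₀) : ℂ) * ec (2⁻¹ * T y y) with hg₂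
  have hn₁ : ∀ x, ‖g₁ x‖ ≤ if x + 0 ∈ Q.zeros then 1 else 0 := fun x => by
    rw [hg₁]
    simp only
    rw [norm_mul, norm_ec, mul_one, Complex.norm_real, add_zero]
    exact hf x
  have hn₂ : ∀ x, ‖g₂ x‖ ≤ if x + h₀ ∈ Q.zeros then 1 else 0 := fun x => by
    rw [hg₂]
    simp only
    rw [norm_mul, norm_ec, mul_one, Complex.norm_real]
    exact hf _
  have h3 : η * b ^ 4 * N ^ 3 ≤ ∑ u, ‖∑ x, g₁ x * g₂ (x + u)‖ ^ 2 := by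
    refine hT.trans ?_
    rw [sum_congr rfl fun k hk => by rw [norm_ftD_eq_norm_corr h2 f T c h₀ (hK k hk)]]
    exact sum_le_sum_of_subset_of_nonneg (subset_univ K) fun _ _ _ => sq_nonneg _
  have h4 : (η * b ^ 4 * N ^ 4) ^ 2 ≤ (∑ ξ : Module.Dual (ZMod p) V, ‖ft g₁ ξ‖ ^ 4) *
      ∑ ξ : Module.Dual (ZMod p) V, ‖ft g₂ ξ‖ ^ 4 := by
    calc (η * b ^ 4 * N ^ 4) ^ 2 = (N * (η * b ^ 4 * N ^ 3)) ^ 2 := by ring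
      _ ≤ (N * ∑ u, ‖∑ x, g₁ x * g₂ (x + u)‖ ^ 2) ^ 2 := by gcongr
      _ = (∑ ξ : Module.Dual (ZMod p) V, ‖ft g₁ (-ξ)‖ ^ 2 * ‖ft g₂ ξ‖ ^ 2) ^ 2 := by
        rw [sum_norm_corr_sq (p := p)]
      _ ≤ (∑ ξ : Module.Dual (ZMod p) V, (‖ft g₁ (-ξ)‖ ^ 2) ^ 2) *
          ∑ ξ : Module.Dual (ZMod p) V, (‖ft g₂ ξ‖ ^ 2) ^ 2 := sum_mul_sq_le_sq_mul_sq _ _ _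
      _ = _ := by
        simp only [← pow_mul]
        congr 1
        exact Equiv.sum_comp (Equiv.neg _) fun ξ : Module.Dual (ZMod p) V => ‖ft g₁ ξ‖ ^ 4
  have h5 : ∑ ξ : Module.Dual (ZMod p) V, ‖ft g₂ ξ‖ ^ 4 ≤ 10 * b ^ 4 * N ^ 4 := by
    refine (sum_norm_ft_pow_four_zeros_le h2 he hQ hb heb2 h₀ hn₂ (m := (2 * b * N) ^ 2)
      (t := 2 * b ^ 4) (fun ξ => ?_) (by positivity) ?_).trans (le_of_eq (by rw [← hN]; ring))
    · refine pow_le_pow_left₀ (norm_nonneg _) (le_trans ?_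
        (card_zeros_le_two_mul h2 he hQ hb heb2)) 2
      rw [ft]
      refine (norm_sum_le _ _).trans ?_
      simp_rw [norm_mul, norm_ec, mul_one]
      refine (sum_le_sum fun x _ => hn₂ x).trans (le_of_eq ?_)
      refine (Equiv.sum_comp (Equiv.addRight h₀) fun y =>
          if y ∈ Q.zeros then (1 : ℝ) else 0).trans ?_
      simp
    · nlinarith
  obtain ⟨ξ, hξ⟩ := Finite.exists_max fun ξ : Module.Dual (ZMod p) V => ‖ft g₁ ξ‖ ^ 2
  have h6 := sum_norm_ft_pow_four_zeros_le h2 he hQ hb heb2 0 hn₁ hξ (t := η ^ 2 * b ^ 4 / 20)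
    (by positivity) (by
      have := mul_le_mul_of_nonneg_left heb hb0.le
      calc 2 * b * e = (b * (800 * e)) / 400 := by ring
        _ ≤ (b * (η ^ 4 * b ^ 7)) / 400 := by gcongr
        _ = _ := by ring)
  refine ⟨T h₀ + c + ξ, ?_⟩
  have h7 : ft g₁ ξ = ∑ x, (f x : ℂ) * ec ((T h₀ + c + ξ) x - 2⁻¹ * T x x) := by
    rw [ft]
    refine sum_congr rfl fun x _ => ?_
    rw [hg₁]
    simp only
    rw [mul_assoc, ← ec_add]
    congr 2
    simp only [LinearMap.add_apply]
    ring
  rw [← h7]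
  set m := ‖ft g₁ ξ‖ ^ 2 with hm
  rw [← hN] at h6
  have h8 : (η * b ^ 4 * N ^ 4) ^ 2 ≤
      (2 * b ^ 2 * N ^ 2 * m + η ^ 2 * b ^ 4 / 20 * N ^ 4) * (10 * b ^ 4 * N ^ 4) :=
    h4.trans (mul_le_mul h6 h5 (sum_nonneg fun _ _ => by positivity) (by positivity))
  refine le_of_mul_le_mul_left (a := 20 * b ^ 6 * N ^ 6) ?_ (by positivity)
  linear_combination h8

end QSys

lemma exists_card_mul_le_sum_translate {V : Type*} [AddCommGroup V] [Fintype V] (K : Finset V)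
    (F : V → ℝ) : ∃ h₀, K.card * ∑ h, F h ≤ Fintype.card V * ∑ k ∈ K, F (h₀ + k) := by
  by_contra! h
  have h1 : ∑ h₀ : V, Fintype.card V * ∑ k ∈ K, F (h₀ + k) < ∑ _h₀ : V, K.card * ∑ h, F h :=
    sum_lt_sum_of_nonempty univ_nonempty fun h₀ _ => h h₀
  have h2 : ∀ k, ∑ x, F (x + k) = ∑ x, F x := fun k => Equiv.sum_comp (Equiv.addRight k) F
  rw [← mul_sum, sum_comm] at h1
  simp [h2] at h1

namespace QSys

variable {p : ℕ} [Fact p.Prime] {V Λ : Type*} [AddCommGroup V] [Module (ZMod p) V] [Fintype V]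
  [AddCommGroup Λ] [Module (ZMod p) Λ] [Fintype Λ] {Q : QSys p V Λ} {e b η : ℝ} {f : V → ℝ}
  [Fintype (Module.Dual (ZMod p) V)]

/-- The polynomial inverse theorem for the local `U³` norm on the zero set of a high rank quadratic
system. -/
theorem exists_quadratic_phase_of_large_U3 (h2 : (2 : ZMod p) ≠ 0) (he : 0 ≤ e)
    (hQ : Q.HighRank (e ^ 2)) (hb : b = (Fintype.card Λ : ℝ)⁻¹) (hη : 0 < η) (hη1 : η ≤ 1 / 4)
    (heb : e ≤ (η * b) ^ (12 * (913 * affExp p) + 1000))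
    (hf : ∀ x, |f x| ≤ if x ∈ Q.zeros then 1 else 0)
    (hU : 1024 * η * U3pow8 (fun x => if x ∈ Q.zeros then (1 : ℝ) else 0) ≤ U3pow8 f) :
    ∃ (S : V →ₗ[ZMod p] Module.Dual (ZMod p) V) (ζ : Module.Dual (ZMod p) V),
      (∀ x y, S x y = S y x) ∧ η ^ (3 * (913 * affExp p) + 8) * Q.zeros.card ≤
        ‖∑ x, (f x : ℂ) * ec (ζ x + S x x)‖ := by
  have hb0 := inv_card_pos hb
  have hb1 := inv_card_le_one hb
  have hη1' : η ≤ 1 := by linarith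
  set k := 913 * affExp p with hk
  clear_value k
  have hle : ∀ i j : ℕ, i ≤ 12 * k + 1000 → j ≤ 12 * k + 1000 → e ≤ η ^ i * b ^ j :=
    fun i j hi hj => heb.trans (mul_pow_le_pow_mul_pow hη.le hη1' hb0.le hb1 hi hj)
  have h4 : ∀ i j : ℕ, η ^ (i + j) * 4 ^ j ≤ η ^ i := fun i j => by
    rw [pow_add, mul_assoc, ← mul_pow]
    exact mul_le_of_le_one_right (by positivity) (pow_le_one₀ (by positivity) (by linarith))
  have heb' : e ≤ (η * b) ^ 1000 := heb.trans
    (pow_le_pow_of_le_one (by positivity) (mul_le_one₀ hη1' hb0.le hb1) (by omega))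
  obtain ⟨T, c, S, hS, hSc⟩ := exists_affine_large_ftD h2 he hQ hb hη hη1 heb' hf hU
  rw [← hk] at hSc
  have heb1 : e ≤ b := by simpa using hle 0 1 (by omega) (by omega)
  have hP := card_zeros_le_two_mul h2 he hQ hb heb1
  set N := (Fintype.card V : ℝ) with hN
  have hN0 : 0 < N := Nat.cast_pos.2 Fintype.card_pos
  have hsum : η ^ (k + 1) * b ^ 4 * N ^ 3 ≤ ∑ h, ‖ftD f h (T h + c)‖ ^ 2 := by
    calc η ^ (k + 1) * b ^ 4 * N ^ 3 = η ^ k * N * (η * b ^ 4 * N ^ 2) := by ring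
      _ ≤ S.card * (η * b ^ 4 * N ^ 2) := by gcongr
      _ = ∑ h ∈ S, η * b ^ 4 * N ^ 2 := by rw [sum_const, nsmul_eq_mul]
      _ ≤ ∑ h ∈ S, ‖ftD f h (T h + c)‖ ^ 2 := sum_le_sum hS
      _ ≤ _ := sum_le_sum_of_subset_of_nonneg (subset_univ S) fun _ _ _ => sq_nonneg _
  set K := univ.filter fun x => (T.flip - T) x = 0 with hKdef
  have hKc := le_card_ker_flip_sub h2 he hQ hb (pow_pos hη (k + 1))
    (pow_le_one₀ hη.le hη1') (by
      have h5 := hle (2 * k + 2 + 2) 9 (by omega) (by omega)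
      have h6 := h4 (2 * k + 2) 2
      rw [← pow_mul, show (k + 1) * 2 = 2 * k + 2 by ring]
      calc 14 * e ≤ 4 ^ 2 * (η ^ (2 * k + 2 + 2) * b ^ 9) := by
            have := h5.trans' he
            linarith
        _ = (η ^ (2 * k + 2 + 2) * 4 ^ 2) * b ^ 9 := by ring
        _ ≤ _ := by gcongr) hf hsum (K := K) (by simp [hKdef])
  rw [← hN] at hKc
  obtain ⟨h₀, hh₀⟩ := exists_card_mul_le_sum_translate K fun h => ‖ftD f h (T h + c)‖ ^ 2
  rw [← hN] at hh₀
  set τ := η ^ (3 * k + 3) / 16 with hτ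
  have hτ0 : 0 < τ := by positivity
  have hsumK : τ * b ^ 4 * N ^ 3 ≤ ∑ k ∈ K, ‖ftD f (h₀ + k) (T (h₀ + k) + c)‖ ^ 2 := by
    refine le_of_mul_le_mul_left (le_trans ?_ hh₀) hN0
    calc N * (τ * b ^ 4 * N ^ 3) = (η ^ (k + 1)) ^ 2 / 16 * N * (η ^ (k + 1) * b ^ 4 * N ^ 3) := by
          rw [hτ]
          ring
      _ ≤ _ := by gcongr
  obtain ⟨ζ, hζ⟩ := exists_large_quadratic_ft h2 he hQ hb hτ0
    ((div_le_self (by positivity) (by norm_num)).trans (pow_le_one₀ hη.le hη1')) (by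
      have h5 := hle (12 * k + 12 + 13) 7 (by omega) (by omega)
      have h6 := h4 (12 * k + 12) 13
      calc 800 * e ≤ 4 ^ 13 * (η ^ (12 * k + 12 + 13) * b ^ 7) / 65536 := by
            have := h5.trans' he
            linarith
        _ = (η ^ (12 * k + 12 + 13) * 4 ^ 13) * b ^ 7 / 65536 := by ring
        _ ≤ η ^ (12 * k + 12) * b ^ 7 / 65536 := by gcongr
        _ = _ := by
          rw [hτ]
          ring) hf (K := K) (by simp [hKdef]) hsumK
  refine ⟨(-(2⁻¹ * 2⁻¹) : ZMod p) • (T + T.flip), ζ, fun x y => ?_, ?_⟩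
  · simp only [LinearMap.smul_apply, LinearMap.add_apply, LinearMap.flip_apply, add_comm]
  · have h7 : ∀ x, ζ x + ((-(2⁻¹ * 2⁻¹) : ZMod p) • (T + T.flip)) x x = ζ x - 2⁻¹ * T x x := by
      intro x
      simp only [LinearMap.smul_apply, LinearMap.add_apply, LinearMap.flip_apply, smul_eq_mul]
      field_simp
      ring
    simp_rw [h7]
    refine le_of_sq_le_sq (le_trans ?_ hζ) (norm_nonneg _)
    have h6 := h4 (6 * k + 6) 10
    norm_num1 at h6
    have h8 : (η ^ (3 * k + 8)) ^ 2 = η ^ (6 * k + 6 + 10) := by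
      rw [← pow_mul]
      congr 1
      ring
    have h9 : (η ^ (3 * k + 3) / 16) ^ 2 = η ^ (6 * k + 6) / 256 := by
      rw [div_pow, ← pow_mul]
      norm_num1
      congr 2
      ring
    calc (η ^ (3 * k + 8) * (Q.zeros.card : ℝ)) ^ 2 ≤ (η ^ (3 * k + 8) * (2 * b * N)) ^ 2 := by
          gcongr
      _ = η ^ (6 * k + 6 + 10) * (4 * (b * N) ^ 2) := by
        rw [mul_pow, h8]
        ring
      _ ≤ η ^ (6 * k + 6) / 40960 * (4 * (b * N) ^ 2) := by
        gcongr
        have : 0 < η ^ (6 * k + 16) := by positivity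
        linarith
      _ = _ := by
        rw [hτ, h9]
        ring

end QSys

namespace QuadFactor

variable {p : ℕ} [Fact p.Prime] {n ℓ q : ℕ} (B : QuadFactor p n ℓ q)

/-- The linear functional `x ↦ dot x r`. -/
def dotL (r : Vec p n) : Module.Dual (ZMod p) (Vec p n) where
  toFun x := dot x r
  map_add' x y := add_dotProduct x y r
  map_smul' a x := smul_dotProduct a x r

lemma dotL_apply (r x : Vec p n) : dotL r x = dot x r := rfl

lemma exists_dotL_eq (ξ : Module.Dual (ZMod p) (Vec p n)) : ∃ r, dotL r = ξ := by
  refine ⟨fun i => ξ (Pi.single i 1), LinearMap.pi_ext' fun i => LinearMap.ext_ring ?_⟩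
  simp [dotL, dot, Pi.single_apply]

/-- The bilinear form of a matrix. -/
noncomputable def matL (M : Matrix (Fin n) (Fin n) (ZMod p)) :
    Vec p n →ₗ[ZMod p] Module.Dual (ZMod p) (Vec p n) :=
  Matrix.toLinearMap₂' (ZMod p) M

lemma matL_apply (M : Matrix (Fin n) (Fin n) (ZMod p)) (x y : Vec p n) :
    matL M x y = dot x (M.mulVec y) := Matrix.toLinearMap₂'_apply' M x y

lemma dot_mulVec_comm {M : Matrix (Fin n) (Fin n) (ZMod p)} (hM : M.IsSymm) (x y : Vec p n) :
    dot x (M.mulVec y) = dot y (M.mulVec x) := by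
  change x ⬝ᵥ M.mulVec y = y ⬝ᵥ M.mulVec x
  rw [Matrix.dotProduct_mulVec, ← Matrix.mulVec_transpose, hM.eq, dotProduct_comm]

/-- The common kernel of the linear forms of a factor. -/
def dir : Submodule (ZMod p) (Vec p n) := ⨅ i, LinearMap.ker (dotL (B.L i))

lemma mem_dir {x : Vec p n} : x ∈ B.dir ↔ ∀ i, dot x (B.L i) = 0 := by
  simp [dir, Submodule.mem_iInf, dotL_apply]

/-- The quadratic system cutting out, inside a coset of the common kernel of the linear forms, the
atom containing `x₀`. -/
noncomputable def sys (x₀ : Vec p n) : QSys p B.dir (Fin q → ZMod p) where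
  M := ∑ j, (LinearMap.proj j : (Fin q → ZMod p) →ₗ[ZMod p] ZMod p).smulRight
    ((2 : ZMod p) • (matL (B.Q j)).compl₁₂ B.dir.subtype B.dir.subtype)
  l := ∑ j, (LinearMap.proj j : (Fin q → ZMod p) →ₗ[ZMod p] ZMod p).smulRight
    ((2 : ZMod p) • (matL (B.Q j) x₀).comp B.dir.subtype)
  c := 0
  symm s x y := by
    simp [LinearMap.sum_apply, matL_apply, dot_mulVec_comm (B.symm _) (x : Vec p n) y]

lemma sys_M_apply (x₀ : Vec p n) (s : Fin q → ZMod p) (x y : B.dir) :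
    (B.sys x₀).M s x y = 2 * matL (∑ j, s j • B.Q j) x y := by
  simp only [sys, LinearMap.sum_apply, LinearMap.smulRight_apply, LinearMap.smul_apply,
    LinearMap.compl₁₂_apply, LinearMap.proj_apply, Submodule.subtype_apply, matL, map_sum, map_smul,
    mul_sum, smul_eq_mul]
  exact sum_congr rfl fun _ _ => by ring

lemma valL_sys_apply (h2 : (2 : ZMod p) ≠ 0) (x₀ : Vec p n) (x : B.dir) (s : Fin q → ZMod p) :
    (B.sys x₀).valL x s = ∑ j, s j * (B.betaQ (x₀ + x) (x₀ + x) j - B.betaQ x₀ x₀ j) := by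
  rw [QSys.valL_apply, sys_M_apply, ← mul_assoc, inv_mul_cancel₀ h2, one_mul]
  simp only [sys, LinearMap.sum_apply, LinearMap.smulRight_apply, LinearMap.smul_apply,
    LinearMap.proj_apply, LinearMap.comp_apply, Submodule.subtype_apply, matL, map_sum, map_smul,
    smul_eq_mul, LinearMap.zero_apply, add_zero]
  rw [← sum_add_distrib]
  refine sum_congr rfl fun j _ => ?_
  change s j * matL (B.Q j) x x + s j * (2 * matL (B.Q j) x₀ x) =
    s j * (dot (x₀ + x : Vec p n) ((B.Q j).mulVec (x₀ + x)) - dot x₀ ((B.Q j).mulVec x₀))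
  rw [← matL_apply, ← matL_apply]
  have h := dot_mulVec_comm (B.symm j) x x₀
  rw [← matL_apply, ← matL_apply] at h
  simp only [map_add, LinearMap.add_apply, h]
  ring

lemma mem_zeros_sys [Fintype B.dir] (h2 : (2 : ZMod p) ≠ 0) (x₀ : Vec p n) (x : B.dir) :
    x ∈ (B.sys x₀).zeros ↔ x₀ + (x : Vec p n) ∈ B.atom (B.betaB x₀) := by
  have h1 : B.betaL (x₀ + x) = B.betaL x₀ := by
    ext i
    have := B.mem_dir.1 x.2 i
    simp only [betaL]
    rw [← dotL_apply, map_add, dotL_apply, dotL_apply, this, add_zero]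
  rw [QSys.mem_zeros, atom, Set.mem_ofPred_eq, betaB, betaB, h1, Prod.mk.injEq,
    and_iff_right rfl]
  refine ⟨fun h => ?_, fun h => ?_⟩
  · ext j
    have h3 := LinearMap.congr_fun h (Pi.single j 1)
    rw [valL_sys_apply B h2, LinearMap.zero_apply] at h3
    simpa [Pi.single_apply, sub_eq_zero] using h3
  · refine LinearMap.ext fun s => ?_
    simp [valL_sys_apply B h2, h]

lemma sub_mem_dir {x₀ x : Vec p n} (hx : x ∈ B.atom (B.betaB x₀)) : x - x₀ ∈ B.dir := by
  rw [mem_dir]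
  intro i
  have h := congrFun (congrArg Prod.fst hx) i
  rw [← dotL_apply, map_sub, sub_eq_zero]
  exact h

lemma finrank_dir : n ≤ Module.finrank (ZMod p) B.dir + ℓ := by
  have h := LinearMap.finrank_range_add_finrank_ker (LinearMap.pi fun i => dotL (B.L i))
  rw [LinearMap.ker_pi, Module.finrank_fin_fun] at h
  have h1 := Submodule.finrank_le (LinearMap.range (LinearMap.pi fun i => dotL (B.L i)))
  rw [Module.finrank_fin_fun] at h1
  rw [dir]
  omega

lemma finrank_ker_sys_add_rank_le (h2 : (2 : ZMod p) ≠ 0) (x₀ : Vec p n) (s : Fin q → ZMod p) :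
    Module.finrank (ZMod p) (LinearMap.ker ((B.sys x₀).M s)) + (∑ j, s j • B.Q j).rank ≤ n + ℓ := by
  set M := ∑ j, s j • B.Q j with hM
  have hsym : M.IsSymm := by
    rw [Matrix.IsSymm, hM, Matrix.transpose_sum]
    exact sum_congr rfl fun j _ => by rw [Matrix.transpose_smul, (B.symm j).eq]
  set ι : LinearMap.ker ((B.sys x₀).M s) →ₗ[ZMod p] Vec p n :=
    B.dir.subtype.comp (LinearMap.ker ((B.sys x₀).M s)).subtype with hι
  have hι1 : Function.Injective ι := (Submodule.injective_subtype _).comp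
    (Submodule.injective_subtype _)
  set φ := (matL M).comp ι with hφ
  have hran : Module.finrank (ZMod p) (LinearMap.range φ) ≤ ℓ := by
    have h3 : LinearMap.range φ ≤ Submodule.span (ZMod p) (Set.range fun i => dotL (B.L i)) := by
      rintro _ ⟨x, rfl⟩
      refine mem_span_of_iInf_ker_le_ker fun y hy => ?_
      have h4 := LinearMap.congr_fun (LinearMap.mem_ker.1 x.2) ⟨y, hy⟩
      rw [sys_M_apply] at h4
      exact (mul_eq_zero.1 h4).resolve_left h2
    refine (Submodule.finrank_mono h3).trans ?_
    exact (finrank_range_le_card _).trans_eq (Fintype.card_fin ℓ)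
  have hker : Module.finrank (ZMod p) (LinearMap.ker φ) + M.rank ≤ n := by
    have h3 := LinearMap.finrank_range_add_finrank_ker M.mulVecLin
    rw [Module.finrank_fin_fun] at h3
    have h4 : Module.finrank (ZMod p) (LinearMap.ker φ) ≤
        Module.finrank (ZMod p) (LinearMap.ker M.mulVecLin) := by
      rw [((LinearMap.ker φ).equivMapOfInjective ι hι1).finrank_eq]
      refine Submodule.finrank_mono ?_
      rintro _ ⟨x, hx, rfl⟩
      rw [LinearMap.mem_ker, Matrix.mulVecLin_apply]
      refine dotProduct_eq_zero _ fun y => ?_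
      rw [dotProduct_comm]
      change dot y (M.mulVec (ι x)) = 0
      rw [dot_mulVec_comm hsym, ← matL_apply]
      exact LinearMap.congr_fun (LinearMap.mem_ker.1 hx) y
    rw [Matrix.rank]
    omega
  have := LinearMap.finrank_range_add_finrank_ker φ
  omega

lemma rank_le_rank_sum (hq : q ≠ 0) {s : Fin q → ZMod p} (hs : s ≠ 0) :
    B.rank ≤ (∑ j, s j • B.Q j).rank := by
  rw [rank, if_neg hq]
  exact Nat.sInf_le ⟨s, hs, rfl⟩

lemma highRank_sys [Fintype B.dir] (h2 : (2 : ZMod p) ≠ 0) (x₀ : Vec p n) {ε : ℝ}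
    (hε : q ≠ 0 → (p : ℝ) ^ (2 * ℓ) ≤ ε * (p : ℝ) ^ B.rank) : (B.sys x₀).HighRank ε := by
  intro s hs
  have hq : q ≠ 0 := by
    rintro rfl
    exact hs (Subsingleton.elim _ _)
  have hp : (1 : ℝ) ≤ p := by exact_mod_cast (Fact.out : p.Prime).one_le
  have hp0 : (0 : ℝ) < p := by linarith
  set K := LinearMap.ker ((B.sys x₀).M s) with hK
  have h1 : (univ.filter fun x => (B.sys x₀).M s x = 0).card =
      p ^ Module.finrank (ZMod p) K := by
    rw [← Fintype.card_subtype, ← Nat.card_eq_fintype_card]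
    have h := Module.natCard_eq_pow_finrank (K := ZMod p) (V := K)
    rw [Nat.card_zmod] at h
    exact h
  have h3 : Fintype.card B.dir = p ^ Module.finrank (ZMod p) B.dir := by
    rw [← Nat.card_eq_fintype_card]
    simpa using Module.natCard_eq_pow_finrank (K := ZMod p) (V := B.dir)
  rw [h1, h3]
  push_cast
  have h4 := B.finrank_ker_sys_add_rank_le h2 x₀ s
  rw [← hK] at h4
  have h5 := B.rank_le_rank_sum hq hs
  have h6 := B.finrank_dir
  refine le_of_mul_le_mul_right (a := (p : ℝ) ^ (B.rank + ℓ)) ?_ (by positivity)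
  have h7 := hε hq
  have hε0 : 0 ≤ ε := by
    by_contra! h
    have := mul_nonpos_of_nonpos_of_nonneg h.le (pow_nonneg hp0.le B.rank)
    have := pow_pos hp0 (2 * ℓ)
    linarith
  calc (p : ℝ) ^ Module.finrank (ZMod p) K * (p : ℝ) ^ (B.rank + ℓ)
      ≤ (p : ℝ) ^ (2 * ℓ + n) := by
        rw [← pow_add]
        exact pow_le_pow_right₀ hp (by omega)
    _ = (p : ℝ) ^ (2 * ℓ) * (p : ℝ) ^ n := pow_add _ _ _
    _ ≤ (ε * (p : ℝ) ^ B.rank) * (p : ℝ) ^ (Module.finrank (ZMod p) B.dir + ℓ) := by gcongr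
    _ = _ := by ring

end QuadFactor

lemma pow_le_mul_pow_of_logb_le {p : ℝ} (hp : 2 ≤ p) {ℓ q K k : ℕ} (hq : q ≠ 0) {δ C : ℝ}
    (hδ : 0 < δ) (hδ1 : δ < 1) (hC : 22 * K + 2 ≤ C)
    (hk : C * ((ℓ : ℝ) + q + Real.logb p δ⁻¹) ≤ k) :
    p ^ (2 * ℓ) ≤ ((δ ^ 8 / 1024 * (p ^ q)⁻¹) ^ K) ^ 2 * p ^ k := by
  have hp0 : 0 < p := by linarith
  have hp1 : 1 < p := by linarith
  set D := Real.logb p δ⁻¹ with hD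
  have hD0 : 0 ≤ D := Real.logb_nonneg hp1 (one_le_inv_iff₀.2 ⟨hδ, hδ1.le⟩)
  have hpD : p ^ D = δ⁻¹ := Real.rpow_logb hp0 hp1.ne' (inv_pos.2 hδ)
  set X := p ^ (11 * (q : ℝ) + 8 * D) with hX
  have hX' : X = p ^ q * (p ^ 10) ^ q * (δ⁻¹) ^ 8 := by
    rw [hX, Real.rpow_add hp0, mul_comm 8 D, Real.rpow_mul hp0.le D, hpD, ← pow_mul, ← pow_add,
      ← Real.rpow_natCast p, ← Real.rpow_natCast δ⁻¹]
    push_cast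
    ring_nf
  have h1 : 1 ≤ δ ^ 8 / 1024 * (p ^ q)⁻¹ * X := by
    have h2 : (1024 : ℝ) ≤ (p ^ 10) ^ q := by
      calc (1024 : ℝ) = 2 ^ 10 := by norm_num
        _ ≤ p ^ 10 := by gcongr
        _ ≤ (p ^ 10) ^ q := le_self_pow₀ (one_le_pow₀ hp1.le) hq
    have h3 : δ ^ 8 / 1024 * (p ^ q)⁻¹ * X = (p ^ 10) ^ q / 1024 := by
      rw [hX']
      field_simp
    rw [h3, one_le_div (by norm_num)]
    exact h2
  have h4 : p ^ (2 * ℓ) * X ^ (K * 2) ≤ p ^ k := by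
    rw [hX, ← Real.rpow_natCast (p ^ _), ← Real.rpow_mul hp0.le, ← Real.rpow_natCast p (2 * ℓ),
      ← Real.rpow_add hp0, ← Real.rpow_natCast p k]
    refine Real.rpow_le_rpow_of_exponent_le hp1.le (le_trans ?_ hk)
    push_cast
    have hs : 0 ≤ (ℓ : ℝ) + q + D := by positivity
    have := mul_le_mul_of_nonneg_right hC hs
    refine le_trans ?_ this
    have h5 : 0 ≤ (K : ℝ) * ℓ := by positivity
    have h6 : 0 ≤ (K : ℝ) * D := by positivity
    have h7 : 0 ≤ (q : ℝ) := by positivity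
    linarith
  calc p ^ (2 * ℓ) = p ^ (2 * ℓ) * 1 := (mul_one _).symm
    _ ≤ p ^ (2 * ℓ) * (δ ^ 8 / 1024 * (p ^ q)⁻¹ * X) ^ (K * 2) := by
      gcongr
      exact one_le_pow₀ h1
    _ = ((δ ^ 8 / 1024 * (p ^ q)⁻¹) ^ K) ^ 2 * (p ^ (2 * ℓ) * X ^ (K * 2)) := by
      rw [mul_pow, ← pow_mul]
      ring
    _ ≤ _ := by gcongr

lemma U3pow8_nonneg {V : Type*} [AddCommGroup V] [Fintype V] (f : V → ℝ) : 0 ≤ U3pow8 f := by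
  rw [U3pow8_eq]
  exact sum_nonneg fun _ _ => sum_nonneg fun _ _ => sq_nonneg _

lemma BadPart.pow_mul_le {V : Type*} [AddCommGroup V] [Fintype V] {δ : ℝ} (hδ : 0 < δ)
    {A P : Set V} (h : BadPart δ A P) :
    δ ^ 8 * U3pow8 (ind1 P) ≤ U3pow8 fun x => (ind1 A x - density A P) * ind1 P x := by
  have h8 : ∀ g : V → ℝ, U3norm g ^ 8 = U3pow8 g := fun g => by
    rw [U3norm, ← Real.rpow_natCast, ← Real.rpow_mul (U3pow8_nonneg g)]
    norm_num
  rw [← h8, ← h8, ← mul_pow]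
  exact pow_le_pow_left₀ (mul_nonneg hδ.le (Real.rpow_nonneg (U3pow8_nonneg _) _)) h.le 8

lemma U3pow8_eq_of_support {k G : Type*} [Ring k] [AddCommGroup G] [Module k G] [Fintype G]
    (V : Submodule k G) [Fintype V] (x₀ : G) {f : G → ℝ} (hf : ∀ x, f x ≠ 0 → x - x₀ ∈ V) :
    U3pow8 f = U3pow8 fun v : V => f (x₀ + v) := by
  have hV : ∀ (v : V) (h : G), f (x₀ + v + h) ≠ 0 → h ∈ V := fun v h hh => by
    simpa [add_sub_right_comm] using V.sub_mem (hf _ hh) v.2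
  have hout : ∀ h : G, h ∉ Set.range ((↑) : V → G) → h ∉ V := by simp
  unfold U3pow8
  symm
  refine Fintype.sum_of_injective (fun v : V => x₀ + v)
    ((add_right_injective x₀).comp Subtype.val_injective) _ _ (fun x hx => ?_) fun v => ?_
  · have h0 : f x = 0 := by
      by_contra h
      exact hx ⟨⟨x - x₀, hf x h⟩, by simp⟩
    simp [cubeProd, h0]
  refine Fintype.sum_of_injective _ Subtype.val_injective _ _ (fun h hh => ?_) fun h₁ => ?_
  · have h0 : f (x₀ + v + h) = 0 := by
      by_contra h'
      exact hout h hh (hV v h h')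
    simp [cubeProd, h0]
  refine Fintype.sum_of_injective _ Subtype.val_injective _ _ (fun h hh => ?_) fun h₂ => ?_
  · have h0 : f (x₀ + v + h) = 0 := by
      by_contra h'
      exact hout h hh (hV v h h')
    simp [cubeProd, h0]
  refine Fintype.sum_of_injective _ Subtype.val_injective _ _ (fun h hh => ?_) fun h₃ => ?_
  · have h0 : f (x₀ + v + h) = 0 := by
      by_contra h'
      exact hout h hh (hV v h h')
    simp [cubeProd, h0]
  simp [cubeProd, add_assoc]

lemma density_nonneg {G : Type*} (A P : Set G) : 0 ≤ density A P := by
  unfold density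
  positivity

lemma density_le_one {G : Type*} [Finite G] (A P : Set G) : density A P ≤ 1 :=
  div_le_one_of_le₀ (by exact_mod_cast Set.ncard_le_ncard Set.inter_subset_right) (by positivity)

lemma abs_ind1_sub_le {G : Type*} [Finite G] (A P : Set G) (x : G) :
    |ind1 A x - density A P| ≤ 1 := by
  have h1 := density_nonneg A P
  have h2 := density_le_one A P
  rw [abs_le]
  by_cases h : x ∈ A <;> simp [ind1, h] <;> constructor <;> linarith

namespace QuadFactor

variable {p : ℕ} [Fact p.Prime] {n ℓ q : ℕ}

lemma exists_symm_dot_eq (V : Submodule (ZMod p) (Vec p n))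
    {S : V →ₗ[ZMod p] Module.Dual (ZMod p) V} (hS : ∀ x y, S x y = S y x)
    (ζ : Module.Dual (ZMod p) V) (x₀ : Vec p n) :
    ∃ (M : Matrix (Fin n) (Fin n) (ZMod p)) (r : Vec p n) (a : ZMod p), M.IsSymm ∧
      ∀ v : V, ζ v + S v v =
        dot (x₀ + (v : Vec p n)) r + dot (x₀ + (v : Vec p n)) (M.mulVec (x₀ + (v : Vec p n))) +
          a := by
  obtain ⟨π, hπ⟩ := V.subtype.exists_leftInverse_of_injective V.ker_subtype
  have hπ' : ∀ v : V, π v = v := fun v => LinearMap.congr_fun hπ v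
  set S' := S.compl₁₂ π π with hS'
  set M := LinearMap.toMatrix₂' (ZMod p) S' with hM
  have hMS : matL M = S' := Matrix.toLinearMap₂'_toMatrix' S'
  obtain ⟨r, hr⟩ := exists_dotL_eq (ζ.comp π - (2 : ZMod p) • S' x₀)
  refine ⟨M, r, S' x₀ x₀ - ζ (π x₀), ?_, fun v => ?_⟩
  · ext i j
    simp only [Matrix.transpose_apply, hM, LinearMap.toMatrix₂'_apply, hS', LinearMap.compl₁₂_apply]
    exact hS _ _
  · rw [← matL_apply, ← dotL_apply, hr, hMS]
    simp only [hS', LinearMap.sub_apply, LinearMap.smul_apply, LinearMap.comp_apply, map_add,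
      LinearMap.add_apply, LinearMap.compl₁₂_apply, hπ', smul_eq_mul, hS v (π x₀)]
    ring

/-- A part on which a set is not uniform correlates with a quadratic phase. -/
theorem exists_phase_of_badPart (h2 : (2 : ZMod p) ≠ 0) (B : QuadFactor p n ℓ q) {m K : ℕ}
    (hm : m = 3 * (913 * affExp p) + 8) (hK : K = 12 * (913 * affExp p) + 1000) {δ C : ℝ}
    (hδ : 0 < δ) (hδ1 : δ < 1) (hC : 22 * (K : ℝ) + 2 ≤ C)
    (hrank : C * ((ℓ : ℝ) + q + Real.logb p δ⁻¹) ≤ B.rank) {A : Set (Vec p n)} {x₀ : Vec p n}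
    (hbad : BadPart δ A (B.atom (B.betaB x₀))) :
    ∃ (M : Matrix (Fin n) (Fin n) (ZMod p)) (r : Vec p n), M.IsSymm ∧
      (δ ^ 8 / 1024) ^ m * ((B.atom (B.betaB x₀)).ncard : ℝ) ≤
        ‖∑ x ∈ (B.atom (B.betaB x₀)).toFinset, ((ind1 A x - density A (B.atom (B.betaB x₀)) : ℝ) :
          ℂ) *
          ec (dot x r + dot x (M.mulVec x))‖ := by
  set P := B.atom (B.betaB x₀) with hP
  set η := δ ^ 8 / 1024 with hη
  have hη0 : 0 < η := by positivity
  have hη1 : η ≤ 1 / 4 := by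
    have := pow_le_one₀ (n := 8) hδ.le hδ1.le
    rw [hη]
    linarith
  have : Finite (Module.Dual (ZMod p) B.dir) := DFunLike.finite _
  have : Fintype (Module.Dual (ZMod p) B.dir) := Fintype.ofFinite _
  set b := (Fintype.card (Fin q → ZMod p) : ℝ)⁻¹ with hb
  have hb0 : 0 < b := QSys.inv_card_pos hb
  set e := (η * b) ^ K with he
  have hp2 : (2 : ℝ) ≤ p := by exact_mod_cast (Fact.out : p.Prime).two_le
  have hbq : b = ((p : ℝ) ^ q)⁻¹ := by
    rw [hb, Fintype.card_fun, ZMod.card, Fintype.card_fin]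
    push_cast
    rfl
  have hHR : (B.sys x₀).HighRank (e ^ 2) := B.highRank_sys h2 x₀ fun hq => by
    rw [he, hη, hbq]
    exact pow_le_mul_pow_of_logb_le hp2 hq hδ hδ1 hC hrank
  set f : Vec p n → ℝ := fun x => (ind1 A x - density A P) * ind1 P x with hf
  have hsupp : ∀ g : Vec p n → ℝ, ∀ x, g x * ind1 P x ≠ 0 → x - x₀ ∈ B.dir := fun g x hx => by
    refine B.sub_mem_dir ?_
    by_contra h
    exact hx (by simp [ind1, Set.indicator_of_notMem (show x ∉ P from h)])
  have hz : ∀ v : B.dir, v ∈ (B.sys x₀).zeros ↔ x₀ + (v : Vec p n) ∈ P := B.mem_zeros_sys h2 x₀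
  have hind : (fun v : B.dir => ind1 P (x₀ + v)) =
      fun v => if v ∈ (B.sys x₀).zeros then (1 : ℝ) else 0 := by
    ext v
    by_cases h : x₀ + (v : Vec p n) ∈ P <;> simp [ind1, hz, h]
  have hU := hbad.pow_mul_le hδ
  rw [U3pow8_eq_of_support B.dir x₀ (hsupp _), U3pow8_eq_of_support B.dir x₀ (f := ind1 P)
    (fun x hx => hsupp 1 x (by simpa using hx)), hind] at hU
  have heb : e ≤ (η * b) ^ (12 * (913 * affExp p) + 1000) := by rw [he, hK]
  have hf1 : ∀ v : B.dir, |f (x₀ + v)| ≤ if v ∈ (B.sys x₀).zeros then 1 else 0 := fun v => by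
    by_cases h : x₀ + (v : Vec p n) ∈ P
    · simpa [hf, hz, h, ind1] using abs_ind1_sub_le A P (x₀ + v)
    · simp [hf, hz, h, ind1]
  have hU1 : 1024 * η * U3pow8 (fun v => if v ∈ (B.sys x₀).zeros then (1 : ℝ) else 0) ≤
      U3pow8 fun v : B.dir => f (x₀ + v) := le_trans (le_of_eq (by rw [hη]; ring)) hU
  have he0 : 0 ≤ e := by positivity
  obtain ⟨S, ζ, hS, hcor⟩ := QSys.exists_quadratic_phase_of_large_U3 h2 he0 hHR hb hη0
    hη1 heb (f := fun v : B.dir => f (x₀ + v)) (fun v => by convert hf1 v) (by convert hU1)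
  obtain ⟨M, r, a, hM, hMr⟩ := exists_symm_dot_eq B.dir hS ζ x₀
  refine ⟨M, r, hM, ?_⟩
  have hcard : (B.sys x₀).zeros.card = P.ncard := by
    rw [Set.ncard_eq_toFinset_card']
    refine card_bij (fun v _ => x₀ + v) (fun v hv => by simpa using (hz v).1 hv)
      (fun v _ w _ h => by simpa using h) fun x hx => ?_
    have hx' : x ∈ P := by simpa using hx
    exact ⟨⟨x - x₀, B.sub_mem_dir hx'⟩, (hz _).2 (by simpa using hx'), by simp⟩
  rw [hcard, ← hm] at hcor
  refine hcor.trans (le_of_eq ?_)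
  rw [← mul_one ‖_‖, ← norm_ec (-a), ← norm_mul, sum_mul]
  congr 1
  refine (Fintype.sum_of_injective (fun v : B.dir => x₀ + (v : Vec p n))
    ((add_right_injective x₀).comp Subtype.val_injective) _
    (fun x => (f x : ℂ) * ec (dot x r + dot x (M.mulVec x))) (fun x hx => ?_) fun v => ?_).trans ?_
  · have h0 : f x = 0 := by
      by_contra h
      exact hx ⟨⟨x - x₀, hsupp (fun x => ind1 A x - density A P) x h⟩, by simp⟩
    simp [h0]
  · rw [hMr, mul_assoc, ← ec_add, add_neg_cancel_right]
  · rw [← sum_subset (subset_univ P.toFinset)]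
    · refine sum_congr rfl fun x hx => ?_
      have hx' : x ∈ P := by simpa using hx
      simp [hf, ind1, hx']
    · intro x _ hx
      have hx' : x ∉ P := by simpa using hx
      simp [hf, ind1, hx']

end QuadFactor

section Energy

variable {G : Type*} [Fintype G]

lemma sum_toFinset_ind1 (A S : Set G) :
    ∑ x ∈ S.toFinset, ind1 A x = density A S * S.ncard := by
  have h : ∑ x ∈ S.toFinset, ind1 A x = (A ∩ S).ncard := by
    simp only [ind1, Set.indicator_apply, Pi.one_apply]
    rw [sum_boole, Set.ncard_eq_toFinset_card']
    congr 2
    ext x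
    simp [and_comm]
  rw [h, density]
  rcases S.eq_empty_or_nonempty with rfl | hS
  · simp
  · have := (Set.ncard_pos S.toFinite).2 hS
    rw [div_mul_cancel₀]
    positivity

lemma sum_toFinset_ind1_sub (A S : Set G) (α : ℝ) :
    ∑ x ∈ S.toFinset, (ind1 A x - α) = (density A S - α) * S.ncard := by
  rw [sum_sub_distrib, sum_toFinset_ind1, sum_const, ← Set.ncard_eq_toFinset_card', nsmul_eq_mul]
  ring

/-- Energy increment: if the balanced function of `A` on `P` correlates with a unimodular function
which is constant on the pieces of a partition of `P`, then passing to this partition increases the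
energy. -/
lemma add_sq_mul_le_sum_density_sq {A P : Set G} {T : Finset (Set G)} (hT : ∀ S ∈ T, S ⊆ P)
    (hdisj : (T : Set (Set G)).PairwiseDisjoint id) (hcov : ∀ x ∈ P, ∃ S ∈ T, x ∈ S)
    {φ : G → ℂ} (hφ : ∀ x, ‖φ x‖ = 1) (hconst : ∀ S ∈ T, ∀ x ∈ S, ∀ y ∈ S, φ x = φ y)
    {κ : ℝ} (hκ : 0 ≤ κ) (hcor : κ * (P.ncard : ℝ) ≤
      ‖∑ x ∈ P.toFinset, ((ind1 A x - density A P : ℝ) : ℂ) * φ x‖) :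
    density A P ^ 2 * P.ncard + κ ^ 2 * P.ncard ≤ ∑ S ∈ T, density A S ^ 2 * S.ncard := by
  set α := density A P with hα
  have hP : P.toFinset = T.biUnion fun S => S.toFinset := by
    ext x
    simp only [Set.mem_toFinset, mem_biUnion]
    exact ⟨hcov x, fun ⟨S, hS, hx⟩ => hT S hS hx⟩
  have hd : (T : Set (Set G)).PairwiseDisjoint fun S => S.toFinset := fun S hS S' hS' h =>
    Set.disjoint_toFinset.2 (hdisj hS hS' h)
  have hw : ∑ S ∈ T, (S.ncard : ℝ) = P.ncard := by
    rw [Set.ncard_eq_toFinset_card' P, hP, card_biUnion hd]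
    push_cast
    exact sum_congr rfl fun S _ => by rw [Set.ncard_eq_toFinset_card']
  have hdw : ∑ S ∈ T, density A S * S.ncard = α * P.ncard := by
    rw [← sum_toFinset_ind1, hP, sum_biUnion hd]
    exact sum_congr rfl fun S _ => (sum_toFinset_ind1 A S).symm
  have hX : ∑ S ∈ T, (density A S - α) ^ 2 * S.ncard =
      ∑ S ∈ T, density A S ^ 2 * S.ncard - α ^ 2 * P.ncard := by
    have h1 : ∀ S ∈ T, (density A S - α) ^ 2 * (S.ncard : ℝ) = density A S ^ 2 * S.ncard -
        2 * α * (density A S * S.ncard) + α ^ 2 * S.ncard := fun S _ => by ring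
    rw [sum_congr rfl h1, sum_add_distrib, sum_sub_distrib, ← mul_sum, ← mul_sum, hw, hdw]
    ring
  have hle : κ * (P.ncard : ℝ) ≤ ∑ S ∈ T, |density A S - α| * S.ncard := by
    refine hcor.trans ?_
    rw [hP, sum_biUnion hd]
    refine (norm_sum_le _ _).trans (sum_le_sum fun S hS => ?_)
    rcases S.eq_empty_or_nonempty with rfl | ⟨y, hy⟩
    · simp
    have h1 : ∑ x ∈ S.toFinset, ((ind1 A x - α : ℝ) : ℂ) * φ x =
        ((∑ x ∈ S.toFinset, (ind1 A x - α) : ℝ) : ℂ) * φ y := by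
      rw [Complex.ofReal_sum, sum_mul]
      exact sum_congr rfl fun x hx => by rw [hconst S hS x (Set.mem_toFinset.1 hx) y hy]
    rw [h1, norm_mul, hφ, mul_one, Complex.norm_real, sum_toFinset_ind1_sub, Real.norm_eq_abs,
      abs_mul, Nat.abs_cast]
  have hcs : (∑ S ∈ T, |density A S - α| * (S.ncard : ℝ)) ^ 2 ≤
      (∑ S ∈ T, (density A S - α) ^ 2 * S.ncard) * ∑ S ∈ T, (S.ncard : ℝ) :=
    sum_sq_le_sum_mul_sum_of_sq_le_mul _ (fun _ _ => by positivity) (fun _ _ => by positivity)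
      fun S _ => le_of_eq <| by
        rw [mul_pow, sq_abs]
        ring
  rw [hw] at hcs
  have h2 : κ ^ 2 * P.ncard ≤ ∑ S ∈ T, (density A S - α) ^ 2 * S.ncard := by
    rcases (Nat.cast_nonneg (α := ℝ) P.ncard).eq_or_lt with h0 | h0
    · rw [← h0, mul_zero]
      exact sum_nonneg fun _ _ => by positivity
    · refine le_of_mul_le_mul_right ?_ h0
      calc κ ^ 2 * (P.ncard : ℝ) * P.ncard = (κ * P.ncard) ^ 2 := by ring
        _ ≤ _ := (pow_le_pow_left₀ (by positivity) hle 2).trans hcs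
  linarith

/-- Refining the parts of a partition satisfying a property increases the energy. -/
lemma exists_partition_refinement {Ps : Finset (Set G)}
    (hPs : Setoid.IsPartition (Ps : Set (Set G))) (A : Set G) (bad : Set G → Prop) {κ : ℝ}
    {T : Set G → Finset (Set G)} (hT : ∀ P ∈ Ps, bad P → ∀ S ∈ T P, S ⊆ P ∧ S.Nonempty)
    (hdisj : ∀ P ∈ Ps, bad P → (T P : Set (Set G)).PairwiseDisjoint id)
    (hcov : ∀ P ∈ Ps, bad P → ∀ x ∈ P, ∃ S ∈ T P, x ∈ S)
    (hgain : ∀ P ∈ Ps, bad P →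
      density A P ^ 2 * P.ncard + κ * P.ncard ≤ ∑ S ∈ T P, density A S ^ 2 * S.ncard)
    (hκ : 0 ≤ κ) :
    ∃ Ps' : Finset (Set G), Setoid.IsPartition (Ps' : Set (Set G)) ∧
      (∀ S ∈ Ps', ∃ P ∈ Ps, S ⊆ P ∧ (S = P ∧ ¬ bad P ∨ bad P ∧ S ∈ T P)) ∧
      ∑ P ∈ Ps, density A P ^ 2 * P.ncard + κ * ((⋃₀ {P | P ∈ Ps ∧ bad P}).ncard : ℝ) ≤
        ∑ S ∈ Ps', density A S ^ 2 * S.ncard := by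
  set R : Set G → Finset (Set G) := fun P => if bad P then T P else {P} with hR
  have huniq : ∀ P ∈ Ps, ∀ P' ∈ Ps, ∀ x ∈ P, x ∈ P' → P = P' := fun P hP P' hP' x hx hx' =>
    (hPs.2 x).unique ⟨hP, hx⟩ ⟨hP', hx'⟩
  have hne : ∀ P ∈ Ps, P.Nonempty := fun P hP =>
    Set.nonempty_iff_ne_empty.2 fun h => hPs.1 (h ▸ hP)
  have hRsub : ∀ P ∈ Ps, ∀ S ∈ R P, S ⊆ P ∧ S.Nonempty := fun P hP S hS => by
    by_cases hb : bad P
    · exact hT P hP hb S (by simpa [hR, hb] using hS)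
    · have : S = P := by simpa [hR, hb] using hS
      rw [this]
      exact ⟨subset_rfl, hne P hP⟩
  have hRcov : ∀ P ∈ Ps, ∀ x ∈ P, ∃ S ∈ R P, x ∈ S := fun P hP x hx => by
    by_cases hb : bad P
    · simpa [hR, hb] using hcov P hP hb x hx
    · simpa [hR, hb] using hx
  have hRdisj : ∀ P ∈ Ps, ∀ S ∈ R P, ∀ S' ∈ R P, ∀ x ∈ S, x ∈ S' → S = S' := by
    intro P hP S hS S' hS' x hx hx'
    by_cases hb : bad P
    · by_contra h
      exact Set.disjoint_left.1 (hdisj P hP hb (by simpa [hR, hb] using hS)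
        (by simpa [hR, hb] using hS') h) hx hx'
    · have h1 : S = P := by simpa [hR, hb] using hS
      have h2 : S' = P := by simpa [hR, hb] using hS'
      rw [h1, h2]
  have hdR : (Ps : Set (Set G)).PairwiseDisjoint R := fun P hP P' hP' h => by
    refine disjoint_left.2 fun S hS hS' => h ?_
    obtain ⟨x, hx⟩ := (hRsub P hP S hS).2
    exact huniq P hP P' hP' x ((hRsub P hP S hS).1 hx) ((hRsub P' hP' S hS').1 hx)
  refine ⟨Ps.biUnion R, ⟨fun h => ?_, fun x => ?_⟩, fun S hS => ?_, ?_⟩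
  · obtain ⟨P, hP, hS⟩ := mem_biUnion.1 (mem_coe.1 h)
    exact Set.not_nonempty_empty (hRsub P hP ∅ hS).2
  · obtain ⟨P, ⟨hP, hx⟩, -⟩ := hPs.2 x
    obtain ⟨S, hS, hxS⟩ := hRcov P hP x hx
    refine ⟨S, ⟨mem_coe.2 (mem_biUnion.2 ⟨P, hP, hS⟩), hxS⟩, fun S' ⟨hS', hxS'⟩ => ?_⟩
    obtain ⟨P', hP', hS'⟩ := mem_biUnion.1 (mem_coe.1 hS')
    obtain rfl := huniq P hP P' hP' x hx ((hRsub P' hP' S' hS').1 hxS')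
    exact hRdisj P hP S' hS' S hS x hxS' hxS
  · obtain ⟨P, hP, hSP⟩ := mem_biUnion.1 hS
    refine ⟨P, hP, (hRsub P hP S hSP).1, ?_⟩
    by_cases hb : bad P
    · exact Or.inr ⟨hb, by simpa [hR, hb] using hSP⟩
    · exact Or.inl ⟨by simpa [hR, hb] using hSP, hb⟩
  · rw [sum_biUnion hdR]
    have h1 : ((⋃₀ {P | P ∈ Ps ∧ bad P}).ncard : ℝ) ≤
        ∑ P ∈ Ps, if bad P then (P.ncard : ℝ) else 0 := by
      rw [← sum_filter]
      have h2 : ⋃₀ {P | P ∈ Ps ∧ bad P} = ↑((Ps.filter bad).biUnion fun P => P.toFinset) := by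
        ext x
        simp [and_assoc]
      rw [h2, Set.ncard_coe_finset]
      refine (Nat.cast_le.2 card_biUnion_le).trans (le_of_eq ?_)
      push_cast
      exact sum_congr rfl fun P _ => by rw [Set.ncard_eq_toFinset_card']
    calc _ ≤ ∑ P ∈ Ps, density A P ^ 2 * P.ncard +
          κ * ∑ P ∈ Ps, (if bad P then (P.ncard : ℝ) else 0) := by gcongr
      _ = ∑ P ∈ Ps, (density A P ^ 2 * P.ncard + κ * if bad P then (P.ncard : ℝ) else 0) := by
        rw [mul_sum, sum_add_distrib]
      _ ≤ _ := sum_le_sum fun P hP => by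
        by_cases hb : bad P
        · simpa [hR, hb] using hgain P hP hb
        · simp [hR, hb]

end Energy

namespace QuadFactor

variable {p : ℕ} [Fact p.Prime] {n ℓ q : ℕ}

/-- A quadratic factor can be extended so as to make a given quadratic polynomial measurable. -/
lemma exists_extend (B : QuadFactor p n ℓ q) {M : Matrix (Fin n) (Fin n) (ZMod p)} (hM : M.IsSymm)
    (r : Vec p n) : ∃ (ℓ' q' : ℕ) (B' : QuadFactor p n ℓ' q'),
      Set.range B.L ⊆ Set.range B'.L ∧ Set.range B.Q ⊆ Set.range B'.Q ∧ ℓ' ≤ ℓ + 1 ∧ q' ≤ q + 1 ∧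
      r ∈ Submodule.span (ZMod p) (Set.range B'.L) ∧ M ∈ Set.range B'.Q := by
  obtain ⟨ℓ', L', hL', hLL', hℓ', hr⟩ : ∃ (ℓ' : ℕ) (L' : Fin ℓ' → Vec p n),
      LinearIndependent (ZMod p) L' ∧ Set.range B.L ⊆ Set.range L' ∧ ℓ' ≤ ℓ + 1 ∧
      r ∈ Submodule.span (ZMod p) (Set.range L') := by
    by_cases h : r ∈ Submodule.span (ZMod p) (Set.range B.L)
    · exact ⟨ℓ, B.L, B.linIndep, subset_rfl, by omega, h⟩
    · refine ⟨ℓ + 1, Fin.cons r B.L, linearIndependent_finCons.2 ⟨B.linIndep, h⟩, ?_, le_rfl, ?_⟩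
      · rw [Fin.range_cons]
        exact Set.subset_insert _ _
      · rw [Fin.range_cons]
        exact Submodule.subset_span (Set.mem_insert _ _)
  obtain ⟨q', Q', hQ', hinj, hQQ', hq', hMQ⟩ :
      ∃ (q' : ℕ) (Q' : Fin q' → Matrix (Fin n) (Fin n) (ZMod p)),
      (∀ j, (Q' j).IsSymm) ∧ Function.Injective Q' ∧ Set.range B.Q ⊆ Set.range Q' ∧ q' ≤ q + 1 ∧
      M ∈ Set.range Q' := by
    by_cases h : M ∈ Set.range B.Q
    · exact ⟨q, B.Q, B.symm, B.inj, subset_rfl, by omega, h⟩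
    · refine ⟨q + 1, Fin.cons M B.Q, fun j => ?_, Fin.cons_injective_iff.2 ⟨h, B.inj⟩, ?_, le_rfl,
        ?_⟩
      · refine Fin.cases ?_ (fun j => ?_) j
        · simpa using hM
        · simpa using B.symm j
      · rw [Fin.range_cons]
        exact Set.subset_insert _ _
      · rw [Fin.range_cons]
        exact Set.mem_insert _ _
  exact ⟨ℓ', q', ⟨L', Q', hL', hQ', hinj⟩, hLL', hQQ', hℓ', hq', hr, hMQ⟩

variable {ℓ' q' : ℕ} {B : QuadFactor p n ℓ q} {B' : QuadFactor p n ℓ' q'} {x y : Vec p n}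

lemma dot_eq_of_mem_span (h : B'.betaB x = B'.betaB y) {r : Vec p n}
    (hr : r ∈ Submodule.span (ZMod p) (Set.range B'.L)) : dot x r = dot y r := by
  change x ⬝ᵥ r = y ⬝ᵥ r
  induction hr using Submodule.span_induction with
  | mem r hr =>
    obtain ⟨i, rfl⟩ := hr
    exact congrFun (congrArg Prod.fst h) i
  | zero => simp
  | add r s _ _ hr hs => rw [dotProduct_add, dotProduct_add, hr, hs]
  | smul a r _ hr => rw [dotProduct_smul, dotProduct_smul, hr]

lemma dot_mulVec_eq_of_mem_range (h : B'.betaB x = B'.betaB y)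
    {M : Matrix (Fin n) (Fin n) (ZMod p)} (hM : M ∈ Set.range B'.Q) :
    dot x (M.mulVec x) = dot y (M.mulVec y) := by
  obtain ⟨j, rfl⟩ := hM
  exact congrFun (congrArg Prod.snd h) j

lemma betaB_eq_of_range_subset (hL : Set.range B.L ⊆ Set.range B'.L)
    (hQ : Set.range B.Q ⊆ Set.range B'.Q) (h : B'.betaB x = B'.betaB y) :
    B.betaB x = B.betaB y :=
  Prod.ext (funext fun i => dot_eq_of_mem_span h (Submodule.subset_span (hL ⟨i, rfl⟩)))
    (funext fun j => dot_mulVec_eq_of_mem_range h (hQ ⟨j, rfl⟩))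

lemma refines_of_range_subset (hL : Set.range B.L ⊆ Set.range B'.L)
    (hQ : Set.range B.Q ⊆ Set.range B'.Q) : Refines B' B := by
  intro ab'
  rcases (B'.atom ab').eq_empty_or_nonempty with h | ⟨y, hy⟩
  · exact ⟨0, h ▸ Set.empty_subset _⟩
  · exact ⟨B.betaB y, fun x hx => betaB_eq_of_range_subset hL hQ
      ((hx : B'.betaB x = ab').trans (hy : B'.betaB y = ab').symm)⟩

/-- A non-uniform atom of a high rank factor has an energy increasing partition into atoms of a
slightly more complex factor. -/
theorem exists_refinement_of_badPart (h2 : (2 : ZMod p) ≠ 0) (B : QuadFactor p n ℓ q) {m K : ℕ}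
    (hm : m = 3 * (913 * affExp p) + 8) (hK : K = 12 * (913 * affExp p) + 1000) {δ C : ℝ}
    (hδ : 0 < δ) (hδ1 : δ < 1) (hC : 22 * (K : ℝ) + 2 ≤ C)
    (hrank : C * ((ℓ : ℝ) + q + Real.logb p δ⁻¹) ≤ B.rank) {A P : Set (Vec p n)}
    {ab : Label p ℓ q} (hP : P = B.atom ab) (hne : P.Nonempty) (hbad : BadPart δ A P) :
    ∃ T : Finset (Set (Vec p n)), (∀ S ∈ T, S ⊆ P ∧ S.Nonempty) ∧
      (T : Set (Set (Vec p n))).PairwiseDisjoint id ∧ (∀ x ∈ P, ∃ S ∈ T, x ∈ S) ∧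
      density A P ^ 2 * P.ncard + ((δ ^ 8 / 1024) ^ m) ^ 2 * P.ncard ≤
        ∑ S ∈ T, density A S ^ 2 * S.ncard ∧
      ∀ S ∈ T, ∃ (ℓ' q' : ℕ) (B' : QuadFactor p n ℓ' q') (ab' : Label p ℓ' q'),
        S = B'.atom ab' ∧ Refines B' B ∧ Set.range B.L ⊆ Set.range B'.L ∧
        Set.range B.Q ⊆ Set.range B'.Q ∧ ℓ' ≤ ℓ + 1 ∧ q' ≤ q + 1 := by
  obtain ⟨x₀, hx₀⟩ := hne
  obtain rfl : B.betaB x₀ = ab := by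
    rw [hP] at hx₀
    exact hx₀
  subst hP
  obtain ⟨M, r, hM, hcor⟩ := exists_phase_of_badPart h2 B hm hK hδ hδ1 hC hrank hbad
  obtain ⟨ℓ', q', B', hL, hQ, hℓ', hq', hr, hMQ⟩ := B.exists_extend hM r
  set P := B.atom (B.betaB x₀) with hP
  set T := P.toFinset.image fun y => B'.atom (B'.betaB y) with hT
  have hTmem : ∀ S, S ∈ T ↔ ∃ y ∈ P, B'.atom (B'.betaB y) = S := fun S => by simp [hT]
  have hsub : ∀ S ∈ T, S ⊆ P ∧ S.Nonempty := fun S hS => by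
    obtain ⟨y, hy, rfl⟩ := (hTmem S).1 hS
    exact ⟨fun x hx => (betaB_eq_of_range_subset hL hQ hx).trans hy, y, rfl⟩
  have hdisj : (T : Set (Set (Vec p n))).PairwiseDisjoint id := fun S hS S' hS' h => by
    obtain ⟨y, -, rfl⟩ := (hTmem S).1 hS
    obtain ⟨y', -, rfl⟩ := (hTmem S').1 hS'
    refine Set.disjoint_left.2 fun x hx hx' => h ?_
    rw [← (hx : B'.betaB x = _), ← (hx' : B'.betaB x = _)]
  have hcov : ∀ x ∈ P, ∃ S ∈ T, x ∈ S := fun x hx =>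
    ⟨B'.atom (B'.betaB x), (hTmem _).2 ⟨x, hx, rfl⟩, rfl⟩
  refine ⟨T, hsub, hdisj, hcov, ?_, fun S hS => ?_⟩
  · refine add_sq_mul_le_sum_density_sq (fun S hS => (hsub S hS).1) hdisj hcov
      (fun x => norm_ec (dot x r + dot x (M.mulVec x))) (fun S hS x hx y hy => ?_) (by positivity)
      hcor
    obtain ⟨z, -, rfl⟩ := (hTmem S).1 hS
    have h : B'.betaB x = B'.betaB y := hx.trans hy.symm
    rw [dot_eq_of_mem_span h hr, dot_mulVec_eq_of_mem_range h hMQ]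
  · obtain ⟨y, -, rfl⟩ := (hTmem S).1 hS
    exact ⟨ℓ', q', B', _, rfl, refines_of_range_subset hL hQ, hL, hQ, hℓ', hq'⟩

end QuadFactor

theorem statement6 (p : ℕ) (hp : p.Prime) (hodd : Odd p) [NeZero p] :
    ∃ C > (0 : ℝ), ∀ δ : ℝ, 0 < δ → δ < 1 →
      ∀ (n : ℕ) (A : Set (Vec p n)) (Ps : Finset (Set (Vec p n))),
        Setoid.IsPartition (Ps : Set (Set (Vec p n))) →
        ∀ (ℓf qf : Set (Vec p n) → ℕ)
          (Bf : (P : Set (Vec p n)) → QuadFactor p n (ℓf P) (qf P)),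
          (∀ P ∈ Ps, ∃ ab : Label p (ℓf P) (qf P), P = (Bf P).atom ab) →
          (∀ P ∈ Ps, C * ((ℓf P : ℝ) + (qf P : ℝ) + Real.logb p δ⁻¹) ≤ ((Bf P).rank : ℝ)) →
          δ * (p : ℝ) ^ n < ((⋃₀ {P | P ∈ Ps ∧ BadPart δ A P}).ncard : ℝ) →
          ∃ Ps' : Finset (Set (Vec p n)),
            Setoid.IsPartition (Ps' : Set (Set (Vec p n))) ∧
            (∀ P' ∈ Ps', ∃ P ∈ Ps, P' ⊆ P) ∧
            indx A Ps + (C ^ 2)⁻¹ * δ ^ (2 * C + 2) ≤ indx A Ps' ∧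
            ∀ P' ∈ Ps',
              (P' ∈ Ps ∧ ¬ BadPart δ A P') ∨
              (∃ P ∈ Ps, BadPart δ A P ∧ P' ⊆ P ∧
                ∃ (ℓ' q' : ℕ) (B' : QuadFactor p n ℓ' q') (ab' : Label p ℓ' q'),
                  P' = B'.atom ab' ∧ Refines B' (Bf P) ∧
                  Set.range (Bf P).L ⊆ Set.range B'.L ∧
                  Set.range (Bf P).Q ⊆ Set.range B'.Q ∧
                  ℓ' ≤ ℓf P + 1 ∧ q' ≤ qf P + 1) := by
  have : Fact p.Prime := ⟨hp⟩
  have h2 : (2 : ZMod p) ≠ 0 := by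
    intro h
    have h3 : ((2 : ℕ) : ZMod p) = 0 := by exact_mod_cast h
    rw [ZMod.natCast_eq_zero_iff, Nat.dvd_prime Nat.prime_two] at h3
    rcases h3 with h3 | h3
    · exact hp.one_lt.ne' h3
    · rw [h3] at hodd
      exact absurd hodd (by decide)
  obtain ⟨m, hm⟩ : ∃ m, m = 3 * (913 * affExp p) + 8 := ⟨_, rfl⟩
  obtain ⟨K, hK⟩ : ∃ K, K = 12 * (913 * affExp p) + 1000 := ⟨_, rfl⟩
  obtain ⟨C, hC⟩ : ∃ C : ℝ, C = 1024 ^ m + 22 * K + 8 * m + 2 := ⟨_, rfl⟩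
  have hpow : (0 : ℝ) < 1024 ^ m := by positivity
  have hm0 : (0 : ℝ) ≤ m := Nat.cast_nonneg m
  have hK0 : (0 : ℝ) ≤ K := Nat.cast_nonneg K
  refine ⟨C, by linarith, fun δ hδ hδ1 n A Ps hPs ℓf qf Bf hatom hrank hbadsize => ?_⟩
  have hne : ∀ P ∈ Ps, P.Nonempty := fun P hP =>
    Set.nonempty_iff_ne_empty.2 fun h => hPs.1 (h ▸ hP)
  have hloc := fun P (hP : P ∈ Ps) (hb : BadPart δ A P) =>
    QuadFactor.exists_refinement_of_badPart h2 (Bf P) hm hK hδ hδ1 (by linarith) (hrank P hP)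
      (hatom P hP).choose_spec (hne P hP) hb
  choose! T hT hdisj hcov hgain hfac using hloc
  obtain ⟨Ps', hPs', hsub, hsum⟩ := exists_partition_refinement hPs A (BadPart δ A) hT hdisj hcov
    hgain (by positivity)
  refine ⟨Ps', hPs', fun S hS => ?_, ?_, fun S hS => ?_⟩
  · obtain ⟨P, hP, h, -⟩ := hsub S hS
    exact ⟨P, hP, h⟩
  · have hpn : (0 : ℝ) < (p : ℝ) ^ n := pow_pos (Nat.cast_pos.2 hp.pos) n
    have hrpow : δ ^ (2 * C + 2) ≤ δ ^ (16 * m + 1) := by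
      rw [← Real.rpow_natCast]
      refine Real.rpow_le_rpow_of_exponent_ge hδ hδ1.le ?_
      push_cast
      linarith
    have hCle : (C ^ 2)⁻¹ ≤ ((1024 ^ m) ^ 2)⁻¹ := by
      gcongr
      linarith
    have hκ : (C ^ 2)⁻¹ * δ ^ (2 * C + 2) ≤ ((δ ^ 8 / 1024) ^ m) ^ 2 * δ := by
      calc (C ^ 2)⁻¹ * δ ^ (2 * C + 2) ≤ ((1024 ^ m) ^ 2)⁻¹ * δ ^ (16 * m + 1) :=
            mul_le_mul hCle hrpow (by positivity) (by positivity)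
        _ = _ := by
          have : δ ^ (16 * m + 1) = ((δ ^ 8) ^ m) ^ 2 * δ := by
            rw [← pow_mul, ← pow_mul, ← pow_succ]
            congr 1
            ring
          rw [this, div_pow, div_pow, div_mul_eq_mul_div, div_eq_inv_mul]
    rw [indx, indx, div_add' _ _ _ hpn.ne']
    refine div_le_div_of_nonneg_right (le_trans ?_ hsum) hpn.le
    refine add_le_add le_rfl ?_
    calc (C ^ 2)⁻¹ * δ ^ (2 * C + 2) * (p : ℝ) ^ n ≤ ((δ ^ 8 / 1024) ^ m) ^ 2 * δ * p ^ n := by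
          gcongr
      _ = ((δ ^ 8 / 1024) ^ m) ^ 2 * (δ * p ^ n) := mul_assoc _ _ _
      _ ≤ _ := by gcongr
  · obtain ⟨P, hP, hSP, ⟨rfl, hb⟩ | ⟨hb, hST⟩⟩ := hsub S hS
    · exact Or.inl ⟨hP, hb⟩
    · exact Or.inr ⟨P, hP, hb, hSP, hfac P hP hb S hST⟩

end PaperTS
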